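/- (Bott periodicity, symplectic case.) For every integer k ≥ 1 there exists an integer N such that for all n, m ≥ N, the k-th homotopy group of the compact symplectic group Sp(n) is isomorphic to the (k+8)-th homotopy group of Sp(m); that is, the stable homotopy groups of the symplectic group are periodic of period 8. -/

import Mathlib

open scoped Topology Quaternion

set_option linter.unusedSectionVars false

namespace Bott
open Matrix Set

/-- A `*`-representation of `R` on a real inner product space. -/
class StarAct (R E : Type) [Ring R] [StarRing R] [NormedAddCommGroup E] [InnerProductSpace ℝ E]
    [Module R E] : Prop where
  inner_smul : ∀ (r : R) (x y : E), inner ℝ (r • x) y = inner ℝ x (star r • y)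

section Act

variable {R : Type} [Ring R] [StarRing R] [Algebra ℝ R] [StarModule ℝ R]
  [TopologicalSpace R] [IsTopologicalRing R] [ContinuousStar R] [ContinuousSMul ℝ R]
variable {E : Type} [NormedAddCommGroup E] [InnerProductSpace ℝ E] [FiniteDimensional ℝ E]
  [Module R E] [IsScalarTower ℝ R E] [ContinuousSMul R E] [StarAct R E]
variable {ι κ μ ν : Type} [Fintype ι] [Fintype κ] [Fintype μ] [Fintype ν]

/-- The Hilbert space on which matrices act. -/
abbrev V (E ι : Type) := PiLp 2 (fun _ : ι => E)

variable (E) in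
/-- The action of a matrix on column vectors. -/
noncomputable def act (A : Matrix ι κ R) : V E κ →L[ℝ] V E ι :=
  LinearMap.toContinuousLinearMap
    { toFun := fun v => WithLp.toLp 2 fun i => ∑ j, A i j • v j
      map_add' := fun v w => by
        ext i; simp [smul_add, Finset.sum_add_distrib]
      map_smul' := fun t v => by
        have := IsScalarTower.to_smulCommClass (R := ℝ) (A := R) (M := E)
        ext i; simp [Finset.smul_sum, smul_comm t] }

theorem act_apply (A : Matrix ι κ R) (v : V E κ) (i : ι) :
    act E A v i = ∑ j, A i j • v j := rfl

theorem act_add (A B : Matrix ι κ R) : act E (A + B) = act E A + act E B := by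
  ext v i; simp [act_apply, add_smul, Finset.sum_add_distrib]

theorem act_neg (A : Matrix ι κ R) : act E (-A) = -act E A := by
  ext v i; simp [act_apply]

theorem act_sub (A B : Matrix ι κ R) : act E (A - B) = act E A - act E B := by
  rw [sub_eq_add_neg, act_add, act_neg, sub_eq_add_neg]

theorem act_zero : act E (0 : Matrix ι κ R) = 0 := by
  ext v i; simp [act_apply]

theorem act_smul (t : ℝ) (A : Matrix ι κ R) : act E (t • A) = t • act E A := by
  ext v i; simp [act_apply, Finset.smul_sum]

theorem act_mul (A : Matrix ι κ R) (B : Matrix κ μ R) (v : V E μ) :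
    act E (A * B) v = act E A (act E B v) := by
  ext i
  simp only [act_apply, Matrix.mul_apply, Finset.sum_smul, Finset.smul_sum, mul_smul]
  exact Finset.sum_comm

theorem act_one [DecidableEq ι] (v : V E ι) : act E (1 : Matrix ι ι R) v = v := by
  ext i; simp [act_apply, Matrix.one_apply, ite_smul]

theorem inner_act (A : Matrix ι κ R) (v : V E κ) (w : V E ι) :
    inner ℝ (act E A v) w = inner ℝ v (act E Aᴴ w) := by
  simp only [PiLp.inner_apply, act_apply, sum_inner, inner_sum, conjTranspose_apply,
    StarAct.inner_smul (R := R)]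
  exact Finset.sum_comm

theorem continuous_act : Continuous fun A : Matrix ι κ R => act E A := by
  rw [continuous_clm_apply]
  intro v
  refine (PiLp.continuous_toLp 2 _).comp (continuous_pi fun i => ?_)
  exact continuous_finsetSum _ fun j _ =>
    ((continuous_apply_apply i j).smul continuous_const)

theorem act_submatrix (A : Matrix ι κ R) (e : μ ≃ ι) (e' : ν ≃ κ) (v : V E ν) :
    act E (A.submatrix e e') v
      = WithLp.toLp 2 fun i => act E A (WithLp.toLp 2 fun j => v (e'.symm j)) (e i) := by
  ext i
  simp only [act_apply, submatrix_apply]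
  exact Fintype.sum_equiv e' _ _ (by simp)

/-- The first component of a vector. -/
def vl (v : V E (ι ⊕ κ)) : V E ι := WithLp.toLp 2 fun i => v (Sum.inl i)

/-- The second component of a vector. -/
def vr (v : V E (ι ⊕ κ)) : V E κ := WithLp.toLp 2 fun i => v (Sum.inr i)

theorem v_ext {v w : V E (ι ⊕ κ)} (h : vl v = vl w) (h' : vr v = vr w) : v = w := by
  ext i
  rcases i with i | i
  · exact congrArg (fun x : V E ι => x i) h
  · exact congrArg (fun x : V E κ => x i) h'

@[simp] theorem vl_zero : vl (0 : V E (ι ⊕ κ)) = 0 := rfl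
@[simp] theorem vr_zero : vr (0 : V E (ι ⊕ κ)) = 0 := rfl

theorem vl_act_fromBlocks (A : Matrix ι μ R) (B : Matrix ι ν R) (C : Matrix κ μ R)
    (D : Matrix κ ν R) (v : V E (μ ⊕ ν)) :
    vl (act E (fromBlocks A B C D) v) = act E A (vl v) + act E B (vr v) := by
  ext i; simp [vl, vr, act_apply]

theorem vr_act_fromBlocks (A : Matrix ι μ R) (B : Matrix ι ν R) (C : Matrix κ μ R)
    (D : Matrix κ ν R) (v : V E (μ ⊕ ν)) :
    vr (act E (fromBlocks A B C D) v) = act E C (vl v) + act E D (vr v) := by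
  ext i; simp [vl, vr, act_apply]

end Act

section Good

variable {R : Type} [Ring R] [StarRing R] [Algebra ℝ R] [StarModule ℝ R]
  [TopologicalSpace R] [IsTopologicalRing R] [ContinuousStar R] [ContinuousSMul ℝ R]
variable {E : Type} [NormedAddCommGroup E] [InnerProductSpace ℝ E] [FiniteDimensional ℝ E]
  [Module R E] [IsScalarTower ℝ R E] [ContinuousSMul R E] [StarAct R E]
variable {ι κ μ ν : Type} [Fintype ι] [Fintype κ] [Fintype μ] [Fintype ν]
variable {𝓢 : Set R}

/-- All entries anticommute with `𝓢`. -/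
def OddM (𝓢 : Set R) (A : Matrix ι κ R) : Prop := ∀ s ∈ 𝓢, ∀ i j, A i j * s = -(s * A i j)

/-- All entries commute with `𝓢`. -/
def EvenM (𝓢 : Set R) (A : Matrix ι κ R) : Prop := ∀ s ∈ 𝓢, ∀ i j, A i j * s = s * A i j

variable (E) in
/-- Injective self-adjoint matrices anticommuting with `𝓢`. -/
structure Good (𝓢 : Set R) (A : Matrix ι ι R) : Prop where
  sa : Aᴴ = A
  odd : OddM 𝓢 A
  inj : ∀ v : V E ι, act E A v = 0 → v = 0

theorem OddM.add {A B : Matrix ι κ R} (hA : OddM 𝓢 A) (hB : OddM 𝓢 B) : OddM 𝓢 (A + B) := by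
  intro s hs i j
  simp only [Matrix.add_apply, add_mul, mul_add, hA s hs, hB s hs, neg_add]

theorem OddM.neg {A : Matrix ι κ R} (hA : OddM 𝓢 A) : OddM 𝓢 (-A) := by
  intro s hs i j
  simp [hA s hs]

theorem OddM.sub {A B : Matrix ι κ R} (hA : OddM 𝓢 A) (hB : OddM 𝓢 B) : OddM 𝓢 (A - B) := by
  rw [sub_eq_add_neg]; exact hA.add hB.neg

theorem OddM.smul {A : Matrix ι κ R} (hA : OddM 𝓢 A) (t : ℝ) : OddM 𝓢 (t • A) := by
  intro s hs i j
  simp [hA s hs]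

theorem OddM.zero : OddM 𝓢 (0 : Matrix ι κ R) := by
  intro s hs i j; simp

theorem EvenM.mul_odd {A : Matrix ι κ R} {B : Matrix κ μ R} (hA : EvenM 𝓢 A) (hB : OddM 𝓢 B) :
    OddM 𝓢 (A * B) := by
  intro s hs i j
  simp only [mul_apply, Finset.sum_mul, Finset.mul_sum, ← Finset.sum_neg_distrib]
  refine Finset.sum_congr rfl fun k _ => ?_
  rw [mul_assoc, hB s hs, mul_neg, ← mul_assoc, hA s hs, mul_assoc]

theorem OddM.mul_even {A : Matrix ι κ R} {B : Matrix κ μ R} (hA : OddM 𝓢 A) (hB : EvenM 𝓢 B) :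
    OddM 𝓢 (A * B) := by
  intro s hs i j
  simp only [mul_apply, Finset.sum_mul, Finset.mul_sum, ← Finset.sum_neg_distrib]
  refine Finset.sum_congr rfl fun k _ => ?_
  rw [mul_assoc, hB s hs, ← mul_assoc, hA s hs, neg_mul, mul_assoc]

theorem OddM.mul_odd {A : Matrix ι κ R} {B : Matrix κ μ R} (hA : OddM 𝓢 A) (hB : OddM 𝓢 B) :
    EvenM 𝓢 (A * B) := by
  intro s hs i j
  simp only [mul_apply, Finset.sum_mul, Finset.mul_sum]
  refine Finset.sum_congr rfl fun k _ => ?_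
  rw [mul_assoc, hB s hs, mul_neg, ← mul_assoc, hA s hs, neg_mul, neg_neg, mul_assoc]

theorem EvenM.mul {A : Matrix ι κ R} {B : Matrix κ μ R} (hA : EvenM 𝓢 A) (hB : EvenM 𝓢 B) :
    EvenM 𝓢 (A * B) := by
  intro s hs i j
  simp only [mul_apply, Finset.sum_mul, Finset.mul_sum]
  refine Finset.sum_congr rfl fun k _ => ?_
  rw [mul_assoc, hB s hs, ← mul_assoc, hA s hs, mul_assoc]

theorem EvenM.add {A B : Matrix ι κ R} (hA : EvenM 𝓢 A) (hB : EvenM 𝓢 B) :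
    EvenM 𝓢 (A + B) := by
  intro s hs i j
  simp only [Matrix.add_apply, add_mul, mul_add, hA s hs, hB s hs]

theorem EvenM.neg {A : Matrix ι κ R} (hA : EvenM 𝓢 A) : EvenM 𝓢 (-A) := by
  intro s hs i j
  simp [hA s hs]

theorem EvenM.smul {A : Matrix ι κ R} (hA : EvenM 𝓢 A) (t : ℝ) : EvenM 𝓢 (t • A) := by
  intro s hs i j
  simp [hA s hs]

theorem EvenM.one [DecidableEq ι] : EvenM 𝓢 (1 : Matrix ι ι R) := by
  intro s hs i j
  by_cases h : i = j <;> simp [one_apply, h]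

theorem OddM.fromBlocks {A : Matrix ι μ R} {B : Matrix ι ν R} {C : Matrix κ μ R}
    {D : Matrix κ ν R} (hA : OddM 𝓢 A) (hB : OddM 𝓢 B) (hC : OddM 𝓢 C) (hD : OddM 𝓢 D) :
    OddM 𝓢 (Matrix.fromBlocks A B C D) := by
  rintro s hs (i | i) (j | j)
  exacts [hA s hs i j, hB s hs i j, hC s hs i j, hD s hs i j]

theorem EvenM.fromBlocks {A : Matrix ι μ R} {B : Matrix ι ν R} {C : Matrix κ μ R}
    {D : Matrix κ ν R} (hA : EvenM 𝓢 A) (hB : EvenM 𝓢 B) (hC : EvenM 𝓢 C) (hD : EvenM 𝓢 D) :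
    EvenM 𝓢 (Matrix.fromBlocks A B C D) := by
  rintro s hs (i | i) (j | j)
  exacts [hA s hs i j, hB s hs i j, hC s hs i j, hD s hs i j]

theorem EvenM.zero : EvenM 𝓢 (0 : Matrix ι κ R) := by
  intro s hs i j; simp

theorem OddM.submatrix {A : Matrix ι κ R} (hA : OddM 𝓢 A) (e : μ → ι) (e' : ν → κ) :
    OddM 𝓢 (A.submatrix e e') := fun s hs i j => hA s hs (e i) (e' j)

/-- The diagonal matrix with a single repeated entry. -/
def scal (ι : Type) [DecidableEq ι] (r : R) : Matrix ι ι R := Matrix.diagonal fun _ => r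

theorem Good.fromBlocks {A : Matrix ι ι R} {B : Matrix κ κ R} (hA : Good E 𝓢 A)
    (hB : Good E 𝓢 B) : Good E 𝓢 (Matrix.fromBlocks A 0 0 B) where
  sa := by simp [fromBlocks_conjTranspose, hA.sa, hB.sa]
  odd := hA.odd.fromBlocks OddM.zero OddM.zero hB.odd
  inj v hv := by
    refine v_ext (hA.inj _ ?_) (hB.inj _ ?_)
    · simpa [vl_act_fromBlocks, act_zero] using congrArg vl hv
    · simpa [vr_act_fromBlocks, act_zero] using congrArg vr hv

theorem Good.submatrix {A : Matrix ι ι R} (hA : Good E 𝓢 A) (e : μ ≃ ι) :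
    Good E 𝓢 (A.submatrix e e) where
  sa := by rw [conjTranspose_submatrix, hA.sa]
  odd := hA.odd.submatrix e e
  inj v hv := by
    rw [act_submatrix] at hv
    have : (WithLp.toLp 2 fun j => v (e.symm j) : V E ι) = 0 := by
      apply hA.inj
      ext i
      simpa using congrArg (fun x : V E μ => x (e.symm i)) hv
    ext i
    simpa using congrArg (fun x : V E ι => x (e i)) this

theorem good_empty [IsEmpty ι] (A : Matrix ι ι R) : Good E 𝓢 A where
  sa := by ext i; exact isEmptyElim i
  odd := fun s hs i => isEmptyElim i
  inj v _ := by ext i; exact isEmptyElim i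

/-- If `A` and `B` anticommute then every nontrivial linear combination is injective. -/
theorem Good.rot {A B : Matrix ι ι R} (hA : Good E 𝓢 A) (hB : Good E 𝓢 B)
    (h : A * B + B * A = 0) {a b : ℝ} (hab : a ≠ 0 ∨ b ≠ 0) : Good E 𝓢 (a • A + b • B) where
  sa := by simp [conjTranspose_smul, hA.sa, hB.sa]
  odd := (hA.odd.smul a).add (hB.odd.smul b)
  inj v hv := by
    have h1 : inner ℝ (act E A v) (act E B v) = 0 := by
      have e1 : inner ℝ (act E A v) (act E B v) = inner ℝ v (act E (A * B) v) := by
        rw [inner_act, hA.sa, act_mul]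
      have e2 : inner ℝ (act E A v) (act E B v) = inner ℝ v (act E (B * A) v) := by
        rw [real_inner_comm, inner_act, hB.sa, act_mul]
      have e3 : inner ℝ v (act E (A * B) v) + inner ℝ v (act E (B * A) v) = 0 := by
        rw [← inner_add_right, ← ContinuousLinearMap.add_apply, ← act_add, h, act_zero]; simp
      linarith
    have h2 : ‖act E (a • A + b • B) v‖ ^ 2
        = a ^ 2 * ‖act E A v‖ ^ 2 + b ^ 2 * ‖act E B v‖ ^ 2 := by
      rw [act_add, act_smul, act_smul]
      simp only [ContinuousLinearMap.add_apply, ContinuousLinearMap.smul_apply]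
      rw [norm_add_sq_real, inner_smul_left, inner_smul_right, h1, norm_smul, norm_smul]
      simp [mul_pow]
    rw [hv] at h2
    rcases hab with ha | hb
    · apply hA.inj
      have : ‖act E A v‖ ^ 2 = 0 := by
        have := sq_pos_of_ne_zero ha
        have h3 : 0 ≤ b ^ 2 * ‖act E B v‖ ^ 2 := by positivity
        simp at h2
        nlinarith [sq_nonneg ‖act E A v‖, mul_nonneg this.le (sq_nonneg ‖act E A v‖)]
      simpa using this
    · apply hB.inj
      have : ‖act E B v‖ ^ 2 = 0 := by
        have := sq_pos_of_ne_zero hb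
        have h3 : 0 ≤ a ^ 2 * ‖act E A v‖ ^ 2 := by positivity
        simp at h2
        nlinarith [sq_nonneg ‖act E B v‖, mul_nonneg this.le (sq_nonneg ‖act E B v‖)]
      simpa using this

/-- Congruence by an invertible matrix. -/
theorem Good.conj [DecidableEq ι] {A : Matrix ι ι R} (hA : Good E 𝓢 A) {U W : Matrix ι ι R}
    (hU : EvenM 𝓢 U) (hU' : EvenM 𝓢 Uᴴ) (hWU : W * U = 1) (hUW : U * W = 1) :
    Good E 𝓢 (U * A * Uᴴ) where
  sa := by simp [Matrix.mul_assoc, hA.sa]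
  odd := (hU.mul_odd hA.odd).mul_even hU'
  inj v hv := by
    have h1 : Wᴴ * Uᴴ = 1 := by rw [← conjTranspose_mul, hUW, conjTranspose_one]
    have h2 : act E (A * Uᴴ) v = 0 := by
      have := congrArg (act E W) hv
      rwa [← act_mul, ← Matrix.mul_assoc, ← Matrix.mul_assoc, hWU, Matrix.one_mul, map_zero] at this
    have h3 := hA.inj _ (by rwa [act_mul] at h2)
    have := congrArg (act E Wᴴ) h3
    rwa [← act_mul, h1, act_one, map_zero] at this

end Good

section Fam

variable {R : Type} [Ring R] [StarRing R] [Algebra ℝ R] [StarModule ℝ R]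
  [TopologicalSpace R] [IsTopologicalRing R] [ContinuousStar R] [ContinuousSMul ℝ R]
variable {E : Type} [NormedAddCommGroup E] [InnerProductSpace ℝ E] [FiniteDimensional ℝ E]
  [Module R E] [IsScalarTower ℝ R E] [ContinuousSMul R E] [StarAct R E]
variable {ι κ μ ν : Type} [Fintype ι] [Fintype κ] [Fintype μ] [Fintype ν]
variable {𝓢 : Set R}
variable {P : Type} [NormedAddCommGroup P]

variable (E) in
/-- A continuous family of good matrices, constant outside a ball. -/
structure IsFam (𝓢 : Set R) (f : P → Matrix ι ι R) : Prop where
  cont : Continuous f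
  good : ∀ q, Good E 𝓢 (f q)
  cs : ∃ (r : ℝ) (c : Matrix ι ι R), ∀ q, r ≤ ‖q‖ → f q = c

variable (E) in
/-- Homotopy of families. -/
def Htpy (𝓢 : Set R) (f g : P → Matrix ι ι R) : Prop :=
  ∃ H : ℝ × P → Matrix ι ι R, Continuous H ∧ (∀ s ∈ Icc (0 : ℝ) 1, ∀ q, Good E 𝓢 (H (s, q))) ∧
    (∃ (r : ℝ) (c : ℝ → Matrix ι ι R), ∀ s ∈ Icc (0 : ℝ) 1, ∀ q, r ≤ ‖q‖ → H (s, q) = c s) ∧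
    (∀ q, H (0, q) = f q) ∧ ∀ q, H (1, q) = g q

theorem Htpy.left {f g : P → Matrix ι ι R} (h : Htpy E 𝓢 f g) : IsFam E 𝓢 f := by
  obtain ⟨H, hc, hg, ⟨r, c, hr⟩, h0, h1⟩ := h
  have e : f = fun q => H (0, q) := funext fun q => (h0 q).symm
  subst e
  exact ⟨by fun_prop, fun q => hg 0 (by simp) q, r, c 0, fun q hq => hr 0 (by simp) q hq⟩

theorem Htpy.symm {f g : P → Matrix ι ι R} (h : Htpy E 𝓢 f g) : Htpy E 𝓢 g f := by
  obtain ⟨H, hc, hg, ⟨r, c, hr⟩, h0, h1⟩ := h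
  have hm : ∀ s ∈ Icc (0 : ℝ) 1, 1 - s ∈ Icc (0 : ℝ) 1 := fun s hs =>
    ⟨by linarith [hs.2], by linarith [hs.1]⟩
  refine ⟨fun x => H (1 - x.1, x.2), by fun_prop, fun s hs q => hg _ (hm s hs) q,
    ⟨r, fun s => c (1 - s), fun s hs q hq => hr _ (hm s hs) q hq⟩, ?_, ?_⟩
  · intro q; simp [h1]
  · intro q; simp [h0]

theorem Htpy.right {f g : P → Matrix ι ι R} (h : Htpy E 𝓢 f g) : IsFam E 𝓢 g := h.symm.left

theorem Htpy.refl {f : P → Matrix ι ι R} (h : IsFam E 𝓢 f) : Htpy E 𝓢 f f := by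
  obtain ⟨hc, hg, r, c, hr⟩ := h
  exact ⟨fun x => f x.2, by fun_prop, fun s _ q => hg q, ⟨r, fun _ => c, fun s _ q hq => hr q hq⟩,
    fun q => rfl, fun q => rfl⟩

theorem Htpy.trans {f g h : P → Matrix ι ι R} (h₁ : Htpy E 𝓢 f g) (h₂ : Htpy E 𝓢 g h) :
    Htpy E 𝓢 f h := by
  obtain ⟨H, hc, hg, ⟨r, c, hr⟩, h0, h1⟩ := h₁
  obtain ⟨H', hc', hg', ⟨r', c', hr'⟩, h0', h1'⟩ := h₂
  refine ⟨fun x => if x.1 ≤ 1 / 2 then H (2 * x.1, x.2) else H' (2 * x.1 - 1, x.2), ?_, ?_,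
    ⟨max r r', fun s => if s ≤ 1 / 2 then c (2 * s) else c' (2 * s - 1), ?_⟩, ?_, ?_⟩
  · refine Continuous.if_le (by fun_prop) (by fun_prop) (by fun_prop) (by fun_prop) ?_
    rintro ⟨s, q⟩ hs
    simp only at hs
    subst hs
    norm_num [h1, h0']
  · intro s hs q
    dsimp only
    split_ifs with h
    · exact hg _ ⟨by linarith [hs.1], by linarith⟩ q
    · exact hg' _ ⟨by linarith, by linarith [hs.2]⟩ q
  · intro s hs q hq
    dsimp only
    split_ifs with h
    · exact hr _ ⟨by linarith [hs.1], by linarith⟩ q ((le_max_left _ _).trans hq)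
    · exact hr' _ ⟨by linarith, by linarith [hs.2]⟩ q ((le_max_right _ _).trans hq)
  · intro q; simp [h0]
  · intro q; norm_num [h1']

theorem Htpy.submatrix {f g : P → Matrix ι ι R} (h : Htpy E 𝓢 f g) (e : μ ≃ ι) :
    Htpy E 𝓢 (fun q => (f q).submatrix e e) (fun q => (g q).submatrix e e) := by
  obtain ⟨H, hc, hg, ⟨r, c, hr⟩, h0, h1⟩ := h
  refine ⟨fun x => (H x).submatrix e e, hc.matrix_submatrix _ _,
    fun s hs q => (hg s hs q).submatrix e,
    ⟨r, fun s => (c s).submatrix e e, fun s hs q hq => by simp only [hr s hs q hq]⟩, ?_, ?_⟩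
  · intro q; simp only [h0]
  · intro q; simp only [h1]

theorem Htpy.fromBlocks {f g : P → Matrix ι ι R} {f' g' : P → Matrix κ κ R}
    (h : Htpy E 𝓢 f g) (h' : Htpy E 𝓢 f' g') :
    Htpy E 𝓢 (fun q => Matrix.fromBlocks (f q) 0 0 (f' q))
      (fun q => Matrix.fromBlocks (g q) 0 0 (g' q)) := by
  obtain ⟨H, hc, hg, ⟨r, c, hr⟩, h0, h1⟩ := h
  obtain ⟨H', hc', hg', ⟨r', c', hr'⟩, h0', h1'⟩ := h'
  refine ⟨fun x => Matrix.fromBlocks (H x) 0 0 (H' x),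
    hc.matrix_fromBlocks continuous_const continuous_const hc',
    fun s hs q => (hg s hs q).fromBlocks (hg' s hs q),
    ⟨max r r', fun s => Matrix.fromBlocks (c s) 0 0 (c' s), fun s hs q hq => ?_⟩, ?_, ?_⟩
  · simp only [hr s hs q ((le_max_left _ _).trans hq), hr' s hs q ((le_max_right _ _).trans hq)]
  · intro q; simp only [h0, h0']
  · intro q; simp only [h1, h1']

theorem IsFam.fromBlocks {f : P → Matrix ι ι R} {f' : P → Matrix κ κ R}
    (h : IsFam E 𝓢 f) (h' : IsFam E 𝓢 f') :
    IsFam E 𝓢 (fun q => Matrix.fromBlocks (f q) 0 0 (f' q)) :=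
  ((Htpy.refl h).fromBlocks (Htpy.refl h')).left

theorem IsFam.submatrix {f : P → Matrix ι ι R} (h : IsFam E 𝓢 f) (e : μ ≃ ι) :
    IsFam E 𝓢 (fun q => (f q).submatrix e e) := ((Htpy.refl h).submatrix e).left

theorem isFam_const {c : Matrix ι ι R} (h : Good E 𝓢 c) : IsFam E 𝓢 (fun _ : P => c) :=
  ⟨continuous_const, fun _ => h, 0, c, fun _ _ => rfl⟩

/-- Affine homotopies. -/
theorem Htpy.lin {f g : P → Matrix ι ι R} (hf : IsFam E 𝓢 f) (hg : IsFam E 𝓢 g)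
    (h : ∀ s ∈ Icc (0 : ℝ) 1, ∀ q, Good E 𝓢 ((1 - s) • f q + s • g q)) : Htpy E 𝓢 f g := by
  obtain ⟨hc, -, r, c, hr⟩ := hf
  obtain ⟨hc', -, r', c', hr'⟩ := hg
  refine ⟨fun x => (1 - x.1) • f x.2 + x.1 • g x.2, by fun_prop, h,
    ⟨max r r', fun s => (1 - s) • c + s • c', fun s hs q hq => ?_⟩, by simp, by simp⟩
  simp only [hr q ((le_max_left _ _).trans hq), hr' q ((le_max_right _ _).trans hq)]

/-- Rotation between anticommuting families. -/
theorem Htpy.rot {f g : P → Matrix ι ι R} (hf : IsFam E 𝓢 f) (hg : IsFam E 𝓢 g)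
    (h : ∀ q, f q * g q + g q * f q = 0) : Htpy E 𝓢 f g := by
  refine Htpy.lin hf hg fun s hs q => (hf.good q).rot (hg.good q) (h q) ?_
  by_cases hs0 : s = 0
  · left; simp [hs0]
  · exact Or.inr hs0

variable (E) in
/-- A family with its index type. -/
structure Fam (𝓢 : Set R) (P : Type) [NormedAddCommGroup P] : Type 1 where
  /-- index type -/
  ι : Type
  [fι : Fintype ι]
  /-- the family -/
  f : P → Matrix ι ι R
  isFam : IsFam E 𝓢 f

attribute [instance] Fam.fι

/-- Stable equivalence of families. -/
def Fam.Rel (F F' : Fam E 𝓢 P) : Prop :=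
  ∃ (κ κ' : Type) (_ : Fintype κ) (_ : Fintype κ') (C : Matrix κ κ R) (C' : Matrix κ' κ' R)
    (e : F'.ι ⊕ κ' ≃ F.ι ⊕ κ), Good E 𝓢 C ∧ Good E 𝓢 C' ∧
    Htpy E 𝓢 (fun q => (fromBlocks (F.f q) 0 0 C).submatrix e e)
      (fun q => fromBlocks (F'.f q) 0 0 C')

theorem Fam.Rel.refl (F : Fam E 𝓢 P) : F.Rel F :=
  ⟨Empty, Empty, inferInstance, inferInstance, 0, 0, Equiv.refl _, good_empty _, good_empty _, by
    simpa using Htpy.refl (F.isFam.fromBlocks (isFam_const (good_empty _)))⟩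

theorem Fam.Rel.symm {F F' : Fam E 𝓢 P} (h : F.Rel F') : F'.Rel F := by
  obtain ⟨κ, κ', _, _, C, C', e, hC, hC', h⟩ := h
  refine ⟨κ', κ, inferInstance, inferInstance, C', C, e.symm, hC', hC, ?_⟩
  simpa [submatrix_submatrix] using (h.submatrix e.symm).symm

theorem fromBlocks_swap_inner (A : Matrix ι ι R) (C : Matrix κ κ R) (D : Matrix μ μ R) :
    fromBlocks (fromBlocks A 0 0 C) 0 0 D =
      (fromBlocks A 0 0 (fromBlocks C 0 0 D)).submatrix (Equiv.sumAssoc ι κ μ)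
        (Equiv.sumAssoc ι κ μ) := by
  ext ((i | i) | i) ((j | j) | j) <;> simp

theorem fromBlocks_comm (A : Matrix ι ι R) (C : Matrix κ κ R) :
    fromBlocks A 0 0 C = (fromBlocks C 0 0 A).submatrix (Equiv.sumComm ι κ) (Equiv.sumComm ι κ) := by
  ext (i | i) (j | j) <;> simp

theorem fromBlocks_submatrix_both (A : Matrix ι ι R) (C : Matrix κ κ R) (e : μ ≃ ι) (e' : ν ≃ κ) :
    fromBlocks (A.submatrix e e) 0 0 (C.submatrix e' e') =
      (fromBlocks A 0 0 C).submatrix (Equiv.sumCongr e e') (Equiv.sumCongr e e') := by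
  ext (i | i) (j | j) <;> simp

theorem Fam.Rel.trans {F F' F'' : Fam E 𝓢 P} (h : F.Rel F') (h' : F'.Rel F'') : F.Rel F'' := by
  obtain ⟨κ, κ', _, _, C, C', e, hC, hC', h⟩ := h
  obtain ⟨μ, μ', _, _, D, D', e', hD, hD', h'⟩ := h'
  have a := (h.fromBlocks (Htpy.refl (isFam_const hD)))
  have b := (h'.fromBlocks (Htpy.refl (isFam_const hC')))
  -- rearrange `(F' ⊕ κ') ⊕ μ` into `(F' ⊕ μ) ⊕ κ'`
  let t : (F'.ι ⊕ μ) ⊕ κ' ≃ (F'.ι ⊕ κ') ⊕ μ :=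
    (Equiv.sumAssoc _ _ _).trans
      ((Equiv.sumCongr (Equiv.refl _) (Equiv.sumComm _ _)).trans (Equiv.sumAssoc _ _ _).symm)
  have a' := a.submatrix ((Equiv.sumCongr e' (Equiv.refl κ')).trans t)
  have key : (fun q => (fromBlocks (fromBlocks (F'.f q) 0 0 C') 0 0 D).submatrix
      ((Equiv.sumCongr e' (Equiv.refl κ')).trans t) ((Equiv.sumCongr e' (Equiv.refl κ')).trans t))
      = fun q => fromBlocks ((fromBlocks (F'.f q) 0 0 D).submatrix e' e') 0 0 C' := by
    funext q
    have e1 : fromBlocks ((fromBlocks (F'.f q) 0 0 D).submatrix e' e') 0 0 C' =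
      (fromBlocks (fromBlocks (F'.f q) 0 0 D) 0 0 C').submatrix (Equiv.sumCongr e' (Equiv.refl κ'))
        (Equiv.sumCongr e' (Equiv.refl κ')) := by
      rw [← fromBlocks_submatrix_both]; simp
    rw [e1, Equiv.coe_trans, ← submatrix_submatrix]
    congr 1
    ext ((i | i) | i) ((j | j) | j) <;> simp [t]
  rw [key] at a'
  have c := a'.trans b
  refine ⟨κ ⊕ μ, μ' ⊕ κ', inferInstance, inferInstance, fromBlocks C 0 0 D, fromBlocks D' 0 0 C',
    (Equiv.sumAssoc _ _ _).symm.trans (((Equiv.sumCongr e' (Equiv.refl κ')).trans t).trans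
      ((Equiv.sumCongr e (Equiv.refl μ)).trans (Equiv.sumAssoc _ _ _))),
    hC.fromBlocks hD, hD'.fromBlocks hC', ?_⟩
  have c' := c.submatrix (Equiv.sumAssoc F''.ι μ' κ').symm
  convert c' using 2 with q q
  · have e1 : ∀ q, fromBlocks ((fromBlocks (F.f q) 0 0 C).submatrix e e) 0 0 D =
      (fromBlocks (fromBlocks (F.f q) 0 0 C) 0 0 D).submatrix (Equiv.sumCongr e (Equiv.refl μ))
        (Equiv.sumCongr e (Equiv.refl μ)) := by
      intro q
      rw [← fromBlocks_submatrix_both]; simp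
    rw [e1, fromBlocks_swap_inner]
    simp only [submatrix_submatrix]
    rfl
  · rw [fromBlocks_swap_inner, submatrix_submatrix]
    simp

variable (E 𝓢 P) in
/-- The setoid of stable equivalence. -/
def famSetoid : Setoid (Fam E 𝓢 P) :=
  ⟨Fam.Rel, Fam.Rel.refl, Fam.Rel.symm, Fam.Rel.trans⟩

variable (E 𝓢 P) in
/-- The monoid of stable classes of families. -/
def G : Type 1 := Quotient (famSetoid E 𝓢 P)

/-- The class of a family. -/
def cls (f : P → Matrix ι ι R) (hf : IsFam E 𝓢 f) : G E 𝓢 P :=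
  Quotient.mk (famSetoid E 𝓢 P) ⟨ι, f, hf⟩

theorem cls_eq_iff {f : P → Matrix ι ι R} {g : P → Matrix κ κ R} (hf : IsFam E 𝓢 f)
    (hg : IsFam E 𝓢 g) : cls f hf = cls g hg ↔
      ∃ (μ ν : Type) (_ : Fintype μ) (_ : Fintype ν) (C : Matrix μ μ R) (D : Matrix ν ν R)
    (e : κ ⊕ ν ≃ ι ⊕ μ), Good E 𝓢 C ∧ Good E 𝓢 D ∧
    Htpy E 𝓢 (fun q => (fromBlocks (f q) 0 0 C).submatrix e e)
      (fun q => fromBlocks (g q) 0 0 D) :=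
  Quotient.eq (r := famSetoid E 𝓢 P)

theorem G.ind (x : G E 𝓢 P) : ∃ (ι : Type) (_ : Fintype ι) (f : P → Matrix ι ι R)
    (hf : IsFam E 𝓢 f), x = cls f hf := by
  obtain ⟨F, rfl⟩ := Quotient.exists_rep x
  exact ⟨F.ι, F.fι, F.f, F.isFam, rfl⟩

theorem cls_submatrix {f : P → Matrix ι ι R} (hf : IsFam E 𝓢 f) (e : μ ≃ ι)
    (h' : IsFam E 𝓢 fun q => (f q).submatrix e e) :
    cls (fun q => (f q).submatrix e e) h' = cls f hf := by
  symm
  rw [cls_eq_iff]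
  refine ⟨Empty, Empty, inferInstance, inferInstance, 0, 0, Equiv.sumCongr e (Equiv.refl _),
    good_empty _, good_empty _, ?_⟩
  simp_rw [← fromBlocks_submatrix_both]
  simpa using Htpy.refl (h'.fromBlocks (isFam_const (good_empty (0 : Matrix Empty Empty R))))

theorem cls_htpy {f g : P → Matrix ι ι R} (h : Htpy E 𝓢 f g) (hf : IsFam E 𝓢 f)
    (hg : IsFam E 𝓢 g) : cls f hf = cls g hg := by
  rw [cls_eq_iff]
  refine ⟨Empty, Empty, inferInstance, inferInstance, 0, 0, Equiv.refl _,
    good_empty _, good_empty _, ?_⟩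
  simpa using h.fromBlocks (Htpy.refl (isFam_const (good_empty (0 : Matrix Empty Empty R))))

theorem cls_stab {f : P → Matrix ι ι R} (hf : IsFam E 𝓢 f) {C : Matrix κ κ R} (hC : Good E 𝓢 C)
    (h' : IsFam E 𝓢 fun q => fromBlocks (f q) 0 0 C) :
    cls (fun q => fromBlocks (f q) 0 0 C) h' = cls f hf := by
  rw [cls_eq_iff]
  refine ⟨Empty, κ, inferInstance, inferInstance, 0, C, (Equiv.sumEmpty _ _).symm,
    good_empty _, hC, ?_⟩
  have : (fun q => (fromBlocks (fromBlocks (f q) 0 0 C) 0 0 (0 : Matrix Empty Empty R)).submatrix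
    (Equiv.sumEmpty _ _).symm (Equiv.sumEmpty _ _).symm) = fun q => fromBlocks (f q) 0 0 C := by
    funext q; ext i j; simp
  rw [this]
  exact Htpy.refl h'

theorem fromBlocks_shuffle (A : Matrix ι ι R) (B : Matrix κ κ R) (C : Matrix μ μ R)
    (D : Matrix ν ν R) : fromBlocks (fromBlocks A 0 0 B) 0 0 (fromBlocks C 0 0 D) =
      (fromBlocks (fromBlocks A 0 0 C) 0 0 (fromBlocks B 0 0 D)).submatrix
        (Equiv.sumSumSumComm ι κ μ ν) (Equiv.sumSumSumComm ι κ μ ν) := by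
  ext ((i | i) | (i | i)) ((j | j) | (j | j)) <;> simp

theorem cls_sum_congr {f : P → Matrix ι ι R} {g : P → Matrix κ κ R} {f' : P → Matrix μ μ R}
    {g' : P → Matrix ν ν R} (hf : IsFam E 𝓢 f) (hg : IsFam E 𝓢 g) (hf' : IsFam E 𝓢 f')
    (hg' : IsFam E 𝓢 g') (h : cls f hf = cls g hg) (h' : cls f' hf' = cls g' hg') :
    cls _ (hf.fromBlocks hf') = cls _ (hg.fromBlocks hg') := by
  rw [cls_eq_iff] at h h' ⊢
  obtain ⟨α, β, _, _, C, D, e, hC, hD, h⟩ := h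
  obtain ⟨α', β', _, _, C', D', e', hC', hD', h'⟩ := h'
  refine ⟨α ⊕ α', β ⊕ β', inferInstance, inferInstance, _, _,
    ((Equiv.sumSumSumComm _ _ _ _).trans (Equiv.sumCongr e e')).trans
      (Equiv.sumSumSumComm _ _ _ _), hC.fromBlocks hC', hD.fromBlocks hD', ?_⟩
  convert (h.fromBlocks h').submatrix (Equiv.sumSumSumComm κ ν β β') using 2 with q q
  · rw [fromBlocks_shuffle, fromBlocks_submatrix_both, submatrix_submatrix, submatrix_submatrix]
    congr 1 <;> ext x <;> rcases x with (x | x) | (x | x) <;> simp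
    all_goals first
      | rcases e (Sum.inl x) with y | y <;> simp
      | rcases e (Sum.inr x) with y | y <;> simp
      | rcases e' (Sum.inl x) with y | y <;> simp
      | rcases e' (Sum.inr x) with y | y <;> simp
  · rw [fromBlocks_shuffle]

instance : Add (G E 𝓢 P) :=
  ⟨Quotient.map₂ (fun F F' => ⟨F.ι ⊕ F'.ι, _, F.isFam.fromBlocks F'.isFam⟩)
    (fun F F' h G' G'' h' => Quotient.exact (s := famSetoid E 𝓢 P) (cls_sum_congr F.isFam F'.isFam G'.isFam G''.isFam
      (Quotient.sound h) (Quotient.sound h')))⟩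

theorem cls_add {f : P → Matrix ι ι R} {g : P → Matrix κ κ R} (hf : IsFam E 𝓢 f)
    (hg : IsFam E 𝓢 g) (h : IsFam E 𝓢 fun q => fromBlocks (f q) 0 0 (g q)) :
    cls _ h = cls f hf + cls g hg := rfl

instance : Zero (G E 𝓢 P) := ⟨cls (fun _ => (0 : Matrix Empty Empty R)) (isFam_const (good_empty _))⟩

theorem cls_const {c : Matrix ι ι R} (hc : Good E 𝓢 c) (h : IsFam E 𝓢 fun _ : P => c) :
    cls _ h = 0 := by
  have h0 : IsFam E 𝓢 fun _ : P => (0 : Matrix Empty Empty R) := isFam_const (good_empty _)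
  have h2 := cls_stab h0 hc (h0.fromBlocks (isFam_const hc))
  have h3 := cls_submatrix (h0.fromBlocks (isFam_const hc)) (Equiv.emptySum Empty ι).symm
    ((h0.fromBlocks (isFam_const hc)).submatrix _)
  have : (fun _ : P => (fromBlocks (0 : Matrix Empty Empty R) 0 0 c).submatrix
      (Equiv.emptySum Empty ι).symm (Equiv.emptySum Empty ι).symm) = fun _ => c := by
    funext q; ext i j; simp
  simp only [this] at h3
  rw [h3, h2]; rfl

instance : AddCommMonoid (G E 𝓢 P) where
  add_assoc x y z := by
    obtain ⟨ι, _, f, hf, rfl⟩ := x.ind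
    obtain ⟨κ, _, g, hg, rfl⟩ := y.ind
    obtain ⟨μ, _, h, hh, rfl⟩ := z.ind
    rw [← cls_add hf hg (hf.fromBlocks hg), ← cls_add _ hh ((hf.fromBlocks hg).fromBlocks hh),
      ← cls_add hg hh (hg.fromBlocks hh), ← cls_add hf _ (hf.fromBlocks (hg.fromBlocks hh)),
      ← cls_submatrix (hf.fromBlocks (hg.fromBlocks hh)) (Equiv.sumAssoc ι κ μ)
        ((hf.fromBlocks (hg.fromBlocks hh)).submatrix _)]
    congr 1
    funext q
    exact fromBlocks_swap_inner _ _ _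
  add_comm x y := by
    obtain ⟨ι, _, f, hf, rfl⟩ := x.ind
    obtain ⟨κ, _, g, hg, rfl⟩ := y.ind
    rw [← cls_add hf hg (hf.fromBlocks hg), ← cls_add hg hf (hg.fromBlocks hf),
      ← cls_submatrix (hg.fromBlocks hf) (Equiv.sumComm ι κ) ((hg.fromBlocks hf).submatrix _)]
    congr 1
    funext q
    exact fromBlocks_comm _ _
  zero_add x := by
    obtain ⟨ι, _, f, hf, rfl⟩ := x.ind
    have h0 : IsFam E 𝓢 fun _ : P => (0 : Matrix Empty Empty R) := isFam_const (good_empty _)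
    have h3 := cls_submatrix (h0.fromBlocks hf) (Equiv.emptySum Empty ι).symm
      ((h0.fromBlocks hf).submatrix _)
    have : (fun q : P => (fromBlocks (0 : Matrix Empty Empty R) 0 0 (f q)).submatrix
        (Equiv.emptySum Empty ι).symm (Equiv.emptySum Empty ι).symm) = f := by
      funext q; ext i j; simp
    simp only [this] at h3
    exact h3.symm
  add_zero x := by
    obtain ⟨ι, _, f, hf, rfl⟩ := x.ind
    exact cls_stab hf (good_empty _) (hf.fromBlocks (isFam_const (good_empty _)))
  nsmul := nsmulRec

/-- Additive maps out of `G`. -/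
def G.lift {A : Type*} [AddCommMonoid A]
    (F : ∀ (ι : Type) [Fintype ι] (f : P → Matrix ι ι R), IsFam E 𝓢 f → A)
    (htpy : ∀ (ι : Type) [Fintype ι] (f g : P → Matrix ι ι R) (h : Htpy E 𝓢 f g),
      F ι f h.left = F ι g h.right)
    (reindex : ∀ (ι κ : Type) [Fintype ι] [Fintype κ] (e : κ ≃ ι) (f : P → Matrix ι ι R)
      (h : IsFam E 𝓢 f), F κ _ (h.submatrix e) = F ι f h)
    (sum : ∀ (ι κ : Type) [Fintype ι] [Fintype κ] (f : P → Matrix ι ι R) (g : P → Matrix κ κ R)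
      (hf : IsFam E 𝓢 f) (hg : IsFam E 𝓢 g), F _ _ (hf.fromBlocks hg) = F _ f hf + F _ g hg)
    (const : ∀ (ι : Type) [Fintype ι] (c : Matrix ι ι R) (h : Good E 𝓢 c),
      F ι _ (isFam_const h) = 0) : G E 𝓢 P →+ A where
  toFun := Quotient.lift (fun X : Fam E 𝓢 P => F X.ι X.f X.isFam) (by
    rintro ⟨ι, f, hf⟩ ⟨κ, g, hg⟩ ⟨μ, ν, _, _, C, D, e, hC, hD, h⟩
    have h1 := htpy _ _ _ h
    have h2 := reindex _ _ e _ (hf.fromBlocks (isFam_const hC))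
    have h3 := sum _ _ _ _ hf (isFam_const hC)
    have h4 := sum _ _ _ _ hg (isFam_const hD)
    rw [const _ _ hC, add_zero] at h3
    rw [const _ _ hD, add_zero] at h4
    exact h3.symm.trans (h2.symm.trans (h1.trans h4)))
  map_zero' := const _ _ (good_empty _)
  map_add' x y := by
    obtain ⟨ι, _, f, hf, rfl⟩ := x.ind
    obtain ⟨κ, _, g, hg, rfl⟩ := y.ind
    exact sum _ _ _ _ hf hg

end Fam

section Tools

variable {R : Type} [Ring R] [StarRing R] [Algebra ℝ R] [StarModule ℝ R]
  [TopologicalSpace R] [IsTopologicalRing R] [ContinuousStar R] [ContinuousSMul ℝ R]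
variable {E : Type} [NormedAddCommGroup E] [InnerProductSpace ℝ E] [FiniteDimensional ℝ E]
  [Module R E] [IsScalarTower ℝ R E] [ContinuousSMul R E] [StarAct R E]
variable {ι κ μ ν : Type} [Fintype ι] [Fintype κ] [Fintype μ] [Fintype ν]
variable {𝓢 : Set R}
variable {P : Type} [NormedAddCommGroup P]

/-- Every element of `𝓢` is self-adjoint or skew-adjoint. -/
def StarOdd (𝓢 : Set R) : Prop := ∀ s ∈ 𝓢, star s = s ∨ star s = -s

theorem EvenM.star (h𝓢 : StarOdd 𝓢) {A : Matrix ι κ R} (hA : EvenM 𝓢 A) : EvenM 𝓢 Aᴴ := by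
  intro s hs i j
  have h := congrArg Star.star (hA s hs j i)
  rw [star_mul, star_mul] at h
  rw [conjTranspose_apply]
  rcases h𝓢 s hs with e | e <;> rw [e] at h
  · exact h.symm
  · simpa using h.symm

theorem OddM.scal [DecidableEq ι] {r : R} (h : ∀ s ∈ 𝓢, r * s = -(s * r)) :
    OddM 𝓢 (scal ι r) := by
  intro s hs i j
  by_cases hij : i = j <;> simp [Bott.scal, hij, h s hs]

theorem EvenM.scal [DecidableEq ι] {r : R} (h : ∀ s ∈ 𝓢, r * s = s * r) :
    EvenM 𝓢 (scal ι r) := by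
  intro s hs i j
  by_cases hij : i = j <;> simp [Bott.scal, hij, h s hs]

theorem scal_mul_scal [DecidableEq ι] (a b : R) : scal ι a * scal ι b = scal ι (a * b) := by
  simp [scal]

theorem scal_one [DecidableEq ι] : scal ι (1 : R) = 1 := by simp [scal]

theorem scal_neg [DecidableEq ι] (a : R) : scal ι (-a) = -scal ι a := by
  simp [scal]

theorem scal_star [DecidableEq ι] (a : R) : (scal ι a)ᴴ = scal ι (star a) := by
  simp [scal, diagonal_conjTranspose]

theorem scal_mul_apply [DecidableEq ι] (a : R) (A : Matrix ι κ R) (i : ι) (j : κ) :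
    (scal ι a * A) i j = a * A i j := by simp [scal]

theorem mul_scal_apply [DecidableEq κ] (a : R) (A : Matrix ι κ R) (i : ι) (j : κ) :
    (A * scal κ a) i j = A i j * a := by simp [scal]

theorem OddM.scal_comm [DecidableEq ι] {A : Matrix ι ι R} (hA : OddM 𝓢 A) {s : R} (hs : s ∈ 𝓢) :
    A * Bott.scal ι s = -(Bott.scal ι s * A) := by
  ext i j; rw [neg_apply, scal_mul_apply, mul_scal_apply, hA s hs]

theorem EvenM.scal_comm [DecidableEq ι] {A : Matrix ι ι R} (hA : EvenM 𝓢 A) {s : R} (hs : s ∈ 𝓢) :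
    A * Bott.scal ι s = Bott.scal ι s * A := by
  ext i j; rw [scal_mul_apply, mul_scal_apply, hA s hs]

theorem Good.of_inv [DecidableEq ι] {A B : Matrix ι ι R} (sa : Aᴴ = A) (odd : OddM 𝓢 A)
    (h : B * A = 1) : Good E 𝓢 A where
  sa := sa
  odd := odd
  inj v hv := by
    have := congrArg (act E B) hv
    rwa [← act_mul, h, act_one, map_zero] at this

/-- Unitary elements anticommuting with `𝓢`. -/
structure OddU (𝓢 : Set R) (w : R) : Prop where
  l : star w * w = 1
  r : w * star w = 1
  odd : ∀ s ∈ 𝓢, w * s = -(s * w)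

theorem OddU.odd_star {w : R} (h : OddU 𝓢 w) : ∀ s ∈ 𝓢, star w * s = -(s * star w) := by
  intro s hs
  have := h.odd s hs
  calc star w * s = star w * s * (w * star w) := by rw [h.r, mul_one]
    _ = -(star w * (w * s) * star w) := by
        rw [this]; noncomm_ring
    _ = -(s * star w) := by rw [← mul_assoc, h.l, one_mul]

/-- The standard off-diagonal involution. -/
def mw (ι : Type) [DecidableEq ι] (w : R) : Matrix (ι ⊕ ι) (ι ⊕ ι) R :=
  fromBlocks 0 (scal ι w) (scal ι (star w)) 0

theorem mw_sa [DecidableEq ι] (w : R) : (mw ι w)ᴴ = mw ι w := by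
  simp [mw, fromBlocks_conjTranspose, scal_star]

theorem mw_odd [DecidableEq ι] {w : R} (h : OddU 𝓢 w) : OddM 𝓢 (mw ι w) :=
  OddM.zero.fromBlocks (OddM.scal h.odd) (OddM.scal h.odd_star) OddM.zero

theorem mw_sq [DecidableEq ι] {w : R} (h : OddU 𝓢 w) : mw ι w * mw ι w = 1 := by
  simp [mw, fromBlocks_multiply, scal_mul_scal, h.l, h.r, scal_one]

theorem mw_good [DecidableEq ι] {w : R} (h : OddU 𝓢 w) : Good E 𝓢 (mw ι w) :=
  Good.of_inv (mw_sa w) (mw_odd h) (mw_sq h)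

/-- The additive inverse of a good matrix. -/
def opp [DecidableEq ι] (w : R) (A : Matrix ι ι R) : Matrix ι ι R :=
  -(scal ι (star w) * A * scal ι w)

theorem opp_apply [DecidableEq ι] (w : R) (A : Matrix ι ι R) (i j : ι) :
    opp w A i j = -(star w * A i j * w) := by
  rw [opp, neg_apply, mul_scal_apply, scal_mul_apply]

theorem Good.opp [DecidableEq ι] {w : R} (h : OddU 𝓢 w) {A : Matrix ι ι R} (hA : Good E 𝓢 A) :
    Good E 𝓢 (opp w A) where
  sa := by
    ext i j
    have := congrFun (congrFun hA.sa i) j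
    rw [conjTranspose_apply] at this
    rw [conjTranspose_apply, opp_apply, opp_apply, star_neg, star_mul, star_mul, star_star, this,
      mul_assoc]
  odd := by
    have h1 : EvenM 𝓢 (scal ι (star w) * A) := (OddM.scal h.odd_star).mul_odd hA.odd
    exact (h1.mul_odd (OddM.scal h.odd)).neg
  inj v hv := by
    have h2 : act E (A * scal ι w) v = 0 := by
      have := congrArg (act E (-(scal ι w))) hv
      rwa [Bott.opp, ← act_mul, neg_mul_neg, ← Matrix.mul_assoc, ← Matrix.mul_assoc, scal_mul_scal,
        h.r, scal_one, Matrix.one_mul, map_zero] at this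
    rw [act_mul] at h2
    have := congrArg (act E (scal ι (star w))) (hA.inj _ h2)
    rwa [← act_mul, scal_mul_scal, h.l, scal_one, act_one, map_zero] at this

theorem opp_anti [DecidableEq ι] {w : R} (h : OddU 𝓢 w) (A : Matrix ι ι R) :
    fromBlocks A 0 0 (opp w A) * mw ι w + mw ι w * fromBlocks A 0 0 (opp w A) = 0 := by
  have e1 : scal ι w * opp w A = -(A * scal ι w) := by
    rw [opp, Matrix.mul_neg, ← Matrix.mul_assoc, ← Matrix.mul_assoc, scal_mul_scal, h.r, scal_one,
      Matrix.one_mul]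
  have e2 : opp w A * scal ι (star w) = -(scal ι (star w) * A) := by
    rw [opp, Matrix.neg_mul, Matrix.mul_assoc, scal_mul_scal, h.r, scal_one,
      Matrix.mul_one]
  simp only [mw, fromBlocks_multiply, fromBlocks_add, Matrix.zero_mul, Matrix.mul_zero, add_zero,
    zero_add, e1, e2]
  simp

theorem continuous_opp [DecidableEq ι] (w : R) : Continuous (opp w : Matrix ι ι R → _) := by
  unfold opp; fun_prop

theorem IsFam.opp [DecidableEq ι] {w : R} (h : OddU 𝓢 w) {f : P → Matrix ι ι R}
    (hf : IsFam E 𝓢 f) : IsFam E 𝓢 fun q => opp w (f q) := by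
  obtain ⟨hc, hg, r, c, hr⟩ := hf
  exact ⟨(continuous_opp w).comp hc, fun q => (hg q).opp h, r, Bott.opp w c,
    fun q hq => by rw [hr q hq]⟩

theorem htpy_opp [DecidableEq ι] {w : R} (h : OddU 𝓢 w) {f : P → Matrix ι ι R}
    (hf : IsFam E 𝓢 f) :
    Htpy E 𝓢 (fun q => fromBlocks (f q) 0 0 (opp w (f q))) (fun _ => mw ι w) :=
  Htpy.rot (hf.fromBlocks (hf.opp h)) (isFam_const (mw_good h)) fun q => opp_anti h _

theorem cls_add_opp [DecidableEq ι] {w : R} (h : OddU 𝓢 w) {f : P → Matrix ι ι R}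
    (hf : IsFam E 𝓢 f) : cls f hf + cls _ (hf.opp h) = 0 := by
  rw [← cls_add hf _ (hf.fromBlocks (hf.opp h)), cls_htpy (htpy_opp h hf) _
    (isFam_const (mw_good h)), cls_const (mw_good h)]

theorem G.exists_neg {w : R} (h : OddU 𝓢 w) (x : G E 𝓢 P) : ∃ y, x + y = 0 := by
  classical
  obtain ⟨ι, _, f, hf, rfl⟩ := x.ind
  exact ⟨_, cls_add_opp h hf⟩

/-- A path of congruences. -/
theorem Htpy.conj [DecidableEq ι] (h𝓢 : StarOdd 𝓢) {f : P → Matrix ι ι R} (hf : IsFam E 𝓢 f)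
    (D W : ℝ → Matrix ι ι R) (hD : Continuous D) (hDe : ∀ s, EvenM 𝓢 (D s))
    (h1 : ∀ s, W s * D s = 1) (h2 : ∀ s, D s * W s = 1) :
    Htpy E 𝓢 (fun q => D 0 * f q * (D 0)ᴴ) (fun q => D 1 * f q * (D 1)ᴴ) := by
  obtain ⟨hc, hg, r, c, hr⟩ := hf
  refine ⟨fun x => D x.1 * f x.2 * (D x.1)ᴴ, by fun_prop, fun s _ q =>
    (hg q).conj (hDe s) ((hDe s).star h𝓢) (h1 s) (h2 s), ⟨r, fun s => D s * c * (D s)ᴴ,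
    fun s _ q hq => by simp only [hr q hq]⟩, fun q => rfl, fun q => rfl⟩

section Whitehead
variable [DecidableEq ι]

/-- Upper elementary block matrix. -/
def e12 (U : Matrix ι ι R) : Matrix (ι ⊕ ι) (ι ⊕ ι) R := fromBlocks 1 U 0 1
/-- Lower elementary block matrix. -/
def e21 (U : Matrix ι ι R) : Matrix (ι ⊕ ι) (ι ⊕ ι) R := fromBlocks 1 0 U 1

theorem e12_mul (U U' : Matrix ι ι R) : e12 U * e12 U' = e12 (U + U') := by
  simp [e12, fromBlocks_multiply, add_comm]
theorem e21_mul (U U' : Matrix ι ι R) : e21 U * e21 U' = e21 (U + U') := by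
  simp [e21, fromBlocks_multiply]
theorem e12_zero : e12 (0 : Matrix ι ι R) = 1 := by simp [e12]
theorem e21_zero : e21 (0 : Matrix ι ι R) = 1 := by simp [e21]

/-- The Whitehead path from `1` to `diag (U, W)`. -/
def wh (U W : Matrix ι ι R) (t : ℝ) : Matrix (ι ⊕ ι) (ι ⊕ ι) R :=
  e12 (t • U) * (e21 (-(t • W)) * (e12 (t • U) * (e12 (-(t • 1)) * (e21 (t • 1) *
    e12 (-(t • 1))))))

/-- The inverse of the Whitehead path. -/
def whi (U W : Matrix ι ι R) (t : ℝ) : Matrix (ι ⊕ ι) (ι ⊕ ι) R :=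
  ((((e12 (t • 1) * e21 (-(t • 1))) * e12 (t • 1)) * e12 (-(t • U))) * e21 (t • W)) *
    e12 (-(t • U))

theorem six_cancel {M : Type*} [Monoid M] {a b c d e f a' b' c' d' e' f' : M} (ha : a * a' = 1)
    (hb : b * b' = 1) (hc : c * c' = 1) (hd : d * d' = 1) (he : e * e' = 1) (hf : f * f' = 1) :
    (a * (b * (c * (d * (e * f))))) * (((((f' * e') * d') * c') * b') * a') = 1 := by
  have h6 : ∀ x, f * (f' * x) = x := fun x => by rw [← mul_assoc, hf, one_mul]
  have h5 : ∀ x, e * (e' * x) = x := fun x => by rw [← mul_assoc, he, one_mul]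
  have h4 : ∀ x, d * (d' * x) = x := fun x => by rw [← mul_assoc, hd, one_mul]
  have h3 : ∀ x, c * (c' * x) = x := fun x => by rw [← mul_assoc, hc, one_mul]
  have h2 : ∀ x, b * (b' * x) = x := fun x => by rw [← mul_assoc, hb, one_mul]
  simp only [mul_assoc, h6, h5, h4, h3, h2, ha]

theorem six_cancel' {M : Type*} [Monoid M] {a b c d e f a' b' c' d' e' f' : M} (ha : a' * a = 1)
    (hb : b' * b = 1) (hc : c' * c = 1) (hd : d' * d = 1) (he : e' * e = 1) (hf : f' * f = 1) :
    (((((f' * e') * d') * c') * b') * a') * (a * (b * (c * (d * (e * f))))) = 1 := by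
  have h1 : ∀ x, a' * (a * x) = x := fun x => by rw [← mul_assoc, ha, one_mul]
  have h5 : ∀ x, e' * (e * x) = x := fun x => by rw [← mul_assoc, he, one_mul]
  have h4 : ∀ x, d' * (d * x) = x := fun x => by rw [← mul_assoc, hd, one_mul]
  have h3 : ∀ x, c' * (c * x) = x := fun x => by rw [← mul_assoc, hc, one_mul]
  have h2 : ∀ x, b' * (b * x) = x := fun x => by rw [← mul_assoc, hb, one_mul]
  simp only [mul_assoc, h1, h5, h4, h3, h2, hf]

theorem wh_mul_whi (U W : Matrix ι ι R) (t : ℝ) : wh U W t * whi U W t = 1 :=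
  six_cancel (by simp [e12_mul, e12_zero]) (by simp [e21_mul, e21_zero])
    (by simp [e12_mul, e12_zero]) (by simp [e12_mul, e12_zero]) (by simp [e21_mul, e21_zero])
    (by simp [e12_mul, e12_zero])

theorem whi_mul_wh (U W : Matrix ι ι R) (t : ℝ) : whi U W t * wh U W t = 1 :=
  six_cancel' (by simp [e12_mul, e12_zero]) (by simp [e21_mul, e21_zero])
    (by simp [e12_mul, e12_zero]) (by simp [e12_mul, e12_zero]) (by simp [e21_mul, e21_zero])
    (by simp [e12_mul, e12_zero])

theorem wh_zero (U W : Matrix ι ι R) : wh U W 0 = 1 := by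
  simp [wh, e12_zero, e21_zero]

theorem wh_one {U W : Matrix ι ι R} (h1 : U * W = 1) (h2 : W * U = 1) :
    wh U W 1 = fromBlocks U 0 0 W := by
  simp only [wh, e12, e21, fromBlocks_multiply, one_smul, Matrix.one_mul, Matrix.mul_one,
    Matrix.zero_mul, Matrix.mul_zero, add_zero, zero_add, Matrix.mul_neg, Matrix.neg_mul,
    Matrix.mul_add, h1, h2]
  simp

theorem continuous_wh {X : Type*} [TopologicalSpace X] {U W : X → Matrix ι ι R} {t : X → ℝ}
    (hU : Continuous U) (hW : Continuous W) (ht : Continuous t) :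
    Continuous fun x => wh (U x) (W x) (t x) := by
  unfold wh e12 e21
  have h : ∀ {A B C D : X → Matrix ι ι R}, Continuous A → Continuous B → Continuous C →
    Continuous D → Continuous fun x => fromBlocks (A x) (B x) (C x) (D x) :=
    fun a b c d => a.matrix_fromBlocks b c d
  have c1 : Continuous fun _ : X => (1 : Matrix ι ι R) := continuous_const
  have c0 : Continuous fun _ : X => (0 : Matrix ι ι R) := continuous_const
  have k1 := h c1 (ht.smul hU) c0 c1
  have k2 := h c1 c0 (ht.smul hW).neg c1
  have k3 := h c1 (ht.smul c1).neg c0 c1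
  have k4 := h c1 c0 (ht.smul c1) c1
  exact k1.mul (k2.mul (k1.mul (k3.mul (k4.mul k3))))

theorem wh_even {U W : Matrix ι ι R} (hU : EvenM 𝓢 U) (hW : EvenM 𝓢 W) (t : ℝ) :
    EvenM 𝓢 (wh U W t) := by
  have h12 : ∀ {X : Matrix ι ι R}, EvenM 𝓢 X → EvenM 𝓢 (e12 X) := fun h =>
    EvenM.one.fromBlocks h EvenM.zero EvenM.one
  have h21 : ∀ {X : Matrix ι ι R}, EvenM 𝓢 X → EvenM 𝓢 (e21 X) := fun h =>
    EvenM.one.fromBlocks EvenM.zero h EvenM.one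
  have h1 : EvenM 𝓢 (t • (1 : Matrix ι ι R)) := EvenM.one.smul t
  exact (h12 (hU.smul t)).mul ((h21 (hW.smul t).neg).mul ((h12 (hU.smul t)).mul
    ((h12 h1.neg).mul ((h21 h1).mul (h12 h1.neg)))))

end Whitehead

/-- Congruent families have the same class. -/
theorem cls_conj [DecidableEq ι] (h𝓢 : StarOdd 𝓢) {e : R} (he : OddU 𝓢 e) (hes : star e = e)
    {f : P → Matrix ι ι R} (hf : IsFam E 𝓢 f) {U W : Matrix ι ι R} (hU : EvenM 𝓢 U)
    (hW : EvenM 𝓢 W) (h1 : U * W = 1) (h2 : W * U = 1)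
    (h' : IsFam E 𝓢 fun q => U * f q * Uᴴ) : cls _ h' = cls f hf := by
  have hC : Good E 𝓢 (scal ι e) := Good.of_inv (B := scal ι e) (by rw [scal_star, hes])
    (OddM.scal he.odd) (by rw [scal_mul_scal, ← scal_one]; nth_rw 1 [← hes]; rw [he.l])
  have hC' : Good E 𝓢 (W * scal ι e * Wᴴ) := hC.conj hW (hW.star h𝓢) h1 h2
  have H := Htpy.conj h𝓢 (hf.fromBlocks (isFam_const hC)) (wh U W) (whi U W)
    (continuous_wh continuous_const continuous_const continuous_id) (wh_even hU hW)
    (whi_mul_wh U W) (wh_mul_whi U W)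
  simp only [wh_zero, wh_one h1 h2, conjTranspose_one, Matrix.one_mul, Matrix.mul_one,
    fromBlocks_conjTranspose, fromBlocks_multiply, conjTranspose_zero, Matrix.zero_mul,
    Matrix.mul_zero, add_zero, zero_add] at H
  rw [← cls_stab hf hC H.left, cls_htpy H H.left H.right, cls_stab h' hC']

end Tools

section Based

variable {R : Type} [Ring R] [StarRing R] [Algebra ℝ R] [StarModule ℝ R]
  [TopologicalSpace R] [IsTopologicalRing R] [ContinuousStar R] [ContinuousSMul ℝ R]
variable {E : Type} [NormedAddCommGroup E] [InnerProductSpace ℝ E] [FiniteDimensional ℝ E]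
  [Module R E] [IsScalarTower ℝ R E] [ContinuousSMul R E] [StarAct R E]
variable {ι κ μ ν : Type} [Fintype ι] [Fintype κ] [Fintype μ] [Fintype ν]
variable {𝓢 : Set R}
variable {P : Type} [NormedAddCommGroup P]
variable {P' : Type} [NormedAddCommGroup P']

/-- Maps pulling bounded sets back to bounded sets. -/
def Proper (φ : P' → P) : Prop := ∀ r : ℝ, ∃ r' : ℝ, ∀ q, r' ≤ ‖q‖ → r ≤ ‖φ q‖

theorem IsFam.comp {f : P → Matrix ι ι R} (hf : IsFam E 𝓢 f) {φ : P' → P} (hφ : Continuous φ)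
    (hp : Proper φ) : IsFam E 𝓢 fun q => f (φ q) := by
  obtain ⟨hc, hg, r, c, hr⟩ := hf
  obtain ⟨r', hr'⟩ := hp r
  exact ⟨hc.comp hφ, fun q => hg _, r', c, fun q hq => hr _ (hr' q hq)⟩

theorem Htpy.comp {f g : P → Matrix ι ι R} (hf : Htpy E 𝓢 f g) {φ : P' → P} (hφ : Continuous φ)
    (hp : Proper φ) : Htpy E 𝓢 (fun q => f (φ q)) fun q => g (φ q) := by
  obtain ⟨H, hc, hg, ⟨r, c, hr⟩, h0, h1⟩ := hf
  obtain ⟨r', hr'⟩ := hp r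
  exact ⟨fun x => H (x.1, φ x.2), by fun_prop, fun s hs q => hg s hs _,
    ⟨r', c, fun s hs q hq => hr s hs _ (hr' q hq)⟩, fun q => h0 _, fun q => h1 _⟩

/-- Homotopies induced by homotopies of the parameter space. -/
theorem IsFam.htpy_comp {f : P → Matrix ι ι R} (hf : IsFam E 𝓢 f) {φ : ℝ × P' → P}
    (hφ : Continuous φ)
    (hp : ∀ r : ℝ, ∃ r' : ℝ, ∀ s ∈ Icc (0 : ℝ) 1, ∀ q, r' ≤ ‖q‖ → r ≤ ‖φ (s, q)‖) :
    Htpy E 𝓢 (fun q => f (φ (0, q))) fun q => f (φ (1, q)) := by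
  obtain ⟨hc, hg, r, c, hr⟩ := hf
  obtain ⟨r', hr'⟩ := hp r
  exact ⟨fun x => f (φ x), by fun_prop, fun s hs q => hg _,
    ⟨r', fun _ => c, fun s hs q hq => hr _ (hr' s hs q hq)⟩, fun q => rfl, fun q => rfl⟩

variable (E 𝓢) in
/-- Pullback along a proper map. -/
def pull (φ : P' → P) (hφ : Continuous φ) (hp : Proper φ) : G E 𝓢 P →+ G E 𝓢 P' :=
  G.lift (fun _ _ f hf => cls _ (hf.comp hφ hp))
    (fun _ _ f g h => cls_htpy (h.comp hφ hp) _ _)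
    (fun _ _ _ _ e f h => cls_submatrix _ e _)
    (fun _ _ _ _ f g hf hg => cls_add _ _ _)
    (fun _ _ c h => cls_const h _)

theorem pull_cls (φ : P' → P) (hφ : Continuous φ) (hp : Proper φ) {f : P → Matrix ι ι R}
    (hf : IsFam E 𝓢 f) : pull E 𝓢 φ hφ hp (cls f hf) = cls _ (hf.comp hφ hp) := rfl

variable (E 𝓢) in
/-- Homeomorphic parameter spaces give isomorphic groups. -/
def pullEquiv (φ : P' ≃ₜ P) (hp : Proper φ) (hp' : Proper φ.symm) : G E 𝓢 P ≃+ G E 𝓢 P' :=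
  { pull E 𝓢 φ φ.continuous hp with
    invFun := pull E 𝓢 φ.symm φ.symm.continuous hp'
    left_inv := fun x => by
      obtain ⟨ι, _, f, hf, rfl⟩ := x.ind
      change pull E 𝓢 _ _ _ (pull E 𝓢 _ _ _ _) = _
      rw [pull_cls, pull_cls]; simp
    right_inv := fun x => by
      obtain ⟨ι, _, f, hf, rfl⟩ := x.ind
      change pull E 𝓢 _ _ _ (pull E 𝓢 _ _ _ _) = _
      rw [pull_cls, pull_cls]; simp }

/-- Families with a prescribed value at infinity. -/
def Based (x₀ : Matrix ι ι R) (f : P → Matrix ι ι R) : Prop := ∃ r : ℝ, ∀ q, r ≤ ‖q‖ → f q = x₀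

variable (E) in
/-- Based homotopies. -/
def HtpyB (𝓢 : Set R) (x₀ : Matrix ι ι R) (f g : P → Matrix ι ι R) : Prop :=
  ∃ H : ℝ × P → Matrix ι ι R, Continuous H ∧ (∀ s ∈ Icc (0 : ℝ) 1, ∀ q, Good E 𝓢 (H (s, q))) ∧
    (∃ r : ℝ, ∀ s ∈ Icc (0 : ℝ) 1, ∀ q, r ≤ ‖q‖ → H (s, q) = x₀) ∧
    (∀ q, H (0, q) = f q) ∧ ∀ q, H (1, q) = g q

/-- A cutoff function, `0` on the ball of radius `r` and `1` outside the ball of radius `r + 1`. -/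
noncomputable def cut (r : ℝ) (q : P) : ℝ := max 0 (min 1 (‖q‖ - r))

theorem cut_mem (r : ℝ) (q : P) : cut r q ∈ Icc (0 : ℝ) 1 :=
  ⟨le_max_left _ _, max_le zero_le_one (min_le_left _ _)⟩

theorem cut_eq_zero {r : ℝ} {q : P} (h : ‖q‖ ≤ r) : cut r q = 0 :=
  max_eq_left ((min_le_right _ _).trans (by linarith))

theorem cut_eq_one {r : ℝ} {q : P} (h : r + 1 ≤ ‖q‖) : cut r q = 1 := by
  rw [cut, min_eq_left (by linarith), max_eq_right zero_le_one]

theorem continuous_cut (r : ℝ) : Continuous (cut r : P → ℝ) := by unfold cut; fun_prop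

theorem exists_norm_ge [NormedSpace ℝ P] [Nontrivial P] (r : ℝ) : ∃ q : P, r ≤ ‖q‖ := by
  obtain ⟨q, hq⟩ := NormedSpace.exists_lt_norm ℝ P r
  exact ⟨q, hq.le⟩

theorem IsFam.exists_good [NormedSpace ℝ P] [Nontrivial P] {f : P → Matrix ι ι R}
    (hf : IsFam E 𝓢 f) : ∃ c, Good E 𝓢 c ∧ ∃ r : ℝ, ∀ q, r ≤ ‖q‖ → f q = c := by
  obtain ⟨hc, hg, r, c, hr⟩ := hf
  obtain ⟨q, hq⟩ := exists_norm_ge (P := P) r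
  exact ⟨c, hr q hq ▸ hg q, r, hr⟩

/-- Every class is represented by a family based at an involution. -/
theorem G.exists_based [NormedSpace ℝ P] [Nontrivial P] {w : R} (hw : OddU 𝓢 w) (x : G E 𝓢 P) :
    ∃ (ι : Type) (_ : Fintype ι) (_ : DecidableEq ι) (f : P → Matrix ι ι R) (hf : IsFam E 𝓢 f)
      (x₀ : Matrix ι ι R), x = cls f hf ∧ Good E 𝓢 x₀ ∧ x₀ * x₀ = 1 ∧ Based x₀ f := by
  classical
  obtain ⟨ι, _, f, hf, rfl⟩ := x.ind
  obtain ⟨c, hc, r, hr⟩ := hf.exists_good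
  have hf1 : IsFam E 𝓢 fun q => fromBlocks (f q) 0 0 (opp w c) :=
    hf.fromBlocks (isFam_const (hc.opp hw))
  have H : Htpy E 𝓢 (fun q => fromBlocks (f q) 0 0 (opp w c))
      (fun q => (1 - cut r q) • fromBlocks (f q) 0 0 (opp w c) + cut r q • mw ι w) := by
    refine ⟨fun x => (1 - x.1 * cut r x.2) • fromBlocks (f x.2) 0 0 (opp w c) +
      (x.1 * cut r x.2) • mw ι w, ?_, ?_, ⟨r + 1, fun s => (1 - s) • fromBlocks c 0 0 (opp w c) +
      s • mw ι w, ?_⟩, by simp, by simp⟩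
    · have h1 := hf1.cont.comp (continuous_snd (X := ℝ))
      have h2 := continuous_fst.mul ((continuous_cut (P := P) r).comp (continuous_snd (X := ℝ)))
      exact ((continuous_const.sub h2).smul h1).add (h2.smul continuous_const)
    · intro s hs q
      dsimp only
      by_cases hq : ‖q‖ ≤ r
      · simpa [cut_eq_zero hq] using hf1.good q
      · rw [hr q (not_le.1 hq).le]
        refine (hc.fromBlocks (hc.opp hw)).rot (mw_good hw) (opp_anti hw c) ?_
        by_cases h0 : s * cut r q = 0
        · left; simp [h0]
        · exact Or.inr h0
    · intro s hs q hq
      dsimp only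
      rw [cut_eq_one hq, hr q (by linarith), mul_one]
  refine ⟨ι ⊕ ι, inferInstance, inferInstance, _, H.right, mw ι w, ?_, mw_good hw, mw_sq hw,
    r + 1, ?_⟩
  · rw [← cls_htpy H H.left H.right, cls_stab hf (hc.opp hw)]
  · intro q hq
    simp [cut_eq_one hq]

/-- A stably null based family becomes null through based homotopies. -/
theorem exists_null_based [NormedSpace ℝ P] [Nontrivial P] [DecidableEq ι] {w : R}
    (hw : OddU 𝓢 w) {f : P → Matrix ι ι R} (hf : IsFam E 𝓢 f) {x₀ : Matrix ι ι R}
    (hb : Based x₀ f) (h0 : cls f hf = 0) :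
    ∃ (κ : Type) (_ : Fintype κ) (_ : DecidableEq κ) (m : Matrix κ κ R)
      (g : P → Matrix (ι ⊕ κ) (ι ⊕ κ) R), Good E 𝓢 m ∧ m * m = 1 ∧
      HtpyB E 𝓢 (fromBlocks x₀ 0 0 m) (fun q => fromBlocks (f q) 0 0 m) g ∧
      HtpyB E 𝓢 (fromBlocks x₀ 0 0 m) g (fun _ => fromBlocks x₀ 0 0 m) := by
  classical
  obtain ⟨μ, ν, _, _, C, D, e, hC, hD, h⟩ := (cls_eq_iff _ _).1
    (h0.trans (cls_const (good_empty (0 : Matrix Empty Empty R))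
      (isFam_const (P := P) (good_empty _))).symm)
  have h' := h.submatrix e.symm
  simp only [submatrix_submatrix, Equiv.self_comp_symm, submatrix_id_id] at h'
  have hopp := isFam_const (P := P) (hC.opp hw)
  have h1 := h'.fromBlocks (Htpy.refl hopp)
  simp only [fromBlocks_swap_inner] at h1
  have h2 := h1.submatrix (Equiv.sumAssoc ι μ μ).symm
  simp only [submatrix_submatrix, Equiv.self_comp_symm, submatrix_id_id] at h2
  have h3 : Htpy E 𝓢 (fun q => fromBlocks (f q) 0 0 (fromBlocks C 0 0 (opp w C)))
    (fun q => fromBlocks (f q) 0 0 (mw μ w)) :=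
    (Htpy.refl hf).fromBlocks (htpy_opp hw (isFam_const (P := P) hC))
  have h4 := h3.symm.trans h2
  obtain ⟨r₁, hb⟩ := hb
  obtain ⟨H, hHc, hHg, ⟨r₂, c, hr⟩, hH0, hH1⟩ := h4
  obtain ⟨q₁, hq₁⟩ := exists_norm_ge (P := P) (max r₁ r₂)
  set r := max r₁ r₂ with hrdef
  have hcc : ∀ s ∈ Icc (0 : ℝ) 1, c s = H (s, q₁) := fun s hs =>
    (hr s hs q₁ ((le_max_right _ _).trans hq₁)).symm
  have hinf : ∀ s ∈ Icc (0 : ℝ) 1, ∀ q, r ≤ ‖q‖ → H (s, q) = H (s, q₁) := fun s hs q hq => by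
    rw [hr s hs q ((le_max_right _ _).trans hq), hcc s hs]
  have hbase : H (0, q₁) = fromBlocks x₀ 0 0 (mw μ w) := by
    rw [hH0]; dsimp only; rw [hb q₁ ((le_max_left _ _).trans hq₁)]
  have hη := continuous_cut (P := P) r
  have hm : ∀ s ∈ Icc (0 : ℝ) 1, ∀ q : P, s * (1 - cut r q) ∈ Icc (0 : ℝ) 1 := fun s hs q =>
    ⟨mul_nonneg hs.1 (by linarith [(cut_mem r q).2]),
      mul_le_one₀ hs.2 (by linarith [(cut_mem r q).2]) (by linarith [(cut_mem r q).1])⟩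
  have hm' : ∀ s ∈ Icc (0 : ℝ) 1, 1 - s ∈ Icc (0 : ℝ) 1 := fun s hs =>
    ⟨by linarith [hs.2], by linarith [hs.1]⟩
  refine ⟨μ ⊕ μ, inferInstance, inferInstance, mw μ w, fun q => H (1 - cut r q, q₁),
    mw_good hw, mw_sq hw, ⟨fun x => H (x.1 * (1 - cut r x.2), x.2), by fun_prop, ?_, ⟨r + 1, ?_⟩,
      ?_, ?_⟩, ⟨fun x => H ((1 - x.1) * (1 - cut r x.2), q₁), by fun_prop, ?_, ⟨r + 1, ?_⟩,
      ?_, ?_⟩⟩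
  · intro s hs q
    exact hHg _ (hm s hs q) q
  · intro s hs q hq
    dsimp only
    rw [cut_eq_one hq, sub_self, mul_zero, hinf 0 (by simp) q (by linarith), hbase]
  · intro q
    simp [hH0]
  · intro q
    dsimp only
    by_cases hq : ‖q‖ ≤ r
    · simp [cut_eq_zero hq, hH1]
    · rw [one_mul]
      exact hinf _ (by simpa using hm 1 (by simp) q) q (not_le.1 hq).le
  · intro s hs q
    exact hHg _ (hm _ (hm' s hs) q) _
  · intro s hs q hq
    dsimp only
    rw [cut_eq_one hq, sub_self, mul_zero, hbase]
  · intro q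
    simp
  · intro q
    simp [hbase]

end Based

section Slow

variable {F : Type*} [NormedAddCommGroup F] [InnerProductSpace ℝ F]

theorem norm_sq_add_half (x w z : F) : ‖x + (1 / 2 : ℝ) • (w + z)‖ ^ 2 =
    ‖x‖ ^ 2 + inner ℝ x w + inner ℝ x z + 1 / 2 * ‖w‖ ^ 2 + 1 / 2 * ‖z‖ ^ 2
      - 1 / 4 * ‖z - w‖ ^ 2 := by
  simp only [← real_inner_self_eq_norm_sq, inner_add_left, inner_add_right, inner_sub_left,
    inner_sub_right, inner_smul_left, inner_smul_right, real_inner_comm x w, real_inner_comm x z,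
    real_inner_comm w z, RCLike.conj_to_real]
  ring

theorem norm_sq_half_half (x x' z : F) : 1 / 2 * ‖x‖ ^ 2 + 1 / 2 * ‖x'‖ ^ 2 + inner ℝ x' z +
    inner ℝ x z + ‖z‖ ^ 2
      = ‖(1 / 2 : ℝ) • (x' - x)‖ ^ 2 + ‖(1 / 2 : ℝ) • (x + x') + z‖ ^ 2 := by
  simp only [← real_inner_self_eq_norm_sq, inner_add_left, inner_add_right, inner_sub_left,
    inner_sub_right, inner_smul_left, inner_smul_right, real_inner_comm x x', real_inner_comm x z,
    real_inner_comm x' z, RCLike.conj_to_real]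
  ring

variable {S : Type*} [Fintype S] (σ : Equiv.Perm S)

theorem sum_perm_symm (f : S → ℝ) : ∑ k, f (σ.symm k) = ∑ k, f k := Equiv.sum_comp σ.symm f

theorem sum_shift (f : S → S → ℝ) : ∑ k, f (σ.symm k) k = ∑ k, f k (σ k) := by
  rw [← Equiv.sum_comp σ]; simp

variable {σ} {c j : F →ₗ[ℝ] F} {δ : S → F →ₗ[ℝ] F} {α : S → ℝ} {m B ε : ℝ}

theorem slow_norm_A (hm : 0 ≤ m) (hcm : ∀ x, m * ‖x‖ ≤ ‖c x‖)
    (hym : ∀ k x, m * ‖x‖ ≤ ‖c x + δ k x‖) (v z : S → F)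
    (hz : ∀ k, z k = δ k ((1 / 2 : ℝ) • (v k + v (σ k)))) :
    m ^ 2 * ∑ k, ‖v k‖ ^ 2 - 1 / 4 * ∑ k, ‖z k - z (σ.symm k)‖ ^ 2 ≤
      ∑ k, ‖c (v k) + (1 / 2 : ℝ) • (z (σ.symm k) + z k)‖ ^ 2 := by
  have e1 : ∑ k, ‖c (v k) + (1 / 2 : ℝ) • (z (σ.symm k) + z k)‖ ^ 2 =
      ∑ k, (‖(1 / 2 : ℝ) • (c (v (σ k)) - c (v k))‖ ^ 2
        + ‖(1 / 2 : ℝ) • (c (v k) + c (v (σ k))) + z k‖ ^ 2)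
      - 1 / 4 * ∑ k, ‖z k - z (σ.symm k)‖ ^ 2 := by
    simp only [norm_sq_add_half, ← norm_sq_half_half, Finset.sum_add_distrib,
      Finset.sum_sub_distrib, ← Finset.mul_sum]
    rw [sum_shift σ fun a b => inner ℝ (c (v b)) (z a), sum_perm_symm σ fun k => ‖z k‖ ^ 2,
      Equiv.sum_comp σ fun k => ‖c (v k)‖ ^ 2]
    ring
  have e2 : m ^ 2 * ∑ k, ‖v k‖ ^ 2 ≤ ∑ k, (‖(1 / 2 : ℝ) • (c (v (σ k)) - c (v k))‖ ^ 2
        + ‖(1 / 2 : ℝ) • (c (v k) + c (v (σ k))) + z k‖ ^ 2) := by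
    have e3 : ∑ k, ‖v k‖ ^ 2 = ∑ k, (1 / 2 * ‖v k‖ ^ 2 + 1 / 2 * ‖v (σ k)‖ ^ 2) := by
      rw [Finset.sum_add_distrib, ← Finset.mul_sum, ← Finset.mul_sum,
        Equiv.sum_comp σ fun k => ‖v k‖ ^ 2]
      ring
    rw [e3, Finset.mul_sum]
    refine Finset.sum_le_sum fun k _ => ?_
    have i0 := norm_sq_half_half (v k) (v (σ k)) 0
    simp only [inner_zero_right, add_zero, norm_zero, ne_eq, OfNat.ofNat_ne_zero,
      not_false_eq_true, zero_pow] at i0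
    rw [i0, mul_add]
    have i1 : (1 / 2 : ℝ) • (c (v (σ k)) - c (v k)) = c ((1 / 2 : ℝ) • (v (σ k) - v k)) := by
      simp
    have i2 : (1 / 2 : ℝ) • (c (v k) + c (v (σ k))) + z k =
      c ((1 / 2 : ℝ) • (v k + v (σ k))) + δ k ((1 / 2 : ℝ) • (v k + v (σ k))) := by
      rw [hz]; simp
    rw [i1, i2]
    refine add_le_add ?_ ?_
    · rw [← mul_pow]; exact pow_le_pow_left₀ (by positivity) (hcm _) 2
    · rw [← mul_pow]; exact pow_le_pow_left₀ (by positivity) (hym _ _) 2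
  linarith

theorem inner_skew (hjs : ∀ x y, inner ℝ (j x) y = -inner ℝ x (j y)) {d : F →ₗ[ℝ] F}
    (hds : ∀ x y, inner ℝ (d x) y = inner ℝ x (d y)) (hdj : ∀ x, d (j x) = -j (d x)) (x y : F) :
    inner ℝ (d x) (j y) = inner ℝ (d y) (j x) := by
  rw [hds, hdj, inner_neg_right, ← hjs, real_inner_comm]

theorem sum_sq_four (v : S → F) : ∑ k, (‖v (σ.symm k)‖ + ‖v k‖ + ‖v (σ k)‖ + ‖v (σ (σ k))‖) ^ 2
    ≤ 16 * ∑ k, ‖v k‖ ^ 2 := by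
  have h : ∀ a b c d : ℝ, (a + b + c + d) ^ 2 ≤ 4 * a ^ 2 + 4 * b ^ 2 + 4 * c ^ 2 + 4 * d ^ 2 := by
    intro a b c d
    nlinarith [sq_nonneg (a - b), sq_nonneg (a - c), sq_nonneg (a - d), sq_nonneg (b - c),
      sq_nonneg (b - d), sq_nonneg (c - d)]
  refine (Finset.sum_le_sum fun k _ => h _ _ _ _).trans ?_
  simp only [Finset.sum_add_distrib, ← Finset.mul_sum]
  rw [sum_perm_symm σ fun k => ‖v k‖ ^ 2, Equiv.sum_comp σ fun k => ‖v k‖ ^ 2,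
    Equiv.sum_comp σ fun k => ‖v (σ k)‖ ^ 2, Equiv.sum_comp σ fun k => ‖v k‖ ^ 2]
  linarith

theorem slow_arith {m B ε V N A J J2 Z : ℝ} (h0 : 0 ≤ V) (hNN : N ≤ 16 * V) (hBε : 0 ≤ B * ε)
    (hs : 80 * B * ε < m ^ 2) (h1 : m ^ 2 * V - 1 / 4 * Z ≤ A)
    (h2 : 1 / 4 * Z ≤ J2 + 2 * B * ε * N) (h3 : -(3 * B * ε * N) ≤ J)
    (h4 : A + J + J2 = 0) : V = 0 := by
  have h5 := mul_le_mul_of_nonneg_left hNN hBε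
  have h6 : (m ^ 2 - 80 * B * ε) * V ≤ 0 := by linarith
  by_contra h
  have : 0 < (m ^ 2 - 80 * B * ε) * V :=
    mul_pos (by linarith) (lt_of_le_of_ne h0 (Ne.symm h))
  linarith

set_option maxHeartbeats 2000000 in
/-- The main estimate: slowly varying loops of invertible operators give invertible operators. -/
theorem slow_inj (hm : 0 < m) (hcm : ∀ x, m * ‖x‖ ≤ ‖c x‖)
    (hym : ∀ k x, m * ‖x‖ ≤ ‖c x + δ k x‖) (hjs : ∀ x y, inner ℝ (j x) y = -inner ℝ x (j y))
    (hjn : ∀ x, ‖j x‖ = ‖x‖) (hcs : ∀ x y, inner ℝ (c x) y = inner ℝ x (c y))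
    (hδs : ∀ k x y, inner ℝ (δ k x) y = inner ℝ x (δ k y)) (hcj : ∀ x, c (j x) = -j (c x))
    (hδj : ∀ k x, δ k (j x) = -j (δ k x)) (hB : 0 ≤ B) (hδB : ∀ k x, ‖δ k x‖ ≤ B * ‖x‖)
    (hα0 : ∀ k, 0 ≤ α k) (hαB : ∀ k, α k ≤ B) (hδα : ∀ k x, ‖δ k x‖ ≤ 2 * α k * ‖x‖)
    (hε : 0 ≤ ε) (hsα : ∀ k, |α (σ k) - α k| ≤ ε)
    (hsδ : ∀ k x, ‖δ (σ k) x - δ k x‖ ≤ ε * ‖x‖) (hsmall : 80 * B * ε < m ^ 2) (v : S → F)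
    (hv : ∀ k, (c (v k) + (1 / 2 : ℝ) • (δ (σ.symm k) ((1 / 2 : ℝ) • (v (σ.symm k) + v k)) +
      δ k ((1 / 2 : ℝ) • (v k + v (σ k))))) +
      (1 / 2 : ℝ) • j (α (σ.symm k) • v (σ.symm k) - α k • v (σ k)) = 0) : v = 0 := by
  set a : S → F := fun k => (1 / 2 : ℝ) • (v k + v (σ k)) with ha
  set z : S → F := fun k => δ k (a k) with hz
  set N : S → ℝ := fun k => ‖v (σ.symm k)‖ + ‖v k‖ + ‖v (σ k)‖ + ‖v (σ (σ k))‖ with hN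
  set A : S → F := fun k => c (v k) + (1 / 2 : ℝ) • (z (σ.symm k) + z k) with hA
  set J : S → F := fun k => (1 / 2 : ℝ) • j (α (σ.symm k) • v (σ.symm k) - α k • v (σ k)) with hJ
  have hN0 : ∀ k, 0 ≤ N k := fun k => by positivity
  have hap : ∀ k, a (σ.symm k) = (1 / 2 : ℝ) • (v (σ.symm k) + v k) := fun k => by simp [ha]
  have hAJ : ∀ k, A k + J k = 0 := fun k => by
    have := hv k
    simp only [hA, hJ, hz, hap k]
    exact this
  have hab : ∀ k, ‖a k‖ ≤ N k := fun k => by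
    have h1 : ‖a k‖ ≤ 1 / 2 * (‖v k‖ + ‖v (σ k)‖) := by
      rw [ha]; simp only [norm_smul]
      norm_num
      linarith [norm_add_le (v k) (v (σ k))]
    have := norm_nonneg (v k); have := norm_nonneg (v (σ k)); have := norm_nonneg (v (σ.symm k))
    have := norm_nonneg (v (σ (σ k)))
    simp only [hN]; linarith
  have hapb : ∀ k, ‖a (σ.symm k)‖ ≤ N k := fun k => by
    have h1 : ‖a (σ.symm k)‖ ≤ 1 / 2 * (‖v (σ.symm k)‖ + ‖v k‖) := by
      rw [hap]; simp only [norm_smul]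
      norm_num
      linarith [norm_add_le (v (σ.symm k)) (v k)]
    have := norm_nonneg (v k); have := norm_nonneg (v (σ k)); have := norm_nonneg (v (σ.symm k))
    have := norm_nonneg (v (σ (σ k)))
    simp only [hN]; linarith
  have hsα' : ∀ k, |α k - α (σ.symm k)| ≤ ε := fun k => by simpa using hsα (σ.symm k)
  have hsδ' : ∀ k x, ‖δ k x - δ (σ.symm k) x‖ ≤ ε * ‖x‖ := fun k x => by
    simpa using hsδ (σ.symm k) x
  have step1 := slow_norm_A (σ := σ) hm.le hcm hym v z (fun k => rfl)
  -- second estimate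
  have step2 : ∀ k, 1 / 4 * ‖z k - z (σ.symm k)‖ ^ 2 ≤ ‖J k‖ ^ 2 + 2 * B * ε * N k ^ 2 := by
    intro k
    have hp0 := norm_nonneg (v k); have hp1 := norm_nonneg (v (σ k))
    have hp2 := norm_nonneg (v (σ.symm k)); have hp3 := norm_nonneg (v (σ (σ k)))
    have e1 : z k - z (σ.symm k) = δ k ((1 / 2 : ℝ) • (v (σ k) - v (σ.symm k)))
        + (δ k (a (σ.symm k)) - δ (σ.symm k) (a (σ.symm k))) := by
      simp only [hz, hap]
      simp only [ha, map_smul, map_add, map_sub]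
      module
    have e2 : J k = (1 / 2 : ℝ) • j (α k • (v (σ.symm k) - v (σ k)))
        - (1 / 2 : ℝ) • j ((α k - α (σ.symm k)) • v (σ.symm k)) := by
      simp only [hJ, ← smul_sub, ← map_sub]
      congr 2
      module
    have n1 : ‖δ k ((1 / 2 : ℝ) • (v (σ k) - v (σ.symm k)))‖ ≤ α k * ‖v (σ k) - v (σ.symm k)‖ := by
      refine (hδα k _).trans ?_
      rw [norm_smul]; norm_num
      linarith
    have n2 : ‖z k - z (σ.symm k)‖ ≤ α k * ‖v (σ k) - v (σ.symm k)‖ + ε * ‖a (σ.symm k)‖ := by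
      rw [e1]
      exact (norm_add_le _ _).trans (add_le_add n1 (hsδ' k _))
    have n3 : 1 / 2 * (α k * ‖v (σ k) - v (σ.symm k)‖) ≤ ‖J k‖ + 1 / 2 * (ε * ‖v (σ.symm k)‖) := by
      have t1 : ‖(1 / 2 : ℝ) • j (α k • (v (σ.symm k) - v (σ k)))‖ =
          1 / 2 * (α k * ‖v (σ k) - v (σ.symm k)‖) := by
        rw [norm_smul, hjn, norm_smul, norm_sub_rev, Real.norm_of_nonneg (hα0 k)]; norm_num
      have t2 : ‖(1 / 2 : ℝ) • j ((α k - α (σ.symm k)) • v (σ.symm k))‖ ≤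
          1 / 2 * (ε * ‖v (σ.symm k)‖) := by
        rw [norm_smul, hjn, norm_smul]; norm_num
        exact mul_le_mul_of_nonneg_right (hsα' k) (norm_nonneg _)
      rw [e2]
      have := norm_sub_norm_le ((1 / 2 : ℝ) • j (α k • (v (σ.symm k) - v (σ k))))
        ((1 / 2 : ℝ) • j ((α k - α (σ.symm k)) • v (σ.symm k)))
      linarith
    have n4 : 1 / 2 * ‖z k - z (σ.symm k)‖ ≤ ‖J k‖ + ε * N k := by
      have u1 := mul_le_mul_of_nonneg_left (hapb k) hε
      have u2 : ‖v (σ.symm k)‖ ≤ N k := by simp only [hN]; linarith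
      have u3 := mul_le_mul_of_nonneg_left u2 hε
      linarith
    have n5 : 1 / 2 * ‖z k - z (σ.symm k)‖ ≤ B * N k := by
      have u1 : ‖z k‖ ≤ B * N k := (hδB _ _).trans (mul_le_mul_of_nonneg_left (hab k) hB)
      have u2 : ‖z (σ.symm k)‖ ≤ B * N k := (hδB _ _).trans (mul_le_mul_of_nonneg_left (hapb k) hB)
      linarith [norm_sub_le (z k) (z (σ.symm k))]
    have n6 : ‖J k‖ ≤ B * N k := by
      simp only [hJ]
      rw [norm_smul, hjn]
      have u1 := norm_sub_le (α (σ.symm k) • v (σ.symm k)) (α k • v (σ k))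
      rw [norm_smul, norm_smul, Real.norm_of_nonneg (hα0 _), Real.norm_of_nonneg (hα0 _)] at u1
      have u2 := mul_le_mul_of_nonneg_right (hαB (σ.symm k)) hp2
      have u3 := mul_le_mul_of_nonneg_right (hαB k) hp1
      have u4 : 0 ≤ B * ‖v k‖ := by positivity
      have u5 : 0 ≤ B * ‖v (σ (σ k))‖ := by positivity
      have u6 : 0 ≤ B * ‖v (σ.symm k)‖ := by positivity
      have u7 : 0 ≤ B * ‖v (σ k)‖ := by positivity
      norm_num
      simp only [hN]
      linarith
    have n7 := hN0 k
    have n8 := norm_nonneg (J k)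
    have n9 := norm_nonneg (z k - z (σ.symm k))
    have n10 : 0 ≤ ε * N k := by positivity
    have n11 : (1 / 2 * ‖z k - z (σ.symm k)‖ - ‖J k‖) * (1 / 2 * ‖z k - z (σ.symm k)‖ + ‖J k‖) ≤
        (ε * N k) * (1 / 2 * ‖z k - z (σ.symm k)‖ + ‖J k‖) :=
      mul_le_mul_of_nonneg_right (by linarith) (by linarith)
    have n12 : (ε * N k) * (1 / 2 * ‖z k - z (σ.symm k)‖ + ‖J k‖) ≤ (ε * N k) * (2 * (B * N k)) :=
      mul_le_mul_of_nonneg_left (by linarith) n10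
    nlinarith
  -- third estimate
  have c1 : ∑ k, inner ℝ (c (v k)) (j (α (σ.symm k) • v (σ.symm k) - α k • v (σ k))) = 0 := by
    simp only [map_sub, map_smul, inner_sub_right, inner_smul_right, Finset.sum_sub_distrib]
    rw [sum_shift σ fun p k => α p * inner ℝ (c (v k)) (j (v p)), sub_eq_zero]
    exact Finset.sum_congr rfl fun k _ => by rw [inner_skew hjs hcs hcj]
  have c2 : ∑ k, inner ℝ (z (σ.symm k) + z k) (j (α (σ.symm k) • v (σ.symm k) - α k • v (σ k))) =
      ∑ k, (inner ℝ (z k) (j ((α (σ.symm k) - α k) • v (σ.symm k)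
        + (α k - α (σ k)) • v (σ (σ k)))) +
        2 * inner ℝ (α k • δ k (a k) - α (σ.symm k) • δ (σ.symm k) (a k)) (j (a (σ.symm k)))) := by
    have s1 : ∑ k, inner ℝ (z (σ.symm k) + z k)
        (j (α (σ.symm k) • v (σ.symm k) - α k • v (σ k))) =
        ∑ k, (inner ℝ (z k) (j (α k • v k - α (σ k) • v (σ (σ k)))) +
          inner ℝ (z k) (j (α (σ.symm k) • v (σ.symm k) - α k • v (σ k)))) := by
      simp only [inner_add_left, Finset.sum_add_distrib]
      rw [sum_shift σ fun p k => inner ℝ (z p) (j (α p • v p - α k • v (σ k)))]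
    have s2 : ∀ k, inner ℝ (z k) (j (α k • v k - α (σ k) • v (σ (σ k)))) +
          inner ℝ (z k) (j (α (σ.symm k) • v (σ.symm k) - α k • v (σ k))) =
        inner ℝ (z k) (j ((α (σ.symm k) - α k) • v (σ.symm k)
        + (α k - α (σ k)) • v (σ (σ k)))) +
        2 * (α k * inner ℝ (z k) (j (a (σ.symm k))) - α k * inner ℝ (z k) (j (a (σ k)))) := by
      intro k
      rw [hap]
      simp only [ha, map_add, map_sub, map_smul, inner_add_right, inner_sub_right,
        inner_smul_right]
      ring
    have s3 : ∑ k, α k * inner ℝ (z k) (j (a (σ k))) =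
        ∑ k, α (σ.symm k) * inner ℝ (δ (σ.symm k) (a k)) (j (a (σ.symm k))) := by
      rw [← sum_shift σ fun p k => α p * inner ℝ (z p) (j (a k))]
      exact Finset.sum_congr rfl fun k _ => by
        rw [inner_skew hjs (hδs (σ.symm k)) (hδj (σ.symm k))]
    rw [s1, Finset.sum_congr rfl fun k _ => s2 k]
    simp only [Finset.sum_add_distrib, ← Finset.mul_sum, Finset.sum_sub_distrib, s3,
      inner_sub_left, inner_smul_left, RCLike.conj_to_real]
    ring
  have c3 : ∀ k, -(6 * B * ε * N k ^ 2) ≤ inner ℝ (z k) (j ((α (σ.symm k) - α k) • v (σ.symm k)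
        + (α k - α (σ k)) • v (σ (σ k)))) +
        2 * inner ℝ (α k • δ k (a k) - α (σ.symm k) • δ (σ.symm k) (a k)) (j (a (σ.symm k))) := by
    intro k
    have hp0 := norm_nonneg (v k); have hp1 := norm_nonneg (v (σ k))
    have hp2 := norm_nonneg (v (σ.symm k)); have hp3 := norm_nonneg (v (σ (σ k)))
    have n7 := hN0 k
    have u1 : ‖z k‖ ≤ B * N k := (hδB _ _).trans (mul_le_mul_of_nonneg_left (hab k) hB)
    have u2 : ‖j ((α (σ.symm k) - α k) • v (σ.symm k) + (α k - α (σ k)) • v (σ (σ k)))‖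
        ≤ ε * N k := by
      rw [hjn]
      refine (norm_add_le _ _).trans ?_
      rw [norm_smul, norm_smul, Real.norm_eq_abs, Real.norm_eq_abs,
        abs_sub_comm (α (σ.symm k)) (α k), abs_sub_comm (α k) (α (σ k))]
      have t1 := mul_le_mul_of_nonneg_right (hsα' k) hp2
      have t2 := mul_le_mul_of_nonneg_right (hsα k) hp3
      have t3 : 0 ≤ ε * ‖v k‖ := by positivity
      have t4 : 0 ≤ ε * ‖v (σ k)‖ := by positivity
      simp only [hN]
      linarith
    have u3 : ‖α k • δ k (a k) - α (σ.symm k) • δ (σ.symm k) (a k)‖ ≤ 2 * B * ε * N k := by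
      have e : α k • δ k (a k) - α (σ.symm k) • δ (σ.symm k) (a k) =
        (α k - α (σ.symm k)) • δ k (a k) + α (σ.symm k) • (δ k (a k) - δ (σ.symm k) (a k)) := by
        module
      rw [e]
      refine (norm_add_le _ _).trans ?_
      rw [norm_smul, norm_smul, Real.norm_eq_abs, Real.norm_of_nonneg (hα0 _)]
      have t1 : |α k - α (σ.symm k)| * ‖δ k (a k)‖ ≤ ε * (B * N k) :=
        mul_le_mul (hsα' k) u1 (norm_nonneg _) hε
      have t2 : α (σ.symm k) * ‖δ k (a k) - δ (σ.symm k) (a k)‖ ≤ B * (ε * N k) :=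
        mul_le_mul (hαB _) ((hsδ' k _).trans (mul_le_mul_of_nonneg_left (hab k) hε))
          (norm_nonneg _) hB
      linarith
    have u4 : ‖j (a (σ.symm k))‖ ≤ N k := by rw [hjn]; exact hapb k
    have w1 := abs_real_inner_le_norm (z k)
      (j ((α (σ.symm k) - α k) • v (σ.symm k) + (α k - α (σ k)) • v (σ (σ k))))
    have w2 := abs_real_inner_le_norm (α k • δ k (a k) - α (σ.symm k) • δ (σ.symm k) (a k))
      (j (a (σ.symm k)))
    have w3 : ‖z k‖ * ‖j ((α (σ.symm k) - α k) • v (σ.symm k) + (α k - α (σ k)) • v (σ (σ k)))‖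
        ≤ (B * N k) * (ε * N k) := mul_le_mul u1 u2 (norm_nonneg _) (by positivity)
    have w4 : ‖α k • δ k (a k) - α (σ.symm k) • δ (σ.symm k) (a k)‖ * ‖j (a (σ.symm k))‖
        ≤ (2 * B * ε * N k) * N k := mul_le_mul u3 u4 (norm_nonneg _) (by positivity)
    have w5 := neg_abs_le (inner ℝ (z k)
      (j ((α (σ.symm k) - α k) • v (σ.symm k) + (α k - α (σ k)) • v (σ (σ k)))))
    have w6 := neg_abs_le (inner ℝ (α k • δ k (a k) - α (σ.symm k) • δ (σ.symm k) (a k))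
      (j (a (σ.symm k))))
    have w7 : 0 ≤ B * ε * N k ^ 2 := by positivity
    nlinarith
  have step3 : -(3 * B * ε * ∑ k, N k ^ 2) ≤ ∑ k, 2 * inner ℝ (A k) (J k) := by
    have e1 : ∑ k, 2 * inner ℝ (A k) (J k) = ∑ k, inner ℝ (c (v k))
        (j (α (σ.symm k) • v (σ.symm k) - α k • v (σ k))) + 1 / 2 * ∑ k,
        inner ℝ (z (σ.symm k) + z k) (j (α (σ.symm k) • v (σ.symm k) - α k • v (σ k))) := by
      rw [Finset.mul_sum, ← Finset.sum_add_distrib]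
      refine Finset.sum_congr rfl fun k _ => ?_
      simp only [hA, hJ, inner_add_left, inner_smul_left, inner_smul_right, RCLike.conj_to_real]
      ring
    rw [e1, c1, c2, zero_add]
    have := Finset.sum_le_sum fun k (_ : k ∈ Finset.univ) => c3 k
    rw [Finset.sum_neg_distrib, ← Finset.mul_sum] at this
    linarith
  have total : ∑ k, ‖A k‖ ^ 2 + ∑ k, 2 * inner ℝ (A k) (J k) + ∑ k, ‖J k‖ ^ 2 = 0 := by
    rw [← Finset.sum_add_distrib, ← Finset.sum_add_distrib]
    refine Finset.sum_eq_zero fun k _ => ?_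
    rw [← norm_add_sq_real, hAJ]; simp
  have step2' : 1 / 4 * ∑ k, ‖z k - z (σ.symm k)‖ ^ 2 ≤
      ∑ k, ‖J k‖ ^ 2 + 2 * B * ε * ∑ k, N k ^ 2 := by
    rw [Finset.mul_sum, Finset.mul_sum, ← Finset.sum_add_distrib]
    exact Finset.sum_le_sum fun k _ => step2 k
  have hNN : ∑ k, N k ^ 2 ≤ 16 * ∑ k, ‖v k‖ ^ 2 := sum_sq_four v
  have hBε : 0 ≤ B * ε := by positivity
  have hs0 : ∑ k, ‖v k‖ ^ 2 = 0 := by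
    have h0 : 0 ≤ ∑ k, ‖v k‖ ^ 2 := Finset.sum_nonneg fun k _ => by positivity
    exact slow_arith h0 hNN hBε hsmall step1 step2' step3 total
  rw [Finset.sum_eq_zero_iff_of_nonneg fun k _ => by positivity] at hs0
  funext k
  simpa using hs0 k (Finset.mem_univ k)

end Slow

section Loops

variable {R : Type} [Ring R] [StarRing R] [Algebra ℝ R] [StarModule ℝ R]
  [TopologicalSpace R] [IsTopologicalRing R] [ContinuousStar R] [ContinuousSMul ℝ R]
variable {E : Type} [NormedAddCommGroup E] [InnerProductSpace ℝ E] [FiniteDimensional ℝ E]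
  [Module R E] [IsScalarTower ℝ R E] [ContinuousSMul R E] [StarAct R E]
variable {ι κ μ ν : Type} [Fintype ι] [Fintype κ] [Fintype μ] [Fintype ν]
variable {𝓢 : Set R}
variable {S S' : Type} [Fintype S] [DecidableEq S] [Fintype S'] [DecidableEq S']

/-- The matrix with a single nonzero block. -/
def blk (x y : S) (m : Matrix ι ι R) : Matrix (S × ι) (S × ι) R :=
  fun p q => if p.1 = x ∧ q.1 = y then m p.2 q.2 else 0

theorem blk_apply (x y : S) (m : Matrix ι ι R) (k l : S) (a b : ι) :
    blk x y m (k, a) (l, b) = if k = x ∧ l = y then m a b else 0 := rfl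

/-- The component of a vector at a site. -/
def vb (k : S) (v : V E (S × ι)) : V E ι := WithLp.toLp 2 fun a => v (k, a)

theorem vb_ext {v w : V E (S × ι)} (h : ∀ k, vb k v = vb k w) : v = w := by
  ext ⟨k, a⟩
  exact congrArg (fun u : V E ι => u a) (h k)

theorem vb_zero (k : S) : vb k (0 : V E (S × ι)) = 0 := rfl
theorem vb_add (k : S) (v w : V E (S × ι)) : vb k (v + w) = vb k v + vb k w := rfl
theorem vb_sum {X : Type*} (s : Finset X) (k : S) (v : X → V E (S × ι)) :
    vb k (∑ x ∈ s, v x) = ∑ x ∈ s, vb k (v x) := by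
  ext a; simp [vb]

theorem act_sum {X : Type*} (s : Finset X) (A : X → Matrix ι κ R) (v : V E κ) :
    act E (∑ x ∈ s, A x) v = ∑ x ∈ s, act E (A x) v := by
  induction s using Finset.cons_induction with
  | empty => simp [act_zero]
  | cons a s ha ih => rw [Finset.sum_cons, Finset.sum_cons, act_add, ← ih]; rfl

theorem vb_act_blk (k x y : S) (m : Matrix ι ι R) (v : V E (S × ι)) :
    vb k (act E (blk x y m) v) = if k = x then act E m (vb y v) else 0 := by
  ext a
  simp only [vb, act_apply, Fintype.sum_prod_type, blk_apply]
  split_ifs with h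
  · rw [Finset.sum_eq_single y]
    · simp [h, act_apply]
    · intro b _ hb; simp [hb]
    · simp
  · simp [h]

theorem blk_conjTranspose (x y : S) (m : Matrix ι ι R) : (blk x y m)ᴴ = blk y x mᴴ := by
  ext ⟨k, a⟩ ⟨l, b⟩
  simp only [conjTranspose_apply, blk_apply, and_comm]
  split_ifs <;> simp

theorem blk_odd (x y : S) {m : Matrix ι ι R} (h : OddM 𝓢 m) : OddM 𝓢 (blk x y m) := by
  rintro s hs ⟨k, a⟩ ⟨l, b⟩
  simp only [blk_apply]
  split_ifs
  · exact h s hs a b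
  · simp

theorem blk_zero (x y : S) : blk x y (0 : Matrix ι ι R) = 0 := by
  ext ⟨k, a⟩ ⟨l, b⟩; simp [blk_apply]

theorem OddM.sum {X : Type*} (s : Finset X) {A : X → Matrix ι κ R} (h : ∀ x ∈ s, OddM 𝓢 (A x)) :
    OddM 𝓢 (∑ x ∈ s, A x) := by
  induction s using Finset.cons_induction with
  | empty => exact OddM.zero
  | cons a s ha ih =>
    rw [Finset.sum_cons]
    exact (h a (by simp)).add (ih fun x hx => h x (by simp [hx]))

/-- The contribution of a bond `(p, σ p)`. -/
noncomputable def bond (σ : Equiv.Perm S) (J δ : Matrix ι ι R) (α : ℝ) (p : S) :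
    Matrix (S × ι) (S × ι) R :=
  blk p p ((1 / 4 : ℝ) • δ) + blk (σ p) (σ p) ((1 / 4 : ℝ) • δ) +
    blk p (σ p) ((1 / 4 : ℝ) • δ - (α / 2) • J) + blk (σ p) p ((1 / 4 : ℝ) • δ + (α / 2) • J)

/-- The lattice operator associated with a discrete loop. -/
noncomputable def latt (σ : Equiv.Perm S) (J c : Matrix ι ι R) (δ : S → Matrix ι ι R) (α : S → ℝ) :
    Matrix (S × ι) (S × ι) R :=
  ∑ k, blk k k c + ∑ p, bond σ J (δ p) (α p) p

theorem latt_sa {σ : Equiv.Perm S} {J c : Matrix ι ι R} {δ : S → Matrix ι ι R} {α : S → ℝ}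
    (hJ : Jᴴ = -J) (hc : cᴴ = c) (hδ : ∀ k, (δ k)ᴴ = δ k) : (latt σ J c δ α)ᴴ = latt σ J c δ α := by
  simp only [latt, bond, conjTranspose_add, conjTranspose_sum, blk_conjTranspose, conjTranspose_sub,
    conjTranspose_smul, hJ, hc, hδ, star_trivial, smul_neg, sub_neg_eq_add, ← sub_eq_add_neg]
  congr 1
  refine Finset.sum_congr rfl fun p _ => ?_
  abel

theorem latt_odd {σ : Equiv.Perm S} {J c : Matrix ι ι R} {δ : S → Matrix ι ι R} {α : S → ℝ}
    (hJ : OddM 𝓢 J) (hc : OddM 𝓢 c) (hδ : ∀ k, OddM 𝓢 (δ k)) : OddM 𝓢 (latt σ J c δ α) := by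
  refine (OddM.sum _ fun k _ => blk_odd _ _ hc).add (OddM.sum _ fun p _ => ?_)
  have h1 := (hδ p).smul (1 / 4 : ℝ)
  have h2 := hJ.smul (α p / 2)
  exact (((blk_odd _ _ h1).add (blk_odd _ _ h1)).add (blk_odd _ _ (h1.sub h2))).add
    (blk_odd _ _ (h1.add h2))

theorem vb_act_latt (σ : Equiv.Perm S) (J c : Matrix ι ι R) (δ : S → Matrix ι ι R) (α : S → ℝ)
    (v : V E (S × ι)) (k : S) : vb k (act E (latt σ J c δ α) v) =
    (act E c (vb k v) + (1 / 2 : ℝ) •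
      (act E (δ (σ.symm k)) ((1 / 2 : ℝ) • (vb (σ.symm k) v + vb k v)) +
        act E (δ k) ((1 / 2 : ℝ) • (vb k v + vb (σ k) v)))) +
      (1 / 2 : ℝ) • act E J (α (σ.symm k) • vb (σ.symm k) v - α k • vb (σ k) v) := by
  have h : ∀ p, (k = σ p ↔ σ.symm k = p) := fun p => Equiv.symm_apply_eq σ |>.symm
  simp only [latt, bond, act_add, act_sum, vb_add, vb_sum, vb_act_blk, ContinuousLinearMap.add_apply,
    Finset.sum_add_distrib, Finset.sum_ite_eq, h, Finset.mem_univ, if_true, Equiv.apply_symm_apply,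
    act_sub, act_smul, ContinuousLinearMap.sub_apply, ContinuousLinearMap.smul_apply, map_add,
    map_sub, map_smul]
  module

/-- Compatibility of a discrete loop with mesh `h` outside the region `|t| ≥ r`. -/
def Mesh (σ : Equiv.Perm S) (t : S → ℝ) (h r : ℝ) : Prop :=
  ∀ k, |t (σ k) - t k| ≤ h ∨ (r ≤ |t k| ∧ r ≤ |t (σ k)|)

variable (E 𝓢) in
/-- Data of a family of loops over `Z`, controlled on `K`. -/
structure Loop {Z : Type} [TopologicalSpace Z] (j : R) (K : Set Z) (y : Z × ℝ → Matrix ι ι R)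
    (c : Z → Matrix ι ι R) (α : Z × ℝ → ℝ) (r : ℝ) : Prop where
  cy : Continuous y
  cc : Continuous c
  cα : Continuous α
  good : ∀ z ∈ K, ∀ t, Good E (insert j 𝓢) (y (z, t))
  dead : ∀ z ∈ K, ∀ t, r ≤ |t| → y (z, t) = c z ∧ α (z, t) = 0
  nonneg : ∀ z ∈ K, ∀ t, 0 ≤ α (z, t)
  bound : ∀ z ∈ K, ∀ t, ∀ v, ‖act E (y (z, t) - c z) v‖ ≤ 2 * α (z, t) * ‖v‖

/-- A skew unitary element anticommuting with `𝓢`. -/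
structure SkewU (𝓢 : Set R) (j : R) : Prop where
  st : star j = -j
  sq : j * j = -1
  odd : ∀ s ∈ 𝓢, j * s = -(s * j)

theorem OddM.mono {𝓣 : Set R} {A : Matrix ι κ R} (h : OddM 𝓣 A) (hs : 𝓢 ⊆ 𝓣) : OddM 𝓢 A :=
  fun s h' => h s (hs h')

theorem Good.mono {𝓣 : Set R} {A : Matrix ι ι R} (h : Good E 𝓣 A) (hs : 𝓢 ⊆ 𝓣) : Good E 𝓢 A :=
  ⟨h.sa, h.odd.mono hs, h.inj⟩

theorem exists_lower_bound {X : Type*} [TopologicalSpace X] {C : Set X} (hC : IsCompact C)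
    {y : X → Matrix ι ι R} (hy : Continuous y) (hg : ∀ x ∈ C, ∀ v, act E (y x) v = 0 → v = 0) :
    ∃ m : ℝ, 0 < m ∧ ∀ x ∈ C, ∀ v, m * ‖v‖ ≤ ‖act E (y x) v‖ := by
  have hK := hC.prod (isCompact_sphere (0 : V E ι) 1)
  have hcont : Continuous fun p : X × V E ι => ‖act E (y p.1) p.2‖ :=
    ((continuous_act.comp (hy.comp continuous_fst)).clm_apply continuous_snd).norm
  have key : ∃ m : ℝ, 0 < m ∧ ∀ x ∈ C, ∀ v : V E ι, ‖v‖ = 1 → m ≤ ‖act E (y x) v‖ := by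
    rcases (C ×ˢ Metric.sphere (0 : V E ι) 1).eq_empty_or_nonempty with h | h
    · refine ⟨1, one_pos, fun x hx v hv => ?_⟩
      have : (x, v) ∈ C ×ˢ Metric.sphere (0 : V E ι) 1 := ⟨hx, by simpa using hv⟩
      rw [h] at this; exact this.elim
    · obtain ⟨⟨x, v⟩, ⟨hx, hv⟩, hmin⟩ := hK.exists_isMinOn h hcont.continuousOn
      refine ⟨‖act E (y x) v‖, norm_pos_iff.2 fun h0 => ?_, fun x' hx' v' hv' =>
        hmin (a := (x', v')) ⟨hx', by simpa using hv'⟩⟩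
      have := hg x hx v h0
      simp only at hv
      subst this; simp at hv
  obtain ⟨m, hm, h⟩ := key
  refine ⟨m, hm, fun x hx v => ?_⟩
  by_cases hv : v = 0
  · subst hv; simp
  · have h1 := h x hx ((‖v‖⁻¹ : ℝ) • v) (by rw [norm_smul]; simp [hv])
    rw [map_smul, norm_smul, norm_inv, norm_norm] at h1
    have : 0 < ‖v‖ := norm_pos_iff.2 hv
    calc m * ‖v‖ ≤ (‖v‖⁻¹ * ‖act E (y x) v‖) * ‖v‖ := by gcongr
      _ = _ := by field_simp

set_option maxHeartbeats 1000000 in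
theorem Loop.slow [DecidableEq ι] {Z : Type} [PseudoMetricSpace Z] {j : R} (hj : SkewU 𝓢 j)
    {K : Set Z} (hK : IsCompact K) {y : Z × ℝ → Matrix ι ι R} {c : Z → Matrix ι ι R}
    {α : Z × ℝ → ℝ} {r : ℝ} (L : Loop E 𝓢 j K y c α r) :
    ∃ h : ℝ, 0 < h ∧ ∀ (S : Type) [Fintype S] [DecidableEq S] (σ : Equiv.Perm S) (t : S → ℝ),
      Mesh σ t h r → ∀ z ∈ K, Good E 𝓢 (latt σ (scal ι j) (c z) (fun k => y (z, t k) - c z)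
        (fun k => α (z, t k))) := by
  set ρ : ℝ := |r| with hρ
  have hrρ : r ≤ |ρ| := by rw [hρ, abs_abs]; exact le_abs_self r
  have hρ0 : 0 ≤ ρ := abs_nonneg r
  have hC : IsCompact (K ×ˢ Icc (-(ρ + 1)) (ρ + 1)) := hK.prod isCompact_Icc
  obtain ⟨m, hm, hlow⟩ := exists_lower_bound (E := E) hC L.cy
    (fun x hx => (L.good x.1 hx.1 x.2).inj)
  have hcz : ∀ z ∈ K, c z = y (z, ρ) := fun z hz => ((L.dead z hz ρ hrρ).1).symm
  have hρI : ρ ∈ Icc (-(ρ + 1)) (ρ + 1) := ⟨by linarith, by linarith⟩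
  obtain ⟨B, hB⟩ := (hC.bddAbove_image L.cα.continuousOn)
  set B' : ℝ := 2 * max B 0 with hB'
  have hB0 : 0 ≤ B' := by positivity
  have hαB : ∀ z ∈ K, ∀ t, 2 * α (z, t) ≤ B' := by
    intro z hz t
    by_cases ht : |t| ≤ ρ + 1
    · have := hB ⟨(z, t), ⟨hz, abs_le.1 ht⟩, rfl⟩
      have := le_max_left B 0
      linarith
    · rw [(L.dead z hz t (by linarith [le_abs_self r])).2]; linarith
  set ε : ℝ := m ^ 2 / (80 * B' + 1) / 2 with hε
  have hε0 : 0 < ε := by positivity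
  have hsmall : 80 * B' * ε < m ^ 2 := by
    rw [hε, div_div, mul_div_assoc', div_lt_iff₀ (by positivity)]
    nlinarith [pow_pos hm 2]
  have hδc : Continuous fun p : Z × ℝ => (α p, act E (y p - c p.1)) :=
    L.cα.prodMk (continuous_act.comp (L.cy.sub (L.cc.comp continuous_fst)))
  obtain ⟨h, hh, huc⟩ := (Metric.uniformContinuousOn_iff (α := Z × ℝ)
    (β := ℝ × (V E ι →L[ℝ] V E ι))).1 (IsCompact.uniformContinuousOn_of_continuous (β := ℝ × (V E ι →L[ℝ] V E ι)) hC
      hδc.continuousOn) ε hε0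
  refine ⟨min 1 (h / 2), by positivity, fun S _ _ σ t hmesh z hz => ?_⟩
  have hstep : ∀ k, |α (z, t (σ k)) - α (z, t k)| ≤ ε ∧
      ‖act E (y (z, t (σ k)) - c z) - act E (y (z, t k) - c z)‖ ≤ ε := by
    intro k
    have hdead : r ≤ |t k| → r ≤ |t (σ k)| → |α (z, t (σ k)) - α (z, t k)| ≤ ε ∧
      ‖act E (y (z, t (σ k)) - c z) - act E (y (z, t k) - c z)‖ ≤ ε := by
      intro h1 h2
      rw [(L.dead z hz _ h1).1, (L.dead z hz _ h1).2, (L.dead z hz _ h2).1, (L.dead z hz _ h2).2,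
        sub_self, sub_self, abs_zero]
      exact ⟨hε0.le, (norm_zero (E := V E ι →L[ℝ] V E ι)).le.trans hε0.le⟩
    rcases hmesh k with h1 | ⟨h1, h2⟩
    · have h1' := h1.trans (min_le_left _ _)
      have h2' := h1.trans (min_le_right _ _)
      have hr := le_abs_self r
      have e1 := abs_sub_abs_le_abs_sub (t (σ k)) (t k)
      have e2 := abs_sub_abs_le_abs_sub (t k) (t (σ k))
      rw [abs_sub_comm] at e2
      by_cases h3 : |t k| ≤ ρ + 1
      · by_cases h4 : |t (σ k)| ≤ ρ + 1
        · have := huc (z, t (σ k)) ⟨hz, abs_le.1 h4⟩ (z, t k) ⟨hz, abs_le.1 h3⟩ (by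
            rw [Prod.dist_eq]
            simp only [dist_self, Real.dist_eq]
            exact max_lt hh (by linarith))
          rw [Prod.dist_eq, max_lt_iff] at this
          exact ⟨this.1.le, (dist_eq_norm (E := V E ι →L[ℝ] V E ι)
            (act E (y (z, t (σ k)) - c z)) (act E (y (z, t k) - c z))).symm.le.trans this.2.le⟩
        · exact hdead (by linarith) (by linarith)
      · exact hdead (by linarith) (by linarith)
    · exact hdead h1 h2
  have hJst : (scal ι j)ᴴ = -scal ι j := by rw [scal_star, hj.st, scal_neg]
  have hgc : Good E (insert j 𝓢) (c z) := by rw [hcz z hz]; exact L.good z hz ρ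
  have hJodd : ∀ {A : Matrix ι ι R}, OddM (insert j 𝓢) A → ∀ x : V E ι,
      act E A (act E (scal ι j) x) = -act E (scal ι j) (act E A x) := by
    intro A hA x
    rw [← act_mul, ← act_mul, hA.scal_comm (mem_insert _ _), act_neg]; rfl
  have hsub := subset_insert j 𝓢
  refine ⟨latt_sa hJst hgc.sa fun k => ?_, latt_odd (OddM.scal hj.odd) (hgc.odd.mono hsub)
    fun k => ((L.good z hz _).odd.sub hgc.odd).mono hsub, fun v hv => ?_⟩
  · rw [conjTranspose_sub, (L.good z hz _).sa, hgc.sa]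
  · have hsa : ∀ {A : Matrix ι ι R}, Aᴴ = A → ∀ x w : V E ι,
        inner ℝ (act E A x) w = inner ℝ x (act E A w) := fun hA x w => by rw [inner_act, hA]
    have hv' := fun k => vb_act_latt (E := E) σ (scal ι j) (c z) (fun k => y (z, t k) - c z)
      (fun k => α (z, t k)) v k
    simp only [hv, vb_zero, eq_comm (a := (0 : V E ι))] at hv'
    have := slow_inj (σ := σ) (c := (act E (c z)).toLinearMap) (j := (act E (scal ι j)).toLinearMap)
      (δ := fun k => (act E (y (z, t k) - c z)).toLinearMap) (α := fun k => α (z, t k)) hm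
      (B := B') (ε := ε)
      (fun x => by rw [hcz z hz]; exact hlow (z, ρ) ⟨hz, hρI⟩ x)
      (fun k x => by
        simp only [ContinuousLinearMap.coe_coe, ← ContinuousLinearMap.add_apply, ← act_add,
          add_sub_cancel]
        by_cases ht : |t k| ≤ ρ + 1
        · exact hlow (z, t k) ⟨hz, abs_le.1 ht⟩ x
        · rw [(L.dead z hz (t k) (by linarith [le_abs_self r])).1, hcz z hz]
          exact hlow (z, ρ) ⟨hz, hρI⟩ x)
      (fun x w => by
        simp only [ContinuousLinearMap.coe_coe]
        rw [inner_act, hJst, act_neg]; simp)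
      (fun x => by
        have : ‖act E (scal ι j) x‖ ^ 2 = ‖x‖ ^ 2 := by
          rw [← real_inner_self_eq_norm_sq, ← real_inner_self_eq_norm_sq, inner_act, ← act_mul,
            scal_star, scal_mul_scal, hj.st, neg_mul, hj.sq, neg_neg, scal_one, act_one]
        exact (sq_eq_sq₀ (norm_nonneg _) (norm_nonneg _)).1 this)
      (fun x w => hsa hgc.sa x w)
      (fun k x w => hsa (by rw [conjTranspose_sub, (L.good z hz _).sa, hgc.sa]) x w)
      (hJodd hgc.odd) (fun k => hJodd ((L.good z hz _).odd.sub hgc.odd)) hB0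
      (fun k x => (L.bound z hz (t k) x).trans
        (mul_le_mul_of_nonneg_right (hαB z hz (t k)) (norm_nonneg _)))
      (fun k => L.nonneg z hz _) (fun k => by linarith [L.nonneg z hz (t k), hαB z hz (t k)])
      (fun k x => L.bound z hz _ x) hε0.le (fun k => (hstep k).1)
      (fun k x => by
        simp only [ContinuousLinearMap.coe_coe, ← ContinuousLinearMap.sub_apply]
        exact (ContinuousLinearMap.le_opNorm _ _).trans
          (mul_le_mul_of_nonneg_right (hstep k).2 (norm_nonneg _)))
      hsmall (fun k => vb k v) (fun k => by
        exact hv' k)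
    exact vb_ext fun k => congrFun this k

end Loops

section Psi

variable {R : Type} [Ring R] [StarRing R] [Algebra ℝ R] [StarModule ℝ R]
  [TopologicalSpace R] [IsTopologicalRing R] [ContinuousStar R] [ContinuousSMul ℝ R]
variable {E : Type} [NormedAddCommGroup E] [InnerProductSpace ℝ E] [FiniteDimensional ℝ E]
  [Module R E] [IsScalarTower ℝ R E] [ContinuousSMul R E] [StarAct R E]
variable {ι κ μ ν : Type} [Fintype ι] [Fintype κ] [Fintype μ] [Fintype ν]
variable {𝓢 : Set R}
variable {P : Type} [NormedAddCommGroup P]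
variable {S S' : Type} [Fintype S] [DecidableEq S] [Fintype S'] [DecidableEq S']

theorem continuous_blk {X : Type*} [TopologicalSpace X] (x y : S) {m : X → Matrix ι ι R}
    (hm : Continuous m) : Continuous fun z => blk x y (m z) := by
  refine continuous_matrix fun p q => ?_
  unfold blk
  split_ifs
  · exact hm.matrix_elem _ _
  · exact continuous_const

theorem continuous_latt {X : Type*} [TopologicalSpace X] (σ : Equiv.Perm S) (J : Matrix ι ι R)
    {c : X → Matrix ι ι R} {δ : X → S → Matrix ι ι R} {α : X → S → ℝ} (hc : Continuous c)
    (hδ : ∀ k, Continuous fun z => δ z k) (hα : ∀ k, Continuous fun z => α z k) :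
    Continuous fun z => latt σ J (c z) (δ z) (α z) := by
  refine (continuous_finsetSum _ fun k _ => continuous_blk _ _ hc).add
    (continuous_finsetSum _ fun p _ => ?_)
  have h1 : Continuous fun z => (1 / 4 : ℝ) • δ z p := (hδ p).const_smul (1 / 4 : ℝ)
  have h2 : Continuous fun z => (α z p / 2) • J := ((hα p).div_const 2).smul continuous_const
  exact (((continuous_blk _ _ h1).add (continuous_blk _ _ h1)).add
    (continuous_blk _ _ (h1.sub h2))).add (continuous_blk _ _ (h1.add h2))

theorem bond_zero (σ : Equiv.Perm S) (J : Matrix ι ι R) (p : S) : bond σ J 0 0 p = 0 := by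
  simp [bond, blk_zero]

theorem latt_congr {σ σ' : Equiv.Perm S} {J c : Matrix ι ι R} {δ : S → Matrix ι ι R} {α : S → ℝ}
    (h : ∀ p, σ p = σ' p ∨ (δ p = 0 ∧ α p = 0)) : latt σ J c δ α = latt σ' J c δ α := by
  unfold latt
  congr 1
  refine Finset.sum_congr rfl fun p _ => ?_
  rcases h p with h | ⟨h1, h2⟩
  · simp [bond, h]
  · rw [h1, h2, bond_zero, bond_zero]

theorem latt_sum (σ : Equiv.Perm S) (σ' : Equiv.Perm S') (J c : Matrix ι ι R)
    (δ : S ⊕ S' → Matrix ι ι R) (α : S ⊕ S' → ℝ) :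
    latt (Equiv.sumCongr σ σ') J c δ α =
      (fromBlocks (latt σ J c (δ ∘ Sum.inl) (α ∘ Sum.inl)) 0 0
        (latt σ' J c (δ ∘ Sum.inr) (α ∘ Sum.inr))).submatrix (Equiv.sumProdDistrib S S' ι)
        (Equiv.sumProdDistrib S S' ι) := by
  ext ⟨k | k, a⟩ ⟨l | l, b⟩ <;>
  simp [latt, bond, blk_apply, Matrix.add_apply, Matrix.sum_apply, Fintype.sum_sum_type]

theorem latt_submatrix (σ : Equiv.Perm S) (J c : Matrix ι ι R) (δ : S → Matrix ι ι R)
    (α : S → ℝ) (e : κ ≃ ι) :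
    latt σ (J.submatrix e e) (c.submatrix e e) (fun k => (δ k).submatrix e e) α =
      (latt σ J c δ α).submatrix (Equiv.prodCongr (Equiv.refl S) e)
        (Equiv.prodCongr (Equiv.refl S) e) := by
  ext ⟨k, a⟩ ⟨l, b⟩
  simp [latt, bond, blk_apply, Matrix.add_apply, Matrix.sum_apply]

theorem latt_fromBlocks (σ : Equiv.Perm S) (J c : Matrix ι ι R) (J' c' : Matrix κ κ R)
    (δ : S → Matrix ι ι R) (δ' : S → Matrix κ κ R) (α : S → ℝ) :
    latt σ (fromBlocks J 0 0 J') (fromBlocks c 0 0 c') (fun k => fromBlocks (δ k) 0 0 (δ' k)) α =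
      (fromBlocks (latt σ J c δ α) 0 0 (latt σ J' c' δ' α)).submatrix
        (Equiv.prodSumDistrib S ι κ) (Equiv.prodSumDistrib S ι κ) := by
  ext ⟨k, a | a⟩ ⟨l, b | b⟩ <;>
  simp [latt, bond, blk_apply, Matrix.add_apply, Matrix.sum_apply]

theorem scal_submatrix [DecidableEq ι] [DecidableEq κ] (j : R) (e : κ ≃ ι) :
    (scal ι j).submatrix e e = scal κ j := by
  ext a b; simp [scal, diagonal_apply]

theorem scal_sum [DecidableEq ι] [DecidableEq κ] (j : R) :
    scal (ι ⊕ κ) j = fromBlocks (scal ι j) 0 0 (scal κ j) := by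
  ext (a | a) (b | b) <;> simp [scal, diagonal_apply]

/-- The lattice operator of a loop sampled at `t`. -/
noncomputable def samp [DecidableEq ι] (σ : Equiv.Perm S) (j : R) (t : S → ℝ) (c : Matrix ι ι R)
    (y : ℝ → Matrix ι ι R) (α : ℝ → ℝ) : Matrix (S × ι) (S × ι) R :=
  latt σ (scal ι j) c (fun k => y (t k) - c) fun k => α (t k)

theorem Loop.htpy [DecidableEq ι] [NormedSpace ℝ P] [FiniteDimensional ℝ P] {j : R}
    (hj : SkewU 𝓢 j) {y : (ℝ × P) × ℝ → Matrix ι ι R} {c : ℝ × P → Matrix ι ι R}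
    {α : (ℝ × P) × ℝ → ℝ} {r : ℝ} (L : Loop E 𝓢 j (Icc (0 : ℝ) 1 ×ˢ univ) y c α r) {ρ : ℝ}
    (hρ : ∀ s ∈ Icc (0 : ℝ) 1, ∀ q q', ρ ≤ ‖q‖ → ρ ≤ ‖q'‖ → c (s, q) = c (s, q') ∧
      ∀ t, y ((s, q), t) = y ((s, q'), t) ∧ α ((s, q), t) = α ((s, q'), t)) :
    ∃ h : ℝ, 0 < h ∧ ∀ (S : Type) [Fintype S] [DecidableEq S] (σ : Equiv.Perm S) (t : ℝ → S → ℝ),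
      Continuous t → (∀ s ∈ Icc (0 : ℝ) 1, Mesh σ (t s) h r) →
      Htpy E 𝓢 (fun q => samp σ j (t 0) (c (0, q)) (fun x => y ((0, q), x))
          (fun x => α ((0, q), x)))
        (fun q => samp σ j (t 1) (c (1, q)) (fun x => y ((1, q), x)) (fun x => α ((1, q), x))) := by
  have : ProperSpace P := FiniteDimensional.proper ℝ P
  obtain ⟨ρ', q₀, hρ', hq₀, hq₀'⟩ : ∃ (ρ' : ℝ) (q₀ : P), ρ ≤ ρ' ∧ ‖q₀‖ ≤ ρ' ∧
      ∀ q : P, ρ' ≤ ‖q‖ → ρ ≤ ‖q₀‖ := by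
    by_cases h : ∃ q : P, ρ ≤ ‖q‖
    · obtain ⟨q, hq⟩ := h
      exact ⟨max ρ ‖q‖, q, le_max_left _ _, le_max_right _ _, fun _ _ => hq⟩
    · push Not at h
      exact ⟨max ρ 0, 0, le_max_left _ _, by simp, fun q hq =>
        absurd ((le_max_left _ _).trans hq) (not_le.2 (h q))⟩
  have hK : IsCompact (Icc (0 : ℝ) 1 ×ˢ Metric.closedBall (0 : P) ρ') :=
    isCompact_Icc.prod (isCompact_closedBall _ _)
  have hsub : Icc (0 : ℝ) 1 ×ˢ Metric.closedBall (0 : P) ρ' ⊆ Icc (0 : ℝ) 1 ×ˢ univ :=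
    prod_mono_right (subset_univ _)
  obtain ⟨h, hh, H⟩ := Loop.slow hj hK (L := (⟨L.cy, L.cc, L.cα, fun z hz => L.good z (hsub hz),
    fun z hz => L.dead z (hsub hz), fun z hz => L.nonneg z (hsub hz),
    fun z hz => L.bound z (hsub hz)⟩ : Loop E 𝓢 j _ y c α r))
  refine ⟨h, hh, fun S _ _ σ t ht hm => ⟨fun z => samp σ j (t z.1) (c z) (fun x => y (z, x))
    (fun x => α (z, x)), ?_, ?_, ⟨ρ', fun s => samp σ j (t s) (c (s, q₀))
      (fun x => y ((s, q₀), x)) (fun x => α ((s, q₀), x)), ?_⟩, fun _ => rfl, fun _ => rfl⟩⟩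
  · have h1 : ∀ k, Continuous fun z : ℝ × P => (z, t z.1 k) := fun k =>
      continuous_id.prodMk ((continuous_apply k).comp (ht.comp continuous_fst))
    exact continuous_latt _ _ L.cc (fun k => (L.cy.comp (h1 k)).sub L.cc)
      fun k => L.cα.comp (h1 k)
  · have hout : ∀ s ∈ Icc (0 : ℝ) 1, ∀ q, ρ' ≤ ‖q‖ → samp σ j (t s) (c (s, q))
        (fun x => y ((s, q), x)) (fun x => α ((s, q), x)) = samp σ j (t s) (c (s, q₀))
        (fun x => y ((s, q₀), x)) (fun x => α ((s, q₀), x)) := by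
      intro s hs q hq
      have := hρ s hs q q₀ (hρ'.trans hq) (hq₀' q hq)
      simp only [this]
    intro s hs q
    by_cases hq : ‖q‖ ≤ ρ'
    · exact H S σ (t s) (hm s hs) (s, q) ⟨hs, by simpa using hq⟩
    · change Good E 𝓢 (samp σ j (t s) (c (s, q)) (fun x => y ((s, q), x)) fun x => α ((s, q), x))
      rw [hout s hs q (not_le.1 hq).le]
      exact H S σ (t s) (hm s hs) (s, q₀) ⟨hs, by simpa using hq₀⟩
  · intro s hs q hq
    have := hρ s hs q q₀ (hρ'.trans hq) (hq₀' q hq)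
    simp only [this]

/-- A cyclic sampling scheme with mesh `h` covering `[-r, r]`. -/
structure Sch (σ : Equiv.Perm S) (l : S) (t : S → ℝ) (h r : ℝ) : Prop where
  top : r ≤ t l
  bot : t (σ l) ≤ -r
  step : ∀ k, k ≠ l → |t (σ k) - t k| ≤ h

theorem Sch.mesh {σ : Equiv.Perm S} {l : S} {t : S → ℝ} {h r : ℝ} (H : Sch σ l t h r) :
    Mesh σ t h r := by
  intro k
  by_cases hk : k = l
  · subst hk
    exact Or.inr ⟨H.top.trans (le_abs_self _), (le_neg_of_le_neg H.bot).trans (neg_le_abs _)⟩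
  · exact Or.inl (H.step k hk)

theorem Sch.mono {σ : Equiv.Perm S} {l : S} {t : S → ℝ} {h r h' r' : ℝ} (H : Sch σ l t h r)
    (hh : h ≤ h') (hr : r' ≤ r) : Sch σ l t h' r' :=
  ⟨hr.trans H.top, H.bot.trans (by linarith), fun k hk => (H.step k hk).trans hh⟩

theorem exists_sch {h : ℝ} (hh : 0 < h) (r : ℝ) :
    ∃ (N : ℕ) (l : Fin (N + 1)) (t : Fin (N + 1) → ℝ), Sch (finRotate (N + 1)) l t h r := by
  obtain ⟨N, hN⟩ := exists_nat_gt (2 * r / h)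
  rw [div_lt_iff₀ hh] at hN
  refine ⟨N, Fin.last N, fun k => -r + k * h, ⟨?_, ?_, fun k hk => ?_⟩⟩
  · simp only [Fin.val_last]; linarith
  · simp
  · rw [coe_finRotate_of_ne_last hk]
    push_cast
    rw [show -r + ((k : ℝ) + 1) * h - (-r + k * h) = h by ring, abs_of_pos hh]

variable (E) in
/-- Admissible coupling functions for a family of loops. -/
structure Valid (f : P × ℝ → Matrix ι ι R) (c : Matrix ι ι R) (α : P × ℝ → ℝ) (r : ℝ) : Prop where
  cα : Continuous α
  dead : ∀ p, r ≤ ‖p‖ → f p = c ∧ α p = 0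
  bound : ∀ p, ‖act E (f p - c)‖ ≤ 2 * α p

theorem Valid.nonneg {f : P × ℝ → Matrix ι ι R} {c : Matrix ι ι R} {α : P × ℝ → ℝ} {r : ℝ}
    (H : Valid E f c α r) (p : P × ℝ) : 0 ≤ α p := by
  have h1 := H.bound p
  have h2 := norm_nonneg (E := V E ι →L[ℝ] V E ι) (act E (f p - c))
  linarith

theorem IsFam.exists_valid {f : P × ℝ → Matrix ι ι R} (hf : IsFam E 𝓢 f) :
    ∃ c α r, Valid E f c α r := by
  obtain ⟨hc, -, r, c, hr⟩ := hf
  refine ⟨c, fun p => 1 / 2 * ‖act E (f p - c)‖, r, ?_, fun p hp => ⟨hr p hp, ?_⟩, fun p => ?_⟩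
  · have : Continuous fun p => act E (f p - c) := continuous_act.comp (hc.sub continuous_const)
    exact continuous_const.mul ((continuous_norm (E := V E ι →L[ℝ] V E ι)).comp this)
  · rw [hr p hp, sub_self, act_zero, norm_zero (E := V E ι →L[ℝ] V E ι), mul_zero]
  · linarith

/-- The sampled family of a family of loops. -/
noncomputable def sampF [DecidableEq ι] (σ : Equiv.Perm S) (j : R) (t : S → ℝ) (c : Matrix ι ι R)
    (f : P × ℝ → Matrix ι ι R) (α : P × ℝ → ℝ) (q : P) : Matrix (S × ι) (S × ι) R :=
  samp σ j t c (fun x => f (q, x)) (fun x => α (q, x))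

theorem Valid.eq_far {f : P × ℝ → Matrix ι ι R} {c : Matrix ι ι R} {α : P × ℝ → ℝ} {r : ℝ}
    (H : Valid E f c α r) {ρ : ℝ} (h : r ≤ ρ) (h0 : 0 ≤ ρ) : f (0, ρ) = c := by
  refine (H.dead _ (h.trans ?_)).1
  simp [Prod.norm_def, abs_of_nonneg h0]

variable [NormedSpace ℝ P] [FiniteDimensional ℝ P]

/-- Homotopies of families of loops induce homotopies of sampled families. -/
theorem samp_htpy [DecidableEq ι] {j : R} (hj : SkewU 𝓢 j) {f g : P × ℝ → Matrix ι ι R}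
    {c c' : Matrix ι ι R} {α α' : P × ℝ → ℝ} {r r' : ℝ} (hf : Valid E f c α r)
    (hg : Valid E g c' α' r') (hfg : Htpy E (insert j 𝓢) f g) :
    ∃ h ρ : ℝ, 0 < h ∧ r ≤ ρ ∧ r' ≤ ρ ∧ ∀ (S : Type) [Fintype S] [DecidableEq S]
      (σ : Equiv.Perm S) (t : ℝ → S → ℝ),
      Continuous t → (∀ s ∈ Icc (0 : ℝ) 1, Mesh σ (t s) h ρ) →
      Htpy E 𝓢 (sampF σ j (t 0) c f α) (sampF σ j (t 1) c' g α') := by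
  obtain ⟨H, Hc, Hg, ⟨r₀, c₀, hr₀⟩, H0, H1⟩ := hfg
  set ρ := max (max r r') (max r₀ 0) with hρ
  have h1 : r ≤ ρ := (le_max_left _ _).trans (le_max_left _ _)
  have h2 : r' ≤ ρ := (le_max_right _ _).trans (le_max_left _ _)
  have h3 : r₀ ≤ ρ := (le_max_left _ _).trans (le_max_right _ _)
  have h4 : 0 ≤ ρ := (le_max_right _ _).trans (le_max_right _ _)
  have hn : ρ ≤ ‖((0 : P), ρ)‖ := by simp [Prod.norm_def, abs_of_nonneg h4]
  have hdead : ∀ s ∈ Icc (0 : ℝ) 1, ∀ p, ρ ≤ ‖p‖ → H (s, p) = H (s, (0, ρ)) := fun s hs p hp => by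
    rw [hr₀ s hs p (h3.trans hp), hr₀ s hs _ (h3.trans hn)]
  have e0 : H (0, (0, ρ)) = c := by rw [H0]; exact Valid.eq_far hf h1 h4
  have e1 : H (1, (0, ρ)) = c' := by rw [H1]; exact Valid.eq_far hg h2 h4
  have cf : Continuous f := by
    have : f = fun q => H (0, q) := funext fun q => (H0 q).symm
    rw [this]; fun_prop
  have cg : Continuous g := by
    have : g = fun q => H (1, q) := funext fun q => (H1 q).symm
    rw [this]; fun_prop
  let y : (ℝ × P) × ℝ → Matrix ι ι R := fun z => H (z.1.1, (z.1.2, z.2))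
  let d : ℝ × P → Matrix ι ι R := fun z => H (z.1, (0, ρ))
  let a : (ℝ × P) × ℝ → ℝ := fun z => 1 / 2 * ‖act E (y z - d z.1)‖ +
    ((1 - z.1.1) * (α (z.1.2, z.2) - 1 / 2 * ‖act E (f (z.1.2, z.2) - c)‖) +
      z.1.1 * (α' (z.1.2, z.2) - 1 / 2 * ‖act E (g (z.1.2, z.2) - c')‖))
  have cN : ∀ {X : Type} [TopologicalSpace X] {m : X → Matrix ι ι R}, Continuous m →
      Continuous fun x => ‖act E (m x)‖ := fun hm => (continuous_norm (E := V E ι →L[ℝ] V E ι)).comp (continuous_act.comp hm)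
  have cy : Continuous y := by fun_prop
  have cd : Continuous d := by fun_prop
  have L : Loop E 𝓢 j (Icc (0 : ℝ) 1 ×ˢ univ) y d a ρ := by
    have hge : ∀ z : (ℝ × P) × ℝ, z.1.1 ∈ Icc (0 : ℝ) 1 →
        1 / 2 * ‖act E (y z - d z.1)‖ ≤ a z := by
      intro z hz
      have i1 := hf.bound (z.1.2, z.2)
      have i2 := hg.bound (z.1.2, z.2)
      have := add_nonneg (mul_nonneg (sub_nonneg.2 hz.2) (sub_nonneg.2
        (show 1 / 2 * ‖act E (f (z.1.2, z.2) - c)‖ ≤ α (z.1.2, z.2) by linarith)))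
        (mul_nonneg hz.1 (sub_nonneg.2
        (show 1 / 2 * ‖act E (g (z.1.2, z.2) - c')‖ ≤ α' (z.1.2, z.2) by linarith)))
      simp only [a]
      linarith
    refine ⟨cy, cd, ?_, fun z hz t => Hg _ hz.1 _, ?_, ?_, ?_⟩
    · have i1 := cN (cy.sub (cd.comp continuous_fst))
      have i2 : Continuous fun z : (ℝ × P) × ℝ => ‖act E (f (z.1.2, z.2) - c)‖ :=
        cN ((cf.comp (by fun_prop)).sub continuous_const)
      have i3 : Continuous fun z : (ℝ × P) × ℝ => ‖act E (g (z.1.2, z.2) - c')‖ :=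
        cN ((cg.comp (by fun_prop)).sub continuous_const)
      have i4 : Continuous fun z : (ℝ × P) × ℝ => α (z.1.2, z.2) := hf.cα.comp (by fun_prop)
      have i5 : Continuous fun z : (ℝ × P) × ℝ => α' (z.1.2, z.2) := hg.cα.comp (by fun_prop)
      exact (continuous_const.mul i1).add
        (((continuous_const.sub (by fun_prop)).mul (i4.sub (continuous_const.mul i2))).add
          (Continuous.mul (by fun_prop) (i5.sub (continuous_const.mul i3))))
    · intro z hz t ht
      have hp : ρ ≤ ‖(z.2, t)‖ := ht.trans (by simp [Prod.norm_def])
      have e : y (z, t) = d z := hdead _ hz.1 _ hp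
      refine ⟨e, ?_⟩
      simp only [a, e, (hf.dead _ (h1.trans hp)).1, (hf.dead _ (h1.trans hp)).2,
        (hg.dead _ (h2.trans hp)).1, (hg.dead _ (h2.trans hp)).2, sub_self, act_zero,
        norm_zero (E := V E ι →L[ℝ] V E ι)]
      ring
    · intro z hz t
      exact le_trans (mul_nonneg (by norm_num) (norm_nonneg (E := V E ι →L[ℝ] V E ι) _))
        (hge (z, t) hz.1)
    · intro z hz t v
      refine (ContinuousLinearMap.le_opNorm _ v).trans
        (mul_le_mul_of_nonneg_right ?_ (norm_nonneg _))
      have := hge (z, t) hz.1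
      linarith
  obtain ⟨h, hh, Q⟩ := L.htpy hj (ρ := ρ) (by
    intro s hs q q' hq hq'
    refine ⟨rfl, fun t => ?_⟩
    have hp : ρ ≤ ‖(q, t)‖ := hq.trans (by simp [Prod.norm_def])
    have hp' : ρ ≤ ‖(q', t)‖ := hq'.trans (by simp [Prod.norm_def])
    have e : y ((s, q), t) = y ((s, q'), t) := (hdead s hs _ hp).trans (hdead s hs _ hp').symm
    refine ⟨e, ?_⟩
    simp only [a, e, (hf.dead _ (h1.trans hp)).1, (hf.dead _ (h1.trans hp)).2,
        (hg.dead _ (h2.trans hp)).1, (hg.dead _ (h2.trans hp)).2, (hf.dead _ (h1.trans hp')).1,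
        (hf.dead _ (h1.trans hp')).2,
        (hg.dead _ (h2.trans hp')).1, (hg.dead _ (h2.trans hp')).2, d])
  refine ⟨h, ρ, hh, h1, h2, fun S _ _ σ t ht hm => ?_⟩
  convert Q S σ t ht hm using 1
  · funext q
    unfold sampF
    congr 1
    · exact e0.symm
    · funext x; exact (H0 _).symm
    · funext x
      simp only [a, y, d, H0, ← e0]
      ring
  · funext q
    unfold sampF
    congr 1
    · exact e1.symm
    · funext x; exact (H1 _).symm
    · funext x
      simp only [a, y, d, H1, ← e1]
      ring

/-- Independence of the sampling scheme. -/
theorem samp_indep [DecidableEq ι] {j : R} (hj : SkewU 𝓢 j) {f : P × ℝ → Matrix ι ι R}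
    (hF : IsFam E (insert j 𝓢) f)
    {c : Matrix ι ι R} {α : P × ℝ → ℝ} {r : ℝ} (hf : Valid E f c α r) :
    ∃ h ρ : ℝ, 0 < h ∧ r ≤ ρ ∧ ∃ x : G E 𝓢 P, ∀ (S : Type) [Fintype S] [DecidableEq S]
      (σ : Equiv.Perm S) (l : S) (t : S → ℝ), Sch σ l t h ρ →
      ∃ hT : IsFam E 𝓢 (sampF σ j t c f α), cls _ hT = x := by
  obtain ⟨h, ρ, hh, hρ, -, H⟩ := samp_htpy hj hf hf (Htpy.refl hF)
  have hI : ∀ (S : Type) [Fintype S] [DecidableEq S] (σ : Equiv.Perm S) (t : S → ℝ),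
      Mesh σ t h ρ → IsFam E 𝓢 (sampF σ j t c f α) := fun S _ _ σ t hm =>
    (H S σ (fun _ => t) continuous_const fun _ _ => hm).left
  have main : ∀ (S S' : Type) [Fintype S] [DecidableEq S] [Fintype S'] [DecidableEq S']
      (σ : Equiv.Perm S) (σ' : Equiv.Perm S') (l : S) (l' : S') (t : S → ℝ) (t' : S' → ℝ)
      (h1 : Sch σ l t h ρ) (h2 : Sch σ' l' t' h ρ),
      cls _ (hI S σ t h1.mesh) = cls _ (hI S' σ' t' h2.mesh) := by
    intro S S' _ _ _ _ σ σ' l l' t t' h1 h2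
    let τ : Equiv.Perm (S ⊕ S') := Equiv.swap (Sum.inl l) (Sum.inr l') |>.trans
      (Equiv.sumCongr σ σ')
    have τl : τ (Sum.inl l) = Sum.inr (σ' l') := by simp [τ]
    have τl' : τ (Sum.inr l') = Sum.inl (σ l) := by simp [τ]
    have τi : ∀ k, k ≠ l → τ (Sum.inl k) = Sum.inl (σ k) := fun k hk => by
      simp [τ, Equiv.swap_apply_of_ne_of_ne (show (Sum.inl k : S ⊕ S') ≠ Sum.inl l by simpa)
        (show (Sum.inl k : S ⊕ S') ≠ Sum.inr l' by simp)]
    have τi' : ∀ k, k ≠ l' → τ (Sum.inr k) = Sum.inr (σ' k) := fun k hk => by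
      simp [τ, Equiv.swap_apply_of_ne_of_ne (show (Sum.inr k : S ⊕ S') ≠ Sum.inl l by simp)
        (show (Sum.inr k : S ⊕ S') ≠ Sum.inr l' by simpa)]
    let u : ℝ → S ⊕ S' → ℝ := fun s => Sum.elim (fun k => (1 - s) * t k + s * t' (σ' l'))
      (fun k => (1 - s) * t l + s * t' k)
    have hu : Continuous u := by
      refine continuous_pi fun k => ?_
      rcases k with k | k
      · change Continuous fun s : ℝ => (1 - s) * t k + s * t' (σ' l')
        fun_prop
      · change Continuous fun s : ℝ => (1 - s) * t l + s * t' k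
        fun_prop
    have hm : ∀ s ∈ Icc (0 : ℝ) 1, Mesh τ (u s) h ρ := by
      intro s hs k
      have hs1 : 0 ≤ 1 - s := by linarith [hs.2]
      rcases k with k | k
      · left
        by_cases hk : k = l
        · subst hk
          rw [τl]
          simp [u, hh.le]
        · rw [τi k hk]
          simp only [u, Sum.elim_inl]
          rw [show (1 - s) * t (σ k) + s * t' (σ' l') - ((1 - s) * t k + s * t' (σ' l')) =
            (1 - s) * (t (σ k) - t k) by ring, abs_mul, abs_of_nonneg hs1]
          nlinarith [h1.step k hk, abs_nonneg (t (σ k) - t k), hs.1]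
      · by_cases hk : k = l'
        · subst hk
          right
          rw [τl']
          simp only [u, Sum.elim_inl, Sum.elim_inr]
          refine ⟨le_trans ?_ (le_abs_self _), le_trans ?_ (neg_le_abs _)⟩
          · nlinarith [h1.top, h2.top, hs.1]
          · nlinarith [h1.bot, h2.bot, hs.1]
        · left
          rw [τi' k hk]
          simp only [u, Sum.elim_inr]
          rw [show (1 - s) * t l + s * t' (σ' k) - ((1 - s) * t l + s * t' k) =
            s * (t' (σ' k) - t' k) by ring, abs_mul, abs_of_nonneg hs.1]
          nlinarith [h2.step k hk, abs_nonneg (t' (σ' k) - t' k), hs.1]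
    have dead : ∀ q x, (ρ ≤ x ∨ x ≤ -ρ) → f (q, x) - c = 0 ∧ α (q, x) = 0 := by
      intro q x hx
      have : r ≤ ‖(q, x)‖ := by
        refine (hρ.trans ?_).trans (show |x| ≤ ‖(q, x)‖ by simp [Prod.norm_def])
        rcases hx with hx | hx
        · exact hx.trans (le_abs_self _)
        · exact (le_neg_of_le_neg hx).trans (neg_le_abs _)
      obtain ⟨e1, e2⟩ := hf.dead _ this
      exact ⟨by rw [e1, sub_self], e2⟩
    have Q := H (S ⊕ S') τ u hu hm
    have e0 : sampF τ j (u 0) c f α = fun q => (fromBlocks (sampF σ j t c f α q) 0 0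
        (latt σ' (scal ι j) c 0 0)).submatrix (Equiv.sumProdDistrib S S' ι)
        (Equiv.sumProdDistrib S S' ι) := by
      funext q
      have : sampF τ j (u 0) c f α q = latt (Equiv.sumCongr σ σ') (scal ι j) c
          (fun k => f (q, u 0 k) - c) (fun k => α (q, u 0 k)) := by
        refine latt_congr fun k => ?_
        rcases k with k | k
        · by_cases hk : k = l
          · subst hk
            right
            simpa [u] using dead q (t k) (Or.inl h1.top)
          · left; rw [τi k hk]; rfl
        · right
          simpa [u] using dead q (t l) (Or.inl h1.top)
      rw [this, latt_sum]
      congr 2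
      · simp only [sampF, samp, u, Function.comp_def, Sum.elim_inl]
        simp
      · congr 1 <;> funext k <;> simp [u, dead q (t l) (Or.inl h1.top)]
    have e1 : sampF τ j (u 1) c f α = fun q => (fromBlocks (latt σ (scal ι j) c 0 0)
        0 0 (sampF σ' j t' c f α q)).submatrix (Equiv.sumProdDistrib S S' ι)
        (Equiv.sumProdDistrib S S' ι) := by
      funext q
      have : sampF τ j (u 1) c f α q = latt (Equiv.sumCongr σ σ') (scal ι j) c
          (fun k => f (q, u 1 k) - c) (fun k => α (q, u 1 k)) := by
        refine latt_congr fun k => ?_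
        rcases k with k | k
        · right
          simpa [u] using dead q (t' (σ' l')) (Or.inr h2.bot)
        · by_cases hk : k = l'
          · subst hk
            right
            simpa [u] using dead q (t' k) (Or.inl h2.top)
          · left; rw [τi' k hk]; rfl
      rw [this, latt_sum]
      congr 2
      · congr 1 <;> funext k <;> simp [u, dead q (t' (σ' l')) (Or.inr h2.bot)]
      · simp only [sampF, samp, u, Function.comp_def, Sum.elim_inr]
        simp
    have g1 : Good E 𝓢 (latt σ (scal ι j) c 0 0) := by
      have := (H S σ (fun _ _ => ρ) continuous_const fun _ _ k => Or.inl (by simp [hh.le])).left.good 0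
      convert this using 1
      unfold sampF samp
      congr 1 <;> funext k <;> simp [dead 0 ρ (Or.inl le_rfl)]
    have g2 : Good E 𝓢 (latt σ' (scal ι j) c 0 0) := by
      have := (H S' σ' (fun _ _ => ρ) continuous_const
        fun _ _ k => Or.inl (by simp [hh.le])).left.good 0
      convert this using 1
      unfold sampF samp
      congr 1 <;> funext k <;> simp [dead 0 ρ (Or.inl le_rfl)]
    rw [e0, e1] at Q
    have i1 := hI S σ t h1.mesh
    have i2 := hI S' σ' t' h2.mesh
    have k1 := i1.fromBlocks (isFam_const (P := P) g2)
    have k2 := (isFam_const (P := P) g1).fromBlocks i2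
    have E1 := cls_htpy Q Q.left Q.right
    have E2 := cls_submatrix k1 (Equiv.sumProdDistrib S S' ι) Q.left
    have E3 := cls_submatrix k2 (Equiv.sumProdDistrib S S' ι) Q.right
    rw [E2, E3, cls_add i1 (isFam_const g2) k1, cls_add (isFam_const g1) i2 k2, cls_const g2,
      cls_const g1, add_zero, zero_add] at E1
    exact E1
  obtain ⟨N, l, t, hS⟩ := exists_sch hh ρ
  exact ⟨h, ρ, hh, hρ, _, fun S _ _ σ l' t' hS' => ⟨hI S σ t' hS'.mesh,
    main S (Fin (N + 1)) σ _ l' l t' t hS' hS⟩⟩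

end Psi

section PsiRel

variable {R : Type} [Ring R] [StarRing R] [Algebra ℝ R] [StarModule ℝ R]
  [TopologicalSpace R] [IsTopologicalRing R] [ContinuousStar R] [ContinuousSMul ℝ R]
variable {E : Type} [NormedAddCommGroup E] [InnerProductSpace ℝ E] [FiniteDimensional ℝ E]
  [Module R E] [IsScalarTower ℝ R E] [ContinuousSMul R E] [StarAct R E]
variable {ι κ μ ν : Type} [Fintype ι] [Fintype κ] [Fintype μ] [Fintype ν]
variable {𝓢 : Set R}
variable {P : Type} [NormedAddCommGroup P]
variable [NormedSpace ℝ P] [FiniteDimensional ℝ P]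

variable (E 𝓢) in
/-- `x` is the class of all fine enough samplings of the family of loops `f`. -/
def PsiRel [DecidableEq ι] (j : R) (f : P × ℝ → Matrix ι ι R) (x : G E 𝓢 P) : Prop :=
  ∀ c α r, Valid E f c α r → ∃ h ρ : ℝ, 0 < h ∧ ∀ (S : Type) [Fintype S] [DecidableEq S]
    (σ : Equiv.Perm S) (l : S) (t : S → ℝ), Sch σ l t h ρ →
    ∃ hT : IsFam E 𝓢 (sampF σ j t c f α), cls _ hT = x

theorem PsiRel.of_sch [DecidableEq ι] {j : R} (hj : SkewU 𝓢 j) {f : P × ℝ → Matrix ι ι R}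
    (hF : IsFam E (insert j 𝓢) f) {c : Matrix ι ι R} {α : P × ℝ → ℝ} {r : ℝ}
    (hv : Valid E f c α r) {x : G E 𝓢 P}
    (H : ∀ h ρ : ℝ, 0 < h → ∃ (S : Type) (_ : Fintype S) (_ : DecidableEq S) (σ : Equiv.Perm S)
      (l : S) (t : S → ℝ), Sch σ l t h ρ ∧ ∃ hT : IsFam E 𝓢 (sampF σ j t c f α), cls _ hT = x) :
    PsiRel E 𝓢 j f x := by
  intro c' α' r' hv'
  obtain ⟨h₁, ρ₁, hh₁, -, x₁, H₁⟩ := samp_indep hj hF hv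
  obtain ⟨h₂, ρ₂, hh₂, -, x₂, H₂⟩ := samp_indep hj hF hv'
  obtain ⟨h₃, ρ₃, hh₃, -, -, H₃⟩ := samp_htpy hj hv hv' (Htpy.refl hF)
  obtain ⟨S, _, _, σ, l, t, hS, hT, hx⟩ := H (min h₁ (min h₂ h₃)) (max ρ₁ (max ρ₂ ρ₃))
    (by positivity)
  obtain ⟨a₁, b₁⟩ := H₁ S σ l t (hS.mono (by simp) (by simp))
  obtain ⟨a₂, b₂⟩ := H₂ S σ l t (hS.mono (by simp) (by simp))
  have Q := H₃ S σ (fun _ => t) continuous_const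
    fun _ _ => (hS.mono (h' := h₃) (r' := ρ₃) (by simp) (by simp)).mesh
  have : x₂ = x := by rw [← hx, ← b₂]; exact (cls_htpy Q hT a₂).symm
  exact ⟨h₂, ρ₂, hh₂, this ▸ H₂⟩

theorem exists_psiRel [DecidableEq ι] {j : R} (hj : SkewU 𝓢 j) {f : P × ℝ → Matrix ι ι R}
    (hF : IsFam E (insert j 𝓢) f) : ∃ x, PsiRel E 𝓢 j f x := by
  obtain ⟨c, α, r, hv⟩ := hF.exists_valid
  obtain ⟨h₁, ρ₁, hh₁, -, x₁, H₁⟩ := samp_indep hj hF hv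
  refine ⟨x₁, PsiRel.of_sch hj hF hv fun h ρ hh => ?_⟩
  obtain ⟨N, l, t, hS⟩ := exists_sch (h := min h h₁) (by positivity) (max ρ ρ₁)
  exact ⟨_, inferInstance, inferInstance, finRotate (N + 1), l, t, hS.mono (by simp) (by simp), H₁ _ _ l t (hS.mono (by simp) (by simp))⟩

theorem PsiRel.htpy [DecidableEq ι] {j : R} (hj : SkewU 𝓢 j) {f g : P × ℝ → Matrix ι ι R}
    (hfg : Htpy E (insert j 𝓢) f g) {x y : G E 𝓢 P} (hx : PsiRel E 𝓢 j f x)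
    (hy : PsiRel E 𝓢 j g y) : x = y := by
  obtain ⟨c, α, r, hv⟩ := hfg.left.exists_valid
  obtain ⟨c', α', r', hv'⟩ := hfg.right.exists_valid
  obtain ⟨h₁, ρ₁, hh₁, H₁⟩ := hx _ _ _ hv
  obtain ⟨h₂, ρ₂, hh₂, H₂⟩ := hy _ _ _ hv'
  obtain ⟨h₃, ρ₃, hh₃, -, -, H₃⟩ := samp_htpy hj hv hv' hfg
  obtain ⟨N, l, t, hS⟩ := exists_sch (h := min h₁ (min h₂ h₃)) (by positivity)
    (max ρ₁ (max ρ₂ ρ₃))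
  obtain ⟨a₁, b₁⟩ := H₁ _ _ l t (hS.mono (by simp) (by simp))
  obtain ⟨a₂, b₂⟩ := H₂ _ _ l t (hS.mono (by simp) (by simp))
  have Q := H₃ _ _ (fun _ => t) continuous_const
    fun _ _ => (hS.mono (h' := h₃) (r' := ρ₃) (by simp) (by simp)).mesh
  rw [← b₁, ← b₂]
  exact cls_htpy Q a₁ a₂

theorem PsiRel.submatrix [DecidableEq ι] [DecidableEq κ] {j : R} (hj : SkewU 𝓢 j)
    {f : P × ℝ → Matrix ι ι R} (hF : IsFam E (insert j 𝓢) f) (e : κ ≃ ι) {x : G E 𝓢 P}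
    (hx : PsiRel E 𝓢 j f x) : PsiRel E 𝓢 j (fun p => (f p).submatrix e e) x := by
  obtain ⟨c, α, r, hv⟩ := hF.exists_valid
  obtain ⟨c', α', r', hv'⟩ := (hF.submatrix e).exists_valid
  let β : P × ℝ → ℝ := fun p => max (α p) (α' p)
  have v1 : Valid E f c β (max r r') := by
    refine ⟨hv.cα.max hv'.cα, fun p hp => ⟨(hv.dead p ((le_max_left _ _).trans hp)).1, ?_⟩,
      fun p => (hv.bound p).trans ?_⟩
    · simp [β, (hv.dead p ((le_max_left _ _).trans hp)).2,
        (hv'.dead p ((le_max_right _ _).trans hp)).2]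
    · linarith [le_max_left (α p) (α' p)]
  have hc : c' = c.submatrix e e := by
    rw [← Valid.eq_far hv' (le_max_left r' (max r 0)) (by simp),
      ← Valid.eq_far hv (ρ := max r' (max r 0)) (by simp) (by simp)]
  have v2 : Valid E (fun p => (f p).submatrix e e) (c.submatrix e e) β (max r r') := by
    refine ⟨v1.cα, fun p hp => ⟨by rw [(v1.dead p hp).1], (v1.dead p hp).2⟩, fun p => ?_⟩
    rw [← hc]
    exact (hv'.bound p).trans (by linarith [le_max_right (α p) (α' p)])
  obtain ⟨h₁, ρ₁, hh₁, H₁⟩ := hx _ _ _ v1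
  refine PsiRel.of_sch hj (hF.submatrix e) v2 fun h ρ hh => ?_
  obtain ⟨N, l, t, hS⟩ := exists_sch (h := min h h₁) (by positivity) (max ρ ρ₁)
  obtain ⟨a, b⟩ := H₁ _ _ l t (hS.mono (by simp) (by simp))
  refine ⟨_, inferInstance, inferInstance, finRotate (N + 1), l, t, hS.mono (by simp) (by simp), ?_⟩
  have : sampF (finRotate (N + 1)) j t (c.submatrix e e) (fun p => (f p).submatrix e e) β =
      fun q => (sampF (finRotate (N + 1)) j t c f β q).submatrix
        (Equiv.prodCongr (Equiv.refl _) e) (Equiv.prodCongr (Equiv.refl _) e) := by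
    funext q
    unfold sampF samp
    rw [← latt_submatrix, scal_submatrix]
    rfl
  rw [this]
  exact ⟨a.submatrix _, (cls_submatrix a _ _).trans b⟩

theorem fromBlocks_diag_sub (A A' : Matrix ι ι R) (B B' : Matrix κ κ R) :
    fromBlocks A 0 0 B - fromBlocks A' 0 0 B' = fromBlocks (A - A') 0 0 (B - B') := by
  ext (i | i) (j | j) <;> simp

theorem norm_act_fromBlocks_le (A : Matrix ι ι R) (B : Matrix κ κ R) :
    ‖act E (fromBlocks A 0 0 B)‖ ≤ ‖act E A‖ + ‖act E B‖ := by
  have key : ∀ w : V E (ι ⊕ κ), ‖w‖ ^ 2 = ‖vl w‖ ^ 2 + ‖vr w‖ ^ 2 := fun w => by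
    simp [PiLp.norm_sq_eq_of_L2, Fintype.sum_sum_type, vl, vr]
  have nA := norm_nonneg (E := V E ι →L[ℝ] V E ι) (act E A)
  have nB := norm_nonneg (E := V E κ →L[ℝ] V E κ) (act E B)
  refine ContinuousLinearMap.opNorm_le_bound _ (add_nonneg nA nB) fun v => ?_
  have h1 := key (act E (fromBlocks A 0 0 B) v)
  rw [vl_act_fromBlocks, vr_act_fromBlocks, act_zero, act_zero] at h1
  have h2 := (act E A).le_opNorm (vl v)
  have h3 := (act E B).le_opNorm (vr v)
  have h4 := key v
  refine abs_le_of_sq_le_sq' ?_ (by positivity) |>.2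
  simp only [ContinuousLinearMap.zero_apply, zero_add, add_zero] at h1
  rw [h1, mul_pow, h4]
  have h5 := pow_le_pow_left₀ (norm_nonneg _) h2 2
  have h6 := pow_le_pow_left₀ (norm_nonneg _) h3 2
  nlinarith [mul_nonneg nA nB, sq_nonneg (‖vl v‖), sq_nonneg (‖vr v‖),
    mul_nonneg (mul_nonneg nA nB) (sq_nonneg (‖vl v‖)),
    mul_nonneg (mul_nonneg nA nB) (sq_nonneg (‖vr v‖)),
    mul_nonneg (sq_nonneg ‖act E A‖) (sq_nonneg (‖vr v‖)),
    mul_nonneg (sq_nonneg ‖act E B‖) (sq_nonneg (‖vl v‖))]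

theorem PsiRel.sum [DecidableEq ι] [DecidableEq κ] {j : R} (hj : SkewU 𝓢 j)
    {f : P × ℝ → Matrix ι ι R} {g : P × ℝ → Matrix κ κ R} (hF : IsFam E (insert j 𝓢) f)
    (hG : IsFam E (insert j 𝓢) g) {x y : G E 𝓢 P}
    (hx : PsiRel E 𝓢 j f x) (hy : PsiRel E 𝓢 j g y) :
    PsiRel E 𝓢 j (fun p => fromBlocks (f p) 0 0 (g p)) (x + y) := by
  obtain ⟨c, α, r, hv⟩ := hF.exists_valid
  obtain ⟨c', α', r', hv'⟩ := hG.exists_valid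
  let β : P × ℝ → ℝ := fun p => α p + α' p
  have hd : ∀ p, max r r' ≤ ‖p‖ → f p = c ∧ g p = c' ∧ β p = 0 := by
    intro p hp
    obtain ⟨e1, e2⟩ := hv.dead p ((le_max_left _ _).trans hp)
    obtain ⟨e3, e4⟩ := hv'.dead p ((le_max_right _ _).trans hp)
    exact ⟨e1, e3, by simp [β, e2, e4]⟩
  have cβ : Continuous β := hv.cα.add hv'.cα
  have v1 : Valid E f c β (max r r') := ⟨cβ, fun p hp => ⟨(hd p hp).1, (hd p hp).2.2⟩,
    fun p => (hv.bound p).trans (by linarith [hv'.nonneg p])⟩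
  have v2 : Valid E g c' β (max r r') := ⟨cβ, fun p hp => (hd p hp).2,
    fun p => (hv'.bound p).trans (by linarith [hv.nonneg p])⟩
  have v3 : Valid E (fun p => fromBlocks (f p) 0 0 (g p)) (fromBlocks c 0 0 c') β (max r r') := by
    refine ⟨cβ, fun p hp => ⟨by rw [(hd p hp).1, (hd p hp).2.1], (hd p hp).2.2⟩, fun p => ?_⟩
    rw [fromBlocks_diag_sub]
    refine (norm_act_fromBlocks_le _ _).trans ?_
    have := hv.bound p
    have := hv'.bound p
    simp only [β]
    linarith
  obtain ⟨h₁, ρ₁, hh₁, H₁⟩ := hx _ _ _ v1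
  obtain ⟨h₂, ρ₂, hh₂, H₂⟩ := hy _ _ _ v2
  refine PsiRel.of_sch hj (hF.fromBlocks hG) v3 fun h ρ hh => ?_
  obtain ⟨N, l, t, hS⟩ := exists_sch (h := min h (min h₁ h₂)) (by positivity) (max ρ (max ρ₁ ρ₂))
  obtain ⟨a₁, b₁⟩ := H₁ _ _ l t (hS.mono (by simp) (by simp))
  obtain ⟨a₂, b₂⟩ := H₂ _ _ l t (hS.mono (by simp) (by simp))
  refine ⟨_, inferInstance, inferInstance, finRotate (N + 1), l, t, hS.mono (by simp) (by simp), ?_⟩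
  have : sampF (finRotate (N + 1)) j t (fromBlocks c 0 0 c')
      (fun p => fromBlocks (f p) 0 0 (g p)) β =
      fun q => (fromBlocks (sampF (finRotate (N + 1)) j t c f β q) 0 0
        (sampF (finRotate (N + 1)) j t c' g β q)).submatrix
        (Equiv.prodSumDistrib _ ι κ) (Equiv.prodSumDistrib _ ι κ) := by
    funext q
    unfold sampF samp
    rw [← latt_fromBlocks, scal_sum]
    simp [fromBlocks_diag_sub]
  rw [this]
  refine ⟨(a₁.fromBlocks a₂).submatrix _, ?_⟩
  rw [cls_submatrix (a₁.fromBlocks a₂), cls_add a₁ a₂, b₁, b₂]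

theorem PsiRel.const [DecidableEq ι] {j : R} (hj : SkewU 𝓢 j) {c : Matrix ι ι R}
    (hc : Good E (insert j 𝓢) c) : PsiRel E 𝓢 j (fun _ : P × ℝ => c) 0 := by
  have hF : IsFam E (insert j 𝓢) (fun _ : P × ℝ => c) := isFam_const hc
  have hv : Valid E (fun _ : P × ℝ => c) c (fun _ => 0) 0 :=
    ⟨continuous_const, fun _ _ => ⟨rfl, rfl⟩, fun _ => by
      rw [sub_self, act_zero, norm_zero (E := V E ι →L[ℝ] V E ι), mul_zero]⟩
  obtain ⟨h₁, ρ₁, hh₁, -, x₁, H₁⟩ := samp_indep hj hF hv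
  refine PsiRel.of_sch hj hF hv fun h ρ hh => ?_
  obtain ⟨N, l, t, hS⟩ := exists_sch (h := min h h₁) (by positivity) (max ρ ρ₁)
  obtain ⟨a, b⟩ := H₁ _ _ l t (hS.mono (by simp) (by simp))
  exact ⟨_, inferInstance, inferInstance, finRotate (N + 1), l, t, hS.mono (by simp) (by simp), a, cls_const (a.good 0) a⟩

open Classical in
/-- The value of the monodromy map on a family. -/
noncomputable def psiVal {j : R} (hj : SkewU 𝓢 j) {f : P × ℝ → Matrix ι ι R}
    (hf : IsFam E (insert j 𝓢) f) : G E 𝓢 P := (exists_psiRel hj hf).choose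

theorem psiVal_spec [DecidableEq ι] {j : R} (hj : SkewU 𝓢 j) {f : P × ℝ → Matrix ι ι R}
    (hf : IsFam E (insert j 𝓢) f) : PsiRel E 𝓢 j f (psiVal hj hf) := by
  classical
  rename_i d
  obtain rfl : d = fun a b => Classical.propDecidable (a = b) := Subsingleton.elim _ _
  exact (exists_psiRel hj hf).choose_spec

theorem psiVal_eq [DecidableEq ι] {j : R} (hj : SkewU 𝓢 j) {f : P × ℝ → Matrix ι ι R}
    (hf : IsFam E (insert j 𝓢) f) {x : G E 𝓢 P} (h : PsiRel E 𝓢 j f x) : psiVal hj hf = x :=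
  PsiRel.htpy hj (Htpy.refl hf) (psiVal_spec hj hf) h

variable (E P) in
open Classical in
/-- The monodromy homomorphism. -/
noncomputable def psi {j : R} (hj : SkewU 𝓢 j) : G E (insert j 𝓢) (P × ℝ) →+ G E 𝓢 P :=
  G.lift (fun _ _ _ hf => psiVal hj hf)
    (fun _ _ _ _ h => PsiRel.htpy hj h (psiVal_spec hj h.left) (psiVal_spec hj h.right))
    (fun _ _ _ _ e _ h => psiVal_eq hj (h.submatrix e) ((psiVal_spec hj h).submatrix hj h e))
    (fun _ _ _ _ _ _ hf hg => psiVal_eq hj (hf.fromBlocks hg)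
      (PsiRel.sum hj hf hg (psiVal_spec hj hf) (psiVal_spec hj hg)))
    (fun _ _ _ h => psiVal_eq hj (isFam_const h) (PsiRel.const hj h))

theorem psi_cls [DecidableEq ι] {j : R} (hj : SkewU 𝓢 j) {f : P × ℝ → Matrix ι ι R}
    (hf : IsFam E (insert j 𝓢) f) : PsiRel E 𝓢 j f (psi E P hj (cls f hf)) := by
  exact psiVal_spec hj hf

theorem psi_eq [DecidableEq ι] {j : R} (hj : SkewU 𝓢 j) {f : P × ℝ → Matrix ι ι R}
    (hf : IsFam E (insert j 𝓢) f) {x : G E 𝓢 P} (h : PsiRel E 𝓢 j f x) :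
    psi E P hj (cls f hf) = x :=
  psiVal_eq hj hf h

end PsiRel

section Bfam

variable {R : Type} [Ring R] [StarRing R] [Algebra ℝ R] [StarModule ℝ R]
  [TopologicalSpace R] [IsTopologicalRing R] [ContinuousStar R] [ContinuousSMul ℝ R]
variable {E : Type} [NormedAddCommGroup E] [InnerProductSpace ℝ E] [FiniteDimensional ℝ E]
  [Module R E] [IsScalarTower ℝ R E] [ContinuousSMul R E] [StarAct R E]
variable {ι κ μ ν : Type} [Fintype ι] [Fintype κ] [Fintype μ] [Fintype ν]
variable {𝓢 : Set R}
variable {P : Type} [NormedAddCommGroup P]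
variable {S : Type} [Fintype S] [DecidableEq S]

/-- A symmetric unitary element anticommuting with `𝓢`. -/
structure SymU (𝓢 : Set R) (s : R) : Prop where
  st : star s = s
  sq : s * s = 1
  odd : ∀ r ∈ 𝓢, s * r = -(r * s)

theorem SymU.scal_sa [DecidableEq ι] {s : R} (h : SymU 𝓢 s) : (scal ι s)ᴴ = scal ι s := by
  rw [scal_star, h.st]

theorem SymU.scal_sq [DecidableEq ι] {s : R} (h : SymU 𝓢 s) : scal ι s * scal ι s = 1 := by
  rw [scal_mul_scal, h.sq, scal_one]

theorem SymU.good [DecidableEq ι] {s : R} (h : SymU 𝓢 s) : Good E 𝓢 (scal ι s) :=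
  .of_inv h.scal_sa (.scal h.odd) h.scal_sq

/-- A self-adjoint involution that can serve as a base value. -/
structure IsBase (𝓢 : Set R) (s : R) (x₀ : Matrix ι ι R) : Prop where
  sa : x₀ᴴ = x₀
  odd : OddM (insert s 𝓢) x₀
  sq : ∀ [DecidableEq ι], x₀ * x₀ = 1

theorem IsBase.good [DecidableEq ι] {s : R} {x₀ : Matrix ι ι R} (h : IsBase 𝓢 s x₀) :
    Good E (insert s 𝓢) x₀ := .of_inv h.sa h.odd h.sq

theorem IsBase.anti [DecidableEq ι] {s : R} {x₀ : Matrix ι ι R} (h : IsBase 𝓢 s x₀) :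
    x₀ * scal ι s = -(scal ι s * x₀) := h.odd.scal_comm (mem_insert _ _)

/-- The rotation by the half angle in the plane of `s` and `x₀`. -/
noncomputable def rv [DecidableEq ι] (x₀ : Matrix ι ι R) (s : R) (v : ℝ) : Matrix ι ι R :=
  Real.cos (v / 2) • (1 : Matrix ι ι R) + Real.sin (v / 2) • (x₀ * scal ι s)

/-- The two-parameter family interpolating between `s` and `x`. -/
noncomputable def bmat [DecidableEq ι] (x₀ : Matrix ι ι R) (s : R) (u v : ℝ) (x : Matrix ι ι R) :
    Matrix ι ι R :=
  (rv x₀ s v)ᴴ * (Real.cos u • scal ι s + Real.sin u • x) * rv x₀ s v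

theorem rv_star [DecidableEq ι] {s : R} (hs : SymU 𝓢 s) {x₀ : Matrix ι ι R} (h : IsBase 𝓢 s x₀)
    (v : ℝ) : (rv x₀ s v)ᴴ =
      Real.cos (v / 2) • (1 : Matrix ι ι R) - Real.sin (v / 2) • (x₀ * scal ι s) := by
  rw [rv, conjTranspose_add, conjTranspose_smul, conjTranspose_smul, conjTranspose_mul,
    conjTranspose_one, h.sa, hs.scal_sa, h.anti, star_trivial, star_trivial, smul_neg, sub_neg_eq_add]

theorem base_mul_sq [DecidableEq ι] {s : R} (hs : SymU 𝓢 s) {x₀ : Matrix ι ι R}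
    (h : IsBase 𝓢 s x₀) : x₀ * scal ι s * (x₀ * scal ι s) = -1 := by
  rw [mul_assoc, ← mul_assoc (scal ι s) x₀, ← neg_eq_iff_eq_neg.2 h.anti, neg_mul, mul_neg,
    mul_assoc x₀, hs.scal_sq, mul_one, h.sq]

theorem rv_star_mul [DecidableEq ι] {s : R} (hs : SymU 𝓢 s) {x₀ : Matrix ι ι R}
    (h : IsBase 𝓢 s x₀) (v : ℝ) : (rv x₀ s v)ᴴ * rv x₀ s v = 1 := by
  rw [rv_star hs h, rv]
  simp only [mul_add, sub_mul, smul_mul_assoc, mul_smul_comm, base_mul_sq hs h, one_mul, mul_one]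
  have := Real.sin_sq_add_cos_sq (v / 2)
  match_scalars
  · linear_combination this
  · ring

theorem rv_mul_star [DecidableEq ι] {s : R} (hs : SymU 𝓢 s) {x₀ : Matrix ι ι R}
    (h : IsBase 𝓢 s x₀) (v : ℝ) : rv x₀ s v * (rv x₀ s v)ᴴ = 1 := by
  rw [rv_star hs h, rv]
  simp only [mul_sub, add_mul, smul_mul_assoc, mul_smul_comm, base_mul_sq hs h, one_mul, mul_one]
  have := Real.sin_sq_add_cos_sq (v / 2)
  match_scalars
  · linear_combination this
  · ring

theorem rv_even [DecidableEq ι] {s : R} (hs : SymU 𝓢 s) {x₀ : Matrix ι ι R}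
    (h : IsBase 𝓢 s x₀) (v : ℝ) : EvenM 𝓢 (rv x₀ s v) :=
  (EvenM.one.smul _).add (((h.odd.mono (subset_insert _ _)).mul_odd (.scal hs.odd)).smul _)

theorem rv_star_even [DecidableEq ι] {s : R} (hs : SymU 𝓢 s) {x₀ : Matrix ι ι R}
    (h : IsBase 𝓢 s x₀) (v : ℝ) : EvenM 𝓢 (rv x₀ s v)ᴴ := by
  rw [rv_star hs h, sub_eq_add_neg, ← neg_smul]
  exact (EvenM.one.smul _).add (((h.odd.mono (subset_insert _ _)).mul_odd (.scal hs.odd)).smul _)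

theorem bmat_good [DecidableEq ι] {s : R} (hs : SymU 𝓢 s) {x₀ x : Matrix ι ι R}
    (h : IsBase 𝓢 s x₀) (hx : Good E (insert s 𝓢) x) (u v : ℝ) : Good E 𝓢 (bmat x₀ s u v x) := by
  have := Good.conj (U := (rv x₀ s v)ᴴ) (W := rv x₀ s v) (Good.rot (a := Real.cos u)
    (b := Real.sin u) hs.good (hx.mono (subset_insert _ _)) ?_ ?_) (rv_star_even hs h v)
    ?_ (rv_mul_star hs h v) (rv_star_mul hs h v)
  · rwa [conjTranspose_conjTranspose] at this
  · rw [hx.odd.scal_comm (mem_insert _ _), add_neg_cancel]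
  · by_contra! hc
    have := Real.sin_sq_add_cos_sq u
    simp [hc.1, hc.2] at this
  · rw [conjTranspose_conjTranspose]; exact rv_even hs h v

theorem bmat_base [DecidableEq ι] {s : R} (hs : SymU 𝓢 s) {x₀ : Matrix ι ι R}
    (h : IsBase 𝓢 s x₀) (u v : ℝ) :
    bmat x₀ s u v x₀ = Real.cos (u - v) • scal ι s + Real.sin (u - v) • x₀ := by
  have e1 : x₀ * scal ι s * scal ι s = x₀ := by rw [mul_assoc, hs.scal_sq, mul_one]
  have e2 : x₀ * scal ι s * x₀ = - scal ι s := by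
    rw [h.anti, neg_mul, mul_assoc, h.sq, mul_one]
  have e3 : x₀ * (x₀ * scal ι s) = scal ι s := by rw [← mul_assoc, h.sq, one_mul]
  have e4 : scal ι s * (x₀ * scal ι s) = -x₀ := by
    rw [h.anti, mul_neg, ← mul_assoc, hs.scal_sq, one_mul]
  rw [bmat, rv_star hs h, rv]
  simp only [mul_add, sub_mul, smul_mul_assoc, mul_smul_comm, one_mul, mul_one, smul_add, smul_sub,
    e1, e2, e3, e4, smul_smul, smul_neg, add_mul, neg_mul]
  have hv : v = v / 2 + v / 2 := by ring
  rw [Real.cos_sub, Real.sin_sub, hv, Real.cos_add, Real.sin_add, ← hv]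
  match_scalars <;> ring

theorem bmat_of_sin [DecidableEq ι] {s : R} (hs : SymU 𝓢 s) {x₀ : Matrix ι ι R}
    (h : IsBase 𝓢 s x₀) {u v : ℝ} (hu : Real.sin u = 0) (x : Matrix ι ι R) :
    bmat x₀ s u v x = Real.cos (u - v) • scal ι s + Real.sin (u - v) • x₀ := by
  rw [← bmat_base hs h, bmat, bmat, hu, zero_smul, zero_smul]

theorem bmat_sub [DecidableEq ι] (s : R) (x₀ x x' : Matrix ι ι R) (u v : ℝ) :
    bmat x₀ s u v x - bmat x₀ s u v x' = Real.sin u • ((rv x₀ s v)ᴴ * (x - x') * rv x₀ s v) := by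
  simp only [bmat, mul_add, add_mul, mul_sub, sub_mul, smul_sub, smul_mul_assoc, mul_smul_comm]
  abel

theorem continuous_bmat [DecidableEq ι] {X : Type*} [TopologicalSpace X] (x₀ : Matrix ι ι R) (s : R)
    {u v : X → ℝ} {x : X → Matrix ι ι R} (hu : Continuous u) (hv : Continuous v)
    (hx : Continuous x) : Continuous fun p => bmat x₀ s (u p) (v p) (x p) := by
  have h : Continuous fun p => rv x₀ s (v p) := by
    unfold rv
    exact ((Real.continuous_cos.comp (hv.div_const 2)).smul continuous_const).add
      ((Real.continuous_sin.comp (hv.div_const 2)).smul continuous_const)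
  exact (h.matrix_conjTranspose.matrix_mul (((Real.continuous_cos.comp hu).smul
    continuous_const).add ((Real.continuous_sin.comp hu).smul hx))).matrix_mul h

theorem rv_sum [DecidableEq ι] [DecidableEq κ] (x₀ : Matrix ι ι R) (y₀ : Matrix κ κ R) (s : R)
    (v : ℝ) : rv (fromBlocks x₀ 0 0 y₀) s v = fromBlocks (rv x₀ s v) 0 0 (rv y₀ s v) := by
  simp [rv, scal_sum, fromBlocks_multiply, fromBlocks_smul, fromBlocks_add, ← fromBlocks_one]

theorem bmat_sum [DecidableEq ι] [DecidableEq κ] (x₀ x : Matrix ι ι R) (y₀ y : Matrix κ κ R) (s : R)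
    (u v : ℝ) : bmat (fromBlocks x₀ 0 0 y₀) s u v (fromBlocks x 0 0 y) =
      fromBlocks (bmat x₀ s u v x) 0 0 (bmat y₀ s u v y) := by
  simp [bmat, rv_sum, scal_sum, fromBlocks_multiply, fromBlocks_smul, fromBlocks_add,
    fromBlocks_conjTranspose]

theorem norm_act_conj_le [DecidableEq ι] {U : Matrix ι ι R} (h : Uᴴ * U = 1) (h' : U * Uᴴ = 1)
    (A : Matrix ι ι R) : ‖act E (Uᴴ * A * U)‖ ≤ ‖act E A‖ := by
  have iso : ∀ {W : Matrix ι ι R}, Wᴴ * W = 1 → ∀ v : V E ι, ‖act E W v‖ = ‖v‖ := by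
    intro W hW v
    rw [← sq_eq_sq₀ (norm_nonneg _) (norm_nonneg _), ← real_inner_self_eq_norm_sq,
      ← real_inner_self_eq_norm_sq, inner_act, ← act_mul, hW, act_one]
  refine ContinuousLinearMap.opNorm_le_bound _ (norm_nonneg (E := V E ι →L[ℝ] V E ι) _) fun v => ?_
  rw [act_mul, act_mul, iso (by rwa [conjTranspose_conjTranspose]), ← iso h v]
  exact (act E A).le_opNorm _

/-- The angle parameter of the loop. -/
noncomputable def ang (t : ℝ) : ℝ := Real.pi * max 0 (min 1 ((t + 1) / 2))

theorem continuous_ang : Continuous ang := by unfold ang; fun_prop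

theorem ang_mem (t : ℝ) : ang t ∈ Icc 0 Real.pi := by
  have : max 0 (min 1 ((t + 1) / 2)) ∈ Icc (0 : ℝ) 1 := ⟨by simp, by simp⟩
  have hp := Real.pi_pos
  exact ⟨mul_nonneg hp.le this.1, by unfold ang; nlinarith [this.2]⟩

theorem sin_ang_nonneg (t : ℝ) : 0 ≤ Real.sin (ang t) :=
  Real.sin_nonneg_of_mem_Icc (ang_mem t)

theorem sin_ang_far {t : ℝ} (h : 1 ≤ |t|) : Real.sin (ang t) = 0 := by
  unfold ang
  rcases le_abs.1 h with h | h
  · rw [min_eq_left (by linarith)]; simp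
  · rw [max_eq_left ((min_le_right _ _).trans (by linarith))]; simp

/-- The loop of families attached to a based family. -/
noncomputable def bfam [DecidableEq ι] (x₀ : Matrix ι ι R) (s : R) (f : P → Matrix ι ι R)
    (p : P × ℝ) : Matrix ι ι R := bmat x₀ s (ang p.2) (ang p.2) (f p.1)

theorem bmat_diag_base [DecidableEq ι] {s : R} (hs : SymU 𝓢 s) {x₀ : Matrix ι ι R}
    (h : IsBase 𝓢 s x₀) (u : ℝ) : bmat x₀ s u u x₀ = scal ι s := by
  rw [bmat_base hs h]; simp

theorem bfam_far [DecidableEq ι] {s : R} (hs : SymU 𝓢 s) {x₀ : Matrix ι ι R}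
    (h : IsBase 𝓢 s x₀) {f : P → Matrix ι ι R} {r : ℝ} (hr : ∀ q, r ≤ ‖q‖ → f q = x₀)
    {p : P × ℝ} (hp : max r 1 ≤ ‖p‖) : bfam x₀ s f p = scal ι s := by
  rw [Prod.norm_def, le_max_iff] at hp
  rcases hp with hp | hp
  · rw [bfam, hr _ ((le_max_left _ _).trans hp), bmat_diag_base hs h]
  · rw [bfam, bmat_of_sin hs h (sin_ang_far ((le_max_right _ _).trans hp))]; simp

theorem bfam_isFam [DecidableEq ι] {s : R} (hs : SymU 𝓢 s) {x₀ : Matrix ι ι R}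
    (h : IsBase 𝓢 s x₀) {f : P → Matrix ι ι R} (hf : IsFam E (insert s 𝓢) f) (hb : Based x₀ f) :
    IsFam E 𝓢 (bfam x₀ s f) := by
  obtain ⟨r, hr⟩ := hb
  have ha : Continuous fun p : P × ℝ => ang p.2 := continuous_ang.comp continuous_snd
  exact ⟨continuous_bmat _ _ ha ha (hf.cont.comp continuous_fst),
    fun p => bmat_good hs h (hf.good _) _ _, max r 1, scal ι s, fun p hp => bfam_far hs h hr hp⟩

theorem bfam_htpy [DecidableEq ι] {s : R} (hs : SymU 𝓢 s) {x₀ : Matrix ι ι R}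
    (h : IsBase 𝓢 s x₀) {f g : P → Matrix ι ι R} (H : HtpyB E (insert s 𝓢) x₀ f g) :
    Htpy E 𝓢 (bfam x₀ s f) (bfam x₀ s g) := by
  obtain ⟨H, hc, hg, ⟨r, hr⟩, h0, h1⟩ := H
  have ha : Continuous fun p : ℝ × P × ℝ => ang p.2.2 :=
    continuous_ang.comp (continuous_snd.comp continuous_snd)
  refine ⟨fun z => bmat x₀ s (ang z.2.2) (ang z.2.2) (H (z.1, z.2.1)),
    continuous_bmat _ _ ha ha (hc.comp (by fun_prop)), fun t ht q => bmat_good hs h (hg t ht _) _ _,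
    ⟨max r 1, fun _ => scal ι s, fun t ht q hq => ?_⟩, fun q => ?_, fun q => ?_⟩
  · exact bfam_far (f := fun q => H (t, q)) hs h (hr t ht) hq
  · simp only [h0]; rfl
  · simp only [h1]; rfl

theorem bfam_null [NormedSpace ℝ P] [Nontrivial P] [DecidableEq ι] {s : R} (hs : SymU 𝓢 s)
    {x₀ : Matrix ι ι R} (h : IsBase 𝓢 s x₀) {w : R} (hw : OddU (insert s 𝓢) w)
    {f : P → Matrix ι ι R} (hf : IsFam E (insert s 𝓢) f) (hb : Based x₀ f) (h0 : cls f hf = 0)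
    (h' : IsFam E 𝓢 (bfam x₀ s f)) : cls _ h' = 0 := by
  obtain ⟨κ, _, _, m, g, hm, hmm, H1, H2⟩ := exists_null_based hw hf hb h0
  have hm' : IsBase 𝓢 s m := ⟨hm.sa, hm.odd, fun {d} => by convert hmm⟩
  have hX : IsBase 𝓢 s (fromBlocks x₀ 0 0 m) :=
    ⟨by rw [fromBlocks_conjTranspose, h.sa, hm.sa]; simp, h.odd.fromBlocks .zero .zero hm.odd,
      fun {d} => by
        rw [Subsingleton.elim d instDecidableEqSum, fromBlocks_multiply, h.sq, hmm]; simp⟩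
  have hc : IsFam E 𝓢 fun _ : P × ℝ => scal κ s := isFam_const hs.good
  have hc' : IsFam E 𝓢 fun _ : P × ℝ => scal (ι ⊕ κ) s := isFam_const hs.good
  have e1 : (fun p : P × ℝ => fromBlocks (bfam x₀ s f p) 0 0 (scal κ s)) =
      bfam (fromBlocks x₀ 0 0 m) s fun q => fromBlocks (f q) 0 0 m := by
    funext p
    rw [bfam, bfam, bmat_sum, bmat_diag_base hs hm']
  have e2 : bfam (fromBlocks x₀ 0 0 m) s (fun _ : P => fromBlocks x₀ 0 0 m) =
      fun _ => scal (ι ⊕ κ) s := by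
    funext p
    rw [bfam, bmat_diag_base hs hX]
  have H := (bfam_htpy hs hX H1).trans (bfam_htpy hs hX H2)
  rw [← e1, e2] at H
  have e3 := cls_htpy H (h'.fromBlocks hc) hc'
  rwa [cls_add h' hc, cls_const hs.good, cls_const hs.good, add_zero] at e3

end Bfam

section Swap

variable {R : Type} [Ring R] [StarRing R] [Algebra ℝ R] [StarModule ℝ R]
  [TopologicalSpace R] [IsTopologicalRing R] [ContinuousStar R] [ContinuousSMul ℝ R]
variable {E : Type} [NormedAddCommGroup E] [InnerProductSpace ℝ E] [FiniteDimensional ℝ E]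
  [Module R E] [IsScalarTower ℝ R E] [ContinuousSMul R E] [StarAct R E]
variable {ι κ μ ν : Type} [Fintype ι] [Fintype κ] [Fintype μ] [Fintype ν]
variable {𝓢 : Set R}
variable {P : Type} [NormedAddCommGroup P]
variable {S : Type} [Fintype S] [DecidableEq S]

/-- The block diagonal matrix with constant blocks. -/
def dg (S : Type) [DecidableEq S] (A : Matrix ι ι R) : Matrix (S × ι) (S × ι) R :=
  fun p q => if p.1 = q.1 then A p.2 q.2 else 0

theorem dg_add (A B : Matrix ι ι R) : dg S (A + B) = dg S A + dg S B := by
  ext ⟨k, a⟩ ⟨l, b⟩; simp only [dg, Matrix.add_apply]; split_ifs <;> simp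

theorem dg_smul (t : ℝ) (A : Matrix ι ι R) : dg S (t • A) = t • dg S A := by
  ext ⟨k, a⟩ ⟨l, b⟩; simp only [dg, Matrix.smul_apply]; split_ifs <;> simp

theorem dg_star (A : Matrix ι ι R) : (dg S A)ᴴ = dg S Aᴴ := by
  ext ⟨k, a⟩ ⟨l, b⟩
  simp only [dg, conjTranspose_apply, eq_comm (a := l)]
  split_ifs <;> simp

theorem dg_mul (A B : Matrix ι ι R) : dg S A * dg S B = dg S (A * B) := by
  ext ⟨k, a⟩ ⟨l, b⟩
  simp only [dg, Matrix.mul_apply, Fintype.sum_prod_type]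
  rw [Finset.sum_eq_single k (fun x _ hx => by simp [hx.symm]) (by simp)]
  simp only [if_true]
  split_ifs <;> simp

theorem dg_scal [DecidableEq ι] (s : R) : dg S (scal ι s) = scal (S × ι) s := by
  ext ⟨k, a⟩ ⟨l, b⟩
  simp only [dg, scal, diagonal_apply, Prod.mk.injEq]
  split_ifs <;> simp_all

theorem dg_one [DecidableEq ι] : dg S (1 : Matrix ι ι R) = 1 := by
  rw [← scal_one, dg_scal, scal_one]

theorem dg_odd {A : Matrix ι ι R} (h : OddM 𝓢 A) : OddM 𝓢 (dg S A) := by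
  rintro s hs ⟨k, a⟩ ⟨l, b⟩
  simp only [dg]
  split_ifs
  · exact h s hs a b
  · simp

theorem dg_mul_blk (A m : Matrix ι ι R) (x y : S) : dg S A * blk x y m = blk x y (A * m) := by
  ext ⟨k, a⟩ ⟨l, b⟩
  simp only [dg, Matrix.mul_apply, Fintype.sum_prod_type, blk_apply]
  rw [Finset.sum_eq_single k (fun x _ hx => by simp [hx.symm]) (by simp)]
  simp only [if_true]
  split_ifs <;> simp

theorem blk_mul_dg (A m : Matrix ι ι R) (x y : S) : blk x y m * dg S A = blk x y (m * A) := by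
  ext ⟨k, a⟩ ⟨l, b⟩
  simp only [dg, Matrix.mul_apply, Fintype.sum_prod_type, blk_apply]
  rw [Finset.sum_eq_single l (fun x _ hx => by simp [hx]) (by simp)]
  simp only [if_true]
  split_ifs <;> simp

theorem latt_zero (σ : Equiv.Perm S) (J c : Matrix ι ι R) : latt σ J c 0 0 = dg S c := by
  ext ⟨k, a⟩ ⟨l, b⟩
  simp only [latt, Pi.zero_apply, bond_zero, Finset.sum_const_zero, add_zero, Matrix.sum_apply,
    blk_apply, dg]
  rw [Finset.sum_eq_single k (fun x _ hx => by simp [hx.symm]) (by simp)]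
  simp [eq_comm]

theorem dg_latt_dg (σ : Equiv.Perm S) (A B J c : Matrix ι ι R) (δ : S → Matrix ι ι R) (α : S → ℝ) :
    dg S A * latt σ J c δ α * dg S B =
      latt σ (A * J * B) (A * c * B) (fun k => A * δ k * B) α := by
  simp only [latt, bond, mul_add, add_mul, Finset.mul_sum, Finset.sum_mul, dg_mul_blk, blk_mul_dg,
    mul_sub, sub_mul, mul_smul_comm, smul_mul_assoc]

theorem latt_affine (σ : Equiv.Perm S) (J c c' : Matrix ι ι R) (δ : S → Matrix ι ι R) (α : S → ℝ)
    (a b : ℝ) : a • dg S c' + b • latt σ J c δ α =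
      latt σ J (a • c' + b • c) (fun k => b • δ k) (fun k => b * α k) := by
  rw [← latt_zero σ J]
  ext ⟨k, x⟩ ⟨l, y⟩
  simp only [latt, bond, Matrix.add_apply, Matrix.smul_apply, Matrix.sum_apply, blk_apply,
    Finset.smul_sum, smul_add, Finset.sum_add_distrib, Pi.zero_apply, smul_zero, ite_self,
    Finset.sum_const_zero, add_zero, Matrix.sub_apply, Matrix.zero_apply, zero_div, zero_smul,
    sub_zero, ← add_assoc, smul_ite]
  congr 1
  · congr 1
    · congr 1
      · congr 1
        · rw [← Finset.sum_add_distrib]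
          refine Finset.sum_congr rfl fun z _ => ?_
          split_ifs <;> simp
        · exact Finset.sum_congr rfl fun z _ => by split_ifs <;> module
      · exact Finset.sum_congr rfl fun z _ => by split_ifs <;> module
    · exact Finset.sum_congr rfl fun z _ => by split_ifs <;> module
  · exact Finset.sum_congr rfl fun z _ => by split_ifs <;> module

theorem norm_act_smul_le {t : ℝ} (ht : 0 ≤ t) (A : Matrix ι ι R) :
    ‖act E (t • A)‖ ≤ t * ‖act E A‖ := by
  refine ContinuousLinearMap.opNorm_le_bound _
    (mul_nonneg ht (norm_nonneg (E := V E ι →L[ℝ] V E ι) _)) fun v => ?_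
  rw [act_smul, ContinuousLinearMap.smul_apply, norm_smul, Real.norm_of_nonneg ht, mul_assoc]
  exact mul_le_mul_of_nonneg_left ((act E A).le_opNorm v) ht

theorem rv_dg [DecidableEq ι] (x₀ : Matrix ι ι R) (s : R) (v : ℝ) :
    rv (dg S x₀) s v = dg S (rv x₀ s v) := by
  rw [rv, rv, ← dg_scal, dg_mul, ← dg_one, ← dg_smul, ← dg_smul, ← dg_add]

theorem IsBase.dg [DecidableEq ι] {s : R} {x₀ : Matrix ι ι R} (h : IsBase 𝓢 s x₀) :
    IsBase 𝓢 s (dg S x₀) :=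
  ⟨by rw [dg_star, h.sa], dg_odd h.odd, fun {d} => by
    rw [dg_mul, h.sq, dg_one]; congr; exact Subsingleton.elim _ _⟩

theorem bmat_latt [DecidableEq ι] {s j : R} {x₀ : Matrix ι ι R}
    (hs : SymU 𝓢 s) (h : IsBase 𝓢 s x₀) (hJ : EvenM {j} (x₀ * scal ι s))
    (σ : Equiv.Perm S) (δ : S → Matrix ι ι R) (α : S → ℝ) (u : ℝ) :
    bmat (dg S x₀) s u u (latt σ (scal ι j) x₀ δ α) = latt σ (scal ι j) (scal ι s)
      (fun k => bmat x₀ s u u (x₀ + δ k) - scal ι s) fun k => Real.sin u * α k := by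
  have e1 : (rv x₀ s u)ᴴ * scal ι j * rv x₀ s u = scal ι j := by
    have : rv x₀ s u * scal ι j = scal ι j * rv x₀ s u :=
      ((EvenM.one.smul _).add (hJ.smul _)).scal_comm (mem_singleton j)
    rw [mul_assoc, ← this, ← mul_assoc, rv_star_mul hs h, one_mul]
  have e2 : (rv x₀ s u)ᴴ * (Real.cos u • scal ι s + Real.sin u • x₀) * rv x₀ s u = scal ι s :=
    bmat_diag_base hs h u
  rw [bmat, rv_dg, ← dg_scal, dg_star, latt_affine, dg_latt_dg, e1, e2]
  congr 1
  funext k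
  rw [← bmat_diag_base hs h u, bmat_sub, add_sub_cancel_left, mul_smul_comm, smul_mul_assoc]

/-- Interchange of the last two coordinates. -/
def swapc (p : (P × ℝ) × ℝ) : (P × ℝ) × ℝ := ((p.1.1, p.2), p.1.2)

theorem bfam_psi [NormedSpace ℝ P] [FiniteDimensional ℝ P] [Nontrivial P] [DecidableEq ι] {s j : R}
    (hs : SymU (insert j 𝓢) s) (hj : SkewU (insert s 𝓢) j) {x₀ : Matrix ι ι R}
    (h : IsBase (insert j 𝓢) s x₀) {w : R} (hw : OddU (insert s 𝓢) w)
    {y : P × ℝ → Matrix ι ι R} (hy : IsFam E (insert s (insert j 𝓢)) y) (hb : Based x₀ y)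
    (h0 : PsiRel E (insert s 𝓢) j y 0) :
    PsiRel E 𝓢 j (fun p => bfam x₀ s y (swapc p)) 0 := by
  have hs' : SymU 𝓢 s := ⟨hs.st, hs.sq, fun r hr => hs.odd r (mem_insert_of_mem _ hr)⟩
  have h' : IsBase 𝓢 s x₀ := ⟨h.sa, h.odd.mono (insert_subset_insert (subset_insert _ _)), h.sq⟩
  have hj' : SkewU 𝓢 j := ⟨hj.st, hj.sq, fun r hr => hj.odd r (mem_insert_of_mem _ hr)⟩
  have hy' : IsFam E (insert j (insert s 𝓢)) y := by rwa [insert_comm]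
  have hJ : EvenM {j} (x₀ * scal ι s) := by
    exact (h.odd.mono (singleton_subset_iff.2 (by simp))).mul_odd
      (.scal fun r hr => hs.odd r (by simp [mem_singleton_iff.1 hr]))
  have hnorm : ∀ p : (P × ℝ) × ℝ, ‖swapc p‖ = ‖p‖ := fun p => by
    simp only [swapc, Prod.norm_def]; rw [max_right_comm]
  have hsw : Continuous (swapc : (P × ℝ) × ℝ → (P × ℝ) × ℝ) := by unfold swapc; fun_prop
  have hF : IsFam E (insert j 𝓢) fun p => bfam x₀ s y (swapc p) :=
    (bfam_isFam hs h hy hb).comp hsw fun r => ⟨r, fun q hq => by rwa [hnorm]⟩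
  obtain ⟨r, hr⟩ := hb
  have hv : Valid E y x₀ (fun p => 1 / 2 * ‖act E (y p - x₀)‖) r := by
    refine ⟨?_, fun p hp => ⟨hr p hp, ?_⟩, fun p => by linarith⟩
    · have : Continuous fun p => act E (y p - x₀) :=
        continuous_act.comp (hy.cont.sub continuous_const)
      exact continuous_const.mul
        ((continuous_norm (E := V E ι →L[ℝ] V E ι)).comp this)
    · rw [hr p hp, sub_self, act_zero, norm_zero (E := V E ι →L[ℝ] V E ι), mul_zero]
  set α : P × ℝ → ℝ := fun p => 1 / 2 * ‖act E (y p - x₀)‖ with hα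
  have hv' : Valid E (fun p => bfam x₀ s y (swapc p)) (scal ι s)
      (fun p => Real.sin (ang p.1.2) * α (p.1.1, p.2)) (max r 1) := by
    refine ⟨?_, fun p hp => ⟨bfam_far hs' h' hr (by rwa [hnorm]), ?_⟩, fun p => ?_⟩
    · exact (Real.continuous_sin.comp (continuous_ang.comp (by fun_prop))).mul
        (hv.cα.comp (by fun_prop))
    · have hp' : max r 1 ≤ ‖swapc p‖ := by rwa [hnorm]
      rw [Prod.norm_def, le_max_iff] at hp'
      rcases hp' with hp' | hp'
      · rw [show α (p.1.1, p.2) = 0 from (hv.dead _ ((le_max_left _ _).trans hp')).2, mul_zero]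
      · rw [show Real.sin (ang p.1.2) = 0 from sin_ang_far ((le_max_right _ _).trans hp'), zero_mul]
    · rw [bfam, ← bmat_diag_base hs' h' (ang (swapc p).2), bmat_sub]
      refine (norm_act_smul_le (sin_ang_nonneg _) _).trans ?_
      have h1 := norm_act_conj_le (E := E) (rv_star_mul hs' h' (ang (swapc p).2))
        (rv_mul_star hs' h' _) (y (swapc p).1 - x₀)
      have h2 := hv.bound (swapc p).1
      have := mul_le_mul_of_nonneg_left (h1.trans h2) (sin_ang_nonneg p.1.2)
      calc _ ≤ _ := this
        _ = _ := by simp only [swapc]; ring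
  obtain ⟨h₀, ρ₀, hh₀, H₀⟩ := h0 _ _ _ hv
  refine PsiRel.of_sch hj' hF hv' fun h₁ ρ₁ hh₁ => ?_
  obtain ⟨N, l, t, hS⟩ := exists_sch (lt_min hh₀ hh₁) (max ρ₀ ρ₁)
  obtain ⟨hT, hx⟩ := H₀ _ (finRotate (N + 1)) l t (hS.mono (min_le_left _ _) (le_max_left _ _))
  have key : sampF (finRotate (N + 1)) j t (scal ι s) (fun p => bfam x₀ s y (swapc p))
      (fun p => Real.sin (ang p.1.2) * α (p.1.1, p.2)) =
      bfam (dg _ x₀) s (sampF (finRotate (N + 1)) j t x₀ y α) := by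
    funext q
    rw [bfam, sampF, samp, sampF, samp, bmat_latt hs' h' hJ]
    simp only [add_sub_cancel]
    rfl
  have hbT : Based (dg _ x₀) (sampF (finRotate (N + 1)) j t x₀ y α) := by
    refine ⟨r, fun q hq => ?_⟩
    have hd : ∀ x : ℝ, y (q, x) = x₀ ∧ α (q, x) = 0 := fun x =>
      hv.dead _ (hq.trans (by simp [Prod.norm_def]))
    rw [sampF, samp, ← latt_zero (finRotate (N + 1)) (scal ι j)]
    congr 1
    · funext k; simp [(hd (t k)).1]
    · funext k; simp [(hd (t k)).2]
  have hbF := bfam_isFam hs' h'.dg hT hbT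
  refine ⟨_, inferInstance, inferInstance, _, l, t, hS.mono (min_le_right _ _) (le_max_right _ _), ?_⟩
  rw [key]
  exact ⟨hbF, bfam_null hs' h'.dg hw hT hbT hx hbF⟩

/-- Reversal of the last coordinate. -/
def rev (p : P × ℝ) : P × ℝ := (p.1, -p.2)

theorem bfam_psi_rev [NormedSpace ℝ P] [FiniteDimensional ℝ P] [Nontrivial P] [DecidableEq ι]
    {s j : R} (hs : SymU (insert j 𝓢) s) (hj : SkewU (insert s 𝓢) j) {x₀ : Matrix ι ι R}
    (h : IsBase (insert j 𝓢) s x₀) {w : R} (hw : OddU (insert s 𝓢) w)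
    {y : P × ℝ → Matrix ι ι R} (hy : IsFam E (insert s (insert j 𝓢)) y) (hb : Based x₀ y)
    (h0 : PsiRel E (insert s 𝓢) j y 0) :
    PsiRel E 𝓢 j (bfam x₀ s fun p => y (rev p)) 0 := by
  have hj' : SkewU 𝓢 j := ⟨hj.st, hj.sq, fun r hr => hj.odd r (mem_insert_of_mem _ hr)⟩
  let φ : ℝ × ((P × ℝ) × ℝ) → (P × ℝ) × ℝ := fun z =>
    ((z.2.1.1, Real.sin (Real.pi / 2 * (1 - z.1)) * z.2.2 - Real.cos (Real.pi / 2 * (1 - z.1)) * z.2.1.2),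
      Real.sin (Real.pi / 2 * (1 - z.1)) * z.2.1.2 + Real.cos (Real.pi / 2 * (1 - z.1)) * z.2.2)
  have hφ : Continuous φ := by fun_prop
  have H := (bfam_isFam hs h hy hb).htpy_comp (φ := φ) hφ fun r => ⟨2 * |r|, fun t _ q hq => by
    have e := Real.sin_sq_add_cos_sq (Real.pi / 2 * (1 - t))
    have b1 := Real.abs_sin_le_one (Real.pi / 2 * (1 - t))
    have b2 := Real.abs_cos_le_one (Real.pi / 2 * (1 - t))
    obtain ⟨⟨p, x⟩, z⟩ := q
    simp only [Prod.norm_def, le_max_iff, Real.norm_eq_abs, φ] at hq ⊢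
    have hr := abs_nonneg r
    have hr' := le_abs_self r
    generalize Real.sin (Real.pi / 2 * (1 - t)) = a at *
    generalize Real.cos (Real.pi / 2 * (1 - t)) = b at *
    rcases hq with (hq | hq) | hq
    · exact Or.inl (Or.inl (by linarith))
    · by_contra! hc
      have e1 : x = a * (a * x + b * z) - b * (a * z - b * x) := by linear_combination (-x) * e
      have h1 : |a * (a * x + b * z)| ≤ 1 * |a * x + b * z| := by rw [abs_mul]; gcongr
      have h2 : |b * (a * z - b * x)| ≤ 1 * |a * z - b * x| := by rw [abs_mul]; gcongr
      have h3 := abs_sub (a * (a * x + b * z)) (b * (a * z - b * x))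
      rw [← e1] at h3
      linarith [hc.1.2, hc.2]
    · by_contra! hc
      have e1 : z = b * (a * x + b * z) + a * (a * z - b * x) := by linear_combination (-z) * e
      have h1 : |b * (a * x + b * z)| ≤ 1 * |a * x + b * z| := by rw [abs_mul]; gcongr
      have h2 : |a * (a * z - b * x)| ≤ 1 * |a * z - b * x| := by rw [abs_mul]; gcongr
      have h3 := abs_add_le (b * (a * x + b * z)) (a * (a * z - b * x))
      rw [← e1] at h3
      linarith [hc.1.2, hc.2]⟩
  have H' : Htpy E (insert j 𝓢) (fun p => bfam x₀ s y (swapc p)) (bfam x₀ s fun p => y (rev p)) := by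
    convert H using 2
    · simp [φ, swapc]
    · simp [φ, bfam, rev]
  obtain ⟨x, hx⟩ := exists_psiRel hj' H'.right
  rwa [PsiRel.htpy hj' H' (bfam_psi hs hj h hw hy hb h0) hx]

end Swap

section Side

variable {W : Type*} [NormedAddCommGroup W] [InnerProductSpace ℝ W]

local notation "⟪" x "," y "⟫" => inner ℝ x y

/-- The algebraic relations on one half of the lattice. -/
structure SideOps (s a x : W →L[ℝ] W) : Prop where
  ssym : ∀ v w, ⟪s v, w⟫ = ⟪v, s w⟫
  asym : ∀ v w, ⟪a v, w⟫ = ⟪v, a w⟫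
  xsym : ∀ v w, ⟪x v, w⟫ = ⟪v, x w⟫
  ssq : ∀ v, s (s v) = v
  asq : ∀ v, a (a v) = v
  sa : ∀ v, a (s v) = -s (a v)
  xs : ∀ v, x (s v) = -s (x v)
  xa : ∀ v, x (a v) = a (x v)
  inj : ∀ v, x v = 0 → v = 0

variable {s a x : W →L[ℝ] W}

theorem SideOps.inner_s (H : SideOps s a x) (v w : W) : ⟪x v, s w⟫ = -⟪x w, s v⟫ := by
  rw [← H.ssym, ← neg_eq_iff_eq_neg.2 (H.xs v), inner_neg_left, H.xsym, real_inner_comm]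

theorem SideOps.inner_sa (H : SideOps s a x) (v w : W) : ⟪x v, s (a w)⟫ = ⟪x w, s (a v)⟫ := by
  rw [H.inner_s, H.xa, H.asym, H.sa, inner_neg_right, neg_neg]

theorem SideOps.inner_self (H : SideOps s a x) (v : W) : ⟪x v, s v⟫ = 0 := by
  linarith [H.inner_s v v]

theorem SideOps.inner_fix (H : SideOps s a x) {v w : W} (hv : a v = v) (hw : a w = w) :
    ⟪x v, s w⟫ = 0 := by
  have : ⟪x v, s w⟫ = -⟪x v, s w⟫ := by
    conv_lhs => rw [← hv, H.xa, H.asym, H.sa, hw, inner_neg_right]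
  linarith

theorem SideOps.norm_a (H : SideOps s a x) (v : W) : ‖a v‖ = ‖v‖ := by
  rw [← sq_eq_sq₀ (norm_nonneg _) (norm_nonneg _), ← real_inner_self_eq_norm_sq,
    ← real_inner_self_eq_norm_sq, H.asym, H.asq]

/-- The off-diagonal part of the equation at an interior site. -/
noncomputable def sideEq (s a x : W →L[ℝ] W) (α β γ : ℕ → ℝ) (w : ℕ → W) (k : ℕ) : W :=
  -((β (k + 1) / 2) • s (w (k + 1) + w (k + 2))) - (β k / 2) • s (w k + w (k + 1)) +
    (α (k + 1) / 2) • s (a (w (k + 2))) - (α k / 2) • s (a (w k)) +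
    (γ (k + 1) / 4) • x (w (k + 1) + w (k + 2)) + (γ k / 4) • x (w k + w (k + 1))

/-- The equation at the first site. -/
noncomputable def sideEq₁ (s a x : W →L[ℝ] W) (α β γ : ℕ → ℝ) (w : ℕ → W) : W :=
  (1 / 2 : ℝ) • s (w 1) - (β 1 / 2) • s (w 1 + w 2) + (α 1 / 2) • s (a (w 2)) +
    (γ 1 / 4) • x (w 1 + w 2)

theorem SideOps.energy (H : SideOps s a x) {α β γ : ℕ → ℝ} {w : ℕ → W} {l : ℝ} {n : ℕ}
    (h0 : a (w 0) = w 0) (h1 : a (w 1) = w 1)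
    (e1 : (1 - l) • sideEq₁ s a x α β γ w + l • x (w 1) - s (w 0) = 0)
    (ek : ∀ k, 1 ≤ k → k ≤ n → s (w (k + 1)) + (1 - l) • sideEq s a x α β γ w k = 0)
    (m : ℕ) (hm : m ≤ n) :
    l * ⟪x (w 1), x (w 1)⟫ + (1 - l) * (-(β (m + 1) / 2) * ⟪x (w (m + 1)), s (w (m + 2))⟫ +
      α (m + 1) / 2 * ⟪x (w (m + 1)), s (a (w (m + 2)))⟫ +
      γ (m + 1) / 4 * ⟪x (w (m + 1)), x (w (m + 1) + w (m + 2))⟫ + ∑ k ∈ Finset.range m,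
        γ (k + 1) / 4 * ⟪x (w (k + 1) + w (k + 2)), x (w (k + 1) + w (k + 2))⟫) = 0 := by
  induction m with
  | zero =>
    have := congrArg (fun z => ⟪x (w 1), z⟫) e1
    simp only [sideEq₁, inner_add_right, inner_sub_right, inner_smul_right, inner_zero_right,
      map_add, H.inner_self, H.inner_fix h1 h0] at this
    simp only [map_add, inner_add_right, Finset.range_zero, Finset.sum_empty, zero_add]
    linarith
  | succ m ih =>
    have ih := ih (by omega)
    have := congrArg (fun z => ⟪x (w (m + 2)), z⟫) (ek (m + 1) (by omega) hm)
    simp only [sideEq, inner_add_right, inner_sub_right, inner_smul_right, inner_zero_right,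
      map_add, H.inner_self, inner_neg_right, Nat.add_assoc, Nat.reduceAdd] at this
    rw [H.inner_s (w (m + 2)) (w (m + 1)), H.inner_sa (w (m + 2)) (w (m + 1)),
      real_inner_comm (x (w (m + 1))) (x (w (m + 2)))] at this
    rw [Finset.sum_range_succ]
    simp only [map_add, inner_add_right, inner_add_left, Nat.add_assoc, Nat.reduceAdd] at ih ⊢
    rw [real_inner_comm (x (w (m + 1))) (x (w (m + 2)))]
    linear_combination ih + this

/-- The half lattice has no kernel. -/
theorem SideOps.eq_zero (H : SideOps s a x) {α β γ : ℕ → ℝ} {w : ℕ → W} {l : ℝ} {n : ℕ}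
    (hn : 2 ≤ n) (hl : l ∈ Icc (0 : ℝ) 1) (hγ : ∀ k < n, 0 < γ (k + 1))
    (hα : |α 2 - α 1| < 2) (ha : α (n + 1) = 0) (hb : β (n + 1) = 0) (hg : γ (n + 1) = 0)
    (ha' : α (n + 2) = 0) (hb' : β (n + 2) = 0) (hg' : γ (n + 2) = 0)
    (h0 : a (w 0) = w 0) (h1 : a (w 1) = w 1)
    (e1 : (1 - l) • sideEq₁ s a x α β γ w + l • x (w 1) - s (w 0) = 0)
    (ek : ∀ k, 1 ≤ k → k ≤ n + 1 → s (w (k + 1)) + (1 - l) • sideEq s a x α β γ w k = 0) :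
    ∀ k ≤ n + 2, w k = 0 := by
  have sinj : ∀ v, s v = 0 → v = 0 := fun v hv => by rw [← H.ssq v, hv, map_zero]
  have en := H.energy h0 h1 e1 (fun k h h' => ek k h (Nat.le_succ_of_le h')) n le_rfl
  rw [ha, hb, hg] at en
  have hnn : ∀ v : W, 0 ≤ ⟪v, v⟫ := fun v => real_inner_self_nonneg
  have hsum : 0 ≤ ∑ k ∈ Finset.range n,
      γ (k + 1) / 4 * ⟪x (w (k + 1) + w (k + 2)), x (w (k + 1) + w (k + 2))⟫ :=
    Finset.sum_nonneg fun k hk =>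
      mul_nonneg (by linarith [hγ k (Finset.mem_range.1 hk)]) (hnn _)
  have p1 := mul_nonneg hl.1 (hnn (x (w 1)))
  have p2 := mul_nonneg (sub_nonneg.2 hl.2) hsum
  have w1 : w 1 = 0 ∧ ∀ k, 1 ≤ k → k ≤ n + 1 → w (k + 1) = 0 := by
    rcases eq_or_lt_of_le hl.2 with rfl | hl'
    · refine ⟨H.inj _ (inner_self_eq_zero (𝕜 := ℝ).1 (by linarith)), fun k h h' => sinj _ ?_⟩
      simpa using ek k h h'
    · have hz : ∑ k ∈ Finset.range n,
          γ (k + 1) / 4 * ⟪x (w (k + 1) + w (k + 2)), x (w (k + 1) + w (k + 2))⟫ = 0 := by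
        have : (1 - l) * ∑ k ∈ Finset.range n,
          γ (k + 1) / 4 * ⟪x (w (k + 1) + w (k + 2)), x (w (k + 1) + w (k + 2))⟫ = 0 := by
            linarith
        exact (mul_eq_zero.1 this).resolve_left (by linarith)
      have hs : ∀ k < n, w (k + 1) + w (k + 2) = 0 := fun k hk => by
        have := (Finset.sum_eq_zero_iff_of_nonneg fun k hk =>
          mul_nonneg (by linarith [hγ k (Finset.mem_range.1 hk)]) (hnn _)).1 hz k
            (Finset.mem_range.2 hk)
        exact H.inj _ (inner_self_eq_zero (𝕜 := ℝ).1
          ((mul_eq_zero.1 this).resolve_left (by linarith [hγ k hk])))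
      have c1 := hs 0 (by omega)
      have c2 := hs 1 (by omega)
      have e2 := ek 1 le_rfl (by omega)
      have b1 : w 1 = -w 2 := eq_neg_of_add_eq_zero_left c1
      have b3 : w 3 = -w 2 := eq_neg_of_add_eq_zero_right c2
      simp only [sideEq, Nat.reduceAdd, b1, b3, map_neg, add_neg_cancel, neg_add_cancel, map_zero,
        smul_zero, neg_zero, sub_zero, zero_add, add_zero, smul_neg, sub_neg_eq_add] at e2
      have e3 : w 2 = ((1 - l) * ((α 2 - α 1) / 2)) • a (w 2) := by
        have := congrArg s e2
        simp only [map_add, map_smul, map_neg, H.ssq, map_zero] at this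
        rw [← sub_eq_zero, ← this]
        module
      have w2 : w 2 = 0 := by
        have := congrArg norm e3
        rw [norm_smul, H.norm_a, norm_mul, Real.norm_of_nonneg (by linarith), Real.norm_eq_abs,
          abs_div, abs_two] at this
        by_contra hne
        have hp := norm_pos_iff.2 hne
        have : (1 - l) * (|α 2 - α 1| / 2) < 1 := by nlinarith [abs_nonneg (α 2 - α 1), hl.1]
        nlinarith
      have hall : ∀ k ≤ n, w (k + 1) = 0 := by
        intro k
        induction k with
        | zero => intro _; rw [b1, w2, neg_zero]
        | succ k ih =>
          intro hk
          have := hs k (by omega)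
          rwa [ih (by omega), zero_add] at this
      refine ⟨hall 0 (by omega), fun k h h' => ?_⟩
      rcases Nat.lt_or_ge k (n + 1) with h2 | h2
      · exact hall k (by omega)
      · obtain rfl : k = n + 1 := by omega
        have := ek (n + 1) h h'
        simp only [sideEq, ha, hb, hg, ha', hb', hg', Nat.add_assoc, Nat.reduceAdd, zero_div,
          zero_smul, neg_zero, sub_zero, add_zero, smul_zero] at this
        exact sinj _ this
  have w2 : w 2 = 0 := w1.2 1 le_rfl (by omega)
  intro k hk
  match k with
  | 0 =>
    simp only [sideEq₁, w1.1, w2, map_zero, add_zero, smul_zero, sub_zero, zero_sub,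
      neg_eq_zero] at e1
    exact sinj _ e1
  | 1 => exact w1.1
  | k + 2 => exact w1.2 (k + 1) (by omega) (by omega)

end Side

section Chain

variable {R : Type} [Ring R] [StarRing R] [Algebra ℝ R] [StarModule ℝ R]
  [TopologicalSpace R] [IsTopologicalRing R] [ContinuousStar R] [ContinuousSMul ℝ R]
variable {E : Type} [NormedAddCommGroup E] [InnerProductSpace ℝ E] [FiniteDimensional ℝ E]
  [Module R E] [IsScalarTower ℝ R E] [ContinuousSMul R E] [StarAct R E]
variable {ι κ μ ν : Type} [Fintype ι] [Fintype κ] [Fintype μ] [Fintype ν]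
variable {𝓢 : Set R}
variable {P : Type} [NormedAddCommGroup P]
variable {S : Type} [Fintype S] [DecidableEq S]

/-- The block matrix of a permutation of the sites. -/
def bp (e : Equiv.Perm S) (m : Matrix ι ι R) : Matrix (S × ι) (S × ι) R :=
  fun p q => if p.1 = e q.1 then m p.2 q.2 else 0

theorem bp_star (e : Equiv.Perm S) (m : Matrix ι ι R) : (bp e m)ᴴ = bp e⁻¹ mᴴ := by
  ext ⟨k, a⟩ ⟨l, b⟩
  simp only [bp, conjTranspose_apply, Equiv.Perm.eq_inv_iff_eq, eq_comm (a := l)]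
  split_ifs <;> simp

theorem bp_mul (e f : Equiv.Perm S) (m m' : Matrix ι ι R) :
    bp e m * bp f m' = bp (e * f) (m * m') := by
  ext ⟨k, a⟩ ⟨l, b⟩
  simp only [bp, Matrix.mul_apply, Fintype.sum_prod_type]
  rw [Finset.sum_eq_single (f l) (fun x _ hx => by simp [hx]) (by simp)]
  simp only [if_true]
  by_cases h : k = e (f l)
  · rw [if_pos (show k = (e * f) l from h)]
    simp [h]
  · rw [if_neg (show ¬k = (e * f) l from h)]
    simp [h]

theorem bp_add (e : Equiv.Perm S) (m m' : Matrix ι ι R) : bp e (m + m') = bp e m + bp e m' := by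
  ext ⟨k, a⟩ ⟨l, b⟩; simp only [bp, Matrix.add_apply]; split_ifs <;> simp

theorem bp_zero (e : Equiv.Perm S) : bp e (0 : Matrix ι ι R) = 0 := by
  ext ⟨k, a⟩ ⟨l, b⟩; simp [bp]

theorem bp_one [DecidableEq ι] : bp (1 : Equiv.Perm S) (1 : Matrix ι ι R) = 1 := by
  rw [← dg_one]; rfl

theorem bp_even (e : Equiv.Perm S) {m : Matrix ι ι R} (h : EvenM 𝓢 m) : EvenM 𝓢 (bp e m) := by
  rintro s hs ⟨k, a⟩ ⟨l, b⟩
  simp only [bp]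
  split_ifs
  · exact h s hs a b
  · simp

theorem vb_act_bp (e : Equiv.Perm S) (m : Matrix ι ι R) (v : V E (S × ι)) (k : S) :
    vb k (act E (bp e m) v) = act E m (vb (e⁻¹ k) v) := by
  ext a
  simp only [vb, act_apply, Fintype.sum_prod_type, bp]
  rw [Finset.sum_eq_single (e⁻¹ k) (fun x _ hx => ?_) (by simp)]
  · simp
  · rw [Ne, Equiv.Perm.eq_inv_iff_eq] at hx
    simp [Ne.symm hx]

/-- A block diagonal matrix. -/
def bdiag (D : S → Matrix ι ι R) : Matrix (S × ι) (S × ι) R :=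
  fun p q => if p.1 = q.1 then D p.1 p.2 q.2 else 0

theorem bdiag_star (D : S → Matrix ι ι R) : (bdiag D)ᴴ = bdiag fun k => (D k)ᴴ := by
  ext ⟨k, a⟩ ⟨l, b⟩
  simp only [bdiag, conjTranspose_apply, eq_comm (a := l)]
  split_ifs with h
  · rw [h]
  · simp

theorem bdiag_odd {D : S → Matrix ι ι R} (h : ∀ k, OddM 𝓢 (D k)) : OddM 𝓢 (bdiag D) := by
  rintro s hs ⟨k, a⟩ ⟨l, b⟩
  simp only [bdiag]
  split_ifs
  · exact h k s hs a b
  · simp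

theorem vb_act_bdiag (D : S → Matrix ι ι R) (v : V E (S × ι)) (k : S) :
    vb k (act E (bdiag D) v) = act E (D k) (vb k v) := by
  ext a
  simp only [vb, act_apply, Fintype.sum_prod_type, bdiag]
  rw [Finset.sum_eq_single k (fun x _ hx => by simp [hx.symm]) (by simp)]
  simp

/-- The cyclic order on the sites of two chains. -/
def chain (n : ℕ) : Equiv.Perm (Fin (n + 3) ⊕ Fin (n + 3)) where
  toFun
    | .inl ⟨0, h⟩ => .inr ⟨0, h⟩
    | .inl ⟨k + 1, h⟩ => .inl ⟨k, by omega⟩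
    | .inr ⟨k, _⟩ => if h' : k + 1 < n + 3 then .inr ⟨k + 1, h'⟩ else .inl ⟨n + 2, by omega⟩
  invFun
    | .inr ⟨0, h⟩ => .inl ⟨0, h⟩
    | .inr ⟨k + 1, h⟩ => .inr ⟨k, by omega⟩
    | .inl ⟨k, _⟩ => if h' : k + 1 < n + 3 then .inl ⟨k + 1, h'⟩ else .inr ⟨n + 2, by omega⟩
  left_inv := by
    rintro (⟨_ | k, h⟩ | ⟨k, h⟩)
    · rfl
    · simp [show k + 1 < n + 3 by omega]
    · by_cases h' : k + 1 < n + 3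
      · simp [h']
      · obtain rfl : k = n + 2 := by omega
        simp
  right_inv := by
    rintro (⟨k, h⟩ | ⟨_ | k, h⟩)
    · by_cases h' : k + 1 < n + 3
      · simp [h']
      · obtain rfl : k = n + 2 := by omega
        simp
    · rfl
    · simp [show k + 1 < n + 3 by omega]

variable {n : ℕ}

theorem chain_inl_zero (h : 0 < n + 3) : chain n (.inl ⟨0, h⟩) = .inr ⟨0, h⟩ := rfl
theorem chain_inl_succ {k : ℕ} (h : k + 1 < n + 3) :
    chain n (.inl ⟨k + 1, h⟩) = .inl ⟨k, by omega⟩ := rfl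
theorem chain_inr {k : ℕ} (h : k < n + 3) (h' : k + 1 < n + 3) :
    chain n (.inr ⟨k, h⟩) = .inr ⟨k + 1, h'⟩ := dif_pos h'
theorem chain_inr_last (h : n + 2 < n + 3) :
    chain n (.inr ⟨n + 2, h⟩) = .inl ⟨n + 2, by omega⟩ := by simp [chain]
theorem chain_symm_inr_zero (h : 0 < n + 3) : (chain n).symm (.inr ⟨0, h⟩) = .inl ⟨0, h⟩ := rfl
theorem chain_symm_inr_succ {k : ℕ} (h : k + 1 < n + 3) :
    (chain n).symm (.inr ⟨k + 1, h⟩) = .inr ⟨k, by omega⟩ := rfl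
theorem chain_symm_inl {k : ℕ} (h : k < n + 3) (h' : k + 1 < n + 3) :
    (chain n).symm (.inl ⟨k, h⟩) = .inl ⟨k + 1, h'⟩ := dif_pos h'
theorem chain_symm_inl_last (h : n + 2 < n + 3) :
    (chain n).symm (.inl ⟨n + 2, h⟩) = .inr ⟨n + 2, by omega⟩ := by simp [chain]

/-- The left half of a vector. -/
def lv (n : ℕ) (v : V E ((Fin (n + 3) ⊕ Fin (n + 3)) × ι)) (k : ℕ) : V E ι :=
  if h : k < n + 3 then vb (.inl ⟨k, h⟩) v else 0

/-- The right half of a vector. -/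
def rv' (n : ℕ) (v : V E ((Fin (n + 3) ⊕ Fin (n + 3)) × ι)) (k : ℕ) : V E ι :=
  if h : k < n + 3 then vb (.inr ⟨k, h⟩) v else 0

theorem lv_eq (v : V E ((Fin (n + 3) ⊕ Fin (n + 3)) × ι)) {k : ℕ} (h : k < n + 3) :
    lv n v k = vb (.inl ⟨k, h⟩) v := dif_pos h
theorem rv'_eq (v : V E ((Fin (n + 3) ⊕ Fin (n + 3)) × ι)) {k : ℕ} (h : k < n + 3) :
    rv' n v k = vb (.inr ⟨k, h⟩) v := dif_pos h

/-- Data on the two chains in terms of the distance from the centre. -/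
structure ChainData (δ : Fin (n + 3) ⊕ Fin (n + 3) → Matrix ι ι R) (al : Fin (n + 3) ⊕ Fin (n + 3) → ℝ)
    (S x x₀ : Matrix ι ι R) (α β γ : ℕ → ℝ) : Prop where
  l0 : ∀ h, δ (.inl ⟨0, h⟩) = (-2 : ℝ) • S ∧ al (.inl ⟨0, h⟩) = 1
  l : ∀ k h, δ (.inl ⟨k + 1, h⟩) = (-2 * β k) • S + γ k • x ∧ al (.inl ⟨k + 1, h⟩) = α k
  r : ∀ k h, δ (.inr ⟨k, h⟩) = (-2 * β k) • S + γ k • x₀ ∧ al (.inr ⟨k, h⟩) = α k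
  z : α 0 = 1 ∧ β 0 = 1 ∧ γ 0 = 0
  e1 : α (n + 1) = 0 ∧ β (n + 1) = 0 ∧ γ (n + 1) = 0
  e2 : α (n + 2) = 0 ∧ β (n + 2) = 0 ∧ γ (n + 2) = 0

section rows

variable {δ : Fin (n + 3) ⊕ Fin (n + 3) → Matrix ι ι R} {al : Fin (n + 3) ⊕ Fin (n + 3) → ℝ}
  {S x x₀ J A : Matrix ι ι R} {α β γ : ℕ → ℝ}

theorem act_comb (b c : ℝ) (S x : Matrix ι ι R) (v : V E ι) :
    act E (b • S + c • x) v = b • act E S v + c • act E x v := by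
  rw [act_add, act_smul, act_smul]; rfl

theorem ChainData.row_l (H : ChainData δ al S x x₀ α β γ)
    (hJ : ∀ v : V E ι, act E J v = act E S (act E A v))
    (v : V E ((Fin (n + 3) ⊕ Fin (n + 3)) × ι)) {k : ℕ} (h : k + 2 < n + 3) :
    vb (.inl ⟨k + 2, h⟩) (act E (latt (chain n) J S δ al) v) =
      act E S (lv n v (k + 2)) + sideEq (act E S) (act E A) (act E x) α β γ (lv n v) (k + 1) := by
  rw [vb_act_latt, chain_inl_succ, ← lv_eq, ← lv_eq, (H.l _ _).1, (H.l _ _).2, sideEq]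
  have key : act E (δ ((chain n).symm (.inl ⟨k + 2, h⟩)))
      ((1 / 2 : ℝ) • (vb ((chain n).symm (.inl ⟨k + 2, h⟩)) v + lv n v (k + 2))) =
      act E ((-2 * β (k + 2)) • S + γ (k + 2) • x)
      ((1 / 2 : ℝ) • (lv n v (k + 3) + lv n v (k + 2))) ∧
      al ((chain n).symm (.inl ⟨k + 2, h⟩)) • vb ((chain n).symm (.inl ⟨k + 2, h⟩)) v =
      α (k + 2) • lv n v (k + 3) := by
    by_cases h' : k + 2 + 1 < n + 3
    · rw [chain_symm_inl h h', (H.l _ _).1, (H.l _ _).2, ← lv_eq]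
      exact ⟨rfl, rfl⟩
    · obtain rfl : k = n := by omega
      rw [chain_symm_inl_last, (H.r _ _).1, (H.r _ _).2, H.e2.1, H.e2.2.1, H.e2.2.2]
      simp [act_zero]
  rw [key.1, key.2]
  simp only [act_comb, map_smul, map_add, map_sub, hJ, Nat.add_assoc, Nat.reduceAdd]
  module

theorem ChainData.row_r (H : ChainData δ al S x x₀ α β γ)
    (hJ : ∀ v : V E ι, act E J v = act E S (act E A v))
    (v : V E ((Fin (n + 3) ⊕ Fin (n + 3)) × ι)) {k : ℕ} (h : k + 2 < n + 3) :
    vb (.inr ⟨k + 2, h⟩) (act E (latt (chain n) J S δ al) v) =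
      act E S (rv' n v (k + 2)) +
        sideEq (act E S) (-act E A) (act E x₀) α β γ (rv' n v) (k + 1) := by
  rw [vb_act_latt, chain_symm_inr_succ, ← rv'_eq, ← rv'_eq, (H.r _ _).1, (H.r _ _).2, (H.r _ _).1,
    (H.r _ _).2, sideEq]
  have key : act E ((-2 * β (k + 2)) • S + γ (k + 2) • x₀)
      ((1 / 2 : ℝ) • (rv' n v (k + 2) + vb (chain n (.inr ⟨k + 2, h⟩)) v)) =
      act E ((-2 * β (k + 2)) • S + γ (k + 2) • x₀)
      ((1 / 2 : ℝ) • (rv' n v (k + 2) + rv' n v (k + 3))) ∧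
      α (k + 2) • vb (chain n (.inr ⟨k + 2, h⟩)) v = α (k + 2) • rv' n v (k + 3) := by
    by_cases h' : k + 2 + 1 < n + 3
    · rw [chain_inr h h', ← rv'_eq]
      exact ⟨rfl, rfl⟩
    · obtain rfl : k = n := by omega
      rw [H.e2.1, H.e2.2.1, H.e2.2.2]
      simp [act_zero]
  rw [key.1, key.2]
  simp only [act_comb, map_smul, map_add, map_sub, hJ, Nat.add_assoc, Nat.reduceAdd,
    ContinuousLinearMap.neg_apply, map_neg]
  module

theorem ChainData.row_l1 (H : ChainData δ al S x x₀ α β γ)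
    (hJ : ∀ v : V E ι, act E J v = act E S (act E A v))
    (v : V E ((Fin (n + 3) ⊕ Fin (n + 3)) × ι)) (h : 1 < n + 3) :
    vb (.inl ⟨1, h⟩) (act E (latt (chain n) J S δ al) v) =
      sideEq₁ (act E S) (act E A) (act E x) α β γ (lv n v)
        - (1 / 2 : ℝ) • act E S (lv n v 0 + act E A (lv n v 0)) := by
  have h2 : 1 + 1 < n + 3 := by omega
  have h1 : 0 + 1 < n + 3 := h
  have e := chain_inl_succ h1
  simp only [Nat.zero_add] at e
  have d := H.l 0 h1
  simp only [Nat.zero_add] at d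
  rw [vb_act_latt, chain_symm_inl h h2, e, ← lv_eq, ← lv_eq, ← lv_eq, (H.l _ _).1, (H.l _ _).2,
    d.1, d.2, sideEq₁, H.z.1, H.z.2.1, H.z.2.2]
  simp only [act_comb, map_smul, map_add, map_sub, hJ, Nat.reduceAdd]
  module

theorem ChainData.row_l0 (H : ChainData δ al S x x₀ α β γ)
    (hJ : ∀ v : V E ι, act E J v = act E S (act E A v))
    (v : V E ((Fin (n + 3) ⊕ Fin (n + 3)) × ι)) (h : 0 < n + 3) :
    vb (.inl ⟨0, h⟩) (act E (latt (chain n) J S δ al) v) =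
      -((1 / 2 : ℝ) • act E S (lv n v 1 - act E A (lv n v 1)))
        - (1 / 2 : ℝ) • act E S (rv' n v 0 + act E A (rv' n v 0)) := by
  have h1 : 0 + 1 < n + 3 := by omega
  rw [vb_act_latt, chain_symm_inl h h1, chain_inl_zero, ← lv_eq, ← lv_eq, ← rv'_eq, (H.l _ _).1,
    (H.l _ _).2, (H.l0 _).1, (H.l0 _).2, H.z.1, H.z.2.1, H.z.2.2]
  simp only [act_comb, act_smul, ContinuousLinearMap.smul_apply, map_smul, map_add, map_sub, hJ,
    Nat.zero_add]
  module

theorem ChainData.row_r0 (H : ChainData δ al S x x₀ α β γ)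
    (hJ : ∀ v : V E ι, act E J v = act E S (act E A v))
    (v : V E ((Fin (n + 3) ⊕ Fin (n + 3)) × ι)) (h : 0 < n + 3) :
    vb (.inr ⟨0, h⟩) (act E (latt (chain n) J S δ al) v) =
      -((1 / 2 : ℝ) • act E S (lv n v 0 - act E A (lv n v 0)))
        - (1 / 2 : ℝ) • act E S (rv' n v 1 + act E A (rv' n v 1)) := by
  have h1 : 0 + 1 < n + 3 := by omega
  rw [vb_act_latt, chain_symm_inr_zero, chain_inr h h1, ← lv_eq, ← rv'_eq, ← rv'_eq, (H.r _ _).1,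
    (H.r _ _).2, (H.l0 _).1, (H.l0 _).2, H.z.1, H.z.2.1, H.z.2.2]
  simp only [act_comb, act_smul, ContinuousLinearMap.smul_apply, map_smul, map_add, map_sub, hJ,
    Nat.zero_add]
  module

theorem ChainData.row_r1 (H : ChainData δ al S x x₀ α β γ)
    (hJ : ∀ v : V E ι, act E J v = act E S (act E A v))
    (v : V E ((Fin (n + 3) ⊕ Fin (n + 3)) × ι)) (h : 1 < n + 3) :
    vb (.inr ⟨1, h⟩) (act E (latt (chain n) J S δ al) v) =
      sideEq₁ (act E S) (-act E A) (act E x₀) α β γ (rv' n v)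
        - (1 / 2 : ℝ) • act E S (rv' n v 0 - act E A (rv' n v 0)) := by
  have h2 : 1 + 1 < n + 3 := by omega
  have h1 : 0 + 1 < n + 3 := h
  have e := chain_symm_inr_succ h1
  simp only [Nat.zero_add] at e
  rw [vb_act_latt, chain_inr h h2, e, ← rv'_eq, ← rv'_eq, ← rv'_eq, (H.r _ _).1, (H.r _ _).2,
    (H.r _ _).1, (H.r _ _).2, sideEq₁, H.z.1, H.z.2.1, H.z.2.2]
  simp only [act_comb, map_smul, map_add, map_sub, hJ, Nat.reduceAdd,
    ContinuousLinearMap.neg_apply, map_neg]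
  module

end rows

section ends

variable [DecidableEq ι]

/-- The spectral projections of an involution. -/
noncomputable def pp (A : Matrix ι ι R) : Matrix ι ι R := (1 / 2 : ℝ) • (1 + A)

theorem pp_act (A : Matrix ι ι R) (v : V E ι) :
    act E (pp A) v = (1 / 2 : ℝ) • (v + act E A v) := by
  rw [pp, act_smul, act_add, ContinuousLinearMap.smul_apply, ContinuousLinearMap.add_apply,
    act_one]

theorem pp_star {A : Matrix ι ι R} (h : Aᴴ = A) : (pp A)ᴴ = pp A := by
  simp [pp, conjTranspose_smul, h]

theorem pp_sq {A : Matrix ι ι R} (h : A * A = 1) : pp A * pp A = pp A := by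
  simp only [pp, smul_mul_smul_comm, mul_add, add_mul, h, one_mul, mul_one]
  module

theorem pp_mul_neg {A : Matrix ι ι R} (h : A * A = 1) : pp A * pp (-A) = 0 := by
  simp only [pp, smul_mul_smul_comm, mul_add, add_mul, h, one_mul, mul_one, mul_neg]
  module

theorem pp_neg_mul {A : Matrix ι ι R} (h : A * A = 1) : pp (-A) * pp A = 0 := by
  simpa using pp_mul_neg (A := -A) (by simpa using h)

theorem pp_add (A : Matrix ι ι R) : pp A + pp (-A) = 1 := by
  simp only [pp]; module

theorem pp_comm {A x : Matrix ι ι R} (h : x * A = A * x) : x * pp A = pp A * x := by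
  simp only [pp, mul_smul_comm, smul_mul_assoc, mul_add, add_mul, h, mul_one, one_mul]

theorem pp_anti {A S : Matrix ι ι R} (h : A * S = -(S * A)) : pp A * S = S * pp (-A) := by
  simp only [pp, mul_smul_comm, smul_mul_assoc, mul_add, add_mul, h, mul_one, one_mul, mul_neg]

theorem pp_even {A : Matrix ι ι R} (h : EvenM 𝓢 A) : EvenM 𝓢 (pp A) :=
  (EvenM.one.add h).smul _

/-- Glue two matrices along the eigenspaces of an involution. -/
noncomputable def gam (A x x₀ : Matrix ι ι R) : Matrix ι ι R := x * pp A + x₀ * pp (-A)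

theorem gam_act (A x x₀ : Matrix ι ι R) (v : V E ι) :
    act E (gam A x x₀) v = act E x (act E (pp A) v) + act E x₀ (act E (pp (-A)) v) := by
  rw [gam, act_add, ContinuousLinearMap.add_apply, act_mul, act_mul]

theorem pp_mul_gam {A x x₀ : Matrix ι ι R} (h : A * A = 1) (hx : x * A = A * x)
    (hx₀ : x₀ * A = A * x₀) : pp A * gam A x x₀ = x * pp A ∧
      pp (-A) * gam A x x₀ = x₀ * pp (-A) := by
  have hx' : x * -A = -A * x := by simp [hx]
  have hx₀' : x₀ * -A = -A * x₀ := by simp [hx₀]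
  simp only [gam, mul_add, ← mul_assoc, ← pp_comm hx, ← pp_comm hx₀, ← pp_comm hx', ← pp_comm hx₀']
  simp [mul_assoc, pp_sq h, pp_mul_neg h, pp_neg_mul h, pp_sq (A := -A) (by simpa using h)]

theorem gam_good {A x x₀ : Matrix ι ι R} (hA : Aᴴ = A) (h : A * A = 1) (he : EvenM 𝓢 A)
    (hx : x * A = A * x) (hx₀ : x₀ * A = A * x₀) (gx : Good E 𝓢 x) (gx₀ : Good E 𝓢 x₀) :
    Good E 𝓢 (gam A x x₀) := by
  have hx' : x * -A = -A * x := by simp [hx]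
  have hx₀' : x₀ * -A = -A * x₀ := by simp [hx₀]
  refine ⟨?_, (gx.odd.mul_even (pp_even he)).add (gx₀.odd.mul_even (pp_even he.neg)), fun v hv => ?_⟩
  · rw [gam, conjTranspose_add, conjTranspose_mul, conjTranspose_mul, gx.sa, gx₀.sa, pp_star hA,
      pp_star (by simp [hA]), ← pp_comm hx, ← pp_comm hx₀']
  · have h1 : act E (pp A) v = 0 := gx.inj _ (by
      rw [← act_mul, ← (pp_mul_gam h hx hx₀).1, act_mul, hv, map_zero])
    have h2 : act E (pp (-A)) v = 0 := gx₀.inj _ (by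
      rw [← act_mul, ← (pp_mul_gam h hx hx₀).2, act_mul, hv, map_zero])
    rw [← act_one (R := R) v, ← pp_add A, act_add, ContinuousLinearMap.add_apply, h1, h2, add_zero]

end ends

/-- The common algebraic setting: `S`, `A`, and a matrix anticommuting with `S`. -/
structure MOps (E : Type) [NormedAddCommGroup E] [InnerProductSpace ℝ E] [FiniteDimensional ℝ E]
  [Module R E] [IsScalarTower ℝ R E] [ContinuousSMul R E] [StarAct R E] [DecidableEq ι]
    (S A x : Matrix ι ι R) : Prop where
  ss : Sᴴ = S
  as : Aᴴ = A
  xst : xᴴ = x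
  ssq : S * S = 1
  asq : A * A = 1
  sa : A * S = -(S * A)
  xs : x * S = -(S * x)
  xa : x * A = A * x
  inj : ∀ v : V E ι, act E x v = 0 → v = 0

section main

variable [DecidableEq ι] {S A x x₀ J : Matrix ι ι R}

theorem MOps.side (H : MOps E S A x) : SideOps (act E S) (act E A) (act E x) := by
  refine ⟨fun v w => ?_, fun v w => ?_, fun v w => ?_, fun v => ?_, fun v => ?_, fun v => ?_,
    fun v => ?_, fun v => ?_, H.inj⟩
  · rw [inner_act, H.ss]
  · rw [inner_act, H.as]
  · rw [inner_act, H.xst]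
  · rw [← act_mul, H.ssq, act_one]
  · rw [← act_mul, H.asq, act_one]
  · rw [← act_mul, H.sa, act_neg, ContinuousLinearMap.neg_apply, act_mul]
  · rw [← act_mul, H.xs, act_neg, ContinuousLinearMap.neg_apply, act_mul]
  · rw [← act_mul, H.xa, act_mul]

theorem MOps.side_neg (H : MOps E S A x) : SideOps (act E S) (-act E A) (act E x) := by
  obtain ⟨h1, h2, h3, h4, h5, h6, h7, h8, h9⟩ := H.side
  refine ⟨h1, fun v w => ?_, h3, h4, fun v => ?_, fun v => ?_, h7, fun v => ?_, h9⟩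
  · simp [h2]
  · simp [h5]
  · simp [h6]
  · simp [h8]

/-- Cyclic permutation of the four central sites. -/
def cyc (n : ℕ) : Equiv.Perm (Fin (n + 3) ⊕ Fin (n + 3)) :=
  Equiv.swap (.inl 1) (.inl 0) * Equiv.swap (.inl 0) (.inr 0) * Equiv.swap (.inr 0) (.inr 1)

/-- The even unitary moving one eigenspace of `A` around the central sites. -/
noncomputable def cycU (n : ℕ) (A : Matrix ι ι R) :
    Matrix ((Fin (n + 3) ⊕ Fin (n + 3)) × ι) ((Fin (n + 3) ⊕ Fin (n + 3)) × ι) R :=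
  bp 1 (pp A) + bp (cyc n) (pp (-A))

/-- The decoupled blocks. -/
noncomputable def finD (n : ℕ) (S A x x₀ : Matrix ι ι R) (k : Fin (n + 3) ⊕ Fin (n + 3)) :
    Matrix ι ι R :=
  if k = .inl 1 then gam A x x₀ else
    if k = .inl 0 ∨ k = .inr 0 ∨ k = .inr 1 then -S else S

/-- The decoupled form of the lattice operator. -/
noncomputable def finT (n : ℕ) (S A x x₀ : Matrix ι ι R) :
    Matrix ((Fin (n + 3) ⊕ Fin (n + 3)) × ι) ((Fin (n + 3) ⊕ Fin (n + 3)) × ι) R :=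
  (cycU n A)ᴴ * bdiag (finD n S A x x₀) * cycU n A

theorem cycU_star (n : ℕ) (hA : Aᴴ = A) :
    (cycU n A)ᴴ = bp 1 (pp A) + bp (cyc n)⁻¹ (pp (-A)) := by
  rw [cycU, conjTranspose_add, bp_star, bp_star, pp_star hA, pp_star (by simp [hA]), inv_one]

theorem cycU_mul (n : ℕ) (hA : Aᴴ = A) (h : A * A = 1) :
    (cycU n A)ᴴ * cycU n A = 1 ∧ cycU n A * (cycU n A)ᴴ = 1 := by
  have h' : -A * -A = 1 := by simpa using h
  constructor <;>
  · rw [cycU_star n hA, cycU]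
    simp only [mul_add, add_mul, bp_mul, pp_sq h, pp_sq h', pp_mul_neg h, pp_neg_mul h, bp_zero,
      inv_mul_cancel, mul_inv_cancel, mul_one, add_zero, zero_add]
    rw [← bp_add, pp_add, bp_one]

theorem cycU_even (n : ℕ) (he : EvenM 𝓢 A) : EvenM 𝓢 (cycU n A) :=
  (bp_even _ (pp_even he)).add (bp_even _ (pp_even he.neg))

theorem finT_row (n : ℕ) (hA : Aᴴ = A) (v : V E ((Fin (n + 3) ⊕ Fin (n + 3)) × ι))
    (k : Fin (n + 3) ⊕ Fin (n + 3)) :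
    vb k (act E (finT n S A x x₀) v) =
      act E (pp A) (act E (finD n S A x x₀ k)
        (act E (pp A) (vb k v) + act E (pp (-A)) (vb ((cyc n)⁻¹ k) v))) +
      act E (pp (-A)) (act E (finD n S A x x₀ (cyc n k))
        (act E (pp A) (vb (cyc n k) v) + act E (pp (-A)) (vb k v))) := by
  rw [finT, cycU_star n hA, act_mul, act_mul, act_add, ContinuousLinearMap.add_apply, vb_add,
    vb_act_bp, vb_act_bp, vb_act_bdiag, vb_act_bdiag, cycU, act_add, ContinuousLinearMap.add_apply,
    vb_add, vb_add, vb_act_bp, vb_act_bp, vb_act_bp, vb_act_bp, inv_one, inv_inv]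
  simp

theorem cyc_l1 : cyc n (.inl 1) = .inl 0 := by simp [cyc, Equiv.swap_apply_def]
theorem cyc_l0 : cyc n (.inl 0) = .inr 0 := by simp [cyc, Equiv.swap_apply_def]
theorem cyc_r0 : cyc n (.inr 0) = .inr 1 := by simp [cyc, Equiv.swap_apply_def]
theorem cyc_r1 : cyc n (.inr 1) = .inl 1 := by simp [cyc]

theorem cyc_fix {k : Fin (n + 3) ⊕ Fin (n + 3)} (h1 : k ≠ .inl 1) (h2 : k ≠ .inl 0)
    (h3 : k ≠ .inr 0) (h4 : k ≠ .inr 1) : cyc n k = k := by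
  simp [cyc, Equiv.swap_apply_def, h1, h2, h3, h4]

theorem finT_l1 (H : MOps E S A x) (H₀ : MOps E S A x₀)
    (v : V E ((Fin (n + 3) ⊕ Fin (n + 3)) × ι)) :
    vb (.inl 1) (act E (finT n S A x x₀) v) =
      (1 / 2 : ℝ) • act E x (vb (.inl 1) v + act E A (vb (.inl 1) v)) -
        (1 / 2 : ℝ) • act E S (vb (.inl 0) v + act E A (vb (.inl 0) v)) := by
  rw [finT_row n H.as, cyc_l1, show (cyc n)⁻¹ (.inl 1) = .inr 1 from
    (Equiv.Perm.inv_eq_iff_eq.2 cyc_r1.symm)]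
  simp only [finD, if_true, if_false, reduceCtorEq, Sum.inl.injEq, zero_ne_one, true_or, gam_act,
    pp_act, act_neg, ContinuousLinearMap.neg_apply, map_add, map_neg, map_smul, H.side.sa,
    H.side.asq, ← H.side.xa, ← H₀.side.xa]
  module

theorem finT_l0 (H : MOps E S A x) (v : V E ((Fin (n + 3) ⊕ Fin (n + 3)) × ι)) :
    vb (.inl 0) (act E (finT n S A x x₀) v) =
      -((1 / 2 : ℝ) • act E S (vb (.inl 1) v - act E A (vb (.inl 1) v))) -
        (1 / 2 : ℝ) • act E S (vb (.inr 0) v + act E A (vb (.inr 0) v)) := by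
  rw [finT_row n H.as, cyc_l0, show (cyc n)⁻¹ (.inl 0) = .inl 1 from
    (Equiv.Perm.inv_eq_iff_eq.2 cyc_l1.symm)]
  simp only [finD, if_true, if_false, reduceCtorEq, Sum.inl.injEq, zero_ne_one, true_or, or_true,
    pp_act, act_neg, ContinuousLinearMap.neg_apply, map_add, map_sub, map_neg, map_smul, H.side.sa,
    H.side.asq]
  module

theorem finT_r0 (H : MOps E S A x) (v : V E ((Fin (n + 3) ⊕ Fin (n + 3)) × ι)) :
    vb (.inr 0) (act E (finT n S A x x₀) v) =
      -((1 / 2 : ℝ) • act E S (vb (.inl 0) v - act E A (vb (.inl 0) v))) -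
        (1 / 2 : ℝ) • act E S (vb (.inr 1) v + act E A (vb (.inr 1) v)) := by
  rw [finT_row n H.as, cyc_r0, show (cyc n)⁻¹ (.inr 0) = .inl 0 from
    (Equiv.Perm.inv_eq_iff_eq.2 cyc_l0.symm)]
  simp only [finD, if_true, if_false, reduceCtorEq, true_or, or_true,
    pp_act, act_neg, ContinuousLinearMap.neg_apply, map_add, map_sub, map_neg, map_smul, H.side.sa,
    H.side.asq]
  module

theorem finT_r1 (H : MOps E S A x) (H₀ : MOps E S A x₀)
    (v : V E ((Fin (n + 3) ⊕ Fin (n + 3)) × ι)) :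
    vb (.inr 1) (act E (finT n S A x x₀) v) =
      (1 / 2 : ℝ) • act E x₀ (vb (.inr 1) v - act E A (vb (.inr 1) v)) -
        (1 / 2 : ℝ) • act E S (vb (.inr 0) v - act E A (vb (.inr 0) v)) := by
  rw [finT_row n H.as, cyc_r1, show (cyc n)⁻¹ (.inr 1) = .inr 0 from
    (Equiv.Perm.inv_eq_iff_eq.2 cyc_r0.symm)]
  simp only [finD, if_true, if_false, reduceCtorEq, or_true, gam_act,
    pp_act, act_neg, ContinuousLinearMap.neg_apply, map_add, map_sub, map_neg, map_smul, H.side.sa,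
    H.side.asq, ← H.side.xa, ← H₀.side.xa]
  module

theorem finT_fix (H : MOps E S A x) {k : Fin (n + 3) ⊕ Fin (n + 3)} (h1 : k ≠ .inl 1)
    (h2 : k ≠ .inl 0) (h3 : k ≠ .inr 0) (h4 : k ≠ .inr 1)
    (v : V E ((Fin (n + 3) ⊕ Fin (n + 3)) × ι)) :
    vb k (act E (finT n S A x x₀) v) = act E S (vb k v) := by
  have e := cyc_fix h1 h2 h3 h4
  rw [finT_row n H.as, e, show (cyc n)⁻¹ k = k from (Equiv.Perm.inv_eq_iff_eq.2 e.symm)]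
  simp only [finD, h1, h2, h3, h4, if_false, or_self,
    pp_act, act_neg, ContinuousLinearMap.neg_apply, map_add, map_neg, map_smul, H.side.sa,
    H.side.asq]
  module

theorem ChainData.inj {δ : Fin (n + 3) ⊕ Fin (n + 3) → Matrix ι ι R}
    {al : Fin (n + 3) ⊕ Fin (n + 3) → ℝ} {α β γ : ℕ → ℝ} (C : ChainData δ al S x x₀ α β γ)
    (H : MOps E S A x) (H₀ : MOps E S A x₀) (hJ : J = S * A) (hn : 2 ≤ n)
    (hγ : ∀ k < n, 0 < γ (k + 1)) (hα : |α 2 - α 1| < 2) {l : ℝ} (hl : l ∈ Icc (0 : ℝ) 1)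
    (v : V E ((Fin (n + 3) ⊕ Fin (n + 3)) × ι))
    (hv : act E ((1 - l) • latt (chain n) J S δ al + l • finT n S A x x₀) v = 0) : v = 0 := by
  have hJ' : ∀ v : V E ι, act E J v = act E S (act E A v) := fun v => by rw [hJ, act_mul]
  have row : ∀ k, (1 - l) • vb k (act E (latt (chain n) J S δ al) v) +
      l • vb k (act E (finT n S A x x₀) v) = 0 := fun k => by
    have := congrArg (vb k) hv
    rwa [act_comb, vb_add, vb_zero] at this
  have h0 : 0 < n + 3 := by omega
  have h1 : 1 < n + 3 := by omega
  have sinj : ∀ v, act E S v = 0 → v = 0 := fun v hv => by rw [← H.side.ssq v, hv, map_zero]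
  have E1 := row (.inl ⟨1, h1⟩)
  have E2 := row (.inl ⟨0, h0⟩)
  have E3 := row (.inr ⟨0, h0⟩)
  have E4 := row (.inr ⟨1, h1⟩)
  have z0 : (⟨0, h0⟩ : Fin (n + 3)) = 0 := rfl
  have z1 : (⟨1, h1⟩ : Fin (n + 3)) = 1 := rfl
  rw [C.row_l1 hJ', z1, finT_l1 H H₀, ← z0, ← z1, ← lv_eq, ← lv_eq] at E1
  rw [C.row_l0 hJ', z0, finT_l0 H, ← z0, ← z1, ← lv_eq, ← rv'_eq, ← add_smul, sub_add_cancel,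
    one_smul] at E2
  rw [C.row_r0 hJ', z0, finT_r0 H, ← z0, ← z1, ← lv_eq, ← rv'_eq, ← add_smul, sub_add_cancel,
    one_smul] at E3
  rw [C.row_r1 hJ', z1, finT_r1 H H₀, ← z0, ← z1, ← rv'_eq, ← rv'_eq] at E4
  have split : ∀ p q : V E ι, -((1 / 2 : ℝ) • act E S (p - act E A p)) -
      (1 / 2 : ℝ) • act E S (q + act E A q) = 0 → act E A p = p ∧ -act E A q = q := fun p q h => by
    have e1 : (p - act E A p) + (q + act E A q) = 0 := sinj _ (by
      have := congrArg ((-2 : ℝ) • ·) h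
      simp only [smul_zero] at this
      rw [← this, map_add]; module)
    have e2 := congrArg (act E A) e1
    simp only [map_add, map_sub, H.side.asq, map_zero] at e2
    have e3 : (2 : ℝ) • (p - act E A p) = 0 := by
      have := congrArg₂ (· - ·) e1 e2
      simp only [sub_zero] at this
      rw [← this]; module
    have e4 : (2 : ℝ) • (q + act E A q) = 0 := by
      have := congrArg₂ (· + ·) e1 e2
      simp only [add_zero] at this
      rw [← this]; module
    rw [smul_eq_zero_iff_right two_ne_zero] at e3 e4
    exact ⟨(sub_eq_zero.1 e3).symm, (eq_neg_of_add_eq_zero_left e4).symm⟩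
  obtain ⟨a1, b0⟩ := split _ _ E2
  obtain ⟨a0, b1⟩ := split _ _ E3
  have b0' := neg_eq_iff_eq_neg.1 b0
  have b1' := neg_eq_iff_eq_neg.1 b1
  rw [a0, a1] at E1
  rw [b0', b1'] at E4
  have L := H.side.eq_zero hn hl hγ hα C.e1.1 C.e1.2.1 C.e1.2.2 C.e2.1 C.e2.2.1 C.e2.2.2 a0 a1
    (by rw [← E1]; simp only [map_add]; module) (fun k hk hk' => by
      obtain ⟨k, rfl⟩ := Nat.exists_eq_add_of_le' hk
      have := row (.inl ⟨k + 2, by omega⟩)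
      rw [C.row_l hJ', finT_fix H (by simp [Fin.ext_iff]) (by simp [Fin.ext_iff]) (by simp) (by simp),
        ← lv_eq] at this
      rw [← this]; module)
  have Rr := H₀.side_neg.eq_zero hn hl hγ hα C.e1.1 C.e1.2.1 C.e1.2.2 C.e2.1 C.e2.2.1 C.e2.2.2
    b0 b1
    (by rw [← E4]; simp only [map_sub, map_neg]; module) (fun k hk hk' => by
      obtain ⟨k, rfl⟩ := Nat.exists_eq_add_of_le' hk
      have := row (.inr ⟨k + 2, by omega⟩)
      rw [C.row_r hJ', finT_fix H (by simp) (by simp) (by simp [Fin.ext_iff]) (by simp [Fin.ext_iff]),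
        ← rv'_eq] at this
      rw [← this]; module)
  refine vb_ext fun k => ?_
  rw [vb_zero]
  rcases k with ⟨k, hk⟩ | ⟨k, hk⟩
  · rw [← lv_eq]; exact L k (by omega)
  · rw [← rv'_eq]; exact Rr k (by omega)

end main

end Chain

section Gamma

variable {R : Type} [Ring R] [StarRing R] [Algebra ℝ R] [StarModule ℝ R]
  [TopologicalSpace R] [IsTopologicalRing R] [ContinuousStar R] [ContinuousSMul ℝ R]
variable {E : Type} [NormedAddCommGroup E] [InnerProductSpace ℝ E] [FiniteDimensional ℝ E]
  [Module R E] [IsScalarTower ℝ R E] [ContinuousSMul R E] [StarAct R E]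
variable {ι κ μ ν : Type} [Fintype ι] [Fintype κ] [Fintype μ] [Fintype ν]
variable {𝓢 : Set R}
variable {P : Type} [NormedAddCommGroup P]
variable {S : Type} [Fintype S] [DecidableEq S]

theorem IsFam.conj {f : P → Matrix ι ι R} (hf : IsFam E 𝓢 f) [DecidableEq ι] {U W : Matrix ι ι R}
    (hU : EvenM 𝓢 U) (hU' : EvenM 𝓢 Uᴴ) (h1 : W * U = 1) (h2 : U * W = 1) :
    IsFam E 𝓢 fun q => U * f q * Uᴴ := by
  obtain ⟨hc, hg, r, c, hr⟩ := hf
  exact ⟨(continuous_const.matrix_mul hc).matrix_mul continuous_const,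
    fun q => (hg q).conj hU hU' h1 h2, r, U * c * Uᴴ, fun q hq => by rw [hr q hq]⟩

theorem bdiag_good {D : S → Matrix ι ι R} (h : ∀ k, Good E 𝓢 (D k)) : Good E 𝓢 (bdiag D) := by
  refine ⟨?_, bdiag_odd fun k => (h k).odd, fun v hv => vb_ext fun k => ?_⟩
  · rw [bdiag_star]
    simp only [(h _).sa]
  · refine (h k).inj _ ?_
    rw [← vb_act_bdiag, hv, vb_zero]

/-- Split off one site. -/
def siteEquiv (ι : Type) (k₀ : S) : ι ⊕ ({k // k ≠ k₀} × ι) ≃ S × ι where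
  toFun := Sum.elim (fun a => (k₀, a)) fun p => (p.1.1, p.2)
  invFun p := if h : p.1 = k₀ then .inl p.2 else .inr (⟨p.1, h⟩, p.2)
  left_inv := by
    rintro (a | ⟨⟨k, hk⟩, a⟩)
    · simp
    · simp [hk]
  right_inv := by
    rintro ⟨k, a⟩
    by_cases h : k = k₀
    · simp [h]
    · simp [h]

theorem bdiag_submatrix (D : S → Matrix ι ι R) (k₀ : S) :
    (bdiag D).submatrix (siteEquiv ι k₀) (siteEquiv ι k₀) =
      fromBlocks (D k₀) 0 0 (bdiag fun k : {k // k ≠ k₀} => D k.1) := by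
  ext (a | ⟨⟨k, hk⟩, a⟩) (b | ⟨⟨l, hl⟩, b⟩)
  · simp [siteEquiv, bdiag]
  · simp [siteEquiv, bdiag, Ne.symm hl]
  · simp [siteEquiv, bdiag, hk]
  · simp only [siteEquiv, bdiag, submatrix_apply, Equiv.coe_fn_mk, Sum.elim_inr, fromBlocks_apply₂₂,
      Subtype.mk.injEq]
    by_cases h : k = l <;> simp [h]

theorem bdiag_fam {g : P → Matrix ι ι R} (hg : IsFam E 𝓢 g) {D : P → S → Matrix ι ι R} (k₀ : S)
    {C : S → Matrix ι ι R} (hC : ∀ k, k ≠ k₀ → Good E 𝓢 (C k)) (h0 : ∀ q, D q k₀ = g q)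
    (h1 : ∀ q k, k ≠ k₀ → D q k = C k) :
    ∃ h : IsFam E 𝓢 (fun q => bdiag (D q)), cls _ h = cls g hg := by
  have hC' : Good E 𝓢 (bdiag fun k : {k // k ≠ k₀} => C k.1) := bdiag_good fun k => hC k.1 k.2
  have hF := hg.fromBlocks (isFam_const (P := P) hC')
  have e : ∀ q, (fromBlocks (g q) 0 0 (bdiag fun k : {k // k ≠ k₀} => C k.1)).submatrix
      (siteEquiv ι k₀).symm (siteEquiv ι k₀).symm = bdiag (D q) := fun q => by
    have : (fun k : {k // k ≠ k₀} => C k.1) = fun k => D q k.1 :=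
      funext fun k => (h1 q k.1 k.2).symm
    rw [this, ← h0, ← bdiag_submatrix, submatrix_submatrix]
    simp
  have hF' := hF.submatrix (siteEquiv ι k₀).symm
  have := cls_submatrix hF (siteEquiv ι k₀).symm hF'
  simp only [e] at this hF'
  refine ⟨hF', this.trans ?_⟩
  rw [cls_add hg (isFam_const hC'), cls_const hC', add_zero]

/-- The model positions of the sites. -/
noncomputable def pos (n : ℕ) : Fin (n + 3) ⊕ Fin (n + 3) → ℝ
  | .inl ⟨i, _⟩ => -(((i - 1 : ℕ) : ℝ) / (n + 1))
  | .inr ⟨i, _⟩ => min ((i : ℝ) / (n + 1)) 1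

theorem pos_sch (n : ℕ) {m : ℝ} (hm : 0 ≤ m) :
    Sch (chain n) (.inr ⟨n + 2, by omega⟩) (fun k => m * pos n k) (m / (n + 1)) m := by
  have hn : (0 : ℝ) < n + 1 := by positivity
  have key : ∀ k : ℕ, |min (((k + 1 : ℕ) : ℝ) / (n + 1)) 1 - min ((k : ℝ) / (n + 1)) 1| ≤
      1 / (n + 1) := fun k => by
    refine (abs_min_sub_min_le_max _ _ _ _).trans ?_
    rw [sub_self, abs_zero, ← sub_div, abs_div, abs_of_pos hn]
    simp; positivity
  refine ⟨?_, ?_, ?_⟩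
  · have : (1 : ℝ) ≤ ((n + 2 : ℕ) : ℝ) / (n + 1) := by
      rw [le_div_iff₀ hn]; push_cast; linarith
    simp only [pos, min_eq_right this, mul_one, le_refl]
  · rw [chain_inr_last]
    have : ((n + 2 - 1 : ℕ) : ℝ) / (n + 1) = 1 := by
      rw [div_eq_one_iff_eq hn.ne']; push_cast [show n + 2 - 1 = n + 1 from rfl]; rfl
    simp only [pos, this]; linarith
  · intro k hk
    have gen : ∀ x : ℝ, |x| ≤ 1 / (n + 1) → |m * x| ≤ m / (n + 1) := fun x hx => by
      rw [abs_mul, abs_of_nonneg hm, div_eq_mul_one_div]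
      exact mul_le_mul_of_nonneg_left hx hm
    rw [← mul_sub]
    refine gen _ ?_
    rcases k with ⟨_ | k, h⟩ | ⟨k, h⟩
    · rw [chain_inl_zero]
      simp [pos]; positivity
    · rw [chain_inl_succ]
      rcases k with _ | k
      · simp [pos]; positivity
      · simp only [pos, Nat.add_sub_cancel]
        rw [neg_sub_neg, ← sub_div, abs_div, abs_of_pos hn]
        simp
    · have h' : k + 1 < n + 3 := by
        rcases lt_or_eq_of_le (Nat.succ_le_of_lt h) with h' | h'
        · exact h'
        · obtain rfl : k = n + 2 := by omega
          exact absurd rfl hk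
      rw [chain_inr h h']
      exact key k

/-- Clamping to the unit interval. -/
noncomputable def clp (t : ℝ) : ℝ := max 0 (min 1 t)

theorem continuous_clp : Continuous clp := by unfold clp; fun_prop

/-- The angle on the edge path. -/
noncomputable def tht (t : ℝ) : ℝ := Real.pi * max 0 (1 - |t|)

theorem continuous_tht : Continuous tht := by unfold tht; fun_prop

theorem tht_mem (t : ℝ) : tht t ∈ Icc 0 Real.pi := by
  have hp := Real.pi_pos
  refine ⟨by unfold tht; positivity, ?_⟩
  have : max 0 (1 - |t|) ≤ 1 := max_le zero_le_one (by linarith [abs_nonneg t])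
  unfold tht; nlinarith

theorem clp_neg {t : ℝ} (h : t ≤ 0) : Real.pi * clp (t + 1) = tht t ∧ Real.pi * clp t = 0 := by
  unfold clp tht
  rw [abs_of_nonpos h, min_eq_right (by linarith), min_eq_right (by linarith), max_eq_left h]
  constructor
  · congr 2; ring
  · simp

theorem clp_pos {t : ℝ} (h : 0 ≤ t) :
    Real.pi * clp (t + 1) = Real.pi ∧ Real.pi * clp (t + 1) - Real.pi * clp t = tht t := by
  have e : Real.pi * clp (t + 1) = Real.pi := by
    unfold clp; rw [min_eq_left (by linarith)]; simp
  refine ⟨e, ?_⟩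
  rw [e]
  unfold clp tht
  rw [abs_of_nonneg h, max_eq_right (a := (0 : ℝ)) (b := min 1 t) (by positivity)]
  rcases le_total t 1 with h1 | h1
  · rw [min_eq_right h1, max_eq_right (by linarith)]; ring
  · rw [min_eq_left h1, max_eq_left (by linarith)]; ring

section edge

variable [DecidableEq ι] {s j : R} {x₀ : Matrix ι ι R}

/-- The homotopy from the diagonal path to the edge path. -/
noncomputable def epath (x₀ : Matrix ι ι R) (s : R) (f : P → Matrix ι ι R) (z : (ℝ × P) × ℝ) :
    Matrix ι ι R :=
  bmat x₀ s ((1 - z.1.1) * ang z.2 + z.1.1 * (Real.pi * clp (z.2 + 1)))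
    ((1 - z.1.1) * ang z.2 + z.1.1 * (Real.pi * clp z.2)) (f z.1.2)

theorem epath_zero (f : P → Matrix ι ι R) (q : P) (t : ℝ) :
    epath x₀ s f ((0, q), t) = bfam x₀ s f (q, t) := by
  simp [epath, bfam]

theorem epath_one (hs : SymU 𝓢 s) (h : IsBase 𝓢 s x₀) (f : P → Matrix ι ι R) (q : P) (t : ℝ) :
    epath x₀ s f ((1, q), t) =
      Real.cos (tht t) • scal ι s + Real.sin (tht t) • (if t ≤ 0 then f q else x₀) := by
  simp only [epath, sub_self, zero_mul, one_mul, zero_add]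
  split_ifs with ht
  · rw [(clp_neg ht).1, (clp_neg ht).2, bmat]
    simp [rv]
  · rw [bmat_of_sin hs h (by rw [(clp_pos (not_le.1 ht).le).1, Real.sin_pi]),
      (clp_pos (not_le.1 ht).le).2]

theorem continuous_epath (x₀ : Matrix ι ι R) (s : R) {f : P → Matrix ι ι R} (hf : Continuous f) :
    Continuous (epath x₀ s f) := by
  have h1 := continuous_ang
  have h2 := continuous_clp
  exact continuous_bmat _ _ (by fun_prop) (by fun_prop) (by fun_prop)

theorem epath_dead (hs : SymU 𝓢 s) (h : IsBase 𝓢 s x₀) (f : P → Matrix ι ι R) (z : ℝ × P) {t : ℝ}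
    (ht : 1 ≤ |t|) : epath x₀ s f (z, t) = scal ι s := by
  have key : ∃ w, ang t = w ∧ Real.pi * clp (t + 1) = w ∧ Real.pi * clp t = w ∧ Real.sin w = 0 := by
    rcases le_abs.1 ht with ht | ht
    · refine ⟨Real.pi, ?_, ?_, ?_, Real.sin_pi⟩
      · unfold ang; rw [min_eq_left (by linarith)]; simp
      · exact (clp_pos (by linarith)).1
      · unfold clp; rw [min_eq_left ht]; simp
    · refine ⟨0, ?_, ?_, (clp_neg (by linarith)).2, Real.sin_zero⟩
      · unfold ang; rw [max_eq_left ((min_le_right _ _).trans (by linarith))]; simp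
      · unfold clp; rw [max_eq_left ((min_le_right _ _).trans (by linarith))]; simp
  obtain ⟨w, h1, h2, h3, h4⟩ := key
  have e : (1 - z.1) * w + z.1 * w = w := by ring
  simp only [epath, h1, h2, h3, e]
  rw [bmat_of_sin hs h h4]
  simp

/-- The weight on the edge path. -/
noncomputable def ewt (B t : ℝ) : ℝ := (1 - Real.cos (tht t) + B * Real.sin (tht t)) / 2

theorem norm_scal_le (hs : SymU 𝓢 s) : ‖act E (scal ι s)‖ ≤ 1 := by
  refine ContinuousLinearMap.opNorm_le_bound _ zero_le_one fun v => ?_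
  rw [one_mul, ← sq_le_sq₀ (norm_nonneg _) (norm_nonneg _), ← real_inner_self_eq_norm_sq,
      ← real_inner_self_eq_norm_sq, inner_act, ← act_mul, hs.scal_sa, hs.scal_sq, act_one]

theorem epath_bound (hs : SymU 𝓢 s) (h : IsBase 𝓢 s x₀) {f : P → Matrix ι ι R} {B : ℝ}
    (hB : ∀ q, ‖act E (f q)‖ ≤ B) (hB₀ : ‖act E x₀‖ ≤ B) (q : P) (t : ℝ) :
    ‖act E (epath x₀ s f ((1, q), t) - scal ι s)‖ ≤ 2 * ewt B t := by
  have e : epath x₀ s f ((1, q), t) - scal ι s = -((1 - Real.cos (tht t)) • scal ι s) +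
      Real.sin (tht t) • (if t ≤ 0 then f q else x₀) := by
    rw [epath_one hs h]; module
  have h1 : 0 ≤ 1 - Real.cos (tht t) := by linarith [Real.cos_le_one (tht t)]
  have h2 := Real.sin_nonneg_of_mem_Icc (tht_mem t)
  have h3 := norm_act_smul_le (E := E) h1 (scal ι s)
  have h4 := norm_act_smul_le (E := E) h2 (if t ≤ 0 then f q else x₀)
  have h5 : ‖act E (if t ≤ 0 then f q else x₀)‖ ≤ B := by split_ifs; exacts [hB q, hB₀]
  have h6 := norm_scal_le (E := E) (ι := ι) hs
  rw [e, act_add, act_neg]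
  refine (norm_add_le (E := V E ι →L[ℝ] V E ι) _ _).trans ?_
  rw [norm_neg (E := V E ι →L[ℝ] V E ι), ewt]
  have := mul_le_mul_of_nonneg_left h6 h1
  have := mul_le_mul_of_nonneg_left h5 h2
  linarith

/-- Weights along the homotopy of paths. -/
noncomputable def hwt (E : Type) [NormedAddCommGroup E] [InnerProductSpace ℝ E]
    [FiniteDimensional ℝ E] [Module R E] [IsScalarTower ℝ R E] [ContinuousSMul R E] [StarAct R E]
    (x₀ : Matrix ι ι R) (s : R) (f : P → Matrix ι ι R) (B : ℝ) (z : (ℝ × P) × ℝ) : ℝ :=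
  ‖act E (epath x₀ s f z - scal ι s)‖ / 2 +
    z.1.1 * (ewt B z.2 - ‖act E (epath x₀ s f ((1, z.1.2), z.2) - scal ι s)‖ / 2)

theorem norm_act_nonneg (A : Matrix ι κ R) : 0 ≤ ‖act E A‖ :=
  norm_nonneg (E := V E κ →L[ℝ] V E ι) _

theorem hwt_bound (hs : SymU 𝓢 s) (h : IsBase 𝓢 s x₀) {f : P → Matrix ι ι R} {B : ℝ}
    (hB : ∀ q, ‖act E (f q)‖ ≤ B) (hB₀ : ‖act E x₀‖ ≤ B) {z : ℝ × P} (hz : 0 ≤ z.1) (t : ℝ) :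
    ‖act E (epath x₀ s f (z, t) - scal ι s)‖ ≤ 2 * hwt E x₀ s f B (z, t) := by
  have h1 := mul_nonneg hz (sub_nonneg.2 (epath_bound hs h hB hB₀ z.2 t))
  unfold hwt
  generalize ‖act E (epath x₀ s f (z, t) - scal ι s)‖ = a at *
  generalize ‖act E (epath x₀ s f ((1, z.2), t) - scal ι s)‖ = b at *
  dsimp only at h1 ⊢
  linarith

theorem continuous_hwt (x₀ : Matrix ι ι R) (s : R) {f : P → Matrix ι ι R} (hf : Continuous f)
    (B : ℝ) : Continuous (hwt E x₀ s f B) := by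
  have n1 : Continuous fun z => ‖act E (epath x₀ s f z - scal ι s)‖ :=
    (continuous_norm (E := V E ι →L[ℝ] V E ι)).comp
      (continuous_act.comp ((continuous_epath x₀ s hf).sub continuous_const))
  have n2 : Continuous fun z : (ℝ × P) × ℝ =>
      ‖act E (epath x₀ s f ((1, z.1.2), z.2) - scal ι s)‖ :=
    n1.comp (show Continuous fun z : (ℝ × P) × ℝ => (((1 : ℝ), z.1.2), z.2) by fun_prop)
  have ht : Continuous fun z : (ℝ × P) × ℝ => ewt B z.2 := by
    have := continuous_tht
    unfold ewt
    fun_prop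
  exact (n1.div_const 2).add ((continuous_fst.fst).mul (ht.sub (n2.div_const 2)))

theorem ewt_dead (B : ℝ) {t : ℝ} (ht : 1 ≤ |t|) : ewt B t = 0 := by
  have : tht t = 0 := by unfold tht; rw [max_eq_left (by linarith)]; simp
  simp [ewt, this]

theorem epath_loop (hs : SymU (insert j 𝓢) s) (h : IsBase (insert j 𝓢) s x₀)
    {f : P → Matrix ι ι R} (hf : IsFam E (insert s (insert j 𝓢)) f) {B : ℝ}
    (hB : ∀ q, ‖act E (f q)‖ ≤ B) (hB₀ : ‖act E x₀‖ ≤ B) :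
    Loop E 𝓢 j (Icc (0 : ℝ) 1 ×ˢ univ) (epath x₀ s f) (fun _ => scal ι s) (hwt E x₀ s f B) 1 := by
  refine ⟨continuous_epath x₀ s hf.cont, continuous_const, continuous_hwt x₀ s hf.cont B,
    fun z _ t => bmat_good hs h (hf.good _) _ _, fun z _ t ht => ⟨epath_dead hs h f z ht, ?_⟩,
    fun z hz t => ?_, fun z hz t v => ?_⟩
  · simp only [hwt, epath_dead hs h f _ ht, ewt_dead B ht, sub_self, act_zero]
    rw [norm_zero (E := V E ι →L[ℝ] V E ι)]
    simp
  · have h1 := (norm_act_nonneg _).trans (hwt_bound (E := E) hs h hB hB₀ hz.1.1 t)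
    exact nonneg_of_mul_nonneg_right h1 two_pos
  · exact ((act E (epath x₀ s f (z, t) - scal ι s)).le_opNorm v).trans
      (mul_le_mul_of_nonneg_right (hwt_bound hs h hB hB₀ hz.1.1 t) (norm_nonneg v))

end edge

end Gamma

section GammaPsi

variable {R : Type} [Ring R] [StarRing R] [Algebra ℝ R] [StarModule ℝ R]
  [TopologicalSpace R] [IsTopologicalRing R] [ContinuousStar R] [ContinuousSMul ℝ R]
variable {E : Type} [NormedAddCommGroup E] [InnerProductSpace ℝ E] [FiniteDimensional ℝ E]
  [Module R E] [IsScalarTower ℝ R E] [ContinuousSMul R E] [StarAct R E]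
variable {ι κ μ ν : Type} [Fintype ι] [Fintype κ] [Fintype μ] [Fintype ν]
variable {𝓢 : Set R}
variable {P : Type} [NormedAddCommGroup P]
variable [DecidableEq ι] {s j : R} {x₀ : Matrix ι ι R}

theorem tht_min {t : ℝ} (ht : 0 ≤ t) : tht (min t 1) = tht t := by
  rcases le_total t 1 with h | h
  · rw [min_eq_left h]
  · rw [min_eq_right h]; unfold tht
    rw [abs_of_nonneg ht, max_eq_left (by linarith : 1 - t ≤ 0)]; simp

theorem chainData_epath (n : ℕ) (hs : SymU 𝓢 s) (h : IsBase 𝓢 s x₀) (f : P → Matrix ι ι R) (B : ℝ)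
    (q : P) : ChainData (n := n) (fun k => epath x₀ s f ((1, q), pos n k) - scal ι s)
      (fun k => ewt B (pos n k)) (scal ι s) (f q) x₀ (fun k => ewt B ((k : ℝ) / (n + 1)))
      (fun k => (1 - Real.cos (tht ((k : ℝ) / (n + 1)))) / 2)
      (fun k => Real.sin (tht ((k : ℝ) / (n + 1)))) := by
  have hn : (0 : ℝ) < n + 1 := by positivity
  have z : tht 0 = Real.pi := by simp [tht]
  have e : ∀ k : ℕ, n + 1 ≤ k → tht ((k : ℝ) / (n + 1)) = 0 := fun k hk => by
    have : (1 : ℝ) ≤ (k : ℝ) / (n + 1) := by rw [le_div_iff₀ hn]; exact_mod_cast by omega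
    unfold tht; rw [abs_of_nonneg (by linarith), max_eq_left (by linarith)]; simp
  have en : ∀ t, tht (-t) = tht t := fun t => by simp [tht]
  refine ⟨fun _ => ?_, fun k _ => ?_, fun k _ => ?_, ?_, ?_, ?_⟩
  · simp [epath_one hs h, pos, z, ewt]; module
  · have : -((k : ℝ) / (n + 1)) ≤ 0 := by simp; positivity
    simp only [epath_one hs h, pos, Nat.add_sub_cancel, en, ewt, if_pos this, and_true]
    module
  · have hk : (0 : ℝ) ≤ (k : ℝ) / (n + 1) := by positivity
    refine ⟨?_, by simp only [pos, ewt, tht_min hk]⟩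
    simp only [epath_one hs h, pos, tht_min hk]
    rcases k with _ | k
    · simp [z]; module
    · have : ¬ min (((k + 1 : ℕ) : ℝ) / (n + 1)) 1 ≤ 0 := by
        rw [not_le]; positivity
      rw [if_neg this]; module
  · simp [ewt, z]
  · simp only [ewt, e (n + 1) le_rfl]; simp
  · simp only [ewt, e (n + 2) (by omega)]; simp

theorem ewt_diff {n : ℕ} (hn : 2 ≤ n) {B : ℝ} (hB : 0 ≤ B)
    (h : (1 + B) * Real.pi / (2 * (n + 1)) < 2) :
    |ewt B (((2 : ℕ) : ℝ) / (n + 1)) - ewt B (((1 : ℕ) : ℝ) / (n + 1))| < 2 := by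
  have hn' : (0 : ℝ) < n + 1 := by positivity
  have hn2 : (2 : ℝ) ≤ n := by exact_mod_cast hn
  have e : ∀ k : ℕ, k ≤ 2 → tht ((k : ℝ) / (n + 1)) = Real.pi * (1 - (k : ℝ) / (n + 1)) :=
      fun k hk => by
    have hk' : (k : ℝ) ≤ 2 := by exact_mod_cast hk
    have : (k : ℝ) / (n + 1) ≤ 1 := by rw [div_le_one hn']; linarith
    unfold tht; rw [abs_of_nonneg (by positivity), max_eq_right (by linarith)]
  refine lt_of_le_of_lt ?_ h
  have hc := Real.abs_cos_sub_cos_le (tht (((2 : ℕ) : ℝ) / (n + 1))) (tht (((1 : ℕ) : ℝ) / (n + 1)))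
  have hsn := Real.abs_sin_sub_sin_le (tht (((2 : ℕ) : ℝ) / (n + 1))) (tht (((1 : ℕ) : ℝ) / (n + 1)))
  have d : |tht (((2 : ℕ) : ℝ) / (n + 1)) - tht (((1 : ℕ) : ℝ) / (n + 1))| =
      Real.pi / (n + 1) := by
    rw [e 2 le_rfl, e 1 (by norm_num),
      show Real.pi * (1 - ((2 : ℕ) : ℝ) / (n + 1)) - Real.pi * (1 - ((1 : ℕ) : ℝ) / (n + 1)) =
        -(Real.pi / (n + 1)) by push_cast; ring, abs_neg, abs_of_pos (by positivity)]
  rw [d] at hc hsn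
  have e2 : (1 + B) * Real.pi / (2 * (n + 1)) = (Real.pi / (n + 1) + B * (Real.pi / (n + 1))) / 2 := by
    field_simp
  rw [e2]
  unfold ewt
  have h3 := mul_le_mul_of_nonneg_left hsn hB
  rw [← abs_of_nonneg hB, ← abs_mul, abs_of_nonneg hB] at h3
  rw [abs_le] at hc h3 ⊢
  constructor <;> linarith [hc.1, hc.2, h3.1, h3.2]

theorem SymU.mul_star (hs : SymU (insert j 𝓢) s) (hj : SkewU 𝓢 j) : star (s * j) = s * j := by
  rw [star_mul, hs.st, hj.st, neg_mul, hs.odd j (mem_insert _ _)]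

theorem SymU.mul_sq (hs : SymU (insert j 𝓢) s) (hj : SkewU 𝓢 j) : s * j * (s * j) = 1 := by
  have b : j * s = -(s * j) := by rw [hs.odd j (mem_insert _ _), neg_neg]
  rw [mul_assoc, ← mul_assoc j, b, neg_mul, mul_assoc, hj.sq, mul_neg_one, neg_neg, hs.sq]

theorem SymU.mops (hs : SymU (insert j 𝓢) s) (hj : SkewU 𝓢 j) {x : Matrix ι ι R}
    (hx : Good E (insert s (insert j 𝓢)) x) : MOps E (scal ι s) (scal ι (s * j)) x := by
  have a := hs.odd j (mem_insert _ _)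
  have b : j * s = -(s * j) := by rw [a, neg_neg]
  have xs := hx.odd.scal_comm (mem_insert s _)
  have xj := hx.odd.scal_comm (mem_insert_of_mem s (mem_insert j _))
  refine ⟨hs.scal_sa, ?_, hx.sa, hs.scal_sq, ?_, ?_, xs, ?_, hx.inj⟩
  · rw [scal_star, hs.mul_star hj]
  · rw [scal_mul_scal, hs.mul_sq hj, scal_one]
  · rw [scal_mul_scal, scal_mul_scal, mul_assoc, b, mul_neg, scal_neg]
  · rw [← scal_mul_scal, ← mul_assoc, xs, neg_mul, mul_assoc, xj, mul_neg, neg_neg, mul_assoc]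

theorem SymU.mul_even (hs : SymU (insert j 𝓢) s) (hj : SkewU 𝓢 j) :
    EvenM 𝓢 (scal ι (s * j)) :=
  .scal fun r hr => by
    rw [mul_assoc, hj.odd r hr, mul_neg, ← mul_assoc, hs.odd r (mem_insert_of_mem _ hr), neg_mul,
      neg_neg, mul_assoc]

theorem IsFam.gam (hs : SymU (insert j 𝓢) s) (hj : SkewU 𝓢 j) (h : IsBase (insert j 𝓢) s x₀)
    {f : P → Matrix ι ι R} (hf : IsFam E (insert s (insert j 𝓢)) f) :
    IsFam E 𝓢 fun q => gam (scal ι (s * j)) (f q) x₀ := by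
  obtain ⟨hc, hg, r, c, hr⟩ := hf
  have m₀ := hs.mops hj (h.good (E := E))
  have hm : 𝓢 ⊆ insert s (insert j 𝓢) := (subset_insert _ _).trans (subset_insert _ _)
  refine ⟨?_, fun q => ?_, r, Bott.gam (scal ι (s * j)) c x₀, fun q hq => by rw [hr q hq]⟩
  · unfold Bott.gam; fun_prop
  · have m := hs.mops hj (hg q)
    exact gam_good m.as m.asq (hs.mul_even hj) m.xa m₀.xa ((hg q).mono hm) (h.good.mono hm)

theorem finT_fam (h𝓢 : StarOdd 𝓢) (hs : SymU (insert j 𝓢) s) (hj : SkewU 𝓢 j)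
    (h : IsBase (insert j 𝓢) s x₀) {f : P → Matrix ι ι R}
    (hf : IsFam E (insert s (insert j 𝓢)) f) (n : ℕ) :
    ∃ hT : IsFam E 𝓢 (fun q => finT n (scal ι s) (scal ι (s * j)) (f q) x₀),
      cls _ hT = cls _ (hf.gam hs hj h) := by
  have m₀ := hs.mops hj (h.good (E := E))
  have hs' : ∀ r ∈ 𝓢, s * r = -(r * s) := fun r hr => hs.odd r (mem_insert_of_mem _ hr)
  have g1 : Good E 𝓢 (scal ι s) := .of_inv hs.scal_sa (.scal hs') hs.scal_sq
  have g2 : Good E 𝓢 (-scal ι s) :=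
    .of_inv (by rw [conjTranspose_neg, hs.scal_sa]) (OddM.neg (.scal hs'))
      (by rw [neg_mul_neg, hs.scal_sq])
  obtain ⟨hb, eb⟩ := bdiag_fam (hf.gam hs hj h) (S := Fin (n + 3) ⊕ Fin (n + 3))
    (D := fun q => finD n (scal ι s) (scal ι (s * j)) (f q) x₀) (.inl 1)
    (C := fun k => if k = .inl 0 ∨ k = .inr 0 ∨ k = .inr 1 then -scal ι s else scal ι s)
    (fun k _ => by split_ifs <;> assumption) (fun q => by simp [finD])
    (fun q k hk => by simp [finD, hk])
  have ce := cycU_even n (hs.mul_even (ι := ι) hj)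
  have cm := cycU_mul n m₀.as m₀.asq
  have hU := ce.star h𝓢
  have hcj := hb.conj (U := (cycU n (scal ι (s * j)))ᴴ) hU (by rwa [conjTranspose_conjTranspose])
    cm.2 cm.1
  have := cls_conj h𝓢 ⟨by rw [hs.st, hs.sq], by rw [hs.st, hs.sq], hs'⟩ hs.st hb hU ce cm.1 cm.2 hcj
  rw [conjTranspose_conjTranspose] at hcj
  simp only [conjTranspose_conjTranspose] at this
  exact ⟨hcj, this.trans eb⟩

variable [NormedSpace ℝ P] [FiniteDimensional ℝ P]

theorem IsFam.exists_bound {f : P → Matrix ι ι R} (hf : IsFam E 𝓢 f) (x₀ : Matrix ι ι R) :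
    ∃ B : ℝ, 0 ≤ B ∧ (∀ q, ‖act E (f q)‖ ≤ B) ∧ ‖act E x₀‖ ≤ B := by
  have : ProperSpace P := FiniteDimensional.proper ℝ P
  obtain ⟨hc, -, r, c, hr⟩ := hf
  have hn : Continuous fun q => ‖act E (f q)‖ :=
    (continuous_norm (E := V E ι →L[ℝ] V E ι)).comp (continuous_act.comp hc)
  obtain ⟨B, hB⟩ := ((isCompact_closedBall (0 : P) r).image hn).bddAbove
  refine ⟨max B (max ‖act E c‖ ‖act E x₀‖), ?_, fun q => ?_, by simp⟩
  · exact (norm_act_nonneg (E := E) x₀).trans (by simp)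
  · rcases le_total r ‖q‖ with h | h
    · rw [hr q h]; simp
    · exact (hB ⟨q, by simpa using h, rfl⟩).trans (le_max_left _ _)

/-- The image under the discretised boundary map of the family of loops attached to `f`. -/
theorem bfam_gam (h𝓢 : StarOdd 𝓢) (hs : SymU (insert j 𝓢) s) (hj : SkewU 𝓢 j)
    (h : IsBase (insert j 𝓢) s x₀) {f : P → Matrix ι ι R}
    (hf : IsFam E (insert s (insert j 𝓢)) f) (hb : Based x₀ f) :
    PsiRel E 𝓢 j (bfam x₀ s f) (cls _ (hf.gam hs hj h)) := by
  obtain ⟨B, hB0, hB, hB₀⟩ := hf.exists_bound x₀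
  have L := epath_loop hs h hf hB hB₀
  have m₀ := hs.mops hj (h.good (E := E))
  have hs' : ∀ r ∈ 𝓢, s * r = -(r * s) := fun r hr => hs.odd r (mem_insert_of_mem _ hr)
  obtain ⟨r, hr⟩ := id hb
  obtain ⟨h1, hh1, HL⟩ := L.htpy hj (ρ := r) fun s _ q q' hq hq' => ⟨rfl, fun t => by
    simp only [epath, hwt, hr q hq, hr q' hq', and_self]⟩
  have hv : Valid E (bfam x₀ s f) (scal ι s) (fun p => hwt E x₀ s f B ((0, p.1), p.2)) (max r 1) := by
    refine ⟨(continuous_hwt x₀ s hf.cont B).comp (by fun_prop), fun p hp => ?_, fun p => ?_⟩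
    · have e := bfam_far hs h hr hp
      refine ⟨e, ?_⟩
      simp only [hwt, epath_zero, Prod.mk.eta, e, sub_self, act_zero, zero_mul, add_zero]
      rw [norm_zero (E := V E ι →L[ℝ] V E ι), zero_div]
    · have := hwt_bound (E := E) hs h hB hB₀ (z := (0, p.1)) le_rfl p.2
      rwa [epath_zero] at this
  refine PsiRel.of_sch hj (bfam_isFam hs h hf hb) hv fun h' ρ hh' => ?_
  obtain ⟨n, hn⟩ := exists_nat_gt (max 2 (max (max ρ 1 / min h' h1) ((1 + B) * Real.pi / 4)))
  simp only [max_lt_iff] at hn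
  obtain ⟨hn2, hn3, hn4⟩ := hn
  have hn2' : 2 ≤ n := by exact_mod_cast hn2.le
  have hn' : (0 : ℝ) < n + 1 := by positivity
  have hm : max ρ 1 / (n + 1) ≤ min h' h1 := by
    rw [div_lt_iff₀ (by positivity)] at hn3
    rw [div_le_iff₀ hn']
    have : 0 < min h' h1 := by positivity
    nlinarith
  have hα := ewt_diff hn2' hB0 (by rw [div_lt_iff₀ (by positivity)]; linarith)
  have sch := fun m (hm0 : 1 ≤ m) (hm1 : m ≤ max ρ 1) => (pos_sch n (zero_le_one.trans hm0)).mono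
    ((div_le_div_of_nonneg_right hm1 hn'.le).trans hm) hm0
  have HT := HL (Fin (n + 3) ⊕ Fin (n + 3)) (chain n)
    (fun u k => ((1 - u) * max ρ 1 + u) * pos n k) (by fun_prop) fun u hu =>
      ((sch _ (by nlinarith [hu.1, hu.2, le_max_right ρ 1])
        (by nlinarith [hu.1, hu.2, le_max_right ρ 1])).mono (min_le_right _ _) le_rfl).mesh
  obtain ⟨hF, eF⟩ := finT_fam h𝓢 hs hj h hf n
  have hT2 := Htpy.lin HT.right hF fun l hl q => by
    have m := hs.mops hj (hf.good q)
    have J1 : OddM 𝓢 (scal ι j) := .scal hj.odd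
    have J2 : (scal ι j)ᴴ = -scal ι j := by rw [scal_star, hj.st, scal_neg]
    have d1 : ∀ t, Good E 𝓢 (epath x₀ s f ((1, q), t)) := fun t =>
      (bmat_good hs h (hf.good _) _ _).mono (subset_insert _ _)
    have C := chainData_epath n hs h f B q
    have e1 : ∀ k, hwt E x₀ s f B ((1, q), pos n k) = ewt B (pos n k) := fun k => by
      simp [hwt]
    simp only [samp, sub_self, zero_mul, zero_add, one_mul, e1]
    refine ⟨?_, ?_, fun v hv => ?_⟩
    · rw [conjTranspose_add, conjTranspose_smul, conjTranspose_smul, star_trivial, star_trivial,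
        latt_sa J2 hs.scal_sa fun k => by rw [conjTranspose_sub, (d1 _).sa, hs.scal_sa],
        (hF.good q).sa]
    · exact ((latt_odd J1 (.scal hs') fun k => (d1 _).odd.sub (.scal hs')).smul _).add
        ((hF.good q).odd.smul _)
    · refine C.inj m m₀ ?_ hn2' (fun k hk => ?_) hα hl v hv
      · rw [scal_mul_scal, ← mul_assoc, hs.sq, one_mul]
      · have hk1 : ((k + 1 : ℕ) : ℝ) / (n + 1) < 1 := by
          rw [div_lt_one hn']; exact_mod_cast by omega
        have hk0 : (0 : ℝ) < ((k + 1 : ℕ) : ℝ) / (n + 1) := by positivity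
        refine Real.sin_pos_of_pos_of_lt_pi ?_ ?_ <;> unfold tht <;>
          rw [abs_of_pos hk0, max_eq_right (by linarith)] <;> nlinarith [Real.pi_pos]
  have HT' := HT.trans hT2
  have e0 : (fun q => samp (chain n) j (fun k => max ρ 1 * pos n k) (scal ι s)
      (fun x => epath x₀ s f ((0, q), x)) fun x => hwt E x₀ s f B ((0, q), x)) =
      sampF (chain n) j (fun k => max ρ 1 * pos n k) (scal ι s) (bfam x₀ s f)
        fun p => hwt E x₀ s f B ((0, p.1), p.2) := by
    funext q; simp only [sampF, epath_zero]
  simp only [sub_zero, one_mul, add_zero] at HT'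
  rw [e0] at HT'
  exact ⟨_, inferInstance, inferInstance, chain n, _, _,
    (pos_sch n (zero_le_one.trans (le_max_right ρ 1))).mono (hm.trans (min_le_left _ _))
      (le_max_left _ _), HT'.left, (cls_htpy HT' HT'.left hF).trans eF⟩

end GammaPsi

section Theta

variable {R : Type} [Ring R] [StarRing R] [Algebra ℝ R] [StarModule ℝ R]
  [TopologicalSpace R] [IsTopologicalRing R] [ContinuousStar R] [ContinuousSMul ℝ R]
variable {E : Type} [NormedAddCommGroup E] [InnerProductSpace ℝ E] [FiniteDimensional ℝ E]
  [Module R E] [IsScalarTower ℝ R E] [ContinuousSMul R E] [StarAct R E]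
variable {ι κ μ ν : Type} [Fintype ι] [Fintype κ] [Fintype μ] [Fintype ν]
variable {𝓢 : Set R}
variable {P : Type} [NormedAddCommGroup P]

/-- An isometry onto the positive part of the involution `A`, which anticommutes with `S`. -/
structure PosIso [DecidableEq ι] [DecidableEq κ] (J : Matrix κ ι R) (S A : Matrix κ κ R) : Prop where
  jj : Jᴴ * J = 1
  aj : A * J = J
  qq : J * Jᴴ = pp A
  ss : S * S = 1
  st : Sᴴ = S
  as : A * S = -(S * A)
  aa : A * A = 1
  sta : Aᴴ = A

/-- The extension of a compressed operator anticommuting with `S`. -/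
def ext (J : Matrix κ ι R) (S : Matrix κ κ R) (z : Matrix ι ι R) : Matrix κ κ R :=
  J * z * Jᴴ - S * (J * z * Jᴴ) * S

namespace PosIso

variable [DecidableEq ι] [DecidableEq κ] {J : Matrix κ ι R} {S A : Matrix κ κ R}
variable (H : PosIso J S A) (z : Matrix ι ι R)
include H

theorem ja : Jᴴ * A = Jᴴ := by
  have := congrArg conjTranspose H.aj
  rwa [conjTranspose_mul, H.sta] at this

theorem nj : pp (-A) * J = 0 := by
  rw [pp, Matrix.smul_mul, Matrix.add_mul, Matrix.neg_mul, H.aj, Matrix.one_mul, add_neg_cancel,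
    smul_zero]

theorem jsj : Jᴴ * S * J = 0 := by
  have h : Jᴴ * pp A = Jᴴ := by
    rw [← H.qq, ← Matrix.mul_assoc, H.jj, Matrix.one_mul]
  rw [← h, Matrix.mul_assoc Jᴴ, pp_anti H.as, Matrix.mul_assoc, Matrix.mul_assoc, H.nj,
    Matrix.mul_zero, Matrix.mul_zero]

theorem ext_sa (hz : zᴴ = z) : (ext J S z)ᴴ = ext J S z := by
  simp [ext, H.st, hz, Matrix.mul_assoc]

theorem ext_s : ext J S z * S = -(S * ext J S z) := by
  rw [ext, sub_mul, mul_sub, mul_assoc _ S, H.ss, mul_one, ← mul_assoc, ← mul_assoc, H.ss, one_mul,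
    neg_sub]

theorem ext_a : ext J S z * A = A * ext J S z := by
  have h1 : J * z * Jᴴ * A = J * z * Jᴴ := by rw [Matrix.mul_assoc, H.ja]
  have h2 : A * (J * z * Jᴴ) = J * z * Jᴴ := by
    rw [← Matrix.mul_assoc, ← Matrix.mul_assoc, H.aj]
  have h3 : S * A = -(A * S) := by rw [H.as, neg_neg]
  rw [ext, sub_mul, mul_sub, h1, h2, mul_assoc _ S A, h3, mul_neg, ← mul_assoc _ A, mul_assoc S _ A,
    h1, ← mul_assoc A, ← mul_assoc A S, H.as, neg_mul, neg_mul, mul_assoc S A, h2]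

theorem ext_j : Jᴴ * ext J S z = z * Jᴴ := by
  rw [ext, Matrix.mul_sub]
  have h1 : Jᴴ * (J * z * Jᴴ) = z * Jᴴ := by
    rw [← Matrix.mul_assoc, ← Matrix.mul_assoc, H.jj, Matrix.one_mul]
  have h2 : Jᴴ * (S * (J * z * Jᴴ) * S) = 0 := by
    simp only [← Matrix.mul_assoc]
    rw [H.jsj, Matrix.zero_mul, Matrix.zero_mul, Matrix.zero_mul]
  rw [h1, h2, sub_zero]

theorem ext_js : Jᴴ * S * ext J S z = -(z * Jᴴ * S) := by
  rw [← neg_neg (Jᴴ * S * ext J S z), Matrix.mul_assoc, ← Matrix.mul_neg, ← H.ext_s,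
    ← Matrix.mul_assoc, H.ext_j]

theorem ext_pp : ext J S z * pp A = J * z * Jᴴ := by
  have h1 : J * z * Jᴴ * A = J * z * Jᴴ := by rw [Matrix.mul_assoc, H.ja]
  have h : Jᴴ * pp A = Jᴴ := by rw [← H.qq, ← Matrix.mul_assoc, H.jj, Matrix.one_mul]
  have h' : Jᴴ * S * pp A = 0 := by
    rw [← H.qq, ← Matrix.mul_assoc, H.jsj, Matrix.zero_mul]
  rw [ext, sub_mul, Matrix.mul_assoc (J * z), h]
  simp only [Matrix.mul_assoc] at h' ⊢
  rw [h', Matrix.mul_zero, Matrix.mul_zero, Matrix.mul_zero, sub_zero]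

theorem ext_sq (hz : z * z = 1) : ext J S z * ext J S z = 1 := by
  have h : S * pp A * S = pp (-A) := by
    rw [mul_assoc, pp_anti H.as, ← mul_assoc, H.ss, one_mul]
  nth_rw 1 [ext]
  rw [sub_mul, Matrix.mul_assoc (J * z), H.ext_j, Matrix.mul_assoc (S * _) S, ← neg_neg (S * ext J S z),
    ← H.ext_s, mul_neg, sub_neg_eq_add, ← Matrix.mul_assoc (S * _), Matrix.mul_assoc S,
    Matrix.mul_assoc (J * z) Jᴴ, H.ext_j]
  have e : J * z * (z * Jᴴ) = pp A := by
    rw [Matrix.mul_assoc J, ← Matrix.mul_assoc z, hz, Matrix.one_mul, H.qq]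
  rw [e, h, pp_add]

theorem ext_inj {v : V E κ} (hz : ∀ v : V E ι, act E z v = 0 → v = 0)
    (hv : act E (ext J S z) v = 0) : v = 0 := by
  have h1 : act E Jᴴ v = 0 := hz _ (by rw [← act_mul, ← H.ext_j, act_mul, hv, map_zero])
  have h2 : act E Jᴴ (act E S v) = 0 := hz _ (by
    have : act E (z * Jᴴ * S) v = 0 := by
      rw [← neg_neg (z * Jᴴ * S), ← H.ext_js, act_neg, ContinuousLinearMap.neg_apply, act_mul, hv,
        map_zero, neg_zero]
    rwa [act_mul, act_mul] at this)
  have h3 : act E (pp A) v = 0 := by rw [← H.qq, act_mul, h1, map_zero]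
  have h4 : act E (pp (-A)) v = 0 := by
    have : pp (-A) = S * J * (Jᴴ * S) := by
      rw [Matrix.mul_assoc S, ← Matrix.mul_assoc J, H.qq, pp_anti H.as, ← mul_assoc, H.ss, one_mul]
    rw [this, act_mul, act_mul Jᴴ, h2, map_zero]
  rw [← act_one (R := R) v, ← pp_add A, act_add, ContinuousLinearMap.add_apply, h3, h4, add_zero]

end PosIso

theorem OddM.insert [DecidableEq ι] {X : Matrix ι ι R} {s : R}
    (h : X * Bott.scal ι s = -(Bott.scal ι s * X)) (hX : OddM 𝓢 X) : OddM (insert s 𝓢) X := by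
  rintro r (rfl | hr) a b
  · have := congrFun (congrFun h a) b
    rwa [neg_apply, scal_mul_apply, mul_scal_apply] at this
  · exact hX r hr a b

/-- Data for doubling: a symmetric generator, a skew generator and an extra unitary. -/
structure Dbl (𝓢 : Set R) (s j w : R) : Prop where
  hst : StarOdd 𝓢
  hs : SymU (insert j 𝓢) s
  hj : SkewU 𝓢 j
  hw : OddU (insert s (insert j 𝓢)) w

namespace Dbl

variable {s j w : R} (H : Dbl 𝓢 s j w)
include H

theorem rel : j * s = -(s * j) ∧ w * s = -(s * w) ∧ w * j = -(j * w) ∧ s * s = 1 ∧ j * j = -1 :=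
  ⟨by rw [H.hs.odd j (mem_insert _ _), neg_neg], H.hw.odd _ (by simp), H.hw.odd _ (by simp), H.hs.sq,
    H.hj.sq⟩

theorem k_star : star (j * w) * (j * w) = 1 ∧ j * w * star (j * w) = 1 := by
  constructor
  · rw [star_mul, H.hj.st, mul_assoc, ← mul_assoc _ j, neg_mul, H.hj.sq, neg_neg, one_mul, H.hw.l]
  · rw [star_mul, H.hj.st, mul_assoc, ← mul_assoc w, H.hw.r, one_mul, mul_neg, H.hj.sq, neg_neg]

theorem k_a : j * w * (s * j) = -(s * j * (j * w)) := by
  obtain ⟨h1, h2, h3, h4, h5⟩ := H.rel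
  have e1 : j * w * (s * j) = j * (w * s) * j := by simp only [mul_assoc]
  have e2 : j * -(s * w) * j = -(j * s * (w * j)) := by simp only [mul_assoc, mul_neg, neg_mul]
  rw [e1, h2, e2, h1, h3]
  simp only [mul_assoc, mul_neg, neg_mul, neg_neg]

theorem k_s : j * w * s = s * (j * w) := by
  obtain ⟨h1, h2, h3, h4, h5⟩ := H.rel
  rw [mul_assoc, h2, mul_neg, ← mul_assoc, h1, neg_mul, neg_neg, mul_assoc]

theorem k_j : j * w * j = -(j * (j * w)) := by
  rw [mul_assoc, H.rel.2.2.1, mul_neg]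

theorem k_even [DecidableEq ι] : EvenM 𝓢 (scal ι (j * w)) :=
  .scal fun r hr => by
    rw [mul_assoc, H.hw.odd r (mem_insert_of_mem _ (mem_insert_of_mem _ hr)), mul_neg, ← mul_assoc,
      H.hj.odd r hr, neg_mul, neg_neg, mul_assoc]

end Dbl


/-- The isometry from `V ι` onto the positive part of the doubled involution. -/
noncomputable def thJ (ι : Type) [Fintype ι] [DecidableEq ι] (s j w : R) : Matrix (ι ⊕ ι) ι R :=
  fromRows (pp (scal ι (s * j))) (pp (scal ι (s * j)) * scal ι (j * w))

/-- The operator on the double extending a compressed operator. -/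
noncomputable def thet [DecidableEq ι] (s j w : R) (z : Matrix ι ι R) : Matrix (ι ⊕ ι) (ι ⊕ ι) R :=
  ext (thJ ι s j w) (scal (ι ⊕ ι) s) z

theorem pp_mul_self {A : Matrix ι ι R} [DecidableEq ι] (h : A * A = 1) : A * pp A = pp A := by
  rw [pp, mul_smul_comm, mul_add, h, mul_one, add_comm]

theorem sandwich {X A S : Matrix ι ι R} [DecidableEq ι] (ha : A * S = -(S * A))
    (hs : S * S = 1) (hX : X * S = -(S * X)) :
    X * pp A - S * (X * pp A) * S = X := by
  have : S * (X * pp A) * S = -(X * pp (-A)) := by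
    rw [← mul_assoc S, ← neg_neg (S * X), ← hX, neg_mul, neg_mul, mul_assoc X, mul_assoc, mul_assoc S,
      pp_anti ha, ← mul_assoc S, hs, one_mul]
  rw [this, sub_neg_eq_add, ← mul_add, pp_add, mul_one]

namespace Dbl

variable {s j w : R} (H : Dbl 𝓢 s j w)
include H

theorem sj_star : star (s * j) = s * j := H.hs.mul_star H.hj

theorem sj_sq : s * j * (s * j) = 1 := H.hs.mul_sq H.hj

theorem s_sj : s * j * s = -(s * (s * j)) := by
  rw [mul_assoc, H.rel.1, mul_neg]

theorem k_pp [DecidableEq ι] :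
    pp (scal ι (s * j)) * scal ι (j * w) = scal ι (j * w) * pp (-scal ι (s * j)) :=
  pp_anti (by rw [scal_mul_scal, scal_mul_scal, ← scal_neg, ← H.k_a.symm, neg_neg])

theorem a_kM' [DecidableEq ι] : scal ι (s * j) * (scal ι (j * w))ᴴ =
    -((scal ι (j * w))ᴴ * scal ι (s * j)) := by
  have := congrArg conjTranspose (show scal ι (j * w) * scal ι (s * j) =
    -(scal ι (s * j) * scal ι (j * w)) by rw [scal_mul_scal, scal_mul_scal, ← scal_neg, H.k_a])
  rwa [conjTranspose_mul, conjTranspose_neg, conjTranspose_mul, scal_star (s * j), H.sj_star] at this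

theorem pp_k [DecidableEq ι] : pp (scal ι (s * j)) * (scal ι (j * w))ᴴ =
    (scal ι (j * w))ᴴ * pp (-scal ι (s * j)) := pp_anti H.a_kM'

theorem posIso [DecidableEq ι] :
    PosIso (thJ ι s j w) (scal (ι ⊕ ι) s) (scal (ι ⊕ ι) (s * j)) := by
  have a1 : scal ι (s * j) * scal ι (s * j) = 1 := by rw [scal_mul_scal, H.sj_sq, scal_one]
  have a2 : (scal ι (s * j))ᴴ = scal ι (s * j) := by rw [scal_star, H.sj_star]
  have k1 : (scal ι (j * w))ᴴ * scal ι (j * w) = 1 := by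
    rw [scal_star, scal_mul_scal, H.k_star.1, scal_one]
  have k2 : scal ι (j * w) * (scal ι (j * w))ᴴ = 1 := by
    rw [scal_star, scal_mul_scal, H.k_star.2, scal_one]
  have jt : (thJ ι s j w)ᴴ = fromCols (pp (scal ι (s * j)))
      ((scal ι (j * w))ᴴ * pp (scal ι (s * j))) := by
    rw [thJ, conjTranspose_fromRows_eq_fromCols_conjTranspose, conjTranspose_mul, pp_star a2]
  constructor
  · rw [jt, thJ, fromCols_mul_fromRows, pp_sq a1, mul_assoc, ← mul_assoc (pp _), pp_sq a1, H.k_pp,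
      ← mul_assoc, k1, one_mul, pp_add]
  · have : scal (ι ⊕ ι) (s * j) = fromBlocks (scal ι (s * j)) 0 0 (scal ι (s * j)) := by
      ext (a | a) (b | b) <;> simp [scal, Matrix.diagonal]
    rw [this, thJ, fromBlocks_mul_fromRows]
    simp only [Matrix.zero_mul, add_zero, zero_add, ← mul_assoc, pp_mul_self a1]
  · have : pp (scal (ι ⊕ ι) (s * j)) =
        fromBlocks (pp (scal ι (s * j))) 0 0 (pp (scal ι (s * j))) := by
      ext (a | a) (b | b) <;> simp [pp, scal, Matrix.diagonal, one_apply]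
    have b12 : pp (scal ι (s * j)) * ((scal ι (j * w))ᴴ * pp (scal ι (s * j))) = 0 := by
      rw [← mul_assoc, H.pp_k, mul_assoc, pp_neg_mul a1, mul_zero]
    have b21 : pp (scal ι (s * j)) * scal ι (j * w) * pp (scal ι (s * j)) = 0 := by
      rw [H.k_pp, mul_assoc, pp_neg_mul a1, mul_zero]
    have b22 : pp (scal ι (s * j)) * scal ι (j * w) *
        ((scal ι (j * w))ᴴ * pp (scal ι (s * j))) = pp (scal ι (s * j)) := by
      rw [mul_assoc, ← mul_assoc (scal ι (j * w)), k2, one_mul, pp_sq a1]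
    rw [jt, thJ, fromRows_mul_fromCols, this, pp_sq a1, b12, b21, b22]
  · rw [scal_mul_scal, H.hs.sq, scal_one]
  · rw [scal_star, H.hs.st]
  · rw [scal_mul_scal, scal_mul_scal, ← scal_neg, H.s_sj]
  · rw [scal_mul_scal, H.sj_sq, scal_one]
  · rw [scal_star, H.sj_star]

theorem thJ_even [DecidableEq ι] : EvenM 𝓢 (thJ ι s j w) := by
  have h1 := pp_even (H.hs.mul_even H.hj (ι := ι))
  have h2 := h1.mul H.k_even
  rintro r hr (a | a) b
  · exact h1 r hr a b
  · exact h2 r hr a b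

theorem s_odd [DecidableEq ι] : OddM 𝓢 (scal ι s) :=
  .scal fun r hr => H.hs.odd r (mem_insert_of_mem _ hr)

theorem scal_j [DecidableEq ι] : scal ι j = scal ι s * scal ι (s * j) := by
  rw [scal_mul_scal, ← mul_assoc, H.hs.sq, one_mul]

theorem thet_odd [DecidableEq ι] {z : Matrix ι ι R} (hz : OddM 𝓢 z) :
    OddM (insert s (insert j 𝓢)) (thet s j w z) := by
  have hJ := H.thJ_even (ι := ι)
  have h1 : OddM 𝓢 (thJ ι s j w * z * (thJ ι s j w)ᴴ) := (hJ.mul_odd hz).mul_even (hJ.star H.hst)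
  have hS := H.posIso.ext_s z
  have hA := H.posIso.ext_a z
  refine .insert hS (.insert ?_ (h1.sub ((H.s_odd.mul_odd h1).mul_odd H.s_odd)))
  rw [H.scal_j, ← mul_assoc, thet, hS, neg_mul, mul_assoc, hA, mul_assoc]

theorem thet_good [DecidableEq ι] {z : Matrix ι ι R} (hz : Good E 𝓢 z) :
    Good E (insert s (insert j 𝓢)) (thet s j w z) :=
  ⟨H.posIso.ext_sa z hz.sa, H.thet_odd hz.odd, fun _ hv => H.posIso.ext_inj z hz.inj hv⟩

theorem comm_sj [DecidableEq ι] {f : Matrix ι ι R} (hf : OddM (insert s (insert j 𝓢)) f) :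
    f * scal ι (s * j) = scal ι (s * j) * f := by
  have h1 := hf.scal_comm (mem_insert s _)
  have h2 := hf.scal_comm (mem_insert_of_mem _ (mem_insert j _))
  rw [← scal_mul_scal, ← mul_assoc, h1, neg_mul, mul_assoc, h2, mul_neg, neg_neg, mul_assoc]

/-- The image of the base value under conjugation by the doubling unitary. -/
noncomputable def tbase (s j w : R) [DecidableEq ι] (x₀ : Matrix ι ι R) : Matrix ι ι R :=
  scal ι (j * w) * x₀ * (scal ι (j * w))ᴴ

theorem k1 [DecidableEq ι] : (scal ι (j * w))ᴴ * scal ι (j * w) = 1 := by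
  rw [scal_star, scal_mul_scal, H.k_star.1, scal_one]

theorem k2 [DecidableEq ι] : scal ι (j * w) * (scal ι (j * w))ᴴ = 1 := by
  rw [scal_star, scal_mul_scal, H.k_star.2, scal_one]

theorem k_sM [DecidableEq ι] : scal ι (j * w) * scal ι s = scal ι s * scal ι (j * w) := by
  rw [scal_mul_scal, scal_mul_scal, H.k_s]

theorem k_sM' [DecidableEq ι] : (scal ι (j * w))ᴴ * scal ι s = scal ι s * (scal ι (j * w))ᴴ := by
  have := congrArg conjTranspose (H.k_sM (ι := ι))
  rwa [conjTranspose_mul, conjTranspose_mul, H.hs.scal_sa, eq_comm] at this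

theorem tbase_anti [DecidableEq ι] {x₀ : Matrix ι ι R} (h : IsBase (insert j 𝓢) s x₀) :
    tbase s j w x₀ * scal ι s = -(scal ι s * tbase s j w x₀) := by
  rw [tbase, mul_assoc, H.k_sM', mul_assoc, ← mul_assoc x₀, h.anti, neg_mul, mul_neg, ← mul_assoc,
    ← mul_assoc, H.k_sM]
  simp only [mul_assoc]

theorem thet_gam [DecidableEq ι] {f x₀ : Matrix ι ι R} (h : IsBase (insert j 𝓢) s x₀)
    (hf : OddM (insert s (insert j 𝓢)) f) :
    thet s j w (gam (scal ι (s * j)) f x₀) = fromBlocks f 0 0 (tbase s j w x₀) := by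
  have a1 : scal ι (s * j) * scal ι (s * j) = 1 := by rw [scal_mul_scal, H.sj_sq, scal_one]
  have a2 : (scal ι (s * j))ᴴ = scal ι (s * j) := by rw [scal_star, H.sj_star]
  have as : scal ι (s * j) * scal ι s = -(scal ι s * scal ι (s * j)) := by
    rw [scal_mul_scal, scal_mul_scal, ← scal_neg, H.s_sj]
  have ss : scal ι s * scal ι s = 1 := H.hs.scal_sq
  have cf := pp_comm (H.comm_sj hf)
  have cx := pp_comm (H.comm_sj h.odd)
  have jt : (thJ ι s j w)ᴴ = fromCols (pp (scal ι (s * j)))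
      ((scal ι (j * w))ᴴ * pp (scal ι (s * j))) := by
    rw [thJ, conjTranspose_fromRows_eq_fromCols_conjTranspose, conjTranspose_mul, pp_star a2]
  have e1 : pp (scal ι (s * j)) * gam (scal ι (s * j)) f x₀ = f * pp (scal ι (s * j)) := by
    rw [gam, mul_add, ← mul_assoc, ← mul_assoc, ← cf, ← cx, mul_assoc, mul_assoc, pp_sq a1,
      pp_mul_neg a1, mul_zero, add_zero]
  have e2 : pp (scal ι (s * j)) * scal ι (j * w) * gam (scal ι (s * j)) f x₀ =
      scal ι (j * w) * x₀ * pp (-scal ι (s * j)) := by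
    have cf' : f * pp (-scal ι (s * j)) = pp (-scal ι (s * j)) * f :=
      pp_comm (by rw [mul_neg, neg_mul, H.comm_sj hf])
    have cx' : x₀ * pp (-scal ι (s * j)) = pp (-scal ι (s * j)) * x₀ :=
      pp_comm (by rw [mul_neg, neg_mul, H.comm_sj h.odd])
    have n2 : pp (-scal ι (s * j)) * pp (-scal ι (s * j)) = pp (-scal ι (s * j)) :=
      pp_sq (by rw [neg_mul_neg, a1])
    rw [H.k_pp, mul_assoc, gam, mul_add, ← mul_assoc (pp _) f, ← mul_assoc (pp _) x₀, ← cf', ← cx',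
      mul_assoc f, mul_assoc x₀, n2, pp_neg_mul a1, mul_zero, zero_add, mul_assoc]
  have b11 : pp (scal ι (s * j)) * gam (scal ι (s * j)) f x₀ * pp (scal ι (s * j)) =
      f * pp (scal ι (s * j)) := by rw [e1, mul_assoc, pp_sq a1]
  have b12 : pp (scal ι (s * j)) * gam (scal ι (s * j)) f x₀ *
      ((scal ι (j * w))ᴴ * pp (scal ι (s * j))) = 0 := by
    rw [e1, mul_assoc, ← mul_assoc (pp _), H.pp_k, mul_assoc _ (pp _), pp_neg_mul a1, mul_zero,
      mul_zero]
  have b21 : pp (scal ι (s * j)) * scal ι (j * w) * gam (scal ι (s * j)) f x₀ *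
      pp (scal ι (s * j)) = 0 := by rw [e2, mul_assoc, pp_neg_mul a1, mul_zero]
  have b22 : pp (scal ι (s * j)) * scal ι (j * w) * gam (scal ι (s * j)) f x₀ *
      ((scal ι (j * w))ᴴ * pp (scal ι (s * j))) = tbase s j w x₀ * pp (scal ι (s * j)) := by
    have hk : pp (-scal ι (s * j)) * (scal ι (j * w))ᴴ = (scal ι (j * w))ᴴ * pp (scal ι (s * j)) := by
      simpa using pp_anti (A := -scal ι (s * j)) (S := (scal ι (j * w))ᴴ)
        (by rw [neg_mul, mul_neg, H.a_kM'])
    rw [e2, mul_assoc _ (pp _), ← mul_assoc (pp _), hk, mul_assoc _ (pp _), pp_sq a1, tbase,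
      ← mul_assoc]
  have hS : scal (ι ⊕ ι) s = fromBlocks (scal ι s) 0 0 (scal ι s) := by
    ext (a | a) (b | b) <;> simp [scal, Matrix.diagonal]
  have hX : thJ ι s j w * gam (scal ι (s * j)) f x₀ * (thJ ι s j w)ᴴ =
      fromBlocks (f * pp (scal ι (s * j))) 0 0 (tbase s j w x₀ * pp (scal ι (s * j))) := by
    rw [jt, thJ, fromRows_mul, fromRows_mul_fromCols, b11, b12, b21, b22]
  have hsub : ∀ a b c d : Matrix ι ι R, fromBlocks a 0 0 b - fromBlocks c 0 0 d =
      fromBlocks (a - c) 0 0 (b - d) := fun a b c d => by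
    ext (i | i) (k | k) <;> simp
  rw [thet, ext, hX, hS, fromBlocks_multiply, fromBlocks_multiply]
  simp only [Matrix.mul_zero, Matrix.zero_mul, add_zero, zero_add]
  rw [hsub, sandwich as ss (hf.scal_comm (mem_insert s _)), sandwich as ss (H.tbase_anti h)]

end Dbl

end Theta

section Mod

variable {R : Type} [Ring R] [StarRing R] [Algebra ℝ R] [StarModule ℝ R]
  [TopologicalSpace R] [IsTopologicalRing R] [ContinuousStar R] [ContinuousSMul ℝ R]
variable {E : Type} [NormedAddCommGroup E] [InnerProductSpace ℝ E] [FiniteDimensional ℝ E]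
  [Module R E] [IsScalarTower ℝ R E] [ContinuousSMul R E] [StarAct R E]
variable {ι κ μ ν : Type} [Fintype ι] [Fintype κ] [Fintype μ] [Fintype ν]
variable {𝓢 : Set R}
variable {P : Type} [NormedAddCommGroup P]
variable [NormedSpace ℝ P]

namespace Dbl

variable {s j w : R} (H : Dbl 𝓢 s j w)
include H

theorem oddU_s : OddU 𝓢 s where
  l := by rw [H.hs.st, H.hs.sq]
  r := by rw [H.hs.st, H.hs.sq]
  odd r hr := H.hs.odd r (mem_insert_of_mem _ hr)

theorem thet_fam [DecidableEq ι] {f : P → Matrix ι ι R} (hf : IsFam E 𝓢 f) :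
    IsFam E (insert s (insert j 𝓢)) fun q => thet s j w (f q) := by
  obtain ⟨hc, hg, r, c, hr⟩ := hf
  refine ⟨?_, fun q => H.thet_good (hg q), r, thet s j w c, fun q hq => by rw [hr q hq]⟩
  unfold thet ext
  fun_prop

theorem thet_htpy [DecidableEq ι] {f g : P → Matrix ι ι R} (h : Htpy E 𝓢 f g) :
    Htpy E (insert s (insert j 𝓢)) (fun q => thet s j w (f q)) fun q => thet s j w (g q) := by
  obtain ⟨K, hc, hg, ⟨r, c, hr⟩, h0, h1⟩ := h
  refine ⟨fun x => thet s j w (K x), ?_, fun t ht q => H.thet_good (hg t ht q),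
    ⟨r, fun t => thet s j w (c t), fun t ht q hq => by beta_reduce; rw [hr t ht q hq]⟩,
    fun q => by beta_reduce; rw [h0], fun q => by beta_reduce; rw [h1]⟩
  unfold thet ext
  fun_prop

theorem gam_htpy [DecidableEq ι] {x₀ : Matrix ι ι R} (h : IsBase (insert j 𝓢) s x₀)
    {f g : P → Matrix ι ι R} (hfg : Htpy E (insert s (insert j 𝓢)) f g) :
    Htpy E 𝓢 (fun q => gam (scal ι (s * j)) (f q) x₀) fun q => gam (scal ι (s * j)) (g q) x₀ := by
  obtain ⟨K, hc, hg, ⟨r, c, hr⟩, h0, h1⟩ := hfg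
  have m (t) (ht : t ∈ Icc (0 : ℝ) 1) (q) : Good E 𝓢 (gam (scal ι (s * j)) (K (t, q)) x₀) :=
    ((isFam_const (P := P) (hg t ht q)).gam H.hs H.hj h).good 0
  refine ⟨fun x => gam (scal ι (s * j)) (K x) x₀, ?_, m,
    ⟨r, fun t => gam (scal ι (s * j)) (c t) x₀, fun t ht q hq => by beta_reduce; rw [hr t ht q hq]⟩,
    fun q => by beta_reduce; rw [h0], fun q => by beta_reduce; rw [h1]⟩
  unfold gam
  fun_prop

theorem k_pp' [DecidableEq ι] :
    scal ι (j * w) * pp (scal ι (s * j)) = pp (-scal ι (s * j)) * scal ι (j * w) := by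
  have := pp_anti (A := -scal ι (s * j)) (S := scal ι (j * w))
    (by rw [neg_mul, mul_neg, scal_mul_scal, scal_mul_scal, H.k_a, scal_neg, neg_neg])
  rw [this, neg_neg]

theorem cls_gam_thet [DecidableEq ι] {f : P → Matrix ι ι R} (hf : IsFam E 𝓢 f)
    {x₀ : Matrix (ι ⊕ ι) (ι ⊕ ι) R} (h : IsBase (insert j 𝓢) s x₀)
    (h' : IsFam E 𝓢 fun q => gam (scal (ι ⊕ ι) (s * j)) (thet s j w (f q)) x₀) :
    cls _ h' = cls f hf := by
  set J := thJ ι s j w with hJ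
  set K := scal (ι ⊕ ι) (j * w) with hK
  set A := scal (ι ⊕ ι) (s * j) with hA
  have a1 : A * A = 1 := H.posIso.aa
  have hp := H.posIso (ι := ι)
  have k1 : Kᴴ * K = 1 := H.k1
  have k2 : K * Kᴴ = 1 := H.k2
  have eJ : EvenM 𝓢 J := H.thJ_even
  have eK : EvenM 𝓢 K := H.k_even
  have eKJ : EvenM 𝓢 (K * J) := eK.mul eJ
  have pJ : Jᴴ * pp A = Jᴴ := by rw [← hp.qq, ← Matrix.mul_assoc, hp.jj, Matrix.one_mul]
  have kj : K * J * (K * J)ᴴ = pp (-A) := by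
    rw [conjTranspose_mul, Matrix.mul_assoc, ← Matrix.mul_assoc J, hp.qq, ← mul_assoc, H.k_pp',
      mul_assoc, k2, mul_one]
  have kj' : (K * J)ᴴ * (K * J) = 1 := by
    rw [conjTranspose_mul, Matrix.mul_assoc, ← Matrix.mul_assoc Kᴴ, k1, Matrix.one_mul, hp.jj]
  have jkj : Jᴴ * (K * J) = 0 := by
    rw [← pJ, Matrix.mul_assoc, ← Matrix.mul_assoc (pp A), H.k_pp, Matrix.mul_assoc, hp.nj,
      Matrix.mul_zero, Matrix.mul_zero]
  have jkj' : (K * J)ᴴ * J = 0 := by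
    have := congrArg conjTranspose jkj
    rwa [conjTranspose_mul, conjTranspose_conjTranspose, conjTranspose_zero] at this
  have cx : x₀ * A = A * x₀ := H.comm_sj h.odd
  have cx' : x₀ * pp (-A) = pp (-A) * x₀ := pp_comm (by rw [mul_neg, neg_mul, cx])
  have n2 : pp (-A) * pp (-A) = pp (-A) := pp_sq (by rw [neg_mul_neg, a1])
  have ox : OddM 𝓢 x₀ := h.odd.mono fun r hr => mem_insert_of_mem _ (mem_insert_of_mem _ hr)
  set z₁ := (K * J)ᴴ * x₀ * (K * J) with hz
  have gz : Good E 𝓢 z₁ := by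
    refine .of_inv (B := z₁) ?_ (((eKJ.star H.hst).mul_odd ox).mul_even eKJ) ?_
    · rw [hz, conjTranspose_mul _ (K * J), conjTranspose_mul _ x₀, conjTranspose_conjTranspose, h.sa,
        Matrix.mul_assoc]
    · have : (K * J)ᴴ * pp (-A) = (K * J)ᴴ := by
        rw [← kj, ← Matrix.mul_assoc, kj', Matrix.one_mul]
      rw [hz, Matrix.mul_assoc _ (K * J), ← Matrix.mul_assoc (K * J), ← Matrix.mul_assoc (K * J), kj,
        ← cx', Matrix.mul_assoc _ x₀, ← Matrix.mul_assoc x₀, ← mul_assoc x₀, h.sq, one_mul,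
        ← Matrix.mul_assoc, this, kj']
  set U : Matrix (ι ⊕ ι) (ι ⊕ ι) R := fromCols J (K * J) with hU
  have ut : Uᴴ = fromRows Jᴴ (K * J)ᴴ := conjTranspose_fromCols_eq_fromRows_conjTranspose ..
  have u1 : U * Uᴴ = 1 := by rw [ut, hU, fromCols_mul_fromRows, kj, hp.qq, pp_add]
  have u2 : Uᴴ * U = 1 := by
    rw [ut, hU, fromRows_mul_fromCols, hp.jj, kj', jkj, jkj', fromBlocks_one]
  have eU : EvenM 𝓢 U := by
    rintro r hr a (b | b)
    · exact eJ r hr a b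
    · exact eKJ r hr a b
  have hd : IsFam E 𝓢 fun q => fromBlocks (f q) 0 0 z₁ := hf.fromBlocks (isFam_const gz)
  have key : (fun q => gam A (thet s j w (f q)) x₀) = fun q => U * fromBlocks (f q) 0 0 z₁ * Uᴴ := by
    funext q
    rw [ut, hU, fromCols_mul_fromBlocks, fromCols_mul_fromRows]
    simp only [Matrix.mul_zero, zero_add, add_zero]
    rw [gam, thet, hp.ext_pp, hz, ← Matrix.mul_assoc (K * J), ← Matrix.mul_assoc (K * J), kj,
      Matrix.mul_assoc _ (K * J), kj, ← cx', mul_assoc, n2]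
  have h'' : IsFam E 𝓢 fun q => U * fromBlocks (f q) 0 0 z₁ * Uᴴ := key ▸ h'
  have e1 : cls _ h' = cls _ h'' := by congr 1
  rw [e1, cls_conj H.hst H.oddU_s H.hs.st hd eU (eU.star H.hst) u1 u2, cls_stab hf gz]

end Dbl

/-- The half-sum projection onto the positive part of `s * j`. -/
noncomputable def hp (s j : R) : R := (1 / 2 : ℝ) • (1 + s * j)

theorem thJ_eq [DecidableEq ι] (s j w : R) :
    thJ ι s j w = fromRows (scal ι (hp s j)) (scal ι (hp s j * (j * w))) := by
  have : pp (scal ι (s * j)) = scal ι (hp s j) := by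
    ext a b
    by_cases h : a = b <;> simp [pp, scal, hp, h, one_apply]
  rw [thJ, this, scal_mul_scal]

theorem thet_apply [DecidableEq ι] (s j w : R) (z : Matrix ι ι R) (x y : ι ⊕ ι) :
    thet s j w z x y =
      (fun a : R => a - s * a * s)
      (Sum.elim (fun _ => hp s j) (fun _ => hp s j * (j * w)) x *
        z (Sum.elim id id x) (Sum.elim id id y) *
      star (Sum.elim (fun _ => hp s j) (fun _ => hp s j * (j * w)) y)) := by
  rw [thet, ext, thJ_eq, conjTranspose_fromRows_eq_fromCols_conjTranspose, fromRows_mul,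
    fromRows_mul_fromCols, Matrix.sub_apply, mul_scal_apply, scal_mul_apply]
  simp only [scal_star]
  rcases x with x | x <;> rcases y with y | y <;>
    simp only [fromBlocks_apply₁₁, fromBlocks_apply₁₂, fromBlocks_apply₂₁, fromBlocks_apply₂₂,
      mul_scal_apply, scal_mul_apply, Sum.elim_inl, Sum.elim_inr, id]

theorem thet_submatrix [DecidableEq ι] [DecidableEq κ] (s j w : R) (z : Matrix ι ι R) (e : κ ≃ ι) :
    thet s j w (z.submatrix e e) =
      (thet s j w z).submatrix (Equiv.sumCongr e e) (Equiv.sumCongr e e) := by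
  ext x y
  rw [submatrix_apply, thet_apply, thet_apply]
  rcases x with x | x <;> rcases y with y | y <;> rfl

theorem thet_fromBlocks [DecidableEq ι] [DecidableEq κ] [DecidableEq (ι ⊕ κ)] (s j w : R) (f : Matrix ι ι R)
    (g : Matrix κ κ R) : thet s j w (fromBlocks f 0 0 g) =
      (fromBlocks (thet s j w f) 0 0 (thet s j w g)).submatrix (Equiv.sumSumSumComm ι κ ι κ)
        (Equiv.sumSumSumComm ι κ ι κ) := by
  ext x y
  rw [submatrix_apply, thet_apply]
  rcases x with (x | x) | (x | x) <;> rcases y with (y | y) | (y | y) <;>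
    simp [thet_apply]

theorem gam_submatrix [DecidableEq ι] [DecidableEq κ] (a w : R) (z : Matrix ι ι R) (e : κ ≃ ι) :
    gam (scal κ a) (z.submatrix e e) (scal κ w) =
      (gam (scal ι a) z (scal ι w)).submatrix e e := by
  have h (r : R) : scal κ r = (scal ι r).submatrix e e := by
    simp [scal, submatrix_diagonal_equiv, Function.comp_def]
  have hp (x : Matrix ι ι R) : pp (x.submatrix e e) = (pp x).submatrix e e := by
    ext i k; simp [pp, one_apply]
  have hn (x : Matrix ι ι R) : -x.submatrix e e = (-x).submatrix e e := rfl
  rw [gam, h, h, hn, hp, hp, submatrix_mul_equiv, submatrix_mul_equiv]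
  rfl

theorem gam_fromBlocks [DecidableEq ι] [DecidableEq κ] [DecidableEq (ι ⊕ κ)] (a w : R) (f : Matrix ι ι R)
    (g : Matrix κ κ R) : gam (scal (ι ⊕ κ) a) (fromBlocks f 0 0 g) (scal (ι ⊕ κ) w) =
      fromBlocks (gam (scal ι a) f (scal ι w)) 0 0 (gam (scal κ a) g (scal κ w)) := by
  have h (r : R) : scal (ι ⊕ κ) r = fromBlocks (scal ι r) 0 0 (scal κ r) := by
    ext (a | a) (b | b) <;> simp [scal, Matrix.diagonal]
  have hp (x : Matrix ι ι R) (y : Matrix κ κ R) :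
      pp (fromBlocks x 0 0 y) = fromBlocks (pp x) 0 0 (pp y) := by
    ext (a | a) (b | b) <;> simp [pp, one_apply]
  simp only [gam, h, fromBlocks_neg, neg_zero, hp, fromBlocks_multiply, fromBlocks_add,
    Matrix.mul_zero, Matrix.zero_mul, add_zero, zero_add]

namespace Dbl

variable {s j w : R} (H : Dbl 𝓢 s j w)
include H

open Classical in
variable (E P) in
/-- Doubling as a homomorphism. -/
noncomputable def theta : G E 𝓢 P →+ G E (insert s (insert j 𝓢)) P :=
  G.lift (fun _ _ f hf => cls _ (H.thet_fam hf))
    (fun _ _ f g h => cls_htpy (H.thet_htpy h) _ _)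
    (fun _ _ _ _ e f h => by
      simp only [thet_submatrix]
      exact cls_submatrix (H.thet_fam h) _ _)
    (fun _ _ _ _ f g hf hg => by
      simp only [thet_fromBlocks]
      rw [cls_submatrix ((H.thet_fam hf).fromBlocks (H.thet_fam hg)), cls_add])
    (fun _ _ c h => cls_const (H.thet_good h) _)

theorem theta_cls [DecidableEq ι] {f : P → Matrix ι ι R} (hf : IsFam E 𝓢 f) :
    H.theta E P (cls f hf) = cls _ (H.thet_fam hf) := by
  obtain rfl : (fun a b => Classical.propDecidable (a = b)) = ‹DecidableEq ι› :=
    Subsingleton.elim _ _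
  rfl

/-- A base value given by a further symmetric generator. -/
theorem isBase_scal [DecidableEq ι] (hw : SymU (insert s (insert j 𝓢)) w) :
    IsBase (insert j 𝓢) s (scal ι w) where
  sa := hw.scal_sa
  odd := .scal hw.odd
  sq := fun {_} => by
    rename_i d1 d2
    rw [Subsingleton.elim d1 d2, hw.scal_sq]

open Classical in
variable (E P) in
/-- The homomorphism inverse to doubling. -/
noncomputable def gamma (hw : SymU (insert s (insert j 𝓢)) w) :
    G E (insert s (insert j 𝓢)) P →+ G E 𝓢 P :=
  G.lift (fun ι _ f hf => cls (fun q => gam (scal ι (s * j)) (f q) (scal ι w))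
      (hf.gam H.hs H.hj (H.isBase_scal hw)))
    (fun _ _ f g h => cls_htpy (H.gam_htpy (H.isBase_scal hw) h) _ _)
    (fun _ _ _ _ e f h => by
      simp only [gam_submatrix]
      exact cls_submatrix (h.gam H.hs H.hj (H.isBase_scal hw)) _ _)
    (fun _ _ _ _ f g hf hg => by
      simp only [gam_fromBlocks]
      exact cls_add (hf.gam H.hs H.hj (H.isBase_scal hw)) (hg.gam H.hs H.hj (H.isBase_scal hw)) _)
    (fun _ _ c h => cls_const (((isFam_const (P := P) h).gam H.hs H.hj (H.isBase_scal hw)).good 0) _)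

theorem gamma_cls [DecidableEq ι] (hw : SymU (insert s (insert j 𝓢)) w) {f : P → Matrix ι ι R}
    (hf : IsFam E (insert s (insert j 𝓢)) f) :
    H.gamma E P hw (cls f hf) = cls _ (hf.gam H.hs H.hj (H.isBase_scal hw)) := by
  obtain rfl : (fun a b => Classical.propDecidable (a = b)) = ‹DecidableEq ι› :=
    Subsingleton.elim _ _
  rfl

theorem tbase_good [DecidableEq ι] {x₀ : Matrix ι ι R} (h : IsBase (insert j 𝓢) s x₀) :
    Good E (insert s (insert j 𝓢)) (tbase s j w x₀) := by
  have ox : OddM 𝓢 x₀ := h.odd.mono fun r hr => mem_insert_of_mem _ (mem_insert_of_mem _ hr)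
  refine .of_inv (B := tbase s j w x₀) ?_ (.insert (H.tbase_anti h) (.insert ?_
    ((H.k_even.mul_odd ox).mul_even (H.k_even.star H.hst)))) ?_
  · rw [tbase, conjTranspose_mul, conjTranspose_mul, conjTranspose_conjTranspose, h.sa, mul_assoc]
  · have hx := h.odd.scal_comm (mem_insert_of_mem _ (mem_insert j 𝓢))
    have kj : scal ι (j * w) * scal ι j = -(scal ι j * scal ι (j * w)) := by
      rw [scal_mul_scal, scal_mul_scal, ← scal_neg, H.k_j]
    have kj' : (scal ι (j * w))ᴴ * scal ι j = -(scal ι j * (scal ι (j * w))ᴴ) := by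
      have := congrArg conjTranspose kj
      rw [conjTranspose_neg, conjTranspose_mul, conjTranspose_mul, scal_star j, H.hj.st, scal_neg,
        neg_mul, mul_neg, neg_neg] at this
      rw [← this]
    rw [tbase, mul_assoc, kj', mul_neg, mul_assoc, ← mul_assoc x₀, hx, neg_mul, mul_neg, neg_neg,
      ← mul_assoc, ← mul_assoc, kj]
    simp only [mul_assoc, neg_mul]
  · rw [tbase, mul_assoc, ← mul_assoc _ᴴ, ← mul_assoc _ᴴ, H.k1, one_mul, mul_assoc, ← mul_assoc x₀,
      h.sq, one_mul, H.k2]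

theorem theta_gam [DecidableEq ι] {x₀ : Matrix ι ι R} (h : IsBase (insert j 𝓢) s x₀)
    {f : P → Matrix ι ι R} (hf : IsFam E (insert s (insert j 𝓢)) f) :
    H.theta E P (cls _ (hf.gam H.hs H.hj h)) = cls f hf := by
  rw [H.theta_cls]
  have e : (fun q => thet s j w (gam (scal ι (s * j)) (f q) x₀)) =
      fun q => fromBlocks (f q) 0 0 (tbase s j w x₀) :=
    funext fun q => H.thet_gam h (hf.good q).odd
  have h' : IsFam E (insert s (insert j 𝓢)) fun q => fromBlocks (f q) 0 0 (tbase s j w x₀) :=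
    hf.fromBlocks (isFam_const (H.tbase_good h))
  rw [← cls_stab hf (H.tbase_good h) h']
  congr 1

variable (E P) in
/-- Adding a pair of generators of opposite type does not change the group. -/
noncomputable def equiv (hw : SymU (insert s (insert j 𝓢)) w) :
    G E 𝓢 P ≃+ G E (insert s (insert j 𝓢)) P where
  __ := H.theta E P
  invFun := H.gamma E P hw
  left_inv x := by
    classical
    obtain ⟨ι, _, f, hf, rfl⟩ := G.ind x
    show H.gamma E P hw (H.theta E P _) = _
    rw [H.theta_cls, H.gamma_cls, H.cls_gam_thet hf (H.isBase_scal hw)]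
  right_inv x := by
    classical
    obtain ⟨ι, _, f, hf, rfl⟩ := G.ind x
    show H.theta E P (H.gamma E P hw _) = _
    rw [H.gamma_cls, H.theta_gam (H.isBase_scal hw)]

end Dbl

theorem psi_surj [FiniteDimensional ℝ P] [Nontrivial P] {s j w : R} (H : Dbl 𝓢 s j w) :
    Function.Surjective (psi E P H.hj) := by
  intro x
  obtain ⟨ι, _, _, z, hz, x₀, rfl, g₀, q₀, r, hr⟩ := x.exists_based H.oddU_s
  have h : IsBase (insert j 𝓢) s (thet s j w x₀) :=
    ⟨(H.thet_good g₀).sa, H.thet_odd g₀.odd, fun {d} => by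
      obtain rfl : d = instDecidableEqSum := Subsingleton.elim _ _
      exact H.posIso.ext_sq x₀ q₀⟩
  have hb : Based (thet s j w x₀) fun q => thet s j w (z q) :=
    ⟨r, fun q hq => by beta_reduce; rw [hr q hq]⟩
  refine ⟨cls _ (bfam_isFam H.hs h (H.thet_fam hz) hb), ?_⟩
  rw [psi_eq H.hj _ (bfam_gam H.hst H.hs H.hj h (H.thet_fam hz) hb), H.cls_gam_thet hz h]

theorem rev_proper : Proper (rev (P := P)) := fun r => ⟨r, fun q hq => by
  simpa [rev, Prod.norm_def] using hq⟩

theorem continuous_rev : Continuous (rev (P := P)) := by unfold rev; fun_prop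

theorem psi_ker [FiniteDimensional ℝ P] [Nontrivial P] {s j w : R} (H : Dbl 𝓢 s j w)
    (hj : SkewU (insert s 𝓢) j) {x : G E (insert j (insert s 𝓢)) (P × ℝ)}
    (hx : psi E P hj x = 0) : x = 0 := by
  have hw : OddU (insert j (insert s 𝓢)) w := insert_comm s j 𝓢 ▸ H.hw
  obtain ⟨ι, _, _, y, hy, x₀, rfl, g₀, q₀, hb⟩ := x.exists_based hw
  have hp := psi_cls hj hy
  rw [hx] at hp
  have ec : insert j (insert s 𝓢) = insert s (insert j 𝓢) := insert_comm j s 𝓢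
  have hy' : IsFam E (insert s (insert j 𝓢)) y := ec ▸ hy
  have h : IsBase (insert j 𝓢) s x₀ := ⟨g₀.sa, ec ▸ g₀.odd, fun {d} => by convert q₀⟩
  have hw' : OddU (insert s 𝓢) w := ⟨hw.l, hw.r, fun r hr => hw.odd r (mem_insert_of_mem _ hr)⟩
  have h1 := bfam_psi_rev H.hs hj h hw' hy' hb hp
  have hy2 : IsFam E (insert s (insert j 𝓢)) fun q => y (rev q) := hy'.comp continuous_rev rev_proper
  have hb2 : Based x₀ fun q => y (rev q) := by
    obtain ⟨r, hr⟩ := hb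
    exact ⟨r, fun q hq => hr _ (by simpa [rev, Prod.norm_def] using hq)⟩
  have h2 := bfam_gam H.hst H.hs H.hj h hy2 hb2
  have h3 := PsiRel.htpy H.hj (.refl (bfam_isFam H.hs h hy2 hb2)) h2 h1
  have h4 : cls _ hy2 = 0 := by rw [← H.theta_gam h hy2, h3, map_zero]
  have h5 : pull E (insert s (insert j 𝓢)) rev continuous_rev rev_proper (cls _ hy2) = cls y hy' := by
    rw [pull_cls]
    simp only [rev, neg_neg]
  rw [h4, map_zero] at h5
  revert hy'
  rw [← ec]
  exact fun _ h => h.symm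

/-- The monodromy map is bijective. -/
theorem psi_bijective [FiniteDimensional ℝ P] [Nontrivial P] {𝓣 : Set R} {s s' j w w' : R}
    (hT : insert s 𝓢 = 𝓣) (H : Dbl 𝓢 s j w) (H' : Dbl 𝓣 s' j w') :
    Function.Bijective (psi E P H'.hj) := by
  subst hT
  refine ⟨fun a b hab => ?_, psi_surj H'⟩
  have hw : OddU (insert j (insert s 𝓢)) w := insert_comm s j 𝓢 ▸ H.hw
  obtain ⟨c, hc⟩ := b.exists_neg hw
  have : a + c = 0 := psi_ker H H'.hj (by rw [map_add, hab, ← map_add, hc, map_zero])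
  rw [← zero_add b, ← this, add_assoc, add_comm c, hc, add_zero]

end Mod

section Chain

variable {R : Type} [Ring R] [StarRing R] [Algebra ℝ R] [StarModule ℝ R]
  [TopologicalSpace R] [IsTopologicalRing R] [ContinuousStar R] [ContinuousSMul ℝ R]
variable {E : Type} [NormedAddCommGroup E] [InnerProductSpace ℝ E] [FiniteDimensional ℝ E]
  [Module R E] [IsScalarTower ℝ R E] [ContinuousSMul R E] [StarAct R E]
variable {ι κ μ ν : Type} [Fintype ι] [Fintype κ] [Fintype μ] [Fintype ν]
variable {𝓢 : Set R}
variable {P : Type} [NormedAddCommGroup P]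
variable {P' : Type} [NormedAddCommGroup P'] [NormedSpace ℝ P] [NormedSpace ℝ P']

theorem proper_linear (e : P' ≃L[ℝ] P) : Proper e.toHomeomorph := fun r => by
  refine ⟨‖(e.symm : P →L[ℝ] P')‖ * |r| + 1, fun q hq => ?_⟩
  by_contra! h
  have h1 := (e.symm : P →L[ℝ] P').le_opNorm (e q)
  simp only [ContinuousLinearEquiv.coe_coe, ContinuousLinearEquiv.symm_apply_apply] at h1
  change ‖e q‖ < r at h
  have h2 := mul_le_mul_of_nonneg_left (h.le.trans (le_abs_self r))
    (norm_nonneg (e.symm : P →L[ℝ] P'))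
  linarith

variable (E 𝓢) in
/-- The group depends only on the dimension of the parameter space. -/
theorem exists_equiv_of_finrank [FiniteDimensional ℝ P] [FiniteDimensional ℝ P']
    (h : Module.finrank ℝ P = Module.finrank ℝ P') : Nonempty (G E 𝓢 P ≃+ G E 𝓢 P') :=
  let e : P' ≃L[ℝ] P := .ofFinrankEq h.symm
  ⟨pullEquiv E 𝓢 e.toHomeomorph (proper_linear e) (proper_linear e.symm)⟩

variable (E P) in
/-- Enlarging the class of admissible operators. -/
def relax {𝓢' : Set R} (h : ∀ r : R, (∀ s ∈ 𝓢, r * s = -(s * r)) → ∀ s ∈ 𝓢', r * s = -(s * r)) :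
    G E 𝓢 P →+ G E 𝓢' P :=
  have o {ι : Type} {A : Matrix ι ι R} (hA : OddM 𝓢 A) : OddM 𝓢' A :=
    fun s hs i k => h (A i k) (fun r hr => hA r hr i k) s hs
  have g {ι : Type} [Fintype ι] {A : Matrix ι ι R} (hA : Good E 𝓢 A) : Good E 𝓢' A :=
    ⟨hA.sa, o hA.odd, hA.inj⟩
  G.lift (fun _ _ f hf => cls f ⟨hf.cont, fun q => g (hf.good q), hf.cs⟩)
    (fun _ _ f k ⟨K, hc, hg, hr, h0, h1⟩ =>
      cls_htpy ⟨K, hc, fun s hs q => g (hg s hs q), hr, h0, h1⟩ _ _)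
    (fun _ _ _ _ e f h => cls_submatrix _ e _)
    (fun _ _ _ _ f g hf hg => cls_add _ _ _)
    (fun _ _ c h => cls_const (g h) _)

variable (E P) in
/-- The group depends only on the set of operators anticommuting with the generators. -/
def relaxEquiv {𝓢' : Set R}
    (h : ∀ r : R, (∀ s ∈ 𝓢, r * s = -(s * r)) → ∀ s ∈ 𝓢', r * s = -(s * r))
    (h' : ∀ r : R, (∀ s ∈ 𝓢', r * s = -(s * r)) → ∀ s ∈ 𝓢, r * s = -(s * r)) :
    G E 𝓢 P ≃+ G E 𝓢' P where
  __ := relax E P h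
  invFun := relax E P h'
  left_inv x := by obtain ⟨ι, _, f, hf, rfl⟩ := x.ind; rfl
  right_inv x := by obtain ⟨ι, _, f, hf, rfl⟩ := x.ind; rfl

/-- Two elements anticommute. -/
def Anti (a b : R) : Prop := a * b = -(b * a)

theorem Anti.symm {a b : R} (h : Anti a b) : Anti b a := by
  unfold Anti at *; rw [h, neg_neg]

theorem Anti.mul {x a b : R} (ha : Anti x a) (hb : Anti x b) : Commute x (a * b) := by
  unfold Anti at *
  rw [commute_iff_eq, ← mul_assoc, ha, neg_mul, mul_assoc, hb, mul_neg, neg_neg, mul_assoc]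

theorem Anti.mul_commute {x a b : R} (ha : Commute x a) (hb : Anti x b) : Anti x (a * b) := by
  unfold Anti at *
  rw [← mul_assoc, ha.eq, mul_assoc, hb, mul_neg, mul_assoc]

theorem Anti.commute_mul {x a b : R} (ha : Anti x a) (hb : Commute x b) : Anti x (a * b) := by
  unfold Anti at *
  rw [← mul_assoc, ha, neg_mul, mul_assoc, hb.eq, mul_assoc]

/-- The generating set built up from a list of generators. -/
def gs (e : R) : List R → Set R
  | [] => {e}
  | a :: l => insert a (gs e l)

theorem gs_eq (e : R) (l : List R) : insert e {r | r ∈ l} = gs e l := by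
  induction l with
  | nil => simp [gs]
  | cons a l ih =>
    rw [gs, ← ih, insert_comm]
    congr 1
    ext r
    simp

theorem mem_gs {e : R} {l : List R} {r : R} (h : r ∈ gs e l) : r = e ∨ r ∈ l := by
  rwa [← gs_eq] at h

/-- Symmetric generators `e`, `t` and a unitary `w`, pairwise anticommuting. -/
structure Frame (e t w : R) : Prop where
  e_st : star e = e
  e_sq : e * e = 1
  t_st : star t = t
  t_sq : t * t = 1
  w_l : star w * w = 1
  w_r : w * star w = 1
  te : Anti t e
  we : Anti w e
  wt : Anti w t

/-- A skew generator anticommuting with a frame. -/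
structure Skew (e t w j : R) : Prop where
  st : star j = -j
  sq : j * j = -1
  je : Anti j e
  tj : Anti t j
  wj : Anti w j

variable {e t w : R}

theorem Frame.dbl (F : Frame e t w) {a : R} {l : List R} (ha : Skew e t w a)
    (hl : ∀ b ∈ l, Skew e t w b) (hal : ∀ b ∈ l, Anti a b) :
    Dbl {r | r ∈ l} e a w ∧ Dbl (gs e l) t a w := by
  refine ⟨⟨fun b hb => .inr (hl b hb).st, ⟨F.e_st, F.e_sq, ?_⟩, ⟨ha.st, ha.sq, hal⟩,
    ⟨F.w_l, F.w_r, ?_⟩⟩, ⟨fun b hb => ?_, ⟨F.t_st, F.t_sq, ?_⟩, ⟨ha.st, ha.sq, ?_⟩,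
    ⟨F.w_l, F.w_r, ?_⟩⟩⟩
  · rintro r (rfl | hr)
    exacts [ha.je.symm, (hl r hr).je.symm]
  · rintro r (rfl | rfl | hr)
    exacts [F.we, ha.wj, (hl r hr).wj]
  · rcases mem_gs hb with rfl | hb
    exacts [.inl F.e_st, .inr (hl b hb).st]
  · rintro r (rfl | hr)
    · exact ha.tj
    · rcases mem_gs hr with rfl | hr
      exacts [F.te, (hl r hr).tj]
  · intro r hr
    rcases mem_gs hr with rfl | hr
    exacts [ha.je, hal r hr]
  · rintro r (rfl | rfl | hr)
    · exact F.wt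
    · exact ha.wj
    · rcases mem_gs hr with rfl | hr
      exacts [F.we, (hl r hr).wj]

variable (E) in
theorem Frame.chain (F : Frame e t w) {l : List R} (hl : ∀ b ∈ l, Skew e t w b)
    (hp : l.Pairwise Anti) (d : ℕ) :
    Nonempty (G E (gs e l) (Fin (d + 1 + l.length) → ℝ) ≃+ G E {e} (Fin (d + 1) → ℝ)) := by
  induction l with
  | nil => exact ⟨.refl _⟩
  | cons a l ih =>
    obtain ⟨f⟩ := ih (fun b hb => hl b (by simp [hb])) hp.of_cons
    obtain ⟨H, H'⟩ := F.dbl (l := l) (hl a (by simp)) (fun b hb => hl b (by simp [hb]))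
      fun b hb => List.rel_of_pairwise_cons hp hb
    have : Nonempty (Fin (d + 1 + l.length)) := ⟨⟨0, by omega⟩⟩
    obtain ⟨g⟩ := exists_equiv_of_finrank E (gs e (a :: l)) (P := Fin (d + 1 + (a :: l).length) → ℝ)
      (P' := (Fin (d + 1 + l.length) → ℝ) × ℝ) (by simp; omega)
    exact ⟨(g.trans (AddEquiv.ofBijective _ (psi_bijective (gs_eq e l) H H'))).trans f⟩

/-- Symmetric generators anticommuting with a frame. -/
structure Symm (e t w s : R) : Prop where
  st : star s = s
  sq : s * s = 1
  se : Anti s e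
  ts : Anti t s
  ws : Anti w s

theorem Frame.double (F : Frame e t w) {𝓢 : Set R} (h𝓢 : StarOdd 𝓢) {s j : R} (hs : Symm e t w s)
    (hj : Skew e t w j) (sj : Anti s j) (s𝓢 : ∀ r ∈ 𝓢, Anti s r) (j𝓢 : ∀ r ∈ 𝓢, Anti j r)
    (t𝓢 : ∀ r ∈ 𝓢, Anti t r) :
    Nonempty (G E 𝓢 P ≃+ G E (insert s (insert j 𝓢)) P) := by
  have ht : SymU (insert s (insert j 𝓢)) t := ⟨F.t_st, F.t_sq, by
    rintro r (rfl | rfl | hr)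
    exacts [hs.ts, hj.tj, t𝓢 r hr]⟩
  have H : Dbl 𝓢 s j t := ⟨h𝓢, ⟨hs.st, hs.sq, by
    rintro r (rfl | hr)
    exacts [sj, s𝓢 r hr]⟩, ⟨hj.st, hj.sq, j𝓢⟩,
    ⟨by rw [F.t_st, F.t_sq], by rw [F.t_st, F.t_sq], ht.odd⟩⟩
  exact ⟨H.equiv E P ht⟩

/-- A base generator, frame generators, and pairwise anticommuting symmetric and skew ones. -/
structure System (e t w : R) (s j : Fin 4 → R) : Prop where
  F : Frame e t w
  hs : ∀ i, Symm e t w (s i)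
  hj : ∀ i, Skew e t w (j i)
  ss : ∀ i k, i ≠ k → Anti (s i) (s k)
  jj : ∀ i k, i ≠ k → Anti (j i) (j k)
  sj : ∀ i k, Anti (s i) (j k)

/-- The generating set built up from a list of pairs of generators. -/
def ds (e : R) (s j : Fin 4 → R) : List (Fin 4) → Set R
  | [] => {e}
  | a :: l => insert (s a) (insert (j a) (ds e s j l))

variable {s j : Fin 4 → R}

theorem mem_ds {l : List (Fin 4)} {r : R} :
    r ∈ ds e s j l ↔ r = e ∨ ∃ a ∈ l, r = s a ∨ r = j a := by
  induction l with
  | nil => simp [ds]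
  | cons a l ih =>
    simp only [ds, mem_insert_iff, ih, List.mem_cons, exists_eq_or_imp]
    grind

variable (E P) in
theorem System.double (S : System e t w s j) {l : List (Fin 4)} (hl : l.Nodup) :
    Nonempty (G E {e} P ≃+ G E (ds e s j l) P) := by
  induction l with
  | nil => exact ⟨.refl _⟩
  | cons a l ih =>
    obtain ⟨hal, hl⟩ := List.nodup_cons.1 hl
    obtain ⟨f⟩ := ih hl
    have ne {b} (hb : b ∈ l) : a ≠ b := fun h => hal (h ▸ hb)
    suffices h : Nonempty (G E (ds e s j l) P ≃+ G E (ds e s j (a :: l)) P) from ⟨f.trans h.some⟩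
    refine S.F.double ?_ (S.hs a) (S.hj a) (S.sj a a) ?_ ?_ ?_
    all_goals
      intro r hr
      obtain rfl | ⟨b, hb, rfl | rfl⟩ := mem_ds.1 hr
    exacts [.inl S.F.e_st, .inl (S.hs b).st, .inr (S.hj b).st, (S.hs a).se, S.ss _ _ (ne hb),
      S.sj _ _, (S.hj a).je, (S.sj _ _).symm, S.jj _ _ (ne hb), S.F.te, (S.hs b).ts, (S.hj b).tj]

/-- The volume element of four generators. -/
def vol (s : Fin 4 → R) : R := s 0 * s 1 * (s 2 * s 3)

theorem commute_vol {x : R} (h : ∀ i, Anti x (s i)) : Commute x (vol s) :=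
  ((h 0).mul (h 1)).mul_right ((h 2).mul (h 3))

section
variable (hs : ∀ i k, i ≠ k → Anti (s i) (s k))
include hs

theorem anti_vol (i : Fin 4) : Anti (s i) (vol s) := by
  fin_cases i
  · exact ((hs 0 1 (by decide)).mul_commute (.refl _)).commute_mul
      ((hs 0 2 (by decide)).mul (hs 0 3 (by decide)))
  · exact ((hs 1 0 (by decide)).commute_mul (.refl _)).commute_mul
      ((hs 1 2 (by decide)).mul (hs 1 3 (by decide)))
  · exact Anti.mul_commute ((hs 2 0 (by decide)).mul (hs 2 1 (by decide)))
      ((hs 2 3 (by decide)).mul_commute (.refl _))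
  · exact Anti.mul_commute ((hs 3 0 (by decide)).mul (hs 3 1 (by decide)))
      ((hs 3 2 (by decide)).commute_mul (.refl _))

theorem vol_pair : Commute (s 0 * s 1) (s 2 * s 3) :=
  ((hs 0 2 (by decide)).mul (hs 0 3 (by decide))).mul_left
    ((hs 1 2 (by decide)).mul (hs 1 3 (by decide)))

theorem vol_sq (h1 : ∀ i, s i * s i = 1) : vol s * vol s = 1 := by
  have h {i k} (hik : i ≠ k) : s i * s k * (s i * s k) = -1 := by
    rw [mul_assoc, ← mul_assoc (s k), hs k i hik.symm, neg_mul, mul_assoc, h1, mul_one, mul_neg, h1]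
  rw [vol, (vol_pair hs).symm.mul_mul_mul_comm, h (by decide), h (by decide), neg_mul_neg, one_mul]

theorem vol_star (h1 : ∀ i, star (s i) = s i) : star (vol s) = vol s := by
  simp only [vol, star_mul, h1]
  rw [hs 3 2 (by decide), hs 1 0 (by decide), neg_mul_neg, (vol_pair hs).eq]

end

theorem System.omega (S : System e t w s j) (i : Fin 4) : Skew e t w (vol s * s i) where
  st := by rw [star_mul, vol_star S.ss fun i => (S.hs i).st, (S.hs i).st, anti_vol S.ss i]
  sq := by
    rw [mul_assoc, ← mul_assoc (s i), anti_vol S.ss i, neg_mul, mul_assoc, (S.hs i).sq, mul_one,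
      mul_neg, vol_sq S.ss fun i => (S.hs i).sq]
  je := (Anti.mul_commute (commute_vol fun i => (S.hs i).se.symm) (S.hs i).se.symm).symm
  tj := Anti.mul_commute (commute_vol fun i => (S.hs i).ts) (S.hs i).ts
  wj := Anti.mul_commute (commute_vol fun i => (S.hs i).ws) (S.hs i).ws

theorem System.omega_mul (S : System e t w s j) (i k : Fin 4) :
    vol s * s i * (vol s * s k) = -(s i * s k) := by
  rw [mul_assoc, ← mul_assoc (s i), anti_vol S.ss i, neg_mul, mul_assoc, mul_neg, ← mul_assoc,
    vol_sq S.ss fun i => (S.hs i).sq, one_mul]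

theorem System.omega_omega (S : System e t w s j) {i k : Fin 4} (h : i ≠ k) :
    Anti (vol s * s i) (vol s * s k) := by
  unfold Anti
  rw [S.omega_mul, S.omega_mul, S.ss i k h]

theorem System.omega_j (S : System e t w s j) (i k : Fin 4) : Anti (vol s * s i) (j k) :=
  (Anti.mul_commute (commute_vol fun i => (S.sj i k).symm) (S.sj i k).symm).symm

variable (E) in
/-- The eightfold periodicity of the groups attached to a single generator. -/
theorem System.period (S : System e t w s j) (d : ℕ) :
    Nonempty (G E {e} (Fin (d + 1 + 8) → ℝ) ≃+ G E {e} (Fin (d + 1) → ℝ)) := by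
  obtain ⟨f⟩ := S.F.chain E (l := (List.finRange 4).map (fun i => vol s * s i) ++
    (List.finRange 4).map j) (by
      intro b hb
      simp only [List.mem_append, List.mem_map] at hb
      obtain ⟨i, _, rfl⟩ | ⟨i, _, rfl⟩ := hb
      exacts [S.omega i, S.hj i]) (by
      rw [List.pairwise_append]
      refine ⟨?_, ?_, ?_⟩
      · exact List.Pairwise.map _ (fun i k h => S.omega_omega h) (List.nodup_finRange 4)
      · exact List.Pairwise.map _ (fun i k h => S.jj i k h) (List.nodup_finRange 4)
      · intro a ha b hb
        simp only [List.mem_map] at ha hb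
        obtain ⟨i, _, rfl⟩ := ha
        obtain ⟨k, _, rfl⟩ := hb
        exact S.omega_j i k) d
  obtain ⟨g⟩ := S.double E (Fin (d + 1 + 8) → ℝ) (List.nodup_finRange 4)
  refine ⟨(g.trans (relaxEquiv E _ (fun r h q hq => ?_) (fun r h q hq => ?_))).trans f⟩
  · have hs (i) : Anti r (s i) := h _ (mem_ds.2 (.inr ⟨i, List.mem_finRange i, .inl rfl⟩))
    obtain rfl | hq := mem_gs hq
    · exact h _ (mem_ds.2 (.inl rfl))
    simp only [List.mem_append, List.mem_map] at hq
    obtain ⟨i, _, rfl⟩ | ⟨i, hi, rfl⟩ := hq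
    · exact Anti.mul_commute (commute_vol hs) (hs i)
    · exact h _ (mem_ds.2 (.inr ⟨i, hi, .inr rfl⟩))
  · rw [← gs_eq] at h
    have hk (i) : Anti r (vol s * s i) := h _ (by simp)
    have hc (i k) : Commute r (s i * s k) := by
      have := (hk i).mul (hk k)
      rwa [S.omega_mul, Commute.neg_right_iff] at this
    obtain rfl | ⟨i, _, rfl | rfl⟩ := mem_ds.1 hq
    · exact h _ (by simp)
    · have := Anti.mul_commute ((hc 0 1).mul_right (hc 2 3)) (hk i)
      change Anti r (vol s * _) at this
      rwa [← mul_assoc, vol_sq S.ss fun i => (S.hs i).sq, one_mul] at this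
    · exact h _ (by simp)

end Chain

section Cholesky

instance : StarModule ℝ ℍ[ℝ] := ⟨fun r a => by ext <;> simp⟩

variable {B C D : Type} [Fintype B] [Fintype C] [Fintype D]
  [DecidableEq B] [DecidableEq C] [DecidableEq D]

/-- Invertible quaternionic matrices, described by injectivity on column vectors. -/
def Inj (T : Matrix B B ℍ[ℝ]) : Prop := ∀ v, T *ᵥ v = 0 → v = 0

omit [DecidableEq B] in
theorem Inj.mul {T S : Matrix B B ℍ[ℝ]} (hT : Inj T) (hS : Inj S) : Inj (T * S) := fun v hv =>
  hS v (hT _ (by rwa [Matrix.mulVec_mulVec]))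

theorem Inj.of_inv {T S : Matrix B B ℍ[ℝ]} (h : S * T = 1) : Inj T := fun v hv => by
  rw [← Matrix.one_mulVec v, ← h, ← Matrix.mulVec_mulVec, hv, Matrix.mulVec_zero]

theorem inj_one : Inj (1 : Matrix B B ℍ[ℝ]) := .of_inv (mul_one 1)

/-- Positive definite quaternionic matrices. -/
structure Pos (A : Matrix B B ℍ[ℝ]) : Prop where
  sa : Aᴴ = A
  pos : ∀ v, v ≠ 0 → 0 < (star v ⬝ᵥ A *ᵥ v).re

omit [DecidableEq B] in
theorem dot_pos {v : B → ℍ[ℝ]} (h : v ≠ 0) : 0 < (star v ⬝ᵥ v).re := by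
  obtain ⟨i, hi⟩ := Function.ne_iff.1 h
  have : (star v ⬝ᵥ v).re = ∑ i, Quaternion.normSq (v i) := by
    have : star v ⬝ᵥ v = ((∑ i, Quaternion.normSq (v i) : ℝ) : ℍ[ℝ]) := by
      rw [dotProduct, show ((∑ i, Quaternion.normSq (v i) : ℝ) : ℍ[ℝ]) =
        algebraMap ℝ ℍ[ℝ] (∑ i, Quaternion.normSq (v i)) from rfl, map_sum]
      exact Finset.sum_congr rfl fun i _ => Quaternion.star_mul_self _
    rw [this, Quaternion.re_coe]
  rw [this]
  exact Finset.sum_pos' (fun i _ => Quaternion.normSq_nonneg)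
    ⟨i, Finset.mem_univ i, Quaternion.normSq_nonneg.lt_of_ne' (Quaternion.normSq_ne_zero.2 hi)⟩

omit [DecidableEq B] in
theorem Inj.pos {T : Matrix B B ℍ[ℝ]} (h : Inj T) : Pos (Tᴴ * T) where
  sa := by simp
  pos v hv := by
    rw [← Matrix.mulVec_mulVec, Matrix.dotProduct_mulVec, ← Matrix.star_mulVec]
    exact dot_pos fun h0 => hv (h v h0)

theorem pos_one : Pos (1 : Matrix B B ℍ[ℝ]) := ⟨by simp, fun v hv => by simpa using dot_pos hv⟩

omit [DecidableEq B] in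
theorem Pos.add {A A' : Matrix B B ℍ[ℝ]} (h : Pos A) (h' : Pos A') {s : ℝ} (h0 : 0 ≤ s)
    (h1 : s ≤ 1) : Pos ((1 - s) • A + s • A') where
  sa := by simp [Matrix.conjTranspose_smul, h.sa, h'.sa]
  pos v hv := by
    simp only [Matrix.add_mulVec, Matrix.smul_mulVec, dotProduct_add, dotProduct_smul,
      Quaternion.re_add, Quaternion.re_smul, smul_eq_mul]
    rcases h0.eq_or_lt with rfl | h0
    · simpa using h.pos v hv
    · exact add_pos_of_nonneg_of_pos (mul_nonneg (by linarith) (h.pos v hv).le)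
        (mul_pos h0 (h'.pos v hv))

/-- Continuous Cholesky factors. -/
def HasChol (B : Type) [Fintype B] [DecidableEq B] : Prop :=
  ∃ c : Matrix B B ℍ[ℝ] → Matrix B B ℍ[ℝ], ContinuousOn c {A | Pos A} ∧ c 1 = 1 ∧
    ∀ A, Pos A → c A * A * (c A)ᴴ = 1

omit [DecidableEq B] [DecidableEq C] in
theorem Pos.submatrix {A : Matrix B B ℍ[ℝ]} (h : Pos A) (e : C ≃ B) : Pos (A.submatrix e e) where
  sa := by rw [Matrix.conjTranspose_submatrix, h.sa]
  pos v hv := by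
    have h1 := h.pos (v ∘ e.symm) fun h0 => hv <| by
      ext1 i; simpa using congr_fun h0 (e i)
    rw [Matrix.submatrix_mulVec_equiv]
    convert h1 using 2
    rw [dotProduct, dotProduct, ← e.sum_comp]
    simp

theorem HasChol.equiv (h : HasChol B) (e : C ≃ B) : HasChol C := by
  obtain ⟨c, hc, h1, h2⟩ := h
  refine ⟨fun A => (c (A.submatrix e.symm e.symm)).submatrix e e, ?_, by simp [h1],
    fun A hA => ?_⟩
  · refine (Continuous.matrix_submatrix (A := id) continuous_id _ _).comp_continuousOn
      (hc.comp (Continuous.continuousOn (by fun_prop)) fun A hA => hA.submatrix _)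
  · have := congr_arg (fun M => M.submatrix e e) (h2 _ (hA.submatrix e.symm))
    simpa [← Matrix.submatrix_mul_equiv _ _ e e e] using this

/-- The Schur complement. -/
noncomputable def schur (A : Matrix (Unit ⊕ B) (Unit ⊕ B) ℍ[ℝ]) : Matrix B B ℍ[ℝ] :=
  A.toBlocks₂₂ - (A (.inl ()) (.inl ())).re⁻¹ • (A.toBlocks₂₁ * A.toBlocks₁₂)

section
omit [DecidableEq B]
variable {A : Matrix (Unit ⊕ B) (Unit ⊕ B) ℍ[ℝ]} (h : Pos A)
include h

theorem Pos.corner_pos : 0 < (A (.inl ()) (.inl ())).re := by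
  classical
  have := h.pos (Pi.single (.inl ()) 1) (by simp)
  simpa [← Pi.single_star] using this

theorem Pos.corner : A.toBlocks₁₁ = (A (.inl ()) (.inl ())).re • 1 := by
  ext1 i k
  have := congr_fun₂ h.sa (.inl ()) (.inl ())
  rw [Matrix.conjTranspose_apply] at this
  have := (Quaternion.star_eq_self).1 this
  simp only [Matrix.toBlocks₁₁, Matrix.of_apply, Matrix.smul_apply, Matrix.one_apply_eq]
  rw [this]
  ext <;> simp

theorem Pos.twelve : (A.toBlocks₂₁)ᴴ = A.toBlocks₁₂ := by
  ext1 i k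
  exact congr_fun₂ h.sa (.inl i) (.inr k)

theorem Pos.blocks : A = fromBlocks ((A (.inl ()) (.inl ())).re • 1) A.toBlocks₁₂ A.toBlocks₂₁
    A.toBlocks₂₂ := by
  rw [← h.corner, Matrix.fromBlocks_toBlocks]

theorem Pos.schur : Pos (schur A) where
  sa := by
    have : (A.toBlocks₂₂)ᴴ = A.toBlocks₂₂ := by
      ext1 i k
      exact congr_fun₂ h.sa (.inr i) (.inr k)
    rw [Bott.schur, Matrix.conjTranspose_sub, this, Matrix.conjTranspose_smul,
      Matrix.conjTranspose_mul, ← h.twelve, Matrix.conjTranspose_conjTranspose, star_trivial]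
  pos v hv := by
    have h0 := h.corner_pos
    set a := (A (.inl ()) (.inl ())).re with ha
    have := h.pos (Sum.elim (-(a⁻¹ • (A.toBlocks₁₂ *ᵥ v))) v) fun h => hv <| by
      ext1 i; exact congr_fun h (.inr i)
    have key (x) : A *ᵥ x = fromBlocks (a • 1) A.toBlocks₁₂ A.toBlocks₂₁ A.toBlocks₂₂ *ᵥ x := by
      rw [← h.blocks]
    rw [key, Matrix.fromBlocks_mulVec] at this
    convert this using 2
    have h1 : (a • 1 : Matrix Unit Unit ℍ[ℝ]) *ᵥ (-(a⁻¹ • (A.toBlocks₁₂ *ᵥ v))) +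
        A.toBlocks₁₂ *ᵥ v = 0 := by
      rw [Matrix.smul_mulVec, Matrix.one_mulVec, smul_neg, smul_smul, mul_inv_cancel₀ h0.ne',
        one_smul, neg_add_cancel]
    have h2 : A.toBlocks₂₁ *ᵥ (-(a⁻¹ • (A.toBlocks₁₂ *ᵥ v))) + A.toBlocks₂₂ *ᵥ v =
        Bott.schur A *ᵥ v := by
      rw [Matrix.mulVec_neg, Matrix.mulVec_smul, Matrix.mulVec_mulVec, Bott.schur,
        Matrix.sub_mulVec, Matrix.smul_mulVec, neg_add_eq_sub]
    rw [Sum.elim_comp_inl, Sum.elim_comp_inr, h1, h2]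
    simp [dotProduct]

end

theorem HasChol.step (h : HasChol B) : HasChol (Unit ⊕ B) := by
  obtain ⟨c, hc, h1, h2⟩ := h
  let a (A : Matrix (Unit ⊕ B) (Unit ⊕ B) ℍ[ℝ]) : ℝ := (A (.inl ()) (.inl ())).re
  refine ⟨fun A => fromBlocks ((√(a A))⁻¹ • 1) 0 (-((a A)⁻¹ • (c (schur A) * A.toBlocks₂₁)))
    (c (schur A)), ?_, ?_, fun A hA => ?_⟩
  · have ca : Continuous a := Quaternion.continuous_re.comp (continuous_id.matrix_elem _ _)
    have ca' : ContinuousOn (fun A => (a A)⁻¹) {A | Pos A} :=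
      ca.continuousOn.inv₀ fun A hA => hA.corner_pos.ne'
    have c21 : Continuous fun A : Matrix (Unit ⊕ B) (Unit ⊕ B) ℍ[ℝ] => A.toBlocks₂₁ :=
      continuous_matrix fun i k => by exact continuous_id.matrix_elem _ _
    have c12 : Continuous fun A : Matrix (Unit ⊕ B) (Unit ⊕ B) ℍ[ℝ] => A.toBlocks₁₂ :=
      continuous_matrix fun i k => by exact continuous_id.matrix_elem _ _
    have c22 : Continuous fun A : Matrix (Unit ⊕ B) (Unit ⊕ B) ℍ[ℝ] => A.toBlocks₂₂ :=
      continuous_matrix fun i k => by exact continuous_id.matrix_elem _ _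
    have cs : ContinuousOn (fun A => c (schur A)) {A : Matrix (Unit ⊕ B) (Unit ⊕ B) ℍ[ℝ] | Pos A} :=
      hc.comp (c22.continuousOn.sub (ca'.smul (c21.matrix_mul c12).continuousOn))
        fun A hA => hA.schur
    rw [continuousOn_iff_continuous_restrict] at *
    refine Continuous.matrix_fromBlocks ?_ continuous_const ?_ cs
    · refine Continuous.smul (Continuous.inv₀ (ca.comp continuous_subtype_val).sqrt
        fun A => ?_) continuous_const
      exact (Real.sqrt_pos.2 A.2.corner_pos).ne'
    · exact (ca'.smul (cs.matrix_mul (c21.comp continuous_subtype_val))).neg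
  · have e21 : (1 : Matrix (Unit ⊕ B) (Unit ⊕ B) ℍ[ℝ]).toBlocks₂₁ = 0 := by
      rw [← Matrix.fromBlocks_one, Matrix.toBlocks_fromBlocks₂₁]
    have es : schur (1 : Matrix (Unit ⊕ B) (Unit ⊕ B) ℍ[ℝ]) = 1 := by
      rw [schur, e21, Matrix.zero_mul, smul_zero, sub_zero, ← Matrix.fromBlocks_one,
        Matrix.toBlocks_fromBlocks₂₂]
    simp [es, h1, e21, a]
  · have h0 := hA.corner_pos
    have hr : (√(a A))⁻¹ * (√(a A))⁻¹ * a A = 1 := by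
      rw [← mul_inv, Real.mul_self_sqrt h0.le, inv_mul_cancel₀ h0.ne']
    have h3 := h2 _ hA.schur
    have e : A = _ := hA.blocks
    have hs : c (schur A) * schur A = c (schur A) * A.toBlocks₂₂ -
        (a A)⁻¹ • (c (schur A) * A.toBlocks₂₁ * A.toBlocks₁₂) := by
      rw [schur, Matrix.mul_sub, Matrix.mul_smul, Matrix.mul_assoc]
    beta_reduce
    generalize hS : schur A = S at *
    generalize c S = K at *
    have ha : a A = (A (.inl ()) (.inl ())).re := rfl
    rw [← ha] at e
    have ht := hA.twelve
    conv_lhs => enter [1, 2]; rw [e]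
    rw [Matrix.fromBlocks_conjTranspose, Matrix.fromBlocks_multiply, Matrix.fromBlocks_multiply,
      ← Matrix.fromBlocks_one]
    simp only [Matrix.zero_mul, Matrix.mul_zero, add_zero, Matrix.conjTranspose_zero,
      Matrix.conjTranspose_neg, Matrix.conjTranspose_smul, Matrix.conjTranspose_mul, ht,
      star_trivial, Matrix.conjTranspose_one, Matrix.smul_mul, Matrix.mul_smul, Matrix.one_mul,
      Matrix.mul_one, Matrix.neg_mul, Matrix.mul_neg, smul_neg, smul_smul]
    rw [mul_inv_cancel₀ (show a A ≠ 0 from h0.ne'), one_smul, neg_add_cancel]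
    congr 1
    · rw [← mul_assoc, mul_right_comm, hr, one_smul]
    · rw [← mul_assoc, inv_mul_cancel₀ (show a A ≠ 0 from h0.ne'), one_mul, neg_add_cancel]
    · simp
    · simp only [Matrix.zero_mul, smul_zero, neg_zero, zero_add]
      rw [← h3, hs, neg_add_eq_sub]

variable (B) in
theorem hasChol : HasChol B := by
  classical
  suffices h : ∀ n, HasChol (Fin n) from (h _).equiv (Fintype.equivFin B)
  intro n
  induction n with
  | zero => exact ⟨id, continuousOn_id, rfl, fun A _ => Subsingleton.elim _ _⟩
  | succ n ih =>
    exact ih.step.equiv (Fintype.equivOfCardEq (by simp [add_comm]))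

variable (B) in
theorem exists_inv : ∃ I : Matrix B B ℍ[ℝ] → Matrix B B ℍ[ℝ], ContinuousOn I {T | Inj T} ∧
    ∀ T, Inj T → I T * T = 1 ∧ T * I T = 1 := by
  obtain ⟨c, hc, -, h⟩ := hasChol B
  have h1 (T : Matrix B B ℍ[ℝ]) (hT : Inj T) : (c (Tᴴ * T))ᴴ * c (Tᴴ * T) * Tᴴ * T = 1 := by
    have := h _ hT.pos
    rw [mul_eq_one_comm] at this
    simpa only [Matrix.mul_assoc] using this
  refine ⟨fun T => (c (Tᴴ * T))ᴴ * c (Tᴴ * T) * Tᴴ, ?_, fun T hT =>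
    ⟨h1 T hT, mul_eq_one_comm.1 (h1 T hT)⟩⟩
  have c1 : Continuous fun T : Matrix B B ℍ[ℝ] => Tᴴ := continuous_id.matrix_conjTranspose
  have c2 : ContinuousOn (fun T => c (Tᴴ * T)) {T | Inj T} :=
    hc.comp (c1.matrix_mul continuous_id).continuousOn fun T hT => hT.pos
  rw [continuousOn_iff_continuous_restrict] at *
  exact (c2.matrix_conjTranspose.matrix_mul c2).matrix_mul (c1.comp continuous_subtype_val)

/-- A continuous matrix inverse. -/
noncomputable def inv (T : Matrix B B ℍ[ℝ]) : Matrix B B ℍ[ℝ] := (exists_inv B).choose T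

theorem continuousOn_inv : ContinuousOn inv {T : Matrix B B ℍ[ℝ] | Inj T} :=
  (exists_inv B).choose_spec.1

theorem Inj.inv_mul {T : Matrix B B ℍ[ℝ]} (h : Inj T) : inv T * T = 1 :=
  ((exists_inv B).choose_spec.2 T h).1

theorem Inj.mul_inv {T : Matrix B B ℍ[ℝ]} (h : Inj T) : T * inv T = 1 :=
  ((exists_inv B).choose_spec.2 T h).2

theorem Inj.inv {T : Matrix B B ℍ[ℝ]} (h : Inj T) : Inj (inv T) := .of_inv h.mul_inv

theorem inv_one : inv (1 : Matrix B B ℍ[ℝ]) = 1 := by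
  rw [← mul_one (inv 1), inj_one.inv_mul]

theorem continuous_inv {X : Type} [TopologicalSpace X] {f : X → Matrix B B ℍ[ℝ]}
    (hf : Continuous f) (h : ∀ x, Inj (f x)) : Continuous fun x => inv (f x) :=
  continuousOn_inv.comp_continuous hf h

end Cholesky

section Column

variable {B C D : Type} [Fintype B] [Fintype C] [Fintype D]
  [DecidableEq B] [DecidableEq C] [DecidableEq D]

/-- The Hermitian norm of a quaternionic vector. -/
noncomputable def nr (a : B → ℍ[ℝ]) : ℝ := √(star a ⬝ᵥ a).re

/-- The normalisation of a quaternionic vector. -/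
noncomputable def unit (a : B → ℍ[ℝ]) : B → ℍ[ℝ] := (nr a)⁻¹ • a

theorem nr_pos {a : B → ℍ[ℝ]} (h : a ≠ 0) : 0 < nr a := Real.sqrt_pos.2 (dot_pos h)

theorem dot_eq_re (a : B → ℍ[ℝ]) : star a ⬝ᵥ a = (((star a ⬝ᵥ a).re : ℝ) : ℍ[ℝ]) := by
  have : star (star a ⬝ᵥ a) = star a ⬝ᵥ a :=
    (Matrix.star_dotProduct _ _).symm
  exact Quaternion.star_eq_self.1 this

theorem unit_dot {a : B → ℍ[ℝ]} (h : a ≠ 0) : star (unit a) ⬝ᵥ unit a = 1 := by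
  have h0 := nr_pos h
  have h1 : nr a * nr a = (star a ⬝ᵥ a).re := Real.mul_self_sqrt (dot_pos h).le
  rw [unit, star_smul, star_trivial, smul_dotProduct, dotProduct_smul, smul_smul, dot_eq_re,
    ← h1, ← Quaternion.coe_mul_eq_smul, ← Quaternion.coe_mul, ← mul_inv,
    inv_mul_cancel₀ (mul_pos h0 h0).ne', Quaternion.coe_one]

theorem unit_eq {e : B → ℍ[ℝ]} (h : star e ⬝ᵥ e = 1) : unit e = e := by
  simp [unit, nr, h]

theorem nr_smul_unit {a : B → ℍ[ℝ]} (h : a ≠ 0) : nr a • unit a = a := by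
  rw [unit, smul_smul, mul_inv_cancel₀ (nr_pos h).ne', one_smul]

theorem continuous_nr : Continuous (nr : (B → ℍ[ℝ]) → ℝ) :=
  (Quaternion.continuous_re.comp (by unfold dotProduct; fun_prop)).sqrt

theorem continuous_unit {X : Type} [TopologicalSpace X] {f : X → B → ℍ[ℝ]} (hf : Continuous f)
    (h : ∀ x, f x ≠ 0) : Continuous fun x => unit (f x) :=
  ((continuous_nr.comp hf).inv₀ fun x => (nr_pos (h x)).ne').smul hf

/-- A path of rank one perturbations of the identity moving `a` to `b`. -/
noncomputable def mv (s : ℝ) (a b : B → ℍ[ℝ]) : Matrix B B ℍ[ℝ] :=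
  1 + s • vecMulVec (b - a) fun k => (star (a + b) ⬝ᵥ a)⁻¹ * star (a + b) k

theorem mv_zero (a b : B → ℍ[ℝ]) : mv 0 a b = 1 := by simp [mv]

theorem mv_mulVec (s : ℝ) (a b v : B → ℍ[ℝ]) : mv s a b *ᵥ v = v + s • fun i =>
    (b i - a i) * ((star (a + b) ⬝ᵥ a)⁻¹ * (star (a + b) ⬝ᵥ v)) := by
  rw [mv, Matrix.add_mulVec, Matrix.one_mulVec, Matrix.smul_mulVec]
  congr 2
  ext1 i
  simp only [mulVec, dotProduct, vecMulVec, Matrix.of_apply, Pi.sub_apply, mul_assoc,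
    Finset.mul_sum]

section
variable {a b : B → ℍ[ℝ]} (ha : star a ⬝ᵥ a = 1) (hb : star b ⬝ᵥ b = 1) (hab : b ≠ -a)
include ha hb hab

theorem re_pos : 0 < (star (a + b) ⬝ᵥ a).re ∧ 0 < (star (a + b) ⬝ᵥ b).re := by
  have h0 : a + b ≠ 0 := fun h => hab (eq_neg_of_add_eq_zero_right h)
  have h1 := dot_pos h0
  have h2 : star (star b ⬝ᵥ a) = star a ⬝ᵥ b := (Matrix.star_dotProduct _ _).symm
  have h3 := congr_arg QuaternionAlgebra.re h2
  simp only [star_add, add_dotProduct, dotProduct_add, ha, hb, Quaternion.re_add,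
    Quaternion.re_star] at *
  constructor <;> linarith

theorem mv_one : mv 1 a b *ᵥ a = b := by
  have h := (re_pos ha hb hab).1
  have h0 : star (a + b) ⬝ᵥ a ≠ 0 := fun h0 => by
    rw [h0, Quaternion.re_zero] at h; exact h.false
  rw [mv_mulVec, inv_mul_cancel₀ h0]
  ext1 i
  simp

theorem mv_inj {s : ℝ} (h0 : 0 ≤ s) (h1 : s ≤ 1) : Inj (mv s a b) := fun v hv => by
  obtain ⟨hx, hy⟩ := re_pos ha hb hab
  have hx0 : star (a + b) ⬝ᵥ a ≠ 0 := fun h0 => by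
    rw [h0, Quaternion.re_zero] at hx; exact hx.false
  rw [mv_mulVec] at hv
  generalize hc : star (a + b) ⬝ᵥ v = c at hv
  have h2 := congr_arg (star (a + b) ⬝ᵥ ·) hv
  have h3 : star (a + b) ⬝ᵥ (fun i => (b i - a i) * ((star (a + b) ⬝ᵥ a)⁻¹ * c)) =
      (star (a + b) ⬝ᵥ b - star (a + b) ⬝ᵥ a) * ((star (a + b) ⬝ᵥ a)⁻¹ * c) := by
    rw [← dotProduct_sub]
    simp only [dotProduct, Finset.sum_mul, mul_assoc, Pi.sub_apply]
  simp only [dotProduct_add, dotProduct_smul, hc, h3, dotProduct_zero] at h2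
  generalize star (a + b) ⬝ᵥ a = x at *
  generalize star (a + b) ⬝ᵥ b = y at *
  have h4 : ((1 - s) • x + s • y) * (x⁻¹ * c) = 0 := by
    rw [← h2, add_mul, sub_smul, one_smul, sub_mul, ← mul_assoc x, mul_inv_cancel₀ hx0, one_mul,
      sub_mul, smul_sub, smul_mul_assoc, smul_mul_assoc, ← mul_assoc x, mul_inv_cancel₀ hx0,
      one_mul]
    abel
  have h5 : (1 - s) • x + s • y ≠ 0 := fun h => by
    have := congr_arg QuaternionAlgebra.re h
    simp only [Quaternion.re_add, Quaternion.re_smul, smul_eq_mul, Quaternion.re_zero] at this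
    nlinarith [mul_nonneg h0 hy.le, mul_nonneg (sub_nonneg.2 h1) hx.le]
  rw [(mul_eq_zero.1 h4).resolve_left h5] at hv
  simpa [← Pi.zero_def] using hv

end

theorem continuous_mv {X : Type} [TopologicalSpace X] {s : X → ℝ} {a b : X → B → ℍ[ℝ]}
    (hs : Continuous s) (ca : Continuous a) (cb : Continuous b) (ha : ∀ x, star (a x) ⬝ᵥ a x = 1)
    (hb : ∀ x, star (b x) ⬝ᵥ b x = 1) (hab : ∀ x, b x ≠ -a x) :
    Continuous fun x => mv (s x) (a x) (b x) := by
  refine continuous_const.add (hs.smul ((cb.sub ca).matrix_vecMulVec ?_))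
  have h : Continuous fun x => (star (a x + b x) ⬝ᵥ a x)⁻¹ := by
    refine Continuous.inv₀ (by unfold dotProduct; fun_prop) fun x h0 => ?_
    have := (re_pos (ha x) (hb x) (hab x)).1
    rw [h0, Quaternion.re_zero] at this
    exact this.false
  fun_prop

/-- Clamping to the unit interval. -/
noncomputable def tau (s : ℝ) : ℝ := max 0 (min 1 s)

theorem continuous_tau : Continuous tau := by unfold tau; fun_prop
theorem tau_nonneg (s : ℝ) : 0 ≤ tau s := le_max_left _ _
theorem tau_le (s : ℝ) : tau s ≤ 1 := by simp [tau]
theorem tau_of_nonpos {s : ℝ} (h : s ≤ 0) : tau s = 0 := by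
  simp [tau, h]
theorem tau_of_one_le {s : ℝ} (h : 1 ≤ s) : tau s = 1 := by simp [tau, h]

variable {Z : Type} [NormedAddCommGroup Z]

/-- Multiplicative homotopies of families of invertible matrices, trivial near infinity. -/
structure FHom (K : ℝ × Z → Matrix B B ℍ[ℝ]) : Prop where
  cont : Continuous K
  inj : ∀ x, Inj (K x)
  far : ∃ r : ℝ, ∀ s z, r ≤ ‖z‖ → K (s, z) = 1
  zero : ∀ z, K (0, z) = 1

variable [NormedSpace ℝ Z] [FiniteDimensional ℝ Z] [Nontrivial Z]

theorem exists_col (hd : Module.finrank ℝ Z + 1 < 4 * Fintype.card B) {e : B → ℍ[ℝ]}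
    (he : star e ⬝ᵥ e = 1) {v : Z → B → ℍ[ℝ]} (hv : Continuous v) (h0 : ∀ z, v z ≠ 0)
    (hr : ∃ r : ℝ, ∀ z, r ≤ ‖z‖ → v z = e) : ∃ K, FHom K ∧ ∀ z : Z, K (1, z) *ᵥ v z = e := by
  obtain ⟨r, hr⟩ := hr
  have cu := continuous_unit hv h0
  have hU : {z : Z | r < ‖z‖} ∈ nhdsSet {z : Z | r + 1 ≤ ‖z‖} :=
    (isOpen_lt continuous_const continuous_norm).mem_nhdsSet.2 fun z hz => by
      simp only [mem_setOf_eq] at *; linarith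
  have hu (z) : unit (v z) ≠ 0 := fun h => by simpa [h] using unit_dot (h0 z)
  obtain ⟨g, gs, gd, ge, -⟩ := cu.exists_contDiff_approx_and_eqOn 1 cu.norm
    (fun z => norm_pos_iff.2 (hu z)) (isClosed_le continuous_const continuous_norm) hU
    (contDiffOn_const (c := e) |>.congr fun z hz => by
      rw [hr z (le_of_lt hz), unit_eq he])
  have gc : Continuous g := gs.continuous
  have gn (z) (c : ℝ) (hc : 0 ≤ c) : g z ≠ -(c • unit (v z)) := fun h => by
    have := gd z
    rw [h, dist_eq_norm, ← neg_add', norm_neg, show c • unit (v z) + unit (v z) =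
      (c + 1) • unit (v z) by module, norm_smul, Real.norm_of_nonneg (by linarith)] at this
    nlinarith [norm_nonneg (unit (v z))]
  have g0 (z) : g z ≠ 0 := by simpa using gn z 0 le_rfl
  obtain ⟨z₀, hz₀⟩ := NormedSpace.exists_lt_norm ℝ Z (max r (r + 1))
  have hz₁ : r ≤ ‖z₀‖ := (le_max_left _ _).trans hz₀.le
  have hz₂ : r + 1 ≤ ‖z₀‖ := (le_max_right _ _).trans hz₀.le
  have gfar (z) (hz : r + 1 ≤ ‖z‖) : g z = e := by
    rw [ge hz]; beta_reduce; rw [hr z (by linarith), unit_eq he]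
  have hs : ContDiff ℝ 1 fun x : ℝ × Z => x.1 • g x.2 :=
    contDiff_fst.smul (gs.comp contDiff_snd)
  obtain ⟨p, hp⟩ := (hs.dense_compl_range_of_finrank_lt_finrank (by
    rw [Module.finrank_prod, Module.finrank_self, Module.finrank_pi_fintype]
    simp only [Quaternion.finrank_eq_four, Finset.sum_const, smul_eq_mul, Finset.card_univ]
    omega)).nonempty
  have p0 : p ≠ 0 := fun h => hp ⟨(0, 0), by simp [h]⟩
  have pg (z) : unit p ≠ -unit (g z) := fun h => hp ⟨(-(nr p * (nr (g z))⁻¹), z), by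
    beta_reduce
    conv_rhs => rw [← nr_smul_unit p0, h]
    rw [unit, neg_smul, smul_neg, smul_smul]⟩
  have ep : e ≠ -unit p := fun h => pg z₀ <| by rw [gfar z₀ hz₂, unit_eq he, h, neg_neg]
  have gv (z) : unit (g z) ≠ -unit (v z) := fun h => gn z (nr (g z)) (nr_pos (g0 z)).le <| by
    rw [← smul_neg, ← h, nr_smul_unit (g0 z)]
  let K' (x : ℝ × Z) : Matrix B B ℍ[ℝ] := ((1 - tau x.1) + tau x.1 * (nr (v x.2))⁻¹) •
    (mv (tau x.1) (unit p) e * (mv (tau x.1) (unit (g x.2)) (unit p) *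
      mv (tau x.1) (unit (v x.2)) (unit (g x.2))))
  have up := unit_dot p0
  have ug (z) := unit_dot (g0 z)
  have uv (z) := unit_dot (h0 z)
  have ct : Continuous fun x : ℝ × Z => tau x.1 := continuous_tau.comp continuous_fst
  have cK : Continuous K' := by
    have cs : Continuous fun x : ℝ × Z => (1 - tau x.1) + tau x.1 * (nr (v x.2))⁻¹ :=
      (continuous_const.sub ct).add (ct.mul ((continuous_nr.comp
        (hv.comp continuous_snd)).inv₀ fun x => (nr_pos (h0 _)).ne'))
    exact cs.smul ((continuous_mv ct continuous_const continuous_const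
      (fun _ => up) (fun _ => he) (fun _ => ep)).matrix_mul ((continuous_mv ct
      (continuous_unit (gc.comp continuous_snd) fun x => g0 _) continuous_const (fun x => ug _)
      (fun x => up) (fun x => pg _)).matrix_mul (continuous_mv ct (cu.comp continuous_snd)
      (continuous_unit (gc.comp continuous_snd) fun x => g0 _) (fun x => uv _) (fun x => ug _)
      (fun x => gv _))))
  have iK (x) : Inj (K' x) := fun w hw => by
    have t0 := tau_nonneg x.1
    have t1 := tau_le x.1
    have hpos : 0 < (1 - tau x.1) + tau x.1 * (nr (v x.2))⁻¹ := by
      have := inv_pos.2 (nr_pos (h0 x.2))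
      rcases t0.eq_or_lt with h | h
      · rw [← h]; norm_num
      · exact add_pos_of_nonneg_of_pos (by linarith) (mul_pos h this)
    rw [Matrix.smul_mulVec] at hw
    exact ((mv_inj up he ep t0 t1).mul ((mv_inj (ug _) up (pg _) t0 t1).mul
      (mv_inj (uv _) (ug _) (gv _) t0 t1))) w ((smul_eq_zero.1 hw).resolve_left hpos.ne')
  have K1 (z) : K' (1, z) *ᵥ v z = e := by
    have h : K' (1, z) *ᵥ v z = (mv 1 (unit p) e * (mv 1 (unit (g z)) (unit p) *
        mv 1 (unit (v z)) (unit (g z)))) *ᵥ unit (v z) := by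
      simp only [K', tau_of_one_le le_rfl, sub_self, zero_add, one_mul, Matrix.smul_mulVec]
      rw [← Matrix.mulVec_smul]; rfl
    rw [h, ← Matrix.mulVec_mulVec, ← Matrix.mulVec_mulVec, mv_one (uv z) (ug z) (gv z),
      mv_one (ug z) up (pg z), mv_one up he ep]
  have K0 (z) : K' (0, z) = 1 := by
    simp [K', tau_of_nonpos le_rfl, mv_zero]
  have Kf (s z) (hz : r + 1 ≤ ‖z‖) : K' (s, z) = K' (s, z₀) := by
    simp only [K', gfar z hz, gfar z₀ hz₂, hr z (by linarith), hr z₀ hz₁]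
  refine ⟨fun x => inv (K' (x.1, z₀)) * K' x, ⟨?_, fun x => (iK _).inv.mul (iK x),
    ⟨r + 1, fun s z hz => ?_⟩, fun z => ?_⟩, fun z => ?_⟩
  · exact (continuous_inv (cK.comp (by fun_prop)) fun x => iK _).matrix_mul cK
  · rw [Kf s z hz, (iK _).inv_mul]
  · rw [K0, K0, inv_one, mul_one]
  · beta_reduce
    have h1 := K1 z₀
    rw [hr z₀ hz₁] at h1
    rw [← Matrix.mulVec_mulVec, K1, ← h1, Matrix.mulVec_mulVec]
    rw [(iK _).inv_mul, Matrix.one_mulVec, h1]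

end Column

section Destab

variable {B C D : Type} [Fintype B] [Fintype C] [Fintype D]
  [DecidableEq B] [DecidableEq C] [DecidableEq D]
variable {Z : Type} [NormedAddCommGroup Z]

/-- Families of invertible matrices, trivial near infinity. -/
structure GFam (T : Z → Matrix B B ℍ[ℝ]) : Prop where
  cont : Continuous T
  inj : ∀ z, Inj (T z)
  far : ∃ r : ℝ, ∀ z, r ≤ ‖z‖ → T z = 1

omit [DecidableEq B] [DecidableEq C] in
theorem inj_fromBlocks {T : Matrix B B ℍ[ℝ]} {S : Matrix C C ℍ[ℝ]} (W : Matrix C B ℍ[ℝ])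
    (hT : Inj T) (hS : Inj S) : Inj (fromBlocks T 0 W S) := fun v hv => by
  rw [Matrix.fromBlocks_mulVec, Matrix.zero_mulVec, add_zero] at hv
  have h1 : v ∘ Sum.inl = 0 := hT _ <| by ext1 i; exact congr_fun hv (.inl i)
  have h2 : v ∘ Sum.inr = 0 := hS _ <| by
    ext1 i
    have := congr_fun hv (.inr i)
    simpa [h1] using this
  ext1 (i | i)
  exacts [congr_fun h1 i, congr_fun h2 i]

omit [DecidableEq B] [DecidableEq C] in
theorem Inj.submatrix {T : Matrix B B ℍ[ℝ]} (h : Inj T) (e : C ≃ B) :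
    Inj (T.submatrix e e) := fun v hv => by
  rw [Matrix.submatrix_mulVec_equiv] at hv
  have := h (v ∘ e.symm) <| by ext1 i; simpa using congr_fun hv (e.symm i)
  ext1 i
  simpa using congr_fun this (e i)

omit [DecidableEq B] [DecidableEq C] in
theorem Inj.of_fromBlocks [DecidableEq C] {T : Matrix B B ℍ[ℝ]} {W : Matrix C B ℍ[ℝ]}
    (h : Inj (fromBlocks T 0 W 1)) : Inj T := fun v hv => by
  have := h (Sum.elim v (-(W *ᵥ v))) <| by
    rw [Matrix.fromBlocks_mulVec]
    simp only [Sum.elim_comp_inl, Sum.elim_comp_inr, hv, Matrix.zero_mulVec, add_zero,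
      Matrix.one_mulVec, add_neg_cancel, Sum.elim_zero_zero]
  ext1 i
  exact congr_fun this (.inl i)

/-- Two families differ by a multiplicative homotopy. -/
def FH (T S : Z → Matrix B B ℍ[ℝ]) : Prop := ∃ K, FHom K ∧ ∀ z, K (1, z) * T z = S z

theorem FH.trans {T S U : Z → Matrix B B ℍ[ℝ]} (h : FH T S) (h' : FH S U) : FH T U := by
  obtain ⟨K, ⟨kc, ki, ⟨r, kr⟩, k0⟩, h⟩ := h
  obtain ⟨L, ⟨lc, li, ⟨r', lr⟩, l0⟩, h'⟩ := h'
  refine ⟨fun x => L x * K x, ⟨lc.matrix_mul kc, fun x => (li x).mul (ki x),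
    ⟨max r r', fun s z hz => ?_⟩, fun z => ?_⟩, fun z => ?_⟩
  · rw [kr s z (le_of_max_le_left hz), lr s z (le_of_max_le_right hz), one_mul]
  · rw [k0, l0, one_mul]
  · beta_reduce; rw [mul_assoc, h, h']

theorem FH.submatrix {T S : Z → Matrix B B ℍ[ℝ]} (h : FH T S) (e : C ≃ B) :
    FH (fun z => (T z).submatrix e e) (fun z => (S z).submatrix e e) := by
  obtain ⟨K, ⟨kc, ki, ⟨r, kr⟩, k0⟩, h⟩ := h
  refine ⟨fun x => (K x).submatrix e e, ⟨kc.matrix_submatrix _ _, fun x => (ki x).submatrix e,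
    ⟨r, fun s z hz => ?_⟩, fun z => ?_⟩, fun z => ?_⟩
  · rw [kr s z hz, Matrix.submatrix_one_equiv]
  · rw [k0, Matrix.submatrix_one_equiv]
  · beta_reduce; rw [Matrix.submatrix_mul_equiv, h]

theorem FH.fromBlocks {T S : Z → Matrix B B ℍ[ℝ]} (h : FH T S) :
    FH (fun z => fromBlocks (T z) 0 0 (1 : Matrix C C ℍ[ℝ])) (fun z => fromBlocks (S z) 0 0 1) := by
  obtain ⟨K, ⟨kc, ki, ⟨r, kr⟩, k0⟩, h⟩ := h
  refine ⟨fun x => Matrix.fromBlocks (K x) 0 0 1, ⟨kc.matrix_fromBlocks continuous_const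
    continuous_const continuous_const, fun x => inj_fromBlocks 0 (ki x) inj_one,
    ⟨r, fun s z hz => ?_⟩, fun z => ?_⟩, fun z => ?_⟩
  · rw [kr s z hz, Matrix.fromBlocks_one]
  · rw [k0, Matrix.fromBlocks_one]
  · beta_reduce; rw [Matrix.fromBlocks_multiply]; simp [h]

theorem GFam.submatrix {T : Z → Matrix B B ℍ[ℝ]} (h : GFam T) (e : C ≃ B) :
    GFam fun z => (T z).submatrix e e := by
  obtain ⟨c, i, r, hr⟩ := h
  refine ⟨c.matrix_submatrix _ _, fun z => (i z).submatrix e, r, fun z hz => ?_⟩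
  rw [hr z hz, Matrix.submatrix_one_equiv]

theorem GFam.fromBlocks {T : Z → Matrix B B ℍ[ℝ]} (h : GFam T) :
    GFam fun z => fromBlocks (T z) 0 0 (1 : Matrix C C ℍ[ℝ]) := by
  obtain ⟨c, i, r, hr⟩ := h
  refine ⟨c.matrix_fromBlocks continuous_const continuous_const continuous_const,
    fun z => inj_fromBlocks 0 (i z) inj_one, r, fun z hz => ?_⟩
  rw [hr z hz, Matrix.fromBlocks_one]

/-- The statement that `C` superfluous coordinates can be split off. -/
def Splits (Z B C : Type) [NormedAddCommGroup Z] [Fintype B] [Fintype C] [DecidableEq B]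
    [DecidableEq C] : Prop :=
  ∀ T : Z → Matrix (B ⊕ C) (B ⊕ C) ℍ[ℝ], GFam T → ∃ T' : Z → Matrix B B ℍ[ℝ], GFam T' ∧
    FH T fun z => fromBlocks (T' z) 0 0 1

/-- Families which are nullhomotopic relative to infinity. -/
def Null (f : Z → Matrix B B ℍ[ℝ]) : Prop :=
  ∃ (H : ℝ × Z → Matrix B B ℍ[ℝ]) (r : ℝ), Continuous H ∧ (∀ x, Inj (H x)) ∧
    (∀ s z, s ≤ -r → H (s, z) = f z) ∧ (∀ s z, r ≤ s → H (s, z) = 1) ∧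
    ∀ s z, r ≤ ‖z‖ → H (s, z) = 1

theorem Null.submatrix {f : Z → Matrix B B ℍ[ℝ]} (h : Null f) (e : C ≃ B) :
    Null fun z => (f z).submatrix e e := by
  obtain ⟨H, r, c, i, h0, h1, h2⟩ := h
  refine ⟨fun x => (H x).submatrix e e, r, c.matrix_submatrix _ _, fun x => (i x).submatrix e,
    fun s z hs => ?_, fun s z hs => ?_, fun s z hs => ?_⟩
  · beta_reduce; rw [h0 s z hs]
  · beta_reduce; rw [h1 s z hs, Matrix.submatrix_one_equiv]
  · beta_reduce; rw [h2 s z hs, Matrix.submatrix_one_equiv]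

section
variable [NormedSpace ℝ Z] [FiniteDimensional ℝ Z] [Nontrivial Z]

/-- Making the last column trivial. -/
theorem exists_clear (hd : Module.finrank ℝ Z + 1 < 4 * (Fintype.card B + 1))
    {T : Z → Matrix (B ⊕ Unit) (B ⊕ Unit) ℍ[ℝ]} (hT : Continuous T) (hi : ∀ z, Inj (T z))
    (hr : ∃ r : ℝ, ∀ z, r ≤ ‖z‖ → ∀ i, T z i (.inr ()) =
      (1 : Matrix (B ⊕ Unit) (B ⊕ Unit) ℍ[ℝ]) i (.inr ())) :
    ∃ K, FHom K ∧ ∃ (T' : Z → Matrix B B ℍ[ℝ]) (W : Z → Matrix Unit B ℍ[ℝ]),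
      Continuous T' ∧ Continuous W ∧ (∀ z, Inj (T' z)) ∧
      ∀ z, K (1, z) * T z = fromBlocks (T' z) 0 (W z) 1 := by
  have col (M : Matrix (B ⊕ Unit) (B ⊕ Unit) ℍ[ℝ]) :
      (fun i => M i (.inr ())) = M *ᵥ Pi.single (.inr ()) 1 := by
    ext1 i; simp
  obtain ⟨K, hK, h⟩ := exists_col (Z := Z) (B := B ⊕ Unit) (by simpa using hd)
    (e := Pi.single (.inr ()) 1) (v := fun z i => T z i (.inr ())) (by simp)
    (by fun_prop) (fun z h0 => by
      rw [col] at h0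
      simpa using hi z _ h0) (by
      obtain ⟨r, hr⟩ := hr
      refine ⟨r, fun z hz => ?_⟩
      rw [funext (hr z hz), col, Matrix.one_mulVec])
  have c1 : Continuous fun z => K (1, z) * T z :=
    (hK.cont.comp (by fun_prop)).matrix_mul hT
  have e (z) : K (1, z) * T z = fromBlocks (K (1, z) * T z).toBlocks₁₁ 0
      (K (1, z) * T z).toBlocks₂₁ 1 := by
    have h1 : ∀ i, (K (1, z) * T z) i (.inr ()) = Pi.single (M := fun _ => ℍ[ℝ]) (.inr ()) 1 i :=
      fun i => congr_fun (h z) i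
    ext1 i k
    rcases i with i | i <;> rcases k with k | k
    · rfl
    · exact (h1 _).trans (by simp)
    · rfl
    · exact (h1 _).trans (by simp)
  refine ⟨K, hK, _, _, ?_, ?_, fun z => ?_, e⟩
  · exact continuous_matrix fun i k => by exact c1.matrix_elem _ _
  · exact continuous_matrix fun i k => by exact c1.matrix_elem _ _
  · have := (hK.inj (1, z)).mul (hi z)
    rw [e] at this
    exact this.of_fromBlocks

theorem splits_unit (hd : Module.finrank ℝ Z + 1 < 4 * (Fintype.card B + 1)) :
    Splits Z B Unit := fun T ⟨hT, hi, r, hr⟩ => by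
  obtain ⟨K, hK, T', W, ct, cw, ti, h⟩ := exists_clear hd hT hi
    ⟨r, fun z hz i => by rw [hr z hz]⟩
  obtain ⟨r', hr'⟩ := hK.far
  have far (z) (hz : max r r' ≤ ‖z‖) : T' z = 1 ∧ W z = 0 := by
    have := h z
    rw [hr z (le_of_max_le_left hz), hr' 1 z (le_of_max_le_right hz), mul_one,
      ← Matrix.fromBlocks_one, Matrix.fromBlocks_inj] at this
    exact ⟨this.1.symm, this.2.2.1.symm⟩
  refine ⟨T', ⟨ct, ti, _, fun z hz => (far z hz).1⟩, FH.trans ⟨K, hK, h⟩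
    ⟨fun x => fromBlocks 1 0 (-(tau x.1 • (W x.2 * inv (T' x.2)))) 1, ⟨?_, fun x =>
      inj_fromBlocks _ inj_one inj_one, ⟨max r r', fun s z hz => ?_⟩, fun z => ?_⟩, fun z => ?_⟩⟩
  · refine continuous_const.matrix_fromBlocks continuous_const ?_ continuous_const
    exact ((continuous_tau.comp continuous_fst).smul ((cw.comp continuous_snd).matrix_mul
      ((continuous_inv ct ti).comp continuous_snd))).neg
  · rw [(far z hz).2, Matrix.zero_mul, smul_zero, neg_zero, Matrix.fromBlocks_one]
  · rw [tau_of_nonpos le_rfl, zero_smul, neg_zero, Matrix.fromBlocks_one]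
  · beta_reduce
    rw [tau_of_one_le le_rfl, one_smul, Matrix.fromBlocks_multiply]
    simp only [Matrix.one_mul, Matrix.zero_mul, Matrix.mul_zero, add_zero, Matrix.mul_one, zero_add,
      Matrix.neg_mul, Matrix.mul_assoc, (ti z).inv_mul, neg_add_cancel]

theorem Null.of_unit (hd : Module.finrank ℝ Z + 2 < 4 * (Fintype.card B + 1))
    {f : Z → Matrix B B ℍ[ℝ]} (h : Null fun z => fromBlocks (f z) 0 0 (1 : Matrix Unit Unit ℍ[ℝ])) :
    Null f := by
  obtain ⟨H, r, c, i, h0, h1, h2⟩ := h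
  obtain ⟨K, hK, T', W, ct, cw, ti, h⟩ := exists_clear (Z := ℝ × Z) (B := B)
    (by simp only [Module.finrank_prod, Module.finrank_self]; omega) c i ⟨r, fun x hx k => by
      obtain ⟨s, z⟩ := x
      rcases le_max_iff.1 (Prod.norm_def (s, z) ▸ hx) with hx | hx
      · rcases le_abs.1 hx with hx | hx
        · rw [h1 s z hx]
        · rw [h0 s z (by linarith)]
          rcases k with k | k <;> simp
      · rw [h2 s z hx]⟩
  obtain ⟨r', hr'⟩ := hK.far
  have key (s z) (h3 : r' ≤ ‖(s, z)‖) {g : Matrix B B ℍ[ℝ]} (hg : H (s, z) = fromBlocks g 0 0 1) :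
      T' (s, z) = g := by
    have := h (s, z)
    rw [hr' 1 _ h3, one_mul, hg, Matrix.fromBlocks_inj] at this
    exact this.1.symm
  refine ⟨T', max r r', ct, ti, fun s z hs => key s z ?_ (h0 s z ?_), fun s z hs => key s z ?_ ?_,
    fun s z hs => key s z ?_ ?_⟩
  · refine le_trans ?_ (le_max_left _ _)
    have := le_max_right r r'
    exact le_abs.2 (.inr (by linarith))
  · have := le_max_left r r'
    linarith
  · exact (le_of_max_le_right hs).trans ((le_abs_self s).trans (le_max_left _ _))
  · rw [h1 s z (le_of_max_le_left hs), Matrix.fromBlocks_one]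
  · exact (le_of_max_le_right hs).trans (le_max_right _ _)
  · rw [h2 s z (le_of_max_le_left hs), Matrix.fromBlocks_one]

/-- Reindexing used to split off coordinates one at a time. -/
noncomputable def sumFinSucc (B : Type) (n : ℕ) : (B ⊕ Fin n) ⊕ Unit ≃ B ⊕ Fin (n + 1) :=
  (Equiv.sumAssoc _ _ _).trans ((Equiv.refl B).sumCongr (Fintype.equivOfCardEq (by simp)))

theorem fromBlocks_sumFinSucc {n : ℕ} (A : Matrix B B ℍ[ℝ]) :
    (fromBlocks A 0 0 (1 : Matrix (Fin (n + 1)) (Fin (n + 1)) ℍ[ℝ])).submatrix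
      (sumFinSucc B n) (sumFinSucc B n) =
    fromBlocks (fromBlocks A 0 0 (1 : Matrix (Fin n) (Fin n) ℍ[ℝ])) 0 0 1 := by
  ext1 ((i | i) | i) ((k | k) | k) <;> simp [sumFinSucc, Matrix.one_apply]

theorem splits_of_card (hd : Module.finrank ℝ Z + 1 < 4 * (Fintype.card B + 1)) :
    Splits Z B C := by
  suffices h : ∀ n, Splits Z B (Fin n) by
    intro T hT
    let e := (Equiv.refl B).sumCongr (Fintype.equivFin C)
    obtain ⟨T', h1, h2⟩ := h _ _ (hT.submatrix e.symm)
    refine ⟨T', h1, ?_⟩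
    convert h2.submatrix e using 3 with z z
    · simp
    · ext1 (i | i) (k | k) <;> simp [e, Matrix.one_apply]
  intro n
  induction n with
  | zero =>
    intro T hT
    refine ⟨_, hT.submatrix (Equiv.sumEmpty B (Fin 0)).symm, fun _ => 1, ⟨continuous_const,
      fun _ => inj_one, ⟨0, fun _ _ _ => rfl⟩, fun _ => rfl⟩, fun z => ?_⟩
    ext1 (i | i) (k | k)
    · simp
    all_goals first | exact i.elim0 | exact k.elim0
  | succ n ih =>
    intro T hT
    let e := sumFinSucc B n
    obtain ⟨T₁, g₁, h₁⟩ := splits_unit (B := B ⊕ Fin n)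
      (hd.trans_le (by simp only [Fintype.card_sum]; omega)) _ (hT.submatrix e)
    obtain ⟨T', g', h'⟩ := ih _ g₁
    refine ⟨T', g', ?_⟩
    convert (h₁.trans h'.fromBlocks).submatrix e.symm using 3 with z z
    · simp
    · rw [← fromBlocks_sumFinSucc]; simp [e]

theorem Null.of_card (hd : Module.finrank ℝ Z + 2 < 4 * (Fintype.card B + 1))
    {f : Z → Matrix B B ℍ[ℝ]} (h : Null fun z => fromBlocks (f z) 0 0 (1 : Matrix C C ℍ[ℝ])) :
    Null f := by
  suffices key : ∀ n, Null (fun z => fromBlocks (f z) 0 0 (1 : Matrix (Fin n) (Fin n) ℍ[ℝ])) →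
      Null f by
    refine key (Fintype.card C) ?_
    convert h.submatrix ((Equiv.refl B).sumCongr (Fintype.equivFin C).symm) using 2 with z
    ext1 (i | i) (k | k) <;> simp [Matrix.one_apply]
  intro n
  induction n with
  | zero =>
    intro h
    convert h.submatrix (Equiv.sumEmpty B (Fin 0)).symm using 2 with z
    rfl
  | succ n ih =>
    intro h
    refine ih (Null.of_unit (B := B ⊕ Fin n)
      (hd.trans_le (by simp only [Fintype.card_sum]; omega)) ?_)
    convert h.submatrix (sumFinSucc B n) using 2 with z
    exact (fromBlocks_sumFinSucc _).symm

end

end Destab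

section Col

variable {B : Type} [Fintype B] [DecidableEq B]

/-- Quaternionic column vectors as a left module over matrices. -/
def Col (B : Type) := PiLp 2 fun _ : B => ℍ[ℝ]

noncomputable instance : NormedAddCommGroup (Col B) :=
  inferInstanceAs (NormedAddCommGroup (PiLp 2 fun _ : B => ℍ[ℝ]))

noncomputable instance : InnerProductSpace ℝ (Col B) :=
  inferInstanceAs (InnerProductSpace ℝ (PiLp 2 fun _ : B => ℍ[ℝ]))

instance : FiniteDimensional ℝ (Col B) :=
  inferInstanceAs (FiniteDimensional ℝ (PiLp 2 fun _ : B => ℍ[ℝ]))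

noncomputable instance : Module (Matrix B B ℍ[ℝ]) (Col B) where
  smul A v := WithLp.toLp 2 (A *ᵥ v.ofLp)
  one_smul v := congrArg (WithLp.toLp 2) (Matrix.one_mulVec _)
  mul_smul A A' v := congrArg (WithLp.toLp 2) (Matrix.mulVec_mulVec _ _ _).symm
  smul_zero A := congrArg (WithLp.toLp 2) (Matrix.mulVec_zero _)
  smul_add A v w := congrArg (WithLp.toLp 2) (Matrix.mulVec_add _ _ _)
  add_smul A A' v := congrArg (WithLp.toLp 2) (Matrix.add_mulVec _ _ _)
  zero_smul v := congrArg (WithLp.toLp 2) (Matrix.zero_mulVec _)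

/-- Coordinates of a column vector. -/
def co (v : Col B) : B → ℍ[ℝ] := WithLp.ofLp v

theorem co_inj {v w : Col B} (h : ∀ i, co v i = co w i) : v = w :=
  congrArg (WithLp.toLp 2) (funext h)

theorem co_sum {ι : Type} (s : Finset ι) (f : ι → Col B) (i : B) :
    co (∑ j ∈ s, f j) i = ∑ j ∈ s, co (f j) i := by
  classical
  induction s using Finset.induction_on with
  | empty => rfl
  | insert a s ha ih => rw [Finset.sum_insert ha, Finset.sum_insert ha, ← ih]; rfl

theorem col_smul_apply (A : Matrix B B ℍ[ℝ]) (v : Col B) (i : B) :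
    co (A • v) i = ∑ k, A i k * co v k := rfl

instance : IsScalarTower ℝ (Matrix B B ℍ[ℝ]) (Col B) where
  smul_assoc t A v := by
    refine co_inj fun i => ?_
    rw [col_smul_apply]
    refine Eq.trans ?_ (Finset.smul_sum (r := t) (f := fun k => A i k * co v k)
      (s := Finset.univ)).symm
    simp only [Matrix.smul_apply, smul_mul_assoc]

instance : ContinuousSMul (Matrix B B ℍ[ℝ]) (Col B) where
  continuous_smul := by
    refine (PiLp.continuous_toLp 2 _).comp (continuous_pi fun i => ?_)
    refine continuous_finsetSum _ fun k _ => ?_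
    exact (continuous_fst.matrix_elem i k).mul
      ((PiLp.continuous_apply 2 _ k).comp continuous_snd)

instance : StarAct (Matrix B B ℍ[ℝ]) (Col B) where
  inner_smul A v w := by
    have key (a b c : ℍ[ℝ]) : inner ℝ (a * b) c = inner ℝ b (star a * c) := by
      simp only [Quaternion.inner_def, star_mul, star_star, Quaternion.re_mul, Quaternion.re_star,
        Quaternion.imI_star, Quaternion.imJ_star, Quaternion.imK_star, Quaternion.imI_mul,
        Quaternion.imJ_mul, Quaternion.imK_mul]
      ring
    have e1 (i) : inner ℝ (co (A • v) i) (co w i) =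
        ∑ k, inner ℝ (A i k * co v k) (co w i) := by
      rw [col_smul_apply, sum_inner]
    have e2 (k) : inner ℝ (co v k) (co (star A • w) k) =
        ∑ i, inner ℝ (co v k) (star A k i * co w i) := by
      rw [col_smul_apply, inner_sum]
    refine (Finset.sum_congr rfl fun i _ => e1 i).trans (Eq.trans ?_
      (Finset.sum_congr rfl fun k _ => e2 k).symm)
    rw [Finset.sum_comm]
    simp only [key, Matrix.star_apply]

end Col

section Off

variable {n : Type} [Fintype n] [DecidableEq n]
variable {ι κ : Type} [Fintype ι] [Fintype κ] [DecidableEq ι] [DecidableEq κ]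
variable {Z : Type} [NormedAddCommGroup Z]

/-- The coefficient ring. -/
abbrev RR (n : Type) := Matrix (n ⊕ n) (n ⊕ n) ℍ[ℝ]

/-- Its defining representation. -/
abbrev EE (n : Type) := Col (n ⊕ n)

/-- The grading operator. -/
noncomputable def ee (n : Type) [DecidableEq n] : RR n := fromBlocks 1 0 0 (-1)

/-- The odd self-adjoint matrix associated with a quaternionic matrix. -/
noncomputable def off (T : Matrix (ι × n) (ι × n) ℍ[ℝ]) : Matrix ι ι (RR n) := fun i k =>
  fromBlocks 0 (of fun a b => T (i, a) (k, b)) (of fun a b => Tᴴ (i, a) (k, b)) 0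

/-- The upper right corner. -/
def on (A : Matrix ι ι (RR n)) : Matrix (ι × n) (ι × n) ℍ[ℝ] := fun x y =>
  A x.1 y.1 (.inl x.2) (.inr y.2)

theorem on_off (T : Matrix (ι × n) (ι × n) ℍ[ℝ]) : on (off T) = T := rfl

theorem off_sa (T : Matrix (ι × n) (ι × n) ℍ[ℝ]) : (off T)ᴴ = off T := by
  ext i k (a | a) (b | b) <;> simp [off, Matrix.star_apply]

theorem off_odd (T : Matrix (ι × n) (ι × n) ℍ[ℝ]) : OddM {ee n} (off T) := by
  rintro s rfl i k
  simp [off, ee, Matrix.fromBlocks_multiply, Matrix.fromBlocks_neg]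

theorem off_mul (T S : Matrix (ι × n) (ι × n) ℍ[ℝ]) (h : T * Sᴴ = 1) (h' : Tᴴ * S = 1) :
    off T * off S = 1 := by
  ext1 i k
  have e (U W : Matrix (ι × n) (ι × n) ℍ[ℝ]) (hU : U * W = 1) :
      ∑ j, (of fun a b => U (i, a) (j, b)) * (of fun a b => W (j, a) (k, b)) =
        if i = k then (1 : Matrix n n ℍ[ℝ]) else 0 := by
    refine Matrix.ext fun a b => ?_
    have := congr_fun₂ hU (i, a) (k, b)
    rw [Matrix.mul_apply, Fintype.sum_prod_type] at this
    rw [Matrix.sum_apply]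
    refine Eq.trans (b := ∑ j, ∑ x, U (i, a) (j, x) * W (j, x) (k, b)) ?_ (this.trans ?_)
    · simp only [Matrix.mul_apply, Matrix.of_apply]
    · by_cases hi : i = k <;> simp [Matrix.one_apply, hi]
  rw [Matrix.mul_apply]
  simp only [off, Matrix.fromBlocks_multiply, Matrix.zero_mul, Matrix.mul_zero, zero_add, add_zero]
  have hs (F F' : ι → Matrix n n ℍ[ℝ]) : ∑ j, fromBlocks (F j) 0 0 (F' j) =
      fromBlocks (∑ j, F j) 0 0 (∑ j, F' j) := by
    ext (a | a) (b | b) <;> simp [Matrix.sum_apply]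
  rw [hs, e _ _ h, e _ _ h']
  by_cases hi : i = k <;> simp [Matrix.one_apply, hi]

theorem off_good {T : Matrix (ι × n) (ι × n) ℍ[ℝ]} (h : Inj T) : Good (EE n) {ee n} (off T) := by
  refine Good.of_inv (B := off (inv T)ᴴ) (off_sa T) (off_odd T) (off_mul _ _ ?_ ?_)
  · rw [← Matrix.conjTranspose_mul, h.mul_inv, Matrix.conjTranspose_one]
  · rw [Matrix.conjTranspose_conjTranspose, h.inv_mul]

theorem corner {A : Matrix ι ι (RR n)} (h : OddM {ee n} A) (i k : ι) (a b : n) :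
    A i k (.inl a) (.inl b) = 0 ∧ A i k (.inr a) (.inr b) = 0 := by
  have z (q : ℍ[ℝ]) (hq : q = -q) : q = 0 := by
    have : (2 : ℝ) • q = 0 := by rw [two_smul]; nth_rw 2 [hq]; exact add_neg_cancel q
    simpa using this
  have := h _ rfl i k
  rw [← Matrix.fromBlocks_toBlocks (A i k), ee, Matrix.fromBlocks_multiply,
    Matrix.fromBlocks_multiply, Matrix.fromBlocks_neg, Matrix.fromBlocks_inj] at this
  obtain ⟨h1, -, -, h2⟩ := this
  simp only [Matrix.mul_one, Matrix.mul_zero, add_zero, Matrix.one_mul, Matrix.zero_mul, zero_add,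
    Matrix.mul_neg, Matrix.neg_mul, neg_neg] at h1 h2
  exact ⟨z _ (congr_fun₂ h1 a b), z _ (congr_fun₂ h2 a b).symm⟩

theorem off_on {A : Matrix ι ι (RR n)} (h : Good (EE n) {ee n} A) : off (on A) = A := by
  ext1 i k
  ext1 (a | a) (b | b)
  · exact (corner h.odd i k a b).1.symm
  · rfl
  · have := congr_fun₂ (congr_fun₂ h.sa i k) (.inr a) (.inl b)
    exact this
  · exact (corner h.odd i k a b).2.symm

theorem on_inj {A : Matrix ι ι (RR n)} (h : Good (EE n) {ee n} A) : Inj (on A) := fun v hv => by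
  let w : V (EE n) ι := WithLp.toLp 2 fun i =>
    (WithLp.toLp 2 (Sum.elim 0 fun b => v (i, b)) : PiLp 2 fun _ : n ⊕ n => ℍ[ℝ])
  have hl (j b) : co (w j) (.inl b) = 0 := rfl
  have hr (j b) : co (w j) (.inr b) = v (j, b) := rfl
  have h0 : w = 0 := h.inj w <| by
    ext1 i
    refine co_inj fun x => ?_
    rw [act_apply, co_sum]
    refine Eq.trans ?_ (show (0 : ℍ[ℝ]) = _ from rfl)
    simp only [col_smul_apply, Fintype.sum_sum_type, hl, hr, mul_zero, Finset.sum_const_zero,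
      zero_add]
    rcases x with a | a
    · refine Eq.trans ?_ (congr_fun hv (i, a))
      simp only [Matrix.mulVec, dotProduct, Fintype.sum_prod_type, on]
    · simp only [(corner h.odd _ _ _ _).2, zero_mul, Finset.sum_const_zero]
  ext1 ⟨i, b⟩
  exact congrArg (fun w : V (EE n) ι => co (w i) (.inr b)) h0

theorem continuous_off : Continuous (off : Matrix (ι × n) (ι × n) ℍ[ℝ] → _) := by
  refine continuous_matrix fun i k => ?_
  refine continuous_const.matrix_fromBlocks ?_ ?_ continuous_const <;>
    refine continuous_matrix fun a b => ?_
  · exact continuous_id.matrix_elem _ _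
  · exact continuous_id.matrix_conjTranspose.matrix_elem _ _

theorem continuous_on : Continuous (on : Matrix ι ι (RR n) → _) :=
  continuous_matrix fun i k => (continuous_id.matrix_elem i.1 k.1).matrix_elem _ _

/-- Families of invertible matrices, constant near infinity. -/
structure CFam (T : Z → Matrix (ι × n) (ι × n) ℍ[ℝ]) : Prop where
  cont : Continuous T
  inj : ∀ z, Inj (T z)
  far : ∃ (r : ℝ) (c : _), ∀ z, r ≤ ‖z‖ → T z = c

theorem GFam.toC {T : Z → Matrix (ι × n) (ι × n) ℍ[ℝ]} (h : GFam T) : CFam T :=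
  ⟨h.cont, h.inj, h.far.imp fun _ h => ⟨1, h⟩⟩

theorem CFam.isFam {T : Z → Matrix (ι × n) (ι × n) ℍ[ℝ]} (h : CFam T) :
    IsFam (EE n) {ee n} fun z => off (T z) := by
  obtain ⟨c, i, r, d, hr⟩ := h
  exact ⟨continuous_off.comp c, fun z => off_good (i z), r, off d, fun z hz => by rw [hr z hz]⟩

/-- The class of a family of invertible quaternionic matrices. -/
noncomputable def ocls (T : Z → Matrix (ι × n) (ι × n) ℍ[ℝ]) (h : CFam T) : G (EE n) {ee n} Z :=
  cls (fun z => off (T z)) h.isFam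

theorem ocls_htpy {T S : Z → Matrix (ι × n) (ι × n) ℍ[ℝ]} (hT : CFam T) (hS : CFam S)
    (K : ℝ × Z → Matrix (ι × n) (ι × n) ℍ[ℝ]) (c : Continuous K) (i : ∀ x, Inj (K x))
    (far : ∃ (r : ℝ) (d : ℝ → _), ∀ s z, r ≤ ‖z‖ → K (s, z) = d s)
    (h0 : ∀ z, K (0, z) = T z) (h1 : ∀ z, K (1, z) = S z) : ocls T hT = ocls S hS := by
  obtain ⟨r, d, far⟩ := far
  refine cls_htpy ⟨fun x => off (K x), continuous_off.comp c, fun s _ z => off_good (i _),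
    ⟨r, fun s => off (d s), fun s _ z hz => ?_⟩, fun z => ?_, fun z => ?_⟩ _ _
  · beta_reduce; rw [far s z hz]
  · beta_reduce; rw [h0]
  · beta_reduce; rw [h1]

/-- Block sum. -/
noncomputable def bs (T : Matrix (ι × n) (ι × n) ℍ[ℝ]) (S : Matrix (κ × n) (κ × n) ℍ[ℝ]) :
    Matrix ((ι ⊕ κ) × n) ((ι ⊕ κ) × n) ℍ[ℝ] :=
  (fromBlocks T 0 0 S).submatrix (Equiv.sumProdDistrib ι κ n) (Equiv.sumProdDistrib ι κ n)

theorem off_bs (T : Matrix (ι × n) (ι × n) ℍ[ℝ]) (S : Matrix (κ × n) (κ × n) ℍ[ℝ]) :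
    off (bs T S) = fromBlocks (off T) 0 0 (off S) := by
  ext (i | i) (k | k) (a | a) (b | b) <;> simp [off, bs]

theorem bs_inj {T : Matrix (ι × n) (ι × n) ℍ[ℝ]} {S : Matrix (κ × n) (κ × n) ℍ[ℝ]}
    (hT : Inj T) (hS : Inj S) : Inj (bs T S) := (inj_fromBlocks 0 hT hS).submatrix _

theorem bs_mul (T T' : Matrix (ι × n) (ι × n) ℍ[ℝ]) (S S' : Matrix (κ × n) (κ × n) ℍ[ℝ]) :
    bs T S * bs T' S' = bs (T * T') (S * S') := by
  rw [bs, bs, Matrix.submatrix_mul_equiv, Matrix.fromBlocks_multiply]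
  simp [bs]

theorem CFam.bs {T : Z → Matrix (ι × n) (ι × n) ℍ[ℝ]} {S : Z → Matrix (κ × n) (κ × n) ℍ[ℝ]}
    (hT : CFam T) (hS : CFam S) : CFam fun z => bs (T z) (S z) := by
  obtain ⟨c, i, r, d, hr⟩ := hT
  obtain ⟨c', i', r', d', hr'⟩ := hS
  refine ⟨(c.matrix_fromBlocks continuous_const continuous_const c').matrix_submatrix _ _,
    fun z => bs_inj (i z) (i' z), max r r', Bott.bs d d', fun z hz => ?_⟩
  rw [hr z (le_of_max_le_left hz), hr' z (le_of_max_le_right hz)]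

theorem CFam.const {c : Matrix (ι × n) (ι × n) ℍ[ℝ]} (h : Inj c) : CFam fun _ : Z => c :=
  ⟨continuous_const, fun _ => h, 0, c, fun _ _ => rfl⟩

theorem ocls_const {c : Matrix (ι × n) (ι × n) ℍ[ℝ]} (h : CFam fun _ : Z => c) :
    ocls _ h = 0 := cls_const (off_good (h.inj 0)) _

theorem ocls_bs {T : Z → Matrix (ι × n) (ι × n) ℍ[ℝ]} {S : Z → Matrix (κ × n) (κ × n) ℍ[ℝ]}
    (hT : CFam T) (hS : CFam S) (h : CFam fun z => bs (T z) (S z)) :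
    ocls _ h = ocls T hT + ocls S hS := by
  simp only [ocls, off_bs]
  exact (cls_add hT.isFam hS.isFam _).symm

/-- Rotation of two blocks. -/
noncomputable def rotm (ι : Type) [DecidableEq ι] (θ : ℝ) : Matrix (ι ⊕ ι) (ι ⊕ ι) ℍ[ℝ] :=
  fromBlocks (Real.cos θ • 1) (-Real.sin θ • 1) (Real.sin θ • 1) (Real.cos θ • 1)

theorem rotm_mul (θ : ℝ) : rotm ι θ * rotm ι (-θ) = 1 := by
  rw [rotm, rotm, Matrix.fromBlocks_multiply, ← Matrix.fromBlocks_one, Real.cos_neg, Real.sin_neg]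
  have := Real.sin_sq_add_cos_sq θ
  congr 1 <;> simp only [Matrix.smul_mul, Matrix.mul_smul, Matrix.one_mul, smul_smul, ← add_smul]
  · rw [show Real.cos θ * Real.cos θ + -Real.sin θ * -Real.sin θ = 1 by linarith, one_smul]
  · ring_nf; simp
  · ring_nf; simp
  · rw [show - -Real.sin θ * Real.sin θ + Real.cos θ * Real.cos θ = 1 by linarith, one_smul]

theorem continuous_rotm : Continuous (rotm ι) := by
  unfold rotm
  exact (Real.continuous_cos.smul continuous_const).matrix_fromBlocks
    (Real.continuous_sin.neg.smul continuous_const) (Real.continuous_sin.smul continuous_const)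
    (Real.continuous_cos.smul continuous_const)

theorem ocls_mul {T S : Z → Matrix (ι × n) (ι × n) ℍ[ℝ]} (hT : CFam T) (hS : CFam S)
    (h : CFam fun z => T z * S z) : ocls _ h = ocls T hT + ocls S hS := by
  have h1 : CFam fun _ : Z => (1 : Matrix (ι × n) (ι × n) ℍ[ℝ]) := CFam.const inj_one
  rw [← ocls_bs hT hS (hT.bs hS), ← add_zero (ocls _ h), ← ocls_const h1,
    ← ocls_bs h h1 (h.bs h1)]
  let e := Equiv.sumProdDistrib ι ι n
  obtain ⟨c, i, r, d, hr⟩ := hT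
  obtain ⟨c', i', r', d', hr'⟩ := hS
  let a (x : ℝ × Z) : ℝ := x.1 * (Real.pi / 2)
  have ca : Continuous a := by fun_prop
  have ri (θ : ℝ) : Inj (rotm (ι × n) θ) := Inj.of_inv (S := rotm (ι × n) (-θ)) <| by
    simpa using rotm_mul (ι := ι × n) (-θ)
  refine (ocls_htpy _ _ (fun x => (fromBlocks (T x.2) 0 0 1 * rotm _ (a x) *
    fromBlocks 1 0 0 (S x.2) * rotm _ (-a x)).submatrix e e) ?_ (fun x => ?_) ⟨max r r', fun s =>
      (fromBlocks d 0 0 1 * rotm _ (s * (Real.pi / 2)) *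
    fromBlocks 1 0 0 d' * rotm _ (-(s * (Real.pi / 2)))).submatrix e e, fun s z hz => ?_⟩
    (fun z => ?_) (fun z => ?_)).symm
  · refine Continuous.matrix_submatrix (Continuous.matrix_mul (Continuous.matrix_mul
      (Continuous.matrix_mul ?_ (continuous_rotm.comp ca)) ?_) (continuous_rotm.comp ca.neg)) _ _
    · exact (c.comp continuous_snd).matrix_fromBlocks continuous_const continuous_const
        continuous_const
    · exact continuous_const.matrix_fromBlocks continuous_const continuous_const
        (c'.comp continuous_snd)
  · exact ((((inj_fromBlocks 0 (i _) inj_one).mul (ri _)).mul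
      (inj_fromBlocks 0 inj_one (i' _))).mul (ri _)).submatrix _
  · beta_reduce
    rw [hr z (le_of_max_le_left hz), hr' z (le_of_max_le_right hz)]
  · simp [a, rotm, bs, e, Matrix.fromBlocks_multiply]
  · simp [a, rotm, bs, e, Matrix.fromBlocks_multiply]

theorem G_ind_off (x : G (EE n) {ee n} Z) : ∃ (ι : Type) (_ : Fintype ι) (_ : DecidableEq ι)
    (T : Z → Matrix (ι × n) (ι × n) ℍ[ℝ]) (h : CFam T), ocls T h = x := by
  classical
  obtain ⟨ι, _, f, hf, rfl⟩ := x.ind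
  obtain ⟨r, c, hr⟩ := hf.cs
  refine ⟨ι, _, inferInstance, fun z => on (f z), ⟨continuous_on.comp hf.cont,
    fun z => on_inj (hf.good z), r, on c, fun z hz => by rw [hr z hz]⟩, ?_⟩
  simp only [ocls, off_on (hf.good _)]

theorem FH.ocls {T S : Z → Matrix (ι × n) (ι × n) ℍ[ℝ]} (h : FH T S) (hT : CFam T)
    (hS : CFam S) : ocls T hT = ocls S hS := by
  obtain ⟨K, ⟨kc, ki, ⟨r, kr⟩, k0⟩, h⟩ := h
  obtain ⟨r', d, hr⟩ := hT.far
  refine ocls_htpy hT hS (fun x => K x * T x.2) (kc.matrix_mul (hT.cont.comp continuous_snd))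
    (fun x => (ki x).mul (hT.inj _)) ⟨max r r', fun _ => d, fun s z hz => ?_⟩ (fun z => ?_) h
  · beta_reduce
    rw [kr s z (le_of_max_le_left hz), hr z (le_of_max_le_right hz), one_mul]
  · rw [k0, one_mul]

end Off

section Kcls

variable {n M D : Type} [Fintype n] [DecidableEq n] [Fintype M] [DecidableEq M] [Fintype D]
  [DecidableEq D]
variable {Z : Type} [NormedAddCommGroup Z]

/-- Stabilisation along a bijection. -/
noncomputable def stab (θ : M × n ≃ M ⊕ D) (f : Matrix M M ℍ[ℝ]) : Matrix (M × n) (M × n) ℍ[ℝ] :=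
  (fromBlocks f 0 0 (1 : Matrix D D ℍ[ℝ])).submatrix θ θ

theorem stab_one (θ : M × n ≃ M ⊕ D) : stab θ 1 = 1 := by
  rw [stab, Matrix.fromBlocks_one, Matrix.submatrix_one_equiv]

theorem stab_mul (θ : M × n ≃ M ⊕ D) (f g : Matrix M M ℍ[ℝ]) :
    stab θ (f * g) = stab θ f * stab θ g := by
  rw [stab, stab, stab, Matrix.submatrix_mul_equiv, Matrix.fromBlocks_multiply]
  simp

theorem GFam.stab {f : Z → Matrix M M ℍ[ℝ]} (h : GFam f) (θ : M × n ≃ M ⊕ D) :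
    GFam fun z => stab θ (f z) := h.fromBlocks.submatrix θ

/-- The class of a stabilised family. -/
noncomputable def kcls (θ : M × n ≃ M ⊕ D) (f : Z → Matrix M M ℍ[ℝ]) (h : GFam f) :
    G (EE n) {ee n} Z := ocls _ (h.stab θ).toC

theorem kcls_mul (θ : M × n ≃ M ⊕ D) {f g : Z → Matrix M M ℍ[ℝ]} (hf : GFam f) (hg : GFam g)
    (h : GFam fun z => f z * g z) : kcls θ _ h = kcls θ f hf + kcls θ g hg := by
  simp only [kcls, stab_mul]
  exact ocls_mul _ _ _

theorem kcls_htpy (θ : M × n ≃ M ⊕ D) {f g : Z → Matrix M M ℍ[ℝ]} (hf : GFam f) (hg : GFam g)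
    (K : ℝ × Z → Matrix M M ℍ[ℝ]) (c : Continuous K) (i : ∀ x, Inj (K x))
    (far : ∃ r : ℝ, ∀ s z, r ≤ ‖z‖ → K (s, z) = 1)
    (h0 : ∀ z, K (0, z) = f z) (h1 : ∀ z, K (1, z) = g z) : kcls θ f hf = kcls θ g hg := by
  refine ocls_htpy _ _ (fun x => Bott.stab θ (K x)) ?_ (fun x => ?_) ?_ (fun z => ?_) fun z => ?_
  · exact (c.matrix_fromBlocks continuous_const continuous_const
      continuous_const).matrix_submatrix _ _
  · exact (inj_fromBlocks 0 (i x) inj_one).submatrix _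
  · exact far.imp fun r h => ⟨fun _ => 1, fun s z hz => by rw [h s z hz, stab_one]⟩
  · rw [h0]
  · rw [h1]

theorem kcls_one (θ : M × n ≃ M ⊕ D) (h : GFam fun _ : Z => (1 : Matrix M M ℍ[ℝ])) :
    kcls θ _ h = 0 := ocls_const _

variable [NormedSpace ℝ Z] [FiniteDimensional ℝ Z] [Nontrivial Z]

theorem kcls_surjective (θ : M × n ≃ M ⊕ D)
    (hd : Module.finrank ℝ Z + 1 < 4 * (Fintype.card M + 1)) (x : G (EE n) {ee n} Z) :
    ∃ (f : Z → Matrix M M ℍ[ℝ]) (h : GFam f), kcls θ f h = x := by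
  obtain ⟨ι, _, _, T, hT, rfl⟩ := G_ind_off x
  obtain ⟨r, d, hr⟩ := id hT.far
  obtain ⟨z₀, hz₀⟩ := exists_norm_eq Z (le_max_right r 0)
  have hd' : Inj d := by
    rw [← hr z₀ (hz₀.symm ▸ le_max_left r 0)]
    exact hT.inj z₀
  have ci : CFam fun _ : Z => inv d := CFam.const hd'.inv
  have g1 : GFam fun z => T z * inv d :=
    ⟨hT.cont.matrix_mul continuous_const, fun z => (hT.inj z).mul hd'.inv, r, fun z hz => by
      rw [hr z hz, hd'.mul_inv]⟩
  have e1 : ocls _ g1.toC = ocls T hT := by rw [ocls_mul hT ci, ocls_const, add_zero]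
  have c1 : CFam fun _ : Z => (1 : Matrix (M × n) (M × n) ℍ[ℝ]) := CFam.const inj_one
  have e2 := ocls_bs c1 g1.toC (c1.bs g1.toC)
  rw [ocls_const, zero_add, e1] at e2
  have g2 : GFam fun z => fromBlocks (1 : Matrix (M × n) (M × n) ℍ[ℝ]) 0 0 (T z * inv d) :=
    ⟨continuous_const.matrix_fromBlocks continuous_const continuous_const g1.cont,
      fun z => inj_fromBlocks 0 inj_one (g1.inj z), r, fun z hz => by
      rw [hr z hz, hd'.mul_inv, Matrix.fromBlocks_one]⟩
  have card : Fintype.card (M × n) = Fintype.card M + Fintype.card D := by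
    rw [Fintype.card_congr θ, Fintype.card_sum]
  obtain ⟨S, hS, h⟩ := splits_of_card (Z := Z) (B := M × n) (C := ι × n)
    (hd.trans_le (by rw [card]; omega)) _ g2
  have e3 := (h.submatrix (Equiv.sumProdDistrib M ι n)).ocls (c1.bs g1.toC)
    (hS.toC.bs (CFam.const inj_one))
  erw [e2, ocls_bs hS.toC (CFam.const inj_one), ocls_const, add_zero] at e3
  obtain ⟨f, hf, h'⟩ := splits_of_card (Z := Z) (B := M) (C := D) hd _ (hS.submatrix θ.symm)
  refine ⟨f, hf, e3.symm ▸ (FH.ocls ?_ _ _).symm⟩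
  convert h'.submatrix θ using 2 with z z
  · simp
  · rfl

theorem null_of_kcls (θ : M × n ≃ M ⊕ D)
    (hd : Module.finrank ℝ Z + 2 < 4 * (Fintype.card M + 1)) {f : Z → Matrix M M ℍ[ℝ]}
    (hf : GFam f) (h : kcls θ f hf = 0) : Null f := by
  have c1 : CFam fun _ : Z => (1 : Matrix (M × n) (M × n) ℍ[ℝ]) := CFam.const inj_one
  rw [← ocls_const c1, kcls, ocls, ocls, cls_eq_iff] at h
  obtain ⟨μ, ν, _, _, C, E, e, hC, -, h⟩ := h
  classical
  obtain ⟨H, hc, hg, ⟨r, c, hr⟩, h0, h1⟩ := h.submatrix e.symm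
  obtain ⟨r', hr'⟩ := hf.far
  obtain ⟨z₀, hz₀⟩ := exists_norm_eq Z (le_max_right (max r r') 0)
  have hr₀ : max r r' ≤ ‖z₀‖ := hz₀.symm ▸ le_max_left _ _
  let N (x : ℝ × Z) := on (H (tau x.1, x.2))
  have Nc : Continuous N := continuous_on.comp
    (hc.comp ((continuous_tau.comp continuous_fst).prodMk continuous_snd))
  have Ni (x) : Inj (N x) := on_inj (hg _ ⟨tau_nonneg _, tau_le _⟩ _)
  have Ic : Continuous fun x : ℝ × Z => inv (N (x.1, z₀)) :=
    continuous_inv (Nc.comp (by fun_prop)) fun _ => Ni _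
  have N0 (s z) (hs : s ≤ 0) : N (s, z) = bs (stab θ (f z)) (on C) := by
    simp only [N, tau_of_nonpos hs, h0]
    rw [Matrix.submatrix_submatrix, Equiv.self_comp_symm, Matrix.submatrix_id_id]
    rw [← off_on hC, ← off_bs, on_off, off_on hC]
  have key : Null fun z => bs (stab θ (f z)) (1 : Matrix (μ × n) (μ × n) ℍ[ℝ]) := by
    refine ⟨fun x => N x * inv (N (x.1, z₀)), max (max r r') 1, Nc.matrix_mul Ic,
      fun x => (Ni x).mul (Ni _).inv, fun s z hs => ?_, fun s z hs => ?_, fun s z hz => ?_⟩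
    · have hs : s ≤ 0 := hs.trans (by linarith [le_max_right (max r r') 1])
      have := N0 s z₀ hs
      rw [hr' z₀ (le_of_max_le_right hr₀), stab_one] at this
      beta_reduce
      rw [N0 s z hs, ← mul_one (stab θ (f z)), ← one_mul (on C), ← bs_mul, ← this, mul_assoc,
        (Ni _).mul_inv, mul_one, mul_one]
    · have : N (s, z) = N (s, z₀) := by
        simp only [N, tau_of_one_le (le_of_max_le_right hs), h1]
      beta_reduce
      rw [this, (Ni _).mul_inv]
    · have (z) (hz : max r r' ≤ ‖z‖) : N (s, z) = on (c (tau s)) := by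
        simp only [N]
        rw [hr _ ⟨tau_nonneg _, tau_le _⟩ _ (le_of_max_le_left hz)]
      beta_reduce
      rw [this z (le_of_max_le_left hz), ← this z₀ hr₀, (Ni _).mul_inv]
  have card : Fintype.card (M × n) = Fintype.card M + Fintype.card D := by
    rw [Fintype.card_congr θ, Fintype.card_sum]
  have k2 : Null fun z => fromBlocks (stab θ (f z)) 0 0 (1 : Matrix (μ × n) (μ × n) ℍ[ℝ]) := by
    convert key.submatrix (Equiv.sumProdDistrib M μ n).symm using 2 with z
    simp [bs]
  have k3 := Null.of_card (hd.trans_le (by rw [card]; omega)) k2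
  refine Null.of_card (C := D) hd ?_
  convert k3.submatrix θ.symm using 2 with z
  simp [stab]

end Kcls

section Loops

variable {M N : Type} [Fintype M] [DecidableEq M] [Fintype N] [DecidableEq N]

/-- The compact symplectic group. -/
noncomputable abbrev Sp (M : Type) [Fintype M] [DecidableEq M] := unitary (Matrix M M ℍ[ℝ])

theorem inj_unitary {T : Matrix M M ℍ[ℝ]} (h : T ∈ unitary (Matrix M M ℍ[ℝ])) : Inj T :=
  .of_inv (Unitary.star_mul_self_of_mem h)

/-- A deformation retraction onto the unitary matrices. -/
noncomputable def rho (s : ℝ) (T : Matrix M M ℍ[ℝ]) : Matrix M M ℍ[ℝ] :=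
  T * ((hasChol (B := M)).choose ((1 - tau s) • 1 + tau s • (Tᴴ * T)))ᴴ

theorem pos_rho (s : ℝ) {T : Matrix M M ℍ[ℝ]} (h : Inj T) :
    Pos ((1 - tau s) • 1 + tau s • (Tᴴ * T)) := pos_one.add h.pos (tau_nonneg s) (tau_le s)

theorem rho_zero (T : Matrix M M ℍ[ℝ]) : rho 0 T = T := by
  simp [rho, tau_of_nonpos, (hasChol (B := M)).choose_spec.2.1]

theorem rho_of_mem (s : ℝ) {T : Matrix M M ℍ[ℝ]} (h : T ∈ unitary (Matrix M M ℍ[ℝ])) :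
    rho s T = T := by
  have : Tᴴ * T = 1 := Unitary.star_mul_self_of_mem h
  rw [rho, this, ← add_smul, sub_add_cancel, one_smul, (hasChol (B := M)).choose_spec.2.1,
    Matrix.conjTranspose_one, mul_one]

theorem rho_inj (s : ℝ) {T : Matrix M M ℍ[ℝ]} (h : Inj T) : Inj (rho s T) :=
  h.mul (.of_inv ((hasChol (B := M)).choose_spec.2.2 _ (pos_rho s h)))

theorem rho_mem {T : Matrix M M ℍ[ℝ]} (h : Inj T) : rho 1 T ∈ unitary (Matrix M M ℍ[ℝ]) := by
  have h1 := (hasChol (B := M)).choose_spec.2.2 _ (pos_rho 1 h)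
  have : star (rho 1 T) * rho 1 T = 1 := by
    rw [← h1, Matrix.star_eq_conjTranspose, rho, Matrix.conjTranspose_mul,
      Matrix.conjTranspose_conjTranspose]
    simp [tau_of_one_le, mul_assoc]
  exact Unitary.mem_iff.2 ⟨this, mul_eq_one_comm.1 this⟩

theorem continuous_rho {X : Type} [TopologicalSpace X] {s : X → ℝ} {T : X → Matrix M M ℍ[ℝ]}
    (hs : Continuous s) (hT : Continuous T) (h : ∀ x, Inj (T x)) :
    Continuous fun x => rho (s x) (T x) := by
  have h1 := continuous_tau.comp hs
  refine hT.matrix_mul (Continuous.matrix_conjTranspose ?_)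
  exact (hasChol (B := M)).choose_spec.1.comp_continuous
    (((continuous_const.sub h1).smul continuous_const).add
      (h1.smul (hT.matrix_conjTranspose.matrix_mul hT))) fun x => pos_rho _ (h x)

/-- Clamping to the unit cube. -/
noncomputable def cl (q : N → ℝ) : N → unitInterval := fun i => projIcc 0 1 zero_le_one (q i)

theorem continuous_cl : Continuous (cl : (N → ℝ) → _) :=
  continuous_pi fun i => continuous_projIcc.comp (continuous_apply i)

theorem cl_coe (y : N → unitInterval) : cl (fun i => (y i : ℝ)) = y :=
  funext fun i => projIcc_val zero_le_one (y i)

theorem exists_abs_ge {q : N → ℝ} {r : ℝ} (hr : 1 ≤ r) (h : r ≤ ‖q‖) :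
    ∃ i, q i ≤ -r ∨ r ≤ q i := by
  by_contra! h0
  exact h.not_gt ((pi_norm_lt_iff (by linarith)).2 fun i => abs_lt.2 (h0 i))

theorem le_norm_of {q : N → ℝ} {r : ℝ} (i : N) (h : q i ≤ -r ∨ r ≤ q i) : r ≤ ‖q‖ := by
  refine le_trans ?_ (norm_le_pi_norm q i)
  rw [Real.norm_eq_abs]
  exact le_abs'.2 h

theorem cl_mem {q : N → ℝ} (h : ∃ i, q i ≤ 0 ∨ 1 ≤ q i) : cl q ∈ Cube.boundary N :=
  h.imp fun _ h => h.imp (projIcc_of_le_left _) (projIcc_of_right_le _)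

/-- The family of matrices attached to a generalised loop. -/
noncomputable def fam (p : GenLoop N (Sp M) 1) (q : N → ℝ) : Matrix M M ℍ[ℝ] := (p (cl q) : Sp M)

theorem fam_mem (p : GenLoop N (Sp M) 1) (q : N → ℝ) : fam p q ∈ unitary (Matrix M M ℍ[ℝ]) :=
  (p (cl q)).2

theorem fam_far (p : GenLoop N (Sp M) 1) (q : N → ℝ) (h : 1 ≤ ‖q‖) : fam p q = 1 := by
  have := exists_abs_ge le_rfl h
  rw [fam, GenLoop.boundary p _ (cl_mem (this.imp fun i => Or.imp_left (by intro h; linarith)))]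
  rfl

theorem continuous_loop (p : GenLoop N (Sp M) 1) : Continuous fun y => (p y : Matrix M M ℍ[ℝ]) :=
  continuous_subtype_val.comp p.1.continuous

theorem gfam (p : GenLoop N (Sp M) 1) : GFam (fam p) :=
  ⟨(continuous_loop p).comp continuous_cl, fun q => inj_unitary (fam_mem p q), 1, fam_far p⟩

theorem homotopic_of {p p' : GenLoop N (Sp M) 1} (F : unitInterval × (N → unitInterval) →
    Matrix M M ℍ[ℝ]) (hc : Continuous F) (hu : ∀ x, F x ∈ unitary (Matrix M M ℍ[ℝ]))
    (hb : ∀ s, ∀ y ∈ Cube.boundary N, F (s, y) = 1) (h0 : ∀ y, F (0, y) = p y)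
    (h1 : ∀ y, F (1, y) = p' y) : GenLoop.Homotopic p p' :=
  ⟨⟨⟨⟨fun x => ⟨F x, hu x⟩, hc.subtype_mk _⟩, fun y => Subtype.ext (h0 y),
    fun y => Subtype.ext (h1 y)⟩, fun s y hy =>
      Subtype.ext ((hb s y hy).trans (congr_arg Subtype.val (GenLoop.boundary p y hy)).symm)⟩⟩

/-- The affine rescaling of the unit cube. -/
def aff (r : ℝ) (y : N → unitInterval) : N → ℝ := fun i => r * (2 * y i - 1)

theorem continuous_aff (r : ℝ) : Continuous (aff r : (N → unitInterval) → _) := by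
  unfold aff; fun_prop

theorem le_aff {r : ℝ} {y : N → unitInterval} (h : y ∈ Cube.boundary N) : r ≤ ‖aff r y‖ := by
  obtain ⟨i, h⟩ := h
  refine le_norm_of i (h.imp (fun h => ?_) fun h => ?_)
  · simp [aff, h]
  · simp only [aff, h, Icc.coe_one]; linarith

/-- The generalised loop attached to a family of unitary matrices. -/
def loopOf (g : (N → ℝ) → Matrix M M ℍ[ℝ]) (r : ℝ) (c : Continuous g)
    (u : ∀ z, g z ∈ unitary (Matrix M M ℍ[ℝ])) (h : ∀ z, r ≤ ‖z‖ → g z = 1) :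
    GenLoop N (Sp M) 1 :=
  ⟨⟨fun y => ⟨g (aff r y), u _⟩, (c.comp (continuous_aff r)).subtype_mk _⟩,
    fun _ hy => Subtype.ext (h _ (le_aff hy))⟩

theorem homotopic_loopOf (p : GenLoop N (Sp M) 1) {r : ℝ} (hr : 1 ≤ r) :
    GenLoop.Homotopic p (loopOf (fam p) r (gfam p).cont (fam_mem p)
      fun z h => fam_far p z (hr.trans h)) := by
  refine homotopic_of (fun x => fam p fun i => (1 - (x.1 : ℝ)) * x.2 i + x.1 * aff r x.2 i)
    ((gfam p).cont.comp ?_) (fun x => fam_mem p _) (fun s y hy => ?_) (fun y => ?_) fun y => ?_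
  · unfold aff; fun_prop
  · have hs := s.2.1
    have hs' := s.2.2
    rw [fam, GenLoop.boundary p _ (cl_mem _)]
    · rfl
    obtain ⟨i, h | h⟩ := hy
    · refine ⟨i, .inl ?_⟩
      simp only [aff, h, Icc.coe_zero]
      nlinarith
    · refine ⟨i, .inr ?_⟩
      simp only [aff, h, Icc.coe_one]
      nlinarith
  · simp [fam, cl_coe]
  · simp only [Icc.coe_one, sub_self, zero_mul, zero_add, one_mul]
    rfl

theorem homotopic_const {p : GenLoop N (Sp M) 1} (h : Null (fam p)) :
    GenLoop.Homotopic p GenLoop.const := by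
  obtain ⟨H, r, hc, hi, h0, h1, hr⟩ := h
  have l1 : 1 ≤ max r 1 := le_max_right _ _
  have l2 : r ≤ max r 1 := le_max_left _ _
  generalize max r 1 = r' at l1 l2
  refine (GenLoop.Homotopic.equiv (X := Sp M) (N := N)).trans (homotopic_loopOf p l1) ?_
  refine homotopic_of (fun x => rho 1 (H (r' * (2 * x.1 - 1), aff r' x.2)))
    (continuous_rho continuous_const (hc.comp ?_) fun x => hi _) (fun x => rho_mem (hi _))
    (fun s y hy => ?_) (fun y => ?_) fun y => ?_
  · unfold aff; fun_prop
  · rw [hr _ _ (l2.trans (le_aff hy)), rho_of_mem _ (one_mem _)]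
  · rw [h0 _ _ (by rw [Icc.coe_zero]; linarith), rho_of_mem _ (fam_mem _ _)]
    rfl
  · rw [h1 _ _ (by rw [Icc.coe_one]; linarith), rho_of_mem _ (one_mem _)]
    rfl

variable {n D : Type} [Fintype n] [DecidableEq n] [Fintype D] [DecidableEq D]
  (θ : M × n ≃ M ⊕ D)

/-- The homotopy class of a generalised loop. -/
noncomputable def mk (p : GenLoop N (Sp M) 1) : HomotopyGroup N (Sp M) 1 := Quotient.mk _ p

theorem exists_mk (x : HomotopyGroup N (Sp M) 1) : ∃ p, mk p = x := Quotient.exists_rep x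

/-- The comparison map from homotopy groups. -/
noncomputable def phi : HomotopyGroup N (Sp M) 1 → G (EE n) {ee n} (N → ℝ) :=
  Quotient.lift (fun p => kcls θ (fam p) (gfam p)) fun p p' ⟨H⟩ => by
    have e (s y) (hy : y ∈ Cube.boundary N) : H (s, y) = 1 :=
      (H.prop' s y hy).trans (GenLoop.boundary p y hy)
    refine kcls_htpy θ _ _ (fun x => (H (projIcc 0 1 zero_le_one x.1, cl x.2) : Sp M).1)
      ?_ (fun x => inj_unitary (H _).2) ⟨1, fun s z hz => ?_⟩ (fun z => ?_) fun z => ?_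
    · exact continuous_subtype_val.comp (H.continuous.comp
        ((continuous_projIcc.comp continuous_fst).prodMk (continuous_cl.comp continuous_snd)))
    · have := exists_abs_ge le_rfl hz
      rw [e _ _ (cl_mem (this.imp fun i => Or.imp_left (by intro h; linarith)))]
      rfl
    · rw [projIcc_of_le_left _ le_rfl]
      exact congr_arg Subtype.val (H.apply_zero _)
    · rw [projIcc_of_right_le _ le_rfl]
      exact congr_arg Subtype.val (H.apply_one _)

theorem phi_mk (p : GenLoop N (Sp M) 1) : phi θ (mk p) = kcls θ (fam p) (gfam p) := rfl

theorem phi_loopOf {g : (N → ℝ) → Matrix M M ℍ[ℝ]} {r : ℝ} (c : Continuous g)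
    (u : ∀ z, g z ∈ unitary (Matrix M M ℍ[ℝ])) (h : ∀ z, r ≤ ‖z‖ → g z = 1) (hr : 1 ≤ r)
    (hg : GFam g) : phi θ (mk (loopOf g r c u h)) = kcls θ g hg := by
  refine (kcls_htpy θ hg (gfam _) (fun x => g fun i => (1 - tau x.1) * x.2 i +
    tau x.1 * aff r (cl x.2) i) (c.comp ?_) (fun x => hg.inj _)
    ⟨r, fun s z hz => h _ ?_⟩ (fun z => ?_) fun z => ?_).symm
  · refine continuous_pi fun i => ?_
    have := continuous_tau
    have h' := (continuous_aff r).comp (continuous_cl (N := N))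
    exact (((continuous_const.sub (this.comp continuous_fst)).mul
      ((continuous_apply i).comp continuous_snd))).add ((this.comp continuous_fst).mul
      ((continuous_apply i).comp (h'.comp continuous_snd)))
  · obtain ⟨i, hi⟩ := exists_abs_ge hr hz
    refine le_norm_of i (hi.imp (fun hi => ?_) fun hi => ?_)
    · have : cl z i = 0 := projIcc_of_le_left _ (by linarith)
      simp only [aff, this, Icc.coe_zero]
      nlinarith [tau_nonneg s, tau_le s]
    · have : cl z i = 1 := projIcc_of_right_le _ (by linarith)
      simp only [aff, this, Icc.coe_one]
      nlinarith [tau_nonneg s, tau_le s]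
  · simp [tau_of_nonpos]
  · simp only [tau_of_one_le le_rfl, sub_self, zero_mul, zero_add, one_mul]
    rfl

variable [Nonempty N]

theorem mk_const : mk GenLoop.const = (1 : HomotopyGroup N (Sp M) 1) := rfl

theorem phi_one : phi (N := N) θ 1 = 0 := by
  rw [← mk_const, phi_mk]
  exact kcls_one θ (gfam GenLoop.const)

theorem phi_mul (a b : HomotopyGroup N (Sp M) 1) : phi θ (a * b) = phi θ a + phi θ b := by
  obtain ⟨a, rfl⟩ := exists_mk a
  obtain ⟨b, rfl⟩ := exists_mk b
  have i : N := Classical.arbitrary N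
  have hm (p q : GenLoop N (Sp M) 1) : mk p * mk q = mk (GenLoop.transAt i q p) :=
    HomotopyGroup.mul_spec
  have e1 : mk (GenLoop.transAt i b GenLoop.const) = mk b := by rw [← hm, mk_const, one_mul]
  have e2 : mk (GenLoop.transAt i GenLoop.const a) = mk a := by rw [← hm, mk_const, mul_one]
  have e : fam (GenLoop.transAt i b a) = fun z => fam (GenLoop.transAt i b GenLoop.const) z *
      fam (GenLoop.transAt i GenLoop.const a) z := by
    ext1 z
    simp only [fam, GenLoop.transAt, GenLoop.coe_copy]
    split_ifs <;> simp
  have h := kcls_mul θ (gfam (GenLoop.transAt i b GenLoop.const))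
    (gfam (GenLoop.transAt i GenLoop.const a)) (e ▸ gfam _)
  rw [← phi_mk, ← phi_mk, e1, e2, add_comm] at h
  rw [hm, ← h, phi_mk]
  congr 1

theorem phi_injective (hd : Fintype.card N + 2 < 4 * (Fintype.card M + 1)) :
    Function.Injective (phi (N := N) θ) := fun a b h => by
  have h0 : phi θ (a * b⁻¹) = 0 := by
    rw [phi_mul, h, ← phi_mul, mul_inv_cancel, phi_one]
  rw [← mul_inv_eq_one]
  generalize a * b⁻¹ = x at h0 ⊢
  obtain ⟨p, rfl⟩ := exists_mk x
  exact Quotient.sound (homotopic_const (null_of_kcls θ (by simpa using hd) (gfam p) h0))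

theorem phi_surjective (hd : Fintype.card N + 1 < 4 * (Fintype.card M + 1)) :
    Function.Surjective (phi (N := N) θ) := fun x => by
  obtain ⟨f, hf, rfl⟩ := kcls_surjective θ (by simpa using hd) x
  obtain ⟨r, hr⟩ := hf.far
  have far (s z) (hz : max r 1 ≤ ‖z‖) : rho s (f z) = 1 := by
    rw [hr z (le_of_max_le_left hz), rho_of_mem _ (one_mem _)]
  have hg : GFam fun z => rho 1 (f z) := ⟨continuous_rho continuous_const hf.cont hf.inj,
    fun z => rho_inj _ (hf.inj z), _, far 1⟩
  refine ⟨mk (loopOf _ _ hg.cont (fun z => rho_mem (hf.inj z)) (far 1)), ?_⟩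
  rw [phi_loopOf θ _ _ _ (le_max_right _ _) hg]
  exact (kcls_htpy θ hf hg (fun x => rho x.1 (f x.2))
    (continuous_rho continuous_fst (hf.cont.comp continuous_snd) fun x => hf.inj _)
    (fun x => rho_inj _ (hf.inj _)) ⟨_, fun s z => far s z⟩ (fun z => rho_zero _)
    fun z => rfl).symm

end Loops

section Generators

variable {n : Type} [Fintype n] [DecidableEq n] {k : ℕ}

/-- A symmetric involution together with `k` symmetric and `k` skew generators, all of them
anticommuting. -/
structure Gen (t : Matrix n n ℍ[ℝ]) (s j : Fin k → Matrix n n ℍ[ℝ]) : Prop where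
  st : star t = t
  sq : t * t = 1
  hs : ∀ i, star (s i) = s i ∧ s i * s i = 1 ∧ Anti t (s i)
  hj : ∀ i, star (j i) = -j i ∧ j i * j i = -1 ∧ Anti t (j i)
  ss : ∀ i k, i ≠ k → Anti (s i) (s k)
  jj : ∀ i k, i ≠ k → Anti (j i) (j k)
  sj : ∀ i k, Anti (s i) (j k)

/-- The antidiagonal double of a matrix. -/
noncomputable def up (g : Matrix n n ℍ[ℝ]) : RR n := fromBlocks 0 g g 0

/-- The standard rotation. -/
noncomputable def jr (n : Type) [DecidableEq n] : RR n := fromBlocks 0 1 (-1) 0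

theorem star_up (g : Matrix n n ℍ[ℝ]) : star (up g) = up (star g) := by
  simp [up, Matrix.star_eq_conjTranspose, Matrix.fromBlocks_conjTranspose]

theorem up_neg (g : Matrix n n ℍ[ℝ]) : up (-g) = -up g := by
  simp [up, Matrix.fromBlocks_neg]

theorem up_mul (g h : Matrix n n ℍ[ℝ]) : up g * up h = fromBlocks (g * h) 0 0 (g * h) := by
  simp [up, Matrix.fromBlocks_multiply]

theorem up_sq {g : Matrix n n ℍ[ℝ]} (h : g * g = 1) : up g * up g = 1 := by
  rw [up_mul, h, Matrix.fromBlocks_one]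

theorem up_sq_neg {g : Matrix n n ℍ[ℝ]} (h : g * g = -1) : up g * up g = -1 := by
  rw [up_mul, h, ← Matrix.fromBlocks_one, Matrix.fromBlocks_neg, neg_zero]

theorem Anti.up {g h : Matrix n n ℍ[ℝ]} (H : Anti g h) : Anti (up g) (up h) := by
  rw [Anti, up_mul, up_mul, H, Matrix.fromBlocks_neg, neg_zero]

theorem ee_up (g : Matrix n n ℍ[ℝ]) : Anti (ee n) (up g) := by
  simp [Anti, ee, up, Matrix.fromBlocks_multiply, Matrix.fromBlocks_neg]

theorem up_ee (g : Matrix n n ℍ[ℝ]) : Anti (up g) (ee n) := (ee_up g).symm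

theorem jr_up (g : Matrix n n ℍ[ℝ]) : Anti (jr n) (up g) := by
  simp [Anti, jr, up, Matrix.fromBlocks_multiply, Matrix.fromBlocks_neg]

theorem up_jr (g : Matrix n n ℍ[ℝ]) : Anti (up g) (jr n) := (jr_up g).symm

theorem ee_jr : Anti (ee n) (jr n) := by
  simp [Anti, jr, ee, Matrix.fromBlocks_multiply, Matrix.fromBlocks_neg]

theorem star_ee : star (ee n) = ee n := by
  simp [ee, Matrix.star_eq_conjTranspose, Matrix.fromBlocks_conjTranspose]

theorem ee_sq : ee n * ee n = 1 := by
  simp [ee, Matrix.fromBlocks_multiply]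

theorem star_jr : star (jr n) = -jr n := by
  simp [jr, Matrix.star_eq_conjTranspose, Matrix.fromBlocks_conjTranspose, Matrix.fromBlocks_neg]

theorem jr_sq : jr n * jr n = -1 := by
  rw [← Matrix.fromBlocks_one, Matrix.fromBlocks_neg, neg_zero]
  simp [jr, Matrix.fromBlocks_multiply]

theorem Gen.cons {t : Matrix n n ℍ[ℝ]} {s j : Fin k → Matrix n n ℍ[ℝ]} (h : Gen t s j) :
    Gen (up t) (Fin.cons (ee n) fun i => up (s i)) (Fin.cons (jr n) fun i => up (j i)) where
  st := by rw [star_up, h.st]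
  sq := up_sq h.sq
  hs := Fin.forall_fin_succ.2 ⟨⟨star_ee, ee_sq, up_ee _⟩, fun i => by
    simpa [star_up, (h.hs i).1] using ⟨up_sq (h.hs i).2.1, (h.hs i).2.2.up⟩⟩
  hj := Fin.forall_fin_succ.2 ⟨⟨star_jr, jr_sq, up_jr _⟩, fun i => by
    simpa [star_up, (h.hj i).1, up_neg] using ⟨up_sq_neg (h.hj i).2.1, (h.hj i).2.2.up⟩⟩
  ss := Fin.forall_fin_succ.2 ⟨Fin.forall_fin_succ.2 ⟨fun h => (h rfl).elim, fun _ _ => ee_up _⟩,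
    fun i => Fin.forall_fin_succ.2 ⟨fun _ => up_ee _, fun k hk =>
      (h.ss i k fun e => hk (congr_arg _ e)).up⟩⟩
  jj := Fin.forall_fin_succ.2 ⟨Fin.forall_fin_succ.2 ⟨fun h => (h rfl).elim, fun _ _ => jr_up _⟩,
    fun i => Fin.forall_fin_succ.2 ⟨fun _ => up_jr _, fun k hk =>
      (h.jj i k fun e => hk (congr_arg _ e)).up⟩⟩
  sj := Fin.forall_fin_succ.2 ⟨Fin.forall_fin_succ.2 ⟨ee_jr, fun _ => ee_up _⟩,
    fun i => Fin.forall_fin_succ.2 ⟨up_jr _, fun k => (h.sj i k).up⟩⟩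

theorem exists_gen (k : ℕ) : ∃ (n : Type) (_ : Fintype n) (_ : DecidableEq n) (_ : Nonempty n)
    (t : Matrix n n ℍ[ℝ]) (s j : Fin k → Matrix n n ℍ[ℝ]), Gen t s j := by
  induction k with
  | zero =>
    exact ⟨Unit, inferInstance, inferInstance, inferInstance, 1, finZeroElim, finZeroElim,
      star_one _, one_mul _, finZeroElim, finZeroElim, finZeroElim, finZeroElim, finZeroElim⟩
  | succ k ih =>
    obtain ⟨n, _, _, _, t, s, j, h⟩ := ih
    exact ⟨n ⊕ n, inferInstance, inferInstance, inferInstance, _, _, _, h.cons⟩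

theorem Gen.system {t : Matrix n n ℍ[ℝ]} {s j : Fin 4 → Matrix n n ℍ[ℝ]} (h : Gen t s j) :
    System (ee n) (up t) (jr n) (fun i => up (s i)) fun i => up (j i) where
  F := {
    e_st := star_ee
    e_sq := ee_sq
    t_st := by rw [star_up, h.st]
    t_sq := up_sq h.sq
    w_l := by rw [star_jr, neg_mul, jr_sq, neg_neg]
    w_r := by rw [star_jr, mul_neg, jr_sq, neg_neg]
    te := up_ee _
    we := ee_jr.symm
    wt := jr_up _ }
  hs i := ⟨by rw [star_up, (h.hs i).1], up_sq (h.hs i).2.1, up_ee _, (h.hs i).2.2.up, jr_up _⟩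
  hj i := ⟨by rw [star_up, (h.hj i).1, up_neg], up_sq_neg (h.hj i).2.1, up_ee _,
    (h.hj i).2.2.up, jr_up _⟩
  ss i k hik := (h.ss i k hik).up
  jj i k hik := (h.jj i k hik).up
  sj i k := (h.sj i k).up

/-- The homotopy groups in the stable range. -/
theorem exists_phi [Nonempty n] (d m : ℕ) (h : d ≤ m) :
    ∃ φ : π_ (d + 1) (Sp (Fin m)) 1 → G (EE n) {ee n} (Fin (d + 1) → ℝ),
      Function.Bijective φ ∧ ∀ a b, φ (a * b) = φ a + φ b := by
  have u : n := Classical.arbitrary n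
  have hn := Fintype.card_pos (α := n)
  have θ : Fin m × n ≃ Fin m ⊕ Fin (m * Fintype.card n - m) := Fintype.equivOfCardEq <| by
    have := Nat.le_mul_of_pos_right m hn
    simp only [Fintype.card_prod, Fintype.card_sum, Fintype.card_fin]
    omega
  refine ⟨phi θ, ⟨phi_injective θ ?_, phi_surjective θ ?_⟩, phi_mul θ⟩ <;>
  · simp only [Fintype.card_fin]
    omega

theorem exists_mulEquiv (k : ℕ) :
    ∃ N : ℕ, ∀ n m : ℕ, N ≤ n → N ≤ m →
      Nonempty ((π_ (k + 1) (unitary (Matrix (Fin n) (Fin n) ℍ[ℝ])) 1) ≃*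
        (π_ (k + 1 + 8) (unitary (Matrix (Fin m) (Fin m) ℍ[ℝ])) 1)) := by
  refine ⟨k + 8, fun n m hn hm => ?_⟩
  obtain ⟨ι, _, _, _, t, s, j, h⟩ := exists_gen 4
  obtain ⟨e⟩ := h.system.period (EE ι) k
  obtain ⟨φ, hφ, φm⟩ := exists_phi (n := ι) k n (by omega)
  obtain ⟨ψ, hψ, ψm⟩ := exists_phi (n := ι) (k + 8) m hm
  refine ⟨⟨((Equiv.ofBijective φ hφ).trans e.symm.toEquiv).trans
    (Equiv.ofBijective ψ hψ).symm, fun a b => hψ.1 ?_⟩⟩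
  have r (x) : ψ ((Equiv.ofBijective ψ hψ).symm x) = x := (Equiv.ofBijective ψ hψ).apply_symm_apply x
  change ψ ((Equiv.ofBijective ψ hψ).symm (e.symm (φ (a * b)))) = ψ
    ((Equiv.ofBijective ψ hψ).symm (e.symm (φ a)) * (Equiv.ofBijective ψ hψ).symm (e.symm (φ b)))
  erw [ψm, r, r, r, φm, map_add]

end Generators

end Bott

/-- **Bott periodicity, symplectic case.**
Here the compact symplectic group `Sp(n)` is realized as the group `unitary` of the
`*`-ring of `n × n` quaternionic matrices, i.e. quaternionic matrices `A` with
`A* A = A A* = 1`.  For every integer `k ≥ 1` (written as `k + 1` with `k : ℕ`), there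
exists `N` such that for all `n, m ≥ N`, the `(k+1)`-st homotopy group of `Sp(n)` is
isomorphic (as a group) to the `(k+1)+8`-th homotopy group of `Sp(m)`: the stable
homotopy groups of the symplectic group are periodic of period 8. -/
theorem bott_periodicity_symplectic (k : ℕ) :
    ∃ N : ℕ, ∀ n m : ℕ, N ≤ n → N ≤ m →
      Nonempty ((π_ (k + 1) (unitary (Matrix (Fin n) (Fin n) ℍ[ℝ])) 1) ≃*
        (π_ (k + 1 + 8) (unitary (Matrix (Fin m) (Fin m) ℍ[ℝ])) 1)) :=
  Bott.exists_mulEquiv k
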